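/- Short-interval cancellation of the Möbius function along arithmetic progressions: for each ε > 0 there exists L_0 such that for each integer L ≥ L_0 and each integer q ≥ 1 satisfying Σ_{p prime, p | q} 1/p ≤ (1−ε) Σ_{p prime, p ≤ L} 1/p, there exists M_0 = M_0(q,L) such that for all M ≥ M_0 there exists an integer z with 0 ≤ z < Lq such that Σ_{j=0}^{⌊M/(Lq)⌋} Σ_{a=0}^{q−1} |Σ_{m ∈ [z+jLq, z+(j+1)Lq], m ≡ a (mod q)} μ(m)| < εM. -/

import Mathlib

open Filter Topology

namespace MR

/-- recursive "real polynomial of degree k with leading coefficient α" predicate (degree k+1) -/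
def IsP : ℕ → ℝ → (ℕ → ℝ) → Prop
  | 0, α, f => ∃ β : ℝ, ∀ m, f m = α * m + β
  | (k+1), α, f => ∀ h : ℕ, IsP k ((k+2) * α * h) (fun m => f (m + h) - f m)

lemma IsP.congr {k : ℕ} {α α' : ℝ} {f g : ℕ → ℝ} (h : IsP k α f) (ha : α = α') (hf : ∀ m, f m = g m) :
    IsP k α' g := by
  have : f = g := funext hf
  subst this; subst ha; exact h

lemma IsP.add {k : ℕ} : ∀ {α β : ℝ} {f g : ℕ → ℝ}, IsP k α f → IsP k β g → IsP k (α + β) (fun m => f m + g m) := by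
  induction k with
  | zero =>
    rintro α β f g ⟨a, ha⟩ ⟨b, hb⟩
    exact ⟨a + b, fun m => by simp only [ha, hb]; ring⟩
  | succ k ih =>
    intro α β f g hf hg h
    exact (ih (hf h) (hg h)).congr (by ring) (fun m => by ring)

lemma IsP.smul {k : ℕ} (c : ℝ) : ∀ {α : ℝ} {f : ℕ → ℝ}, IsP k α f → IsP k (c * α) (fun m => c * f m) := by
  induction k with
  | zero =>
    rintro α f ⟨a, ha⟩
    exact ⟨c * a, fun m => by simp only [ha]; ring⟩
  | succ k ih =>
    intro α f hf h
    exact (ih (hf h)).congr (by ring) (fun m => by ring)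

lemma IsP.shift {k : ℕ} (j : ℕ) : ∀ {α : ℝ} {f : ℕ → ℝ}, IsP k α f → IsP k α (fun m => f (m + j)) := by
  induction k with
  | zero =>
    rintro α f ⟨a, ha⟩
    exact ⟨α * j + a, fun m => by simp only [ha]; push_cast; ring⟩
  | succ k ih =>
    intro α f hf h
    exact (ih (hf h)).congr rfl (fun m => by rw [show m + j + h = m + h + j by ring])

lemma IsP.up {k : ℕ} : ∀ {α : ℝ} {f : ℕ → ℝ}, IsP k α f → IsP (k+1) 0 f := by
  induction k with
  | zero =>
    rintro α f ⟨a, ha⟩ h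
    exact ⟨α * h, fun m => by simp only [ha]; push_cast; ring⟩
  | succ k ih =>
    intro α f hf h
    exact (ih (hf h)).congr (by simp) (fun m => rfl)

lemma IsP.mulX {k : ℕ} : ∀ {α : ℝ} {f : ℕ → ℝ}, IsP k α f → IsP (k+1) α (fun m => m * f m) := by
  induction k with
  | zero =>
    rintro α f ⟨a, ha⟩ h
    exact ⟨α * h * h + a * h, fun m => by simp only [ha]; push_cast; ring⟩
  | succ k ih =>
    intro α f hf h
    have h1 := ih (hf h)
    have h2 := (hf.shift h).smul h
    exact (h1.add h2).congr (by push_cast; ring) (fun m => by push_cast; ring)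

lemma IsP.const (k : ℕ) (c : ℝ) : IsP k 0 (fun _ => c) := by
  induction k with
  | zero => exact ⟨c, fun m => by simp⟩
  | succ k ih => exact ih.up

/-- polynomial Σ_{j≤k+1} c_j m^j -/
lemma IsP.poly (k : ℕ) (c : ℕ → ℝ) : IsP k (c (k+1)) (fun m => ∑ j ∈ Finset.range (k+2), c j * (m:ℝ)^j) := by
  induction k generalizing c with
  | zero => exact ⟨c 0, fun m => by simp [Finset.sum_range_succ]; ring⟩
  | succ k ih =>
    have h1 := (ih (fun j => c (j+1))).mulX
    have h2 := IsP.const (k+1) (c 0)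
    refine (h1.add h2).congr (by simp) (fun m => ?_)
    rw [Finset.sum_range_succ' _ (k+1+1), Finset.mul_sum]
    simp only [pow_zero, mul_one, add_left_inj]
    exact Finset.sum_congr rfl (fun j _ => by ring)

noncomputable def ee (x : ℝ) : ℂ := Complex.exp (x * Complex.I)
lemma norm_ee (x : ℝ) : ‖ee x‖ = 1 := by rw [ee, Complex.norm_exp_ofReal_mul_I]
lemma ee_add (x y : ℝ) : ee (x + y) = ee x * ee y := by simp [ee, add_mul, Complex.exp_add]
lemma ee_zero : ee 0 = 1 := by simp [ee]
lemma ee_conj (x : ℝ) : (starRingEnd ℂ) (ee x) = ee (-x) := by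
  rw [ee, ← Complex.exp_conj]; simp [ee]
lemma ee_sub (x y : ℝ) : ee (x - y) = ee x * (starRingEnd ℂ) (ee y) := by
  rw [ee_conj, ← ee_add, sub_eq_add_neg]
lemma norm_ee_sub_one_le (x : ℝ) : ‖ee x - 1‖ ≤ |x| := by
  have := Real.norm_exp_I_mul_ofReal_sub_one_le (x := x)
  rw [ee, mul_comm]; simpa using this
lemma norm_ee_sub_le (x y : ℝ) : ‖ee x - ee y‖ ≤ |x - y| := by
  have : ee x - ee y = ee y * (ee (x - y) - 1) := by rw [mul_sub, ← ee_add]; simp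
  rw [this, norm_mul, norm_ee, one_mul]; exact norm_ee_sub_one_le _

lemma weyl_diff_eq (f : ℕ → ℝ) (M : ℕ) :
    ‖∑ m ∈ Finset.range M, ee (f m)‖^2 = M + 2 * (∑ h ∈ Finset.Ico 1 M,
      ∑ m ∈ Finset.range (M - h), ee (f (m + h) - f m)).re := by
  induction M with
  | zero => simp
  | succ M ih =>
    have h1 : (∑ h ∈ Finset.Ico 1 (M+1), ∑ m ∈ Finset.range (M + 1 - h), ee (f (m + h) - f m))
        = (∑ h ∈ Finset.Ico 1 M, ∑ m ∈ Finset.range (M - h), ee (f (m + h) - f m))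
          + ∑ m ∈ Finset.range M, ee (f M - f m) := by
      have e1 : ∀ h ∈ Finset.Ico 1 (M+1), ∑ m ∈ Finset.range (M + 1 - h), ee (f (m + h) - f m) =
          ∑ m ∈ Finset.range (M - h), ee (f (m + h) - f m) + ee (f M - f (M - h)) := by
        intro h hh
        rw [Finset.mem_Ico] at hh
        rw [show M + 1 - h = (M - h) + 1 by omega, Finset.sum_range_succ,
          show M - h + h = M by omega]
      rw [Finset.sum_congr rfl e1, Finset.sum_add_distrib]
      congr 1
      · rcases Nat.eq_zero_or_pos M with h0 | h0
        · subst h0; simp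
        · rw [Finset.sum_Ico_succ_top (by omega)]; simp
      · rw [Finset.sum_Ico_eq_sum_range, ← Finset.sum_range_reflect]
        refine Finset.sum_congr (by simp) (fun j hj => ?_)
        simp at hj
        congr 3; omega
    rw [h1, Finset.sum_range_succ, ← Complex.normSq_eq_norm_sq, Complex.normSq_add,
      Complex.normSq_eq_norm_sq, Complex.normSq_eq_norm_sq, norm_ee, ih, Complex.add_re]
    have h2 : (∑ m ∈ Finset.range M, ee (f M - f m)).re =
        ((∑ m ∈ Finset.range M, ee (f m)) * (starRingEnd ℂ) (ee (f M))).re := by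
      rw [← Complex.conj_re, map_sum, Finset.sum_mul]
      congr 1
      exact Finset.sum_congr rfl (fun m _ => by rw [ee_sub, map_mul, Complex.conj_conj, mul_comm])
    rw [h2]; push_cast; ring

/-- Weyl differencing. -/
lemma weyl_diff (f : ℕ → ℝ) (M : ℕ) :
    ‖∑ m ∈ Finset.range M, ee (f m)‖^2 ≤ M + 2 * ∑ h ∈ Finset.Ico 1 M,
      ‖∑ m ∈ Finset.range (M - h), ee (f (m + h) - f m)‖ := by
  rw [weyl_diff_eq]
  have := (Complex.re_le_norm (∑ h ∈ Finset.Ico 1 M,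
      ∑ m ∈ Finset.range (M - h), ee (f (m + h) - f m))).trans (norm_sum_le _ _)
  linarith

lemma norm_sum_ee_le (f : ℕ → ℝ) (s : Finset ℕ) : ‖∑ m ∈ s, ee (f m)‖ ≤ s.card := by
  refine (norm_sum_le _ _).trans ?_
  simp [norm_ee]

lemma geom_bound (α β : ℝ) (h1 : α ≠ 0) (h2 : |α| ≤ 1) (M : ℕ) :
    ‖∑ m ∈ Finset.range M, ee (α * m + β)‖ ≤ 4 / |α| := by
  have e1 : ∀ m : ℕ, ee (α * m + β) = (ee α)^m * ee β := by
    intro m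
    rw [ee_add]; congr 1
    rw [ee, ee, ← Complex.exp_nat_mul]; congr 1; push_cast; ring
  have hne : |α| / 2 ≤ ‖ee α - 1‖ := by
    have hs : |α| / 2 ≤ |Real.sin α| := by
      have h3 : Real.sin |α| ≥ |α| - |α|^3/4 := by
        have := Real.sin_gt_sub_cube (abs_pos.mpr h1)
        have h9 : 0 < |α|^3 := by positivity
        linarith
      have h4 : |α|^3 ≤ |α| := by
        have := abs_nonneg α
        nlinarith [sq_nonneg α, mul_nonneg this this]
      have h5 : Real.sin |α| ≤ |Real.sin α| := by
        rcases abs_cases α with ⟨h, _⟩ | ⟨h, _⟩ <;> rw [h]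
        · exact le_abs_self _
        · rw [Real.sin_neg]; exact neg_le_abs _
      have := abs_nonneg α
      linarith
    refine hs.trans ?_
    have : (ee α - 1).im = Real.sin α := by simp [ee, Complex.exp_ofReal_mul_I_im]
    rw [← this]; exact Complex.abs_im_le_norm _
  have hα : 0 < |α| := abs_pos.mpr h1
  have hne' : ee α ≠ 1 := by
    intro h; rw [h] at hne; simp only [sub_self, norm_zero] at hne; linarith
  simp only [e1]
  rw [← Finset.sum_mul, norm_mul, norm_ee, mul_one, geom_sum_eq hne', norm_div]
  rw [div_le_div_iff₀ (by linarith) hα]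
  have : ‖ee α ^ M - 1‖ ≤ 2 := by
    refine (norm_sub_le _ _).trans ?_
    rw [norm_pow, norm_ee]; norm_num
  nlinarith

lemma sum_inv_sqrt_le (K : ℕ) : ∑ h ∈ Finset.range K, 1 / Real.sqrt ((h+1 : ℕ) : ℝ) ≤ 2 * Real.sqrt K := by
  induction K with
  | zero => simp
  | succ K ih =>
    rw [Finset.sum_range_succ]
    have hK : (0:ℝ) ≤ K := by positivity
    have a1 : 0 < Real.sqrt (K+1:ℕ) := Real.sqrt_pos.mpr (by positivity)
    have a0 := Real.sqrt_nonneg K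
    have a3 := Real.sq_sqrt hK
    have a4 : Real.sqrt (K+1:ℕ)^2 = (K+1:ℕ) := Real.sq_sqrt (by positivity)
    push_cast at a1 a4
    have : 1 / Real.sqrt ((K:ℝ)+1) ≤ 2 * (Real.sqrt ((K:ℝ)+1) - Real.sqrt K) := by
      rw [div_le_iff₀ a1]
      nlinarith only [a3, a4, sq_nonneg (Real.sqrt ((K:ℝ)+1) - Real.sqrt K)]
    push_cast at ih ⊢
    linarith

lemma sum_rpow_le (s : ℝ) (hs2 : s ≤ 1/2) (M : ℕ) :
    ∑ h ∈ Finset.Ico 1 M, ((M:ℝ)/h)^s ≤ 2 * M := by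
  have h1 : ∀ h ∈ Finset.Ico 1 M, ((M:ℝ)/h)^s ≤ Real.sqrt M * (1 / Real.sqrt h) := by
    intro h hh
    rw [Finset.mem_Ico] at hh
    have hh0 : (0:ℝ) < h := by exact_mod_cast hh.1
    have hhM : (h:ℝ) ≤ M := by exact_mod_cast hh.2.le
    have : ((M:ℝ)/h)^s ≤ ((M:ℝ)/h)^(1/2:ℝ) :=
      Real.rpow_le_rpow_of_exponent_le (by rw [le_div_iff₀ hh0]; linarith) hs2
    rw [← Real.sqrt_eq_rpow, Real.sqrt_div (by positivity)] at this
    rwa [mul_one_div]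
  refine (Finset.sum_le_sum h1).trans ?_
  rw [← Finset.mul_sum, Finset.sum_Ico_eq_sum_range]
  have := sum_inv_sqrt_le (M-1)
  have h3 : Real.sqrt ((M-1:ℕ):ℝ) ≤ Real.sqrt M := Real.sqrt_le_sqrt (by exact_mod_cast Nat.sub_le _ _)
  have h4 := Real.mul_self_sqrt (show (0:ℝ) ≤ M by positivity)
  have h5 := Real.sqrt_nonneg (M:ℝ)
  simp only [add_comm 1]
  nlinarith

/-- Weyl inequality for polynomial phases without wrap-around. -/
lemma weyl_poly (k : ℕ) : ∃ C : ℝ, 1 ≤ C ∧ ∀ (α : ℝ) (f : ℕ → ℝ) (M M' : ℕ), IsP k α f → α ≠ 0 → M' ≤ M →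
    (Nat.factorial (k+1)) * |α| * (M:ℝ)^k ≤ 1 →
    ‖∑ m ∈ Finset.range M', ee (f m)‖ ≤ C * M * (1 / (|α| * (M:ℝ)^(k+1)))^((1/2:ℝ)^(k+1)) := by
  induction k with
  | zero =>
    refine ⟨4, by norm_num, ?_⟩
    rintro α f M M' ⟨β, hβ⟩ h0 hM h1
    simp only [hβ]
    simp at h1
    rcases Nat.eq_zero_or_pos M with hM0 | hM0
    · subst hM0; simp at hM; subst hM; simp
    have hα : 0 < |α| := abs_pos.mpr h0
    have hMp : (0:ℝ) < M := by exact_mod_cast hM0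
    simp only [zero_add, pow_one]
    rcases le_total 1 (1/(|α| * M)) with h | h
    · have a1 : (1:ℝ) ≤ (1/(|α| * M))^(1/2:ℝ) := Real.one_le_rpow h (by norm_num)
      have a2 := norm_sum_ee_le (fun m => α * m + β) (Finset.range M')
      have a3 : (M':ℝ) ≤ M := by exact_mod_cast hM
      simp only [Finset.card_range] at a2
      nlinarith only [hMp, a3, a2, a1]
    · have a1 : (1/(|α| * M)) ≤ (1/(|α| * M))^(1/2:ℝ) := by
        conv_lhs => rw [← Real.rpow_one (1/(|α| * M))]
        exact Real.rpow_le_rpow_of_exponent_ge (by positivity) h (by norm_num)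
      have a2 := geom_bound α β h0 h1 M'
      have a3 : 4 / |α| = 4 * M * (1/(|α| * M)) := by field_simp
      rw [a3] at a2
      refine a2.trans ?_
      gcongr
  | succ k ih =>
    obtain ⟨C, hC, ih⟩ := ih
    refine ⟨Real.sqrt (1 + 4 * C), by rw [Real.one_le_sqrt]; linarith, ?_⟩
    intro α f M M' hf h0 hM h1
    rcases Nat.eq_zero_or_pos M with hM0 | hM0
    · subst hM0; simp at hM; subst hM; simp
    have hα : 0 < |α| := abs_pos.mpr h0
    have hMp : (0:ℝ) < M := by exact_mod_cast hM0
    have hM1 : (1:ℝ) ≤ M := by exact_mod_cast hM0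
    set δ : ℝ := 1 / (|α| * (M:ℝ)^(k+1+1)) with hδ
    set s : ℝ := (1/2:ℝ)^(k+1) with hs
    have hs0 : 0 < s := by positivity
    have hs2 : s ≤ 1/2 := by
      rw [hs, pow_succ]
      have : (1/2:ℝ)^k ≤ 1 := pow_le_one₀ (by norm_num) (by norm_num)
      linarith
    have hδ0 : 0 < δ := by positivity
    have hs' : (1/2:ℝ)^(k+1+1) = s / 2 := by rw [pow_succ, hs]; ring
    rw [hs']
    have hM'r : (M':ℝ) ≤ M := by exact_mod_cast hM
    have hfact : (1:ℝ) ≤ Nat.factorial (k+1+1) := by exact_mod_cast Nat.factorial_pos _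
    -- δ ≥ 1/M
    have hδM : 1 ≤ M * δ := by
      rw [hδ, mul_one_div, le_div_iff₀ (by positivity), pow_succ]
      have : |α| * (M:ℝ)^(k+1) ≤ 1 := by
        refine le_trans ?_ h1
        rw [mul_assoc]
        exact le_mul_of_one_le_left (by positivity) hfact
      nlinarith only [this]
    have hδs : 1 ≤ M * δ^s := by
      rcases le_total 1 δ with h | h
      · have := Real.one_le_rpow h hs0.le
        nlinarith only [hM1, this]
      · have : δ ≤ δ^s := by
          conv_lhs => rw [← Real.rpow_one δ]
          exact Real.rpow_le_rpow_of_exponent_ge hδ0 h (by linarith)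
        nlinarith only [hδM, this]
    have hsq : ‖∑ m ∈ Finset.range M', ee (f m)‖^2 ≤ (1 + 4 * C) * (M:ℝ)^2 * δ^s := by
      refine (weyl_diff f M').trans ?_
      have hterm : ∀ h ∈ Finset.Ico 1 M', ‖∑ m ∈ Finset.range (M' - h), ee (f (m + h) - f m)‖ ≤
          C * M * δ^s * ((M:ℝ)/h)^s := by
        intro h hh
        rw [Finset.mem_Ico] at hh
        have hh0 : (0:ℝ) < h := by exact_mod_cast hh.1
        have hhM : (h:ℝ) ≤ M := by exact_mod_cast hh.2.le.trans hM
        have e1 : |((k:ℝ)+2) * α * h| = (k+2) * |α| * h := by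
          rw [abs_mul, abs_mul, abs_of_pos hh0, abs_of_pos (by positivity : (0:ℝ) < (k:ℝ)+2)]
        have := ih (((k:ℝ)+2) * α * h) (fun m => f (m + h) - f m) M (M' - h) (hf h)
          (by positivity) (by omega) (by
            rw [e1]
            refine le_trans ?_ h1
            rw [Nat.factorial_succ (k+1), pow_succ]
            push_cast
            have : ((Nat.factorial (k+1)) * ((k + 2) * |α| * h) * (M:ℝ)^k) =
              ((k + 1 + 1) * (Nat.factorial (k+1)) * |α| * ((M:ℝ)^k * h)) := by ring
            rw [this]
            gcongr)
        refine this.trans ?_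
        rw [mul_assoc (C * M), ← Real.mul_rpow hδ0.le (by positivity)]
        gcongr
        rw [e1, hδ, div_mul_div_comm, one_mul, pow_succ (M:ℝ) (k+1)]
        rw [div_le_div_iff₀ (by positivity) (by positivity)]
        have : (1:ℝ) ≤ k + 2 := by linarith [show (0:ℝ) ≤ k by positivity]
        have h5 : 0 ≤ |α| * ((M:ℝ)^(k+1) * M) * h := by positivity
        nlinarith only [h5]
      have hsum : ∑ h ∈ Finset.Ico 1 M', ‖∑ m ∈ Finset.range (M' - h), ee (f (m + h) - f m)‖ ≤
          C * M * δ^s * (2 * M) := by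
        refine (Finset.sum_le_sum hterm).trans ?_
        rw [← Finset.mul_sum]
        gcongr
        refine le_trans ?_ (sum_rpow_le s hs2 M)
        exact Finset.sum_le_sum_of_subset_of_nonneg (Finset.Ico_subset_Ico_right hM) (fun _ _ _ => by positivity)
      nlinarith only [hM'r, hsum, hδs, Real.rpow_nonneg hδ0.le s]
    have hfin : (Real.sqrt (1 + 4 * C) * M * δ^(s/2))^2 = (1 + 4 * C) * (M:ℝ)^2 * δ^s := by
      rw [mul_pow, mul_pow, Real.sq_sqrt (by linarith), ← Real.rpow_natCast (δ^(s/2)), ← Real.rpow_mul hδ0.le]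
      congr 2; push_cast; ring
    exact (sq_le_sq₀ (norm_nonneg _) (by positivity)).mp (by rw [hfin]; exact hsq)


lemma weyl_block (κ : ℕ) : ∃ C : ℝ, 1 ≤ C ∧ ∀ (u : ℝ) (n0 M M' : ℕ), 1 ≤ n0 → u ≠ 0 → M' ≤ M → 2 * M ≤ n0 →
    (Nat.factorial (κ+1)) * |u| * (M:ℝ)^κ ≤ (n0:ℝ)^(κ+1) →
    ‖∑ m ∈ Finset.range M', ee (u * Real.log ((n0 + m : ℕ) : ℝ))‖ ≤
      C * M * ((κ+1) * (n0:ℝ)^(κ+1) / (|u| * (M:ℝ)^(κ+1)))^((1/2:ℝ)^(κ+1))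
      + M * (|u| * (2 * ((M:ℝ)/n0)^(κ+2))) := by
  obtain ⟨C, hC, hW⟩ := weyl_poly κ
  refine ⟨C, hC, ?_⟩
  intro u n0 M M' hn0 hu hM hMn hcond
  have hn : (0:ℝ) < n0 := by exact_mod_cast hn0
  set c : ℕ → ℝ := fun j => if j = 0 then u * Real.log n0 else -u * (-1/n0)^j / j with hc
  have hP := IsP.poly κ c
  have hca : c (κ+1) = -u * (-1/n0)^(κ+1) / (κ+1 : ℕ) := by simp [hc]
  have habs : |c (κ+1)| = |u| / ((κ+1) * (n0:ℝ)^(κ+1)) := by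
    rw [hca, abs_div, abs_mul, abs_neg, abs_pow, abs_div, abs_neg, abs_one, abs_of_pos hn,
      Nat.abs_cast, div_pow, one_pow]
    push_cast; field_simp
  have hu' : 0 < |u| := abs_pos.mpr hu
  have h1 := hW (c (κ+1)) _ M M' hP (by rw [← abs_pos, habs]; positivity) hM (by
    rw [habs]
    have : (Nat.factorial (κ+1)) * (|u| / ((κ+1) * (n0:ℝ)^(κ+1))) * (M:ℝ)^κ =
      ((Nat.factorial (κ+1)) * |u| * (M:ℝ)^κ) / ((κ+1) * (n0:ℝ)^(κ+1)) := by ring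
    rw [this, div_le_one (by positivity)]
    refine hcond.trans (le_mul_of_one_le_left (by positivity) (by linarith [show (0:ℝ) ≤ κ by positivity])))
  have hTay : ∀ m ∈ Finset.range M', ‖ee (u * Real.log ((n0 + m : ℕ) : ℝ)) -
      ee (∑ j ∈ Finset.range (κ+2), c j * (m:ℝ)^j)‖ ≤ |u| * (2 * ((M:ℝ)/n0)^(κ+2)) := by
    intro m hm
    rw [Finset.mem_range] at hm
    refine (norm_ee_sub_le _ _).trans ?_
    have hmM : (m:ℝ) ≤ M := by exact_mod_cast (hm.trans_le hM).le
    have hMn' : 2 * (M:ℝ) ≤ n0 := by exact_mod_cast hMn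
    set x : ℝ := m / n0 with hx
    have hx0 : 0 ≤ x := by positivity
    have hx2 : x ≤ 1/2 := by rw [hx, div_le_iff₀ hn]; linarith
    have hlog : Real.log ((n0 + m : ℕ) : ℝ) = Real.log n0 + Real.log (1 - (-x)) := by
      rw [← Real.log_mul hn.ne' (by linarith)]
      congr 1; rw [hx]; push_cast; field_simp; ring
    have hsum : ∑ j ∈ Finset.range (κ+2), c j * (m:ℝ)^j = u * Real.log n0 - u * ∑ i ∈ Finset.range (κ+1), (-x)^(i+1)/(i+1) := by
      rw [Finset.sum_range_succ', Finset.mul_sum, sub_eq_add_neg, ← Finset.sum_neg_distrib, add_comm]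
      congr 1
      · simp [hc]
      · refine Finset.sum_congr rfl (fun i _ => ?_)
        simp only [hc, hx]
        rw [if_neg (by omega)]
        rw [show -((m:ℝ)/n0) = (-1/n0) * m by ring, mul_pow]
        push_cast; ring
    have key := Real.abs_log_sub_add_sum_range_le (x := -x) (by rw [abs_neg, abs_of_nonneg hx0]; linarith) (κ+1)
    rw [hlog, hsum]
    have e : u * (Real.log n0 + Real.log (1 - (-x))) - (u * Real.log n0 - u * ∑ i ∈ Finset.range (κ+1), (-x)^(i+1)/(i+1))
       = u * ((∑ i ∈ Finset.range (κ+1), (-x)^(i+1)/(i+1)) + Real.log (1 - (-x))) := by ring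
    rw [e, abs_mul]
    gcongr
    refine key.trans ?_
    rw [abs_neg, abs_of_nonneg hx0, div_le_iff₀ (by linarith)]
    have h3 : x^(κ+1+1) ≤ ((M:ℝ)/n0)^(κ+2) := by
      rw [hx]; gcongr
    have h4 : (0:ℝ) ≤ ((M:ℝ)/n0)^(κ+2) := by positivity
    nlinarith only [h3, hx2, h4]
  have h2 : ‖∑ m ∈ Finset.range M', ee (u * Real.log ((n0 + m : ℕ) : ℝ)) -
      ∑ m ∈ Finset.range M', ee (∑ j ∈ Finset.range (κ+2), c j * (m:ℝ)^j)‖ ≤ M * (|u| * (2 * ((M:ℝ)/n0)^(κ+2))) := by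
    rw [← Finset.sum_sub_distrib]
    refine (norm_sum_le_of_le _ hTay).trans ?_
    rw [Finset.sum_const, Finset.card_range, nsmul_eq_mul]
    have : (M':ℝ) ≤ M := by exact_mod_cast hM
    gcongr
  have h3 : (1 / (|c (κ+1)| * (M:ℝ)^(κ+1))) = ((κ+1) * (n0:ℝ)^(κ+1) / (|u| * (M:ℝ)^(κ+1))) := by
    rw [habs]
    rcases Nat.eq_zero_or_pos M with h | h
    · subst h; simp
    · field_simp
  rw [h3] at h1
  have h4 := norm_add_le (∑ m ∈ Finset.range M', ee (u * Real.log ((n0 + m : ℕ) : ℝ)) -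
      ∑ m ∈ Finset.range M', ee (∑ j ∈ Finset.range (κ+2), c j * (m:ℝ)^j)) (∑ m ∈ Finset.range M', ee (∑ j ∈ Finset.range (κ+2), c j * (m:ℝ)^j))
  rw [sub_add_cancel] at h4
  linarith only [h1, h2, h4]

lemma block_sum (F : ℕ → ℂ) (N M : ℕ) (B : ℝ) (hB : ∀ n0 M', N ≤ n0 → n0 ≤ 2 * N + 1 → M' ≤ M → ‖∑ m ∈ Finset.range M', F (n0 + m)‖ ≤ B) :
    ∀ a T n0 : ℕ, N ≤ n0 → n0 + T ≤ 2 * N + 1 → T ≤ a * M → ‖∑ m ∈ Finset.range T, F (n0 + m)‖ ≤ a * B := by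
  intro a
  induction a with
  | zero => intro T n0 _ _ hT; simp at hT; subst hT; simp
  | succ a ih =>
    intro T n0 hn hn2 hT
    rcases le_total T M with h | h
    · have h0 : 0 ≤ B := by simpa using hB n0 0 hn (by omega) (by omega)
      have := hB n0 T hn (by omega) h
      push_cast
      nlinarith only [this, h0, show (0:ℝ) ≤ a by positivity]
    · obtain ⟨T', rfl⟩ := Nat.exists_eq_add_of_le h
      rw [Finset.sum_range_add]
      refine (norm_add_le _ _).trans ?_
      have h1 := hB n0 M hn (by omega) le_rfl
      have h2 := ih T' (n0 + M) (by omega) (by omega) (by rw [Nat.succ_mul] at hT; omega)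
      simp only [add_assoc] at h2
      push_cast
      linarith

set_option maxHeartbeats 1000000 in
/-- Weyl bound for zeta sums. -/
theorem weyl (A : ℝ) (hA : 1 ≤ A) : ∃ c : ℝ, 0 < c ∧ c < 1 ∧ ∃ C : ℝ, 1 ≤ C ∧ ∀ (N N' : ℕ) (u : ℝ), 1 ≤ N → N' ≤ 2 * N →
    (N:ℝ)^(1/3:ℝ) ≤ |u| → |u| ≤ (N:ℝ)^A →
    ‖∑ n ∈ Finset.Ioc N N', ee (u * Real.log n)‖ ≤ C * (N:ℝ)^(1 - c) := by
  set κ : ℕ := ⌈2*A⌉₊ with hκ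
  have hκA : 2 * A ≤ κ := Nat.le_ceil _
  set e0 : ℝ := 1 / ((κ:ℝ) + 3/2) with he0
  have he0p : 0 < e0 := by positivity
  have he01 : e0 ≤ 1 := by rw [he0, div_le_one (by positivity)]; linarith [show (0:ℝ) ≤ κ by positivity]
  set s : ℝ := (1/2:ℝ)^(κ+1) with hs
  have hs0 : 0 < s := by positivity
  have hs1 : s ≤ 1 := pow_le_one₀ (by norm_num) (by norm_num)
  obtain ⟨C, hC, hB⟩ := weyl_block κ
  set c : ℝ := e0 * s / 6 with hc
  have hc0 : 0 < c := by positivity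
  have hce : c ≤ e0 / 6 := by rw [hc]; nlinarith only [he0p, hs1]
  set K : ℝ := (Nat.factorial (κ+1)) * 2^κ with hK
  have hK1 : 1 ≤ K := by
    have h1 : (1:ℝ) ≤ Nat.factorial (κ+1) := by exact_mod_cast Nat.factorial_pos _
    have h2 : (1:ℝ) ≤ 2^κ := one_le_pow₀ (by norm_num)
    rw [hK]; nlinarith only [h1, h2]
  set D : ℝ := (κ+1) * 3^(κ+1) with hD
  have hD1 : 1 ≤ D := by
    have h2 : (1:ℝ) ≤ 3^(κ+1) := one_le_pow₀ (by norm_num)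
    rw [hD]; nlinarith only [hA, hκA, he01, hc0, hce, h2, show (0:ℝ) ≤ κ by positivity]
  refine ⟨c, hc0, by linarith, 4 + K + 2 * (C * D + 2^(κ+3)), by nlinarith only [hC, hK1, hD1, show (0:ℝ) < 2^(κ+3) by positivity], ?_⟩
  intro N N' u hN hN' hu1 hu2
  have hNp : (0:ℝ) < N := by exact_mod_cast hN
  have hN1 : (1:ℝ) ≤ N := by exact_mod_cast hN
  have hNc : 0 < (N:ℝ)^(1-c) := by positivity
  have hNN : (N:ℝ) = (N:ℝ)^c * (N:ℝ)^(1-c) := by rw [← Real.rpow_add hNp]; simp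
  have htriv : ‖∑ n ∈ Finset.Ioc N N', ee (u * Real.log n)‖ ≤ N := by
    refine (norm_sum_ee_le (fun n => u * Real.log n) _).trans ?_
    rw [Nat.card_Ioc]; exact_mod_cast (by omega)
  have hbig : 0 ≤ C * D + 2^(κ+3) := by positivity
  by_cases hx1 : (N:ℝ)^(e0/3) < 4
  · have : (N:ℝ)^c ≤ (N:ℝ)^(e0/3) := Real.rpow_le_rpow_of_exponent_le hN1 (by linarith only [hc0, hce])
    refine htriv.trans ?_
    conv_lhs => rw [hNN]
    gcongr; linarith only [he01, hc0, hce, hK1, hbig, hx1, this]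
  by_cases hx2 : (N:ℝ)^(1/4:ℝ) < K
  · have : (N:ℝ)^c ≤ (N:ℝ)^(1/4:ℝ) := Real.rpow_le_rpow_of_exponent_le hN1 (by linarith only [he01, hc0, hce])
    refine htriv.trans ?_
    conv_lhs => rw [hNN]
    gcongr; linarith only [he01, hc0, hce, hbig, hx2, this]
  push Not at hx1 hx2
  have hu0 : 0 < |u| := lt_of_lt_of_le (by positivity) hu1
  set r : ℝ := |u|^e0 with hr
  have hr0 : 0 < r := by positivity
  have hur : |u| = r^((κ:ℝ)+3/2) := by
    rw [hr, ← Real.rpow_mul hu0.le, he0, one_div, inv_mul_cancel₀ (by positivity), Real.rpow_one]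
  have hrlow : (N:ℝ)^(e0/3) ≤ r := by
    rw [hr, show e0/3 = (1/3) * e0 by ring, Real.rpow_mul hNp.le]; gcongr
  have hrup : r ≤ (N:ℝ)^(1/2:ℝ) := by
    have : r ≤ ((N:ℝ)^A)^e0 := by rw [hr]; gcongr
    refine this.trans ?_
    rw [← Real.rpow_mul hNp.le]
    refine Real.rpow_le_rpow_of_exponent_le hN1 ?_
    rw [he0, mul_one_div, div_le_iff₀ (by positivity)]; linarith only [hκA, he01, hc0, hce]
  have hr4 : 4 ≤ r := hx1.trans hrlow
  have hrN : r ≤ N := hrup.trans (by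
    conv_rhs => rw [← Real.rpow_one (N:ℝ)]
    exact Real.rpow_le_rpow_of_exponent_le hN1 (by norm_num))
  set M : ℕ := ⌈(N:ℝ)/r⌉₊ with hM
  have hM1 : (N:ℝ)/r ≤ M := Nat.le_ceil _
  have hNr1 : 1 ≤ (N:ℝ)/r := by rw [le_div_iff₀ hr0]; linarith only [hrN]
  have hM2 : (M:ℝ) ≤ 2 * (N/r) := by
    have := Nat.ceil_lt_add_one (show 0 ≤ (N:ℝ)/r by positivity)
    linarith only [hNr1, this]
  have hMp : (0:ℝ) < M := by linarith only [he01, hc0, hce, hM1, hNr1]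
  have hMN : 2 * (M:ℝ) ≤ N := by
    have : (N:ℝ)/r ≤ N/4 := by gcongr
    linarith only [hM2, this]
  have hr12 : r^(-(1/2):ℝ) ≤ r^(-(s/2)) := Real.rpow_le_rpow_of_exponent_le (by linarith only [he01, hc0, hce, hx1, hrlow]) (by linarith only [hs1])
  have hblock : ∀ n0 M', N ≤ n0 → n0 ≤ 2 * N + 1 → M' ≤ M →
      ‖∑ m ∈ Finset.range M', ee (u * Real.log ((n0 + m : ℕ) : ℝ))‖ ≤ M * ((C * D + 2^(κ+3)) * r^(-(s/2))) := by
    intro n0 M' hn1 hn2 hM'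
    have hn1r : (N:ℝ) ≤ n0 := by exact_mod_cast hn1
    have hn2r : (n0:ℝ) ≤ 3 * N := by exact_mod_cast (by omega : n0 ≤ 3 * N)
    have hn0p : (0:ℝ) < n0 := by linarith only [he01, hc0, hce, hx1, hrlow, hrN, hn1r]
    have e1 : r^((κ:ℝ)+3/2) = r^κ * r^(3/2:ℝ) := by rw [Real.rpow_add hr0, Real.rpow_natCast]
    have e2 : r^((κ:ℝ)+3/2) = r^(κ+1) * r^(1/2:ℝ) := by
      rw [← Real.rpow_natCast r (κ+1), ← Real.rpow_add hr0]; congr 1; push_cast; ring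
    have e3 : r^((κ:ℝ)+3/2) = r^(κ+2) * r^(-(1/2):ℝ) := by
      rw [← Real.rpow_natCast r (κ+2), ← Real.rpow_add hr0]; congr 1; push_cast; ring
    have := hB u n0 M M' (by omega) (abs_pos.mp hu0) hM' (by exact_mod_cast hMN.trans hn1r) (by
      calc (Nat.factorial (κ+1)) * |u| * (M:ℝ)^κ ≤ (Nat.factorial (κ+1)) * |u| * (2 * (N/r))^κ := by gcongr
        _ = K * r^(3/2:ℝ) * (N:ℝ)^κ := by rw [hur, e1, mul_pow, div_pow, hK]; field_simp
        _ ≤ (N:ℝ)^(1/4:ℝ) * ((N:ℝ)^(1/2:ℝ))^(3/2:ℝ) * (N:ℝ)^κ := by gcongr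
        _ = (N:ℝ)^(κ+1) := by
          rw [← Real.rpow_mul hNp.le, ← Real.rpow_add hNp, pow_succ]
          norm_num; ring
        _ ≤ _ := by gcongr)
    refine this.trans ?_
    have hδ : (κ+1) * (n0:ℝ)^(κ+1) / (|u| * (M:ℝ)^(κ+1)) ≤ D * r^(-(1/2):ℝ) := by
      calc (κ+1) * (n0:ℝ)^(κ+1) / (|u| * (M:ℝ)^(κ+1)) ≤ (κ+1) * (3 * N)^(κ+1) / (|u| * ((N:ℝ)/r)^(κ+1)) := by gcongr
        _ = D * r^(-(1/2):ℝ) := by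
          rw [hur, e2, Real.rpow_neg hr0.le, hD, mul_pow, div_pow]; field_simp
    have hδs : ((κ+1) * (n0:ℝ)^(κ+1) / (|u| * (M:ℝ)^(κ+1)))^s ≤ D * r^(-(s/2)) := by
      calc ((κ+1) * (n0:ℝ)^(κ+1) / (|u| * (M:ℝ)^(κ+1)))^s ≤ (D * r^(-(1/2):ℝ))^s := by gcongr
        _ = D^s * r^(-(s/2)) := by
          rw [Real.mul_rpow (by linarith only [he01, hc0, hce, hD1]) (by positivity), ← Real.rpow_mul hr0.le]; congr 2; ring
        _ ≤ D^(1:ℝ) * r^(-(s/2)) := by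
          gcongr
        _ = _ := by rw [Real.rpow_one]
    have hT : |u| * (2 * ((M:ℝ)/n0)^(κ+2)) ≤ 2^(κ+3) * r^(-(s/2)) := by
      calc |u| * (2 * ((M:ℝ)/n0)^(κ+2)) ≤ |u| * (2 * ((2 * (N/r))/N)^(κ+2)) := by gcongr
        _ = 2^(κ+3) * r^(-(1/2):ℝ) := by
          rw [hur, e3, show 2 * ((N:ℝ)/r)/N = 2/r by field_simp, div_pow]; field_simp; ring
        _ ≤ _ := by gcongr
    calc _ ≤ C * M * (D * r^(-(s/2))) + M * (2^(κ+3) * r^(-(s/2))) := by gcongr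
      _ = _ := by ring
  have hMpos : 0 < M := by exact_mod_cast hMp
  have hsum := block_sum (fun n => ee (u * Real.log (n:ℝ))) N M _ hblock (N / M + 1) (N' - N) (N+1) (by omega)
    (by omega) (by
      have := Nat.div_add_mod N M
      have := Nat.mod_lt N hMpos
      nlinarith [show N' - N ≤ N by omega])
  have heq : ∑ n ∈ Finset.Ioc N N', ee (u * Real.log n) = ∑ m ∈ Finset.range (N' - N), ee (u * Real.log ((N + 1 + m : ℕ):ℝ)) := by
    have := Finset.sum_Ico_eq_sum_range (fun n : ℕ => ee (u * Real.log n)) (N+1) (N'+1)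
    rw [show N' + 1 - (N + 1) = N' - N by omega] at this
    rw [← this]
    exact Finset.sum_congr (by ext n; simp only [Finset.mem_Ioc, Finset.mem_Ico]; omega) (fun _ _ => rfl)
  rw [heq]
  refine hsum.trans ?_
  have ha : ((N / M + 1 : ℕ):ℝ) * M ≤ 2 * N := by
    have h1 : N / M * M ≤ N := Nat.div_mul_le_self N M
    have h2 : ((N / M * M : ℕ):ℝ) ≤ N := by exact_mod_cast h1
    push_cast at h2 ⊢
    linarith only [he01, hc0, hce, hx1, hrlow, hrN, hMN, h2]
  calc ((N / M + 1 : ℕ):ℝ) * (M * ((C * D + 2^(κ+3)) * r^(-(s/2))))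
      = (((N / M + 1 : ℕ):ℝ) * M) * ((C * D + 2^(κ+3)) * r^(-(s/2))) := by ring
    _ ≤ (2 * N) * ((C * D + 2^(κ+3)) * ((N:ℝ)^(e0/3))^(-(s/2))) := by
      gcongr ?_ * (_ * ?_)
      exact Real.rpow_le_rpow_of_nonpos (by positivity) hrlow (by linarith only [hs0])
    _ = 2 * (C * D + 2^(κ+3)) * (N:ℝ)^(1-c) := by
      rw [← Real.rpow_mul hNp.le, show 1 - c = 1 + e0/3 * (-(s/2)) by rw [hc]; ring, Real.rpow_add hNp, Real.rpow_one]; ring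
    _ ≤ _ := by gcongr; linarith only [he01, hc0, hce, hK1]
end MR

namespace MR

lemma abel_bound (a : ℕ → ℂ) (w : ℕ → ℝ) (N : ℕ) (B : ℝ) (hw : ∀ n, N ≤ n → w (n+1) ≤ w n) (hw0 : ∀ n, 0 ≤ w n) (N' : ℕ)
    (hB : ∀ k, N ≤ k → k ≤ N' → ‖∑ n ∈ Finset.Ioc N k, a n‖ ≤ B) (hN : N ≤ N') :
    ‖∑ n ∈ Finset.Ioc N N', (w n : ℂ) * a n‖ ≤ B * w N := by
  have key : ∀ k, N ≤ k → k ≤ N' → ‖∑ n ∈ Finset.Ioc N k, (w n : ℂ) * a n - w k * ∑ n ∈ Finset.Ioc N k, a n‖ ≤ B * (w N - w k) := by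
    intro k hk
    induction k, hk using Nat.le_induction with
    | base => intro _; simp
    | succ k hk ih =>
      intro hk'
      have ih' := ih (by omega)
      have hb := hB k hk (by omega)
      rw [← Finset.insert_Ioc_right_eq_Ioc_add_one hk, Finset.sum_insert (by simp), Finset.sum_insert (by simp)]
      have e : (w (k+1) : ℂ) * a (k+1) + ∑ n ∈ Finset.Ioc N k, (w n : ℂ) * a n - w (k+1) * (a (k+1) + ∑ n ∈ Finset.Ioc N k, a n)
        = (∑ n ∈ Finset.Ioc N k, (w n : ℂ) * a n - w k * ∑ n ∈ Finset.Ioc N k, a n) + ((w k - w (k+1) : ℝ) : ℂ) * ∑ n ∈ Finset.Ioc N k, a n := by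
        push_cast; ring
      rw [e]
      refine (norm_add_le _ _).trans ?_
      rw [norm_mul, Complex.norm_real, Real.norm_of_nonneg (sub_nonneg.2 (hw k hk))]
      have := mul_le_mul_of_nonneg_left hb (sub_nonneg.2 (hw k hk))
      linarith
  have h1 := key N' hN le_rfl
  have h2 := hB N' hN le_rfl
  have h3 : ‖(w N' : ℂ) * ∑ n ∈ Finset.Ioc N N', a n‖ ≤ w N' * B := by
    rw [norm_mul, Complex.norm_real, Real.norm_of_nonneg (hw0 _)]
    exact mul_le_mul_of_nonneg_left h2 (hw0 _)
  have h4 := norm_add_le (∑ n ∈ Finset.Ioc N N', (w n : ℂ) * a n - w N' * ∑ n ∈ Finset.Ioc N N', a n) (w N' * ∑ n ∈ Finset.Ioc N N', a n)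
  rw [sub_add_cancel] at h4
  linarith

/-- ∫_a^b e^{ius} ds -/
noncomputable def JJ (u a b : ℝ) : ℂ := ∫ s in a..b, ee (u * s)

lemma continuous_ee : Continuous ee := by unfold ee; fun_prop

lemma JJ_add (u a b c : ℝ) : JJ u a b + JJ u b c = JJ u a c :=
  intervalIntegral.integral_add_adjacent_intervals
    (Continuous.intervalIntegrable (by have := continuous_ee; fun_prop) _ _)
    (Continuous.intervalIntegrable (by have := continuous_ee; fun_prop) _ _)

lemma norm_JJ_le (u a b : ℝ) : ‖JJ u a b‖ ≤ |b - a| := by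
  have := intervalIntegral.norm_integral_le_of_norm_le_const (a := a) (b := b) (C := 1) (f := fun s => ee (u * s))
    (fun s _ => (norm_ee _).le)
  simpa [JJ] using this

lemma JJ_eq (u a b : ℝ) (hu : u ≠ 0) : JJ u a b = (ee (u * b) - ee (u * a)) / (u * Complex.I) := by
  have h := integral_exp_mul_complex (a := a) (b := b) (c := (u:ℂ) * Complex.I) (by simp [hu])
  rw [JJ]
  convert h using 1
  · congr 1; ext s; rw [ee]; congr 1; push_cast; ring
  · simp only [ee]; push_cast; congr 3 <;> ring_nf

lemma norm_JJ_le' (u a b : ℝ) (hu : u ≠ 0) : ‖JJ u a b‖ ≤ 2 / |u| := by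
  rw [JJ_eq u a b hu, norm_div, norm_mul, Complex.norm_I, mul_one, Complex.norm_real, Real.norm_eq_abs]
  gcongr
  refine (norm_sub_le _ _).trans ?_
  rw [norm_ee, norm_ee]; norm_num

lemma JJ_shift (u a b t : ℝ) : ee (u * t) * JJ u a b = JJ u (a + t) (b + t) := by
  rw [JJ, JJ, ← intervalIntegral.integral_comp_add_right (fun s => ee (u * s)) t, ← intervalIntegral.integral_const_mul]
  congr 1; ext s; rw [← ee_add]; congr 1; ring

lemma log_step (n : ℕ) (hn : 1 ≤ n) : Real.log (n+1:ℕ) - Real.log n ≤ 1 / n ∧ 1 / ((n:ℝ)+1) ≤ Real.log (n+1:ℕ) - Real.log n := by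
  have hn0 : (0:ℝ) < n := by exact_mod_cast hn
  have e : Real.log (n+1:ℕ) - Real.log n = Real.log (1 + 1/n) := by
    rw [← Real.log_div (by positivity) hn0.ne']; congr 1; push_cast; field_simp
  have e' : Real.log (n+1:ℕ) - Real.log n = - Real.log (1 - 1/(n+1)) := by
    rw [← Real.log_div (by positivity) hn0.ne', ← Real.log_inv]; congr 1; push_cast; rw [eq_comm, inv_eq_iff_eq_inv, inv_div]; field_simp; ring
  constructor
  · rw [e]
    have := Real.log_le_sub_one_of_pos (show (0:ℝ) < 1 + 1/n by positivity)
    linarith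
  · rw [e']
    have := Real.log_le_sub_one_of_pos (show (0:ℝ) < 1 - 1/((n:ℝ)+1) by
      rw [sub_pos, div_lt_one (by positivity)]; linarith)
    linarith

lemma step_err (u : ℝ) (n : ℕ) (hn : 1 ≤ n) :
    ‖ee (u * Real.log (n+1:ℕ)) / ((n+1:ℕ):ℂ) - JJ u (Real.log n) (Real.log (n+1:ℕ))‖ ≤ (|u| + 1) * (2 * (1/(n:ℝ) - 1/((n:ℝ)+1))) := by
  obtain ⟨h1, h2⟩ := log_step n hn
  have hn0 : (1:ℝ) ≤ n := by exact_mod_cast hn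
  set b := Real.log (n+1:ℕ)
  set a := Real.log n
  have hab : 0 ≤ b - a := le_trans (by positivity) h2
  have e1 : JJ u a b - (b - a : ℝ) * ee (u * b) = ∫ s in a..b, (ee (u * s) - ee (u * b)) := by
    rw [intervalIntegral.integral_sub (Continuous.intervalIntegrable (by have := continuous_ee; fun_prop) _ _) (by simp), JJ]
    simp
  have e2 : ‖JJ u a b - (b - a : ℝ) * ee (u * b)‖ ≤ |u| * (b - a) * (b - a) := by
    rw [e1]
    have := intervalIntegral.norm_integral_le_of_norm_le_const (a := a) (b := b) (C := |u| * (b-a)) (f := fun s => ee (u * s) - ee (u * b))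
      (fun s hs => by
        rw [Set.uIoc_of_le (by linarith)] at hs
        refine (norm_ee_sub_le _ _).trans ?_
        rw [← mul_sub, abs_mul]
        gcongr
        rw [abs_sub_comm, abs_of_nonneg (by linarith [hs.2])]; linarith [hs.1])
    rwa [abs_of_nonneg hab] at this
  have e3 : ee (u * b) / ((n+1:ℕ):ℂ) - JJ u a b = -(JJ u a b - (b - a : ℝ) * ee (u * b)) + ((1/((n:ℝ)+1) - (b - a) : ℝ)) * ee (u * b) := by
    push_cast; ring
  rw [e3]
  refine (norm_add_le _ _).trans ?_
  rw [norm_neg, norm_mul, norm_ee, mul_one, Complex.norm_real, Real.norm_eq_abs, abs_sub_comm, abs_of_nonneg (by linarith)]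
  have e4 : 1/(n:ℝ) - 1/((n:ℝ)+1) = 1/(n * ((n:ℝ)+1)) := by field_simp; ring
  have e5 : (b - a) * (b - a) ≤ 2 * (1/(n:ℝ) - 1/((n:ℝ)+1)) := by
    have : (b-a)*(b-a) ≤ (1/n) * (1/n) := by gcongr
    refine this.trans ?_
    rw [e4, div_mul_div_comm, mul_one_div, div_le_div_iff₀ (by positivity) (by positivity)]
    nlinarith only [hn0]
  have e6 : 0 ≤ (1/(n:ℝ) - 1/((n:ℝ)+1)) := by rw [e4]; positivity
  have := abs_nonneg u
  nlinarith only [h1, h2, e2, e5, this]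

/-- small frequencies -/
lemma small_freq (u : ℝ) (N N' : ℕ) (hN : 1 ≤ N) (h : N ≤ N') :
    ‖∑ n ∈ Finset.Ioc N N', ee (u * Real.log n) / (n:ℂ) - JJ u (Real.log N) (Real.log N')‖ ≤ (|u| + 1) * (2 / N) := by
  have key : ‖∑ n ∈ Finset.Ioc N N', ee (u * Real.log n) / (n:ℂ) - JJ u (Real.log N) (Real.log N')‖ ≤ (|u| + 1) * (2 * (1/(N:ℝ) - 1/N')) := by
    induction N', h using Nat.le_induction with
    | base => simp [JJ]
    | succ k hk ih =>
      have := step_err u k (by omega)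
      rw [← Finset.insert_Ioc_right_eq_Ioc_add_one hk, Finset.sum_insert (by simp), ← JJ_add u _ (Real.log k) _]
      have e : ∀ a b c d : ℂ, a + b - (c + d) = (b - c) + (a - d) := by intros; ring
      rw [e]
      refine (norm_add_le _ _).trans ((add_le_add ih this).trans (le_of_eq ?_))
      push_cast; ring
  refine key.trans ?_
  gcongr
  have : (0:ℝ) ≤ 1/N' := by positivity
  rw [← mul_one_div 2 (N:ℝ)]
  linarith

lemma large_freq (A : ℝ) (hA : 1 ≤ A) : ∃ c : ℝ, 0 < c ∧ c < 1/3 ∧ ∃ C : ℝ, 1 ≤ C ∧ ∀ (k N N' : ℕ) (u : ℝ), 1 ≤ N → N ≤ N' → N' ≤ 2^k*N →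
    ((2^k*N:ℕ):ℝ)^(1/3:ℝ) ≤ |u| → |u| ≤ (N:ℝ)^A → ‖∑ n ∈ Finset.Ioc N N', ee (u * Real.log n) / (n:ℂ)‖ ≤ k * (C * (N:ℝ)^(-c)) := by
  obtain ⟨c0, hc0, hc1, C, hC, h⟩ := weyl A hA
  have hc' : min c0 (1/4) ≤ c0 := min_le_left _ _
  refine ⟨min c0 (1/4), by positivity, lt_of_le_of_lt (min_le_right _ _) (by norm_num), C, hC, ?_⟩
  set c := min c0 (1/4) with hc
  intro k
  induction k with
  | zero =>
    intro N N' u h1 h2 h3 _ _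
    have : N' = N := by simp at h3; omega
    simp [this]
  | succ k ih =>
    have base : ∀ (N N' : ℕ) (u : ℝ), 1 ≤ N → N ≤ N' → N' ≤ 2*N → (N:ℝ)^(1/3:ℝ) ≤ |u| → |u| ≤ (N:ℝ)^A →
        ‖∑ n ∈ Finset.Ioc N N', ee (u * Real.log n) / (n:ℂ)‖ ≤ C * (N:ℝ)^(-c) := by
      intro N N' u h1 h2 h3 h4 h5
      have hN : (1:ℝ) ≤ N := by exact_mod_cast h1
      have := abel_bound (fun n => ee (u * Real.log n)) (fun n => 1/(n:ℝ)) N (C * (N:ℝ)^(1-c0))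
        (fun n hn => by
          have : (0:ℝ) < n := by exact_mod_cast (by omega : 0 < n)
          push_cast; gcongr; linarith) (fun n => by positivity) N'
        (fun m hm hm' => h N m u h1 (by omega) h4 h5) h2
      have e : ∑ n ∈ Finset.Ioc N N', ee (u * Real.log n) / (n:ℂ) = ∑ n ∈ Finset.Ioc N N', ((1/(n:ℝ) : ℝ) : ℂ) * ee (u * Real.log n) := by
        refine Finset.sum_congr rfl fun n _ => ?_
        push_cast; ring
      rw [e]
      refine this.trans ?_
      rw [mul_assoc]
      gcongr
      rw [mul_one_div]
      nth_rw 2 [← Real.rpow_one (N:ℝ)]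
      rw [← Real.rpow_sub (by linarith)]
      exact Real.rpow_le_rpow_of_exponent_le hN (by linarith)
    intro N N' u h1 h2 h3 h4 h5
    have hN : (1:ℝ) ≤ N := by exact_mod_cast h1
    have h4' : (N:ℝ)^(1/3:ℝ) ≤ |u| := by
      refine le_trans ?_ h4
      apply Real.rpow_le_rpow (by positivity) _ (by norm_num)
      have : 1 ≤ 2^(k+1) := Nat.one_le_two_pow
      exact_mod_cast (by nlinarith only [h2, h3] : N ≤ 2^(k+1)*N)
    have hk : (0:ℝ) ≤ k * (C * (N:ℝ)^(-c)) := by positivity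
    by_cases hh : N' ≤ 2*N
    · refine (base N N' u h1 h2 hh h4' h5).trans ?_
      push_cast; linarith
    · push Not at hh
      have e : 2^k*(2*N) = 2^(k+1)*N := by ring
      have i1 := base N (2*N) u h1 (by omega) le_rfl h4' h5
      have i2 := ih (2*N) N' u (by omega) hh.le (by rw [e]; exact h3) (by rw [e]; exact h4)
        (h5.trans (Real.rpow_le_rpow (by positivity) (by push_cast; linarith) (by linarith)))
      rw [← Finset.sum_Ioc_consecutive _ (show N ≤ 2*N by omega) hh.le]
      refine (norm_add_le _ _).trans ((add_le_add i1 i2).trans ?_)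
      have : ((2*N:ℕ):ℝ)^(-c) ≤ (N:ℝ)^(-c) := by
        apply Real.rpow_le_rpow_of_nonpos (by linarith) (by push_cast; linarith)
        simp only [hc, Left.neg_nonpos_iff]; positivity
      have : (k:ℝ) * (C * ((2*N:ℕ):ℝ)^(-c)) ≤ k * (C * (N:ℝ)^(-c)) := by gcongr
      push_cast at this ⊢; linarith

noncomputable def SS (u x y : ℝ) : ℂ := ∑ n ∈ Finset.Ioc ⌊x⌋₊ ⌊y⌋₊, ee (u * Real.log n) / (n:ℂ)

lemma floor_log (x : ℝ) (hx : 1 ≤ x) : 0 ≤ Real.log x - Real.log ⌊x⌋₊ ∧ Real.log x - Real.log ⌊x⌋₊ ≤ 1/⌊x⌋₊ := by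
  have h1 : 1 ≤ ⌊x⌋₊ := Nat.one_le_floor_iff _ |>.2 hx
  have h0 : (0:ℝ) < ⌊x⌋₊ := by exact_mod_cast h1
  have h2 := Nat.floor_le (show 0 ≤ x by linarith)
  have h3 := (Nat.lt_floor_add_one x).le
  constructor
  · exact sub_nonneg.2 (Real.log_le_log h0 h2)
  · have := (log_step ⌊x⌋₊ h1).1
    have h4 : Real.log x ≤ Real.log (⌊x⌋₊+1:ℕ) := Real.log_le_log (by linarith) (by push_cast; exact h3)
    linarith

lemma G0a (A : ℝ) (hA : 1 ≤ A) : ∃ c : ℝ, 0 < c ∧ c < 1/3 ∧ ∃ C : ℝ, 1 ≤ C ∧ ∀ (x y u : ℝ), 1 ≤ x → x ≤ y → y ≤ 8*x → |u| ≤ x^A →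
    ‖SS u x y - JJ u (Real.log x) (Real.log y)‖ ≤ C * x^(-c) := by
  obtain ⟨c, hc0, hc1, C, hC, h⟩ := large_freq (2*A) (by linarith)
  refine ⟨c, hc0, hc1, 100 * C, by linarith, ?_⟩
  intro x y u hx hxy hy hu
  have hN1 : 1 ≤ ⌊x⌋₊ := Nat.one_le_floor_iff _ |>.2 hx
  have hNN' : ⌊x⌋₊ ≤ ⌊y⌋₊ := Nat.floor_mono hxy
  have hNx := Nat.floor_le (show 0 ≤ x by linarith)
  have hxN := (Nat.lt_floor_add_one x).le
  have hNy := Nat.floor_le (show 0 ≤ y by linarith)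
  obtain ⟨lx0, lx1⟩ := floor_log x hx
  obtain ⟨ly0, ly1⟩ := floor_log y (by linarith)
  unfold SS
  set N := ⌊x⌋₊
  set N' := ⌊y⌋₊
  have hN : (1:ℝ) ≤ N := by exact_mod_cast hN1
  have hN'N : N' ≤ 2^4*N := by
    have : (N':ℝ) ≤ 16 * N := by linarith
    exact_mod_cast this
  have hly1 : Real.log y - Real.log N' ≤ 1/N := ly1.trans (by gcongr)
  have hNc : (N:ℝ)^(-c) ≤ 2 * x^(-c) := by
    have h1 : (x/2)^(-c) ≤ 2 * x^(-c) := by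
      rw [Real.div_rpow (by linarith) (by norm_num), Real.rpow_neg (by norm_num : (0:ℝ) ≤ 2), div_inv_eq_mul, mul_comm]
      gcongr
      calc (2:ℝ)^c ≤ 2^(1:ℝ) := Real.rpow_le_rpow_of_exponent_le (by norm_num) (by linarith)
        _ = 2 := by norm_num
    refine le_trans (Real.rpow_le_rpow_of_nonpos (by linarith) (by linarith) (by linarith)) h1
  have hxc : 0 ≤ x^(-c) := by positivity
  suffices hs : ‖∑ n ∈ Finset.Ioc N N', ee (u * Real.log n) / (n:ℂ) - JJ u (Real.log x) (Real.log y)‖ ≤ 50 * C * (N:ℝ)^(-c) by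
    refine hs.trans ?_
    nlinarith only [hNc, hc0, hc1, hC]
  have hNNc : 0 < (N:ℝ)^(-c) := by positivity
  by_cases hcase : |u| < ((2^4*N:ℕ):ℝ)^(1/3:ℝ)
  · have s1 := small_freq u N N' hN1 hNN'
    have s2 : JJ u (Real.log x) (Real.log y) = JJ u (Real.log x) (Real.log N) + (JJ u (Real.log N) (Real.log N') + JJ u (Real.log N') (Real.log y)) := by
      rw [JJ_add, JJ_add]
    have s3 := norm_JJ_le u (Real.log x) (Real.log N)
    have s4 := norm_JJ_le u (Real.log N') (Real.log y)
    rw [abs_sub_comm, abs_of_nonneg lx0] at s3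
    rw [abs_of_nonneg ly0] at s4
    have e : ∀ a b c d : ℂ, a - (b + (c + d)) = (a - c) - (b + d) := by intros; ring
    rw [s2, e]
    refine (norm_sub_le _ _).trans ((add_le_add s1 (norm_add_le _ _)).trans ?_)
    have h16 : ((2^4*N:ℕ):ℝ)^(1/3:ℝ) ≤ 3 * (N:ℝ)^(1/3:ℝ) := by
      push_cast
      rw [Real.mul_rpow (by norm_num) (by positivity)]
      gcongr
      calc (16:ℝ)^(1/3:ℝ) ≤ (3^(3:ℝ))^(1/3:ℝ) := Real.rpow_le_rpow (by norm_num) (by norm_num) (by norm_num)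
        _ = 3 := by rw [← Real.rpow_mul (by norm_num)]; norm_num
    have hq : (N:ℝ)^(1/3:ℝ) * (1/N) ≤ (N:ℝ)^(-c) := by
      rw [mul_one_div]
      nth_rw 2 [← Real.rpow_one (N:ℝ)]
      rw [← Real.rpow_sub (by linarith only [hc0, hc1, hN])]
      exact Real.rpow_le_rpow_of_exponent_le hN (by linarith only [hc0, hc1])
    have hq' : (1/(N:ℝ)) ≤ (N:ℝ)^(-c) := by
      refine le_trans ?_ hq
      have : 1 ≤ (N:ℝ)^(1/3:ℝ) := Real.one_le_rpow hN (by norm_num)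
      have h0 : (0:ℝ) < 1/N := by positivity
      nlinarith only [hc0, hc1, lx0, this, lx1]
    have : (|u| + 1) * (2 / N) ≤ 6 * (N:ℝ)^(-c) + 2 * (N:ℝ)^(-c) := by
      have h0 : (0:ℝ) < 1/N := by positivity
      have : |u| * (1/N) ≤ 3 * (N:ℝ)^(1/3:ℝ) * (1/N) := by gcongr; linarith only [hcase, h16]
      rw [← mul_one_div 2]; nlinarith only [hq, hq', this]
    nlinarith only [lx1, hly1, s3, s4, hq', this, hc0, hNNc, hc1, hC]
  · push Not at hcase
    have hu0 : 0 < |u| := lt_of_lt_of_le (by positivity) hcase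
    by_cases hN2 : 2 ≤ N
    · have h5 : |u| ≤ (N:ℝ)^(2*A) := by
        refine hu.trans ?_
        rw [Real.rpow_mul (by linarith only [hc0, hc1, hN])]
        refine Real.rpow_le_rpow (by linarith) ?_ (by linarith only [hA, hc0, hc1])
        have : (2:ℝ) ≤ N := by exact_mod_cast hN2
        rw [Real.rpow_two]; nlinarith only [hc0, hc1, hxN, this]
      have i1 := h 4 N N' u hN1 hNN' hN'N hcase h5
      have i2 := norm_JJ_le' u (Real.log x) (Real.log y) (by simpa using hu0)
      have i3 : 2/|u| ≤ 2 * (N:ℝ)^(-c) := by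
        rw [Real.rpow_neg (by linarith only [hc0, hc1, hN]), ← div_eq_mul_inv]
        gcongr
        refine le_trans ?_ hcase
        push_cast
        calc (N:ℝ)^c ≤ (N:ℝ)^(1/3:ℝ) := Real.rpow_le_rpow_of_exponent_le hN (by linarith only [hc1])
          _ ≤ _ := Real.rpow_le_rpow (by linarith only [hc0, hc1, hN]) (by linarith only [hc0, hc1, hN]) (by norm_num)
      refine (norm_sub_le _ _).trans ((add_le_add i1 i2).trans ?_)
      push_cast; nlinarith only [i3, hc0, hNNc, hc1, hC]
    · have hN1' : N = 1 := by omega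
      have i2 := norm_JJ_le u (Real.log x) (Real.log y)
      have i3 : |Real.log y - Real.log x| ≤ 7 := by
        rw [abs_of_nonneg (sub_nonneg.2 (Real.log_le_log (by linarith only [hc0, hc1, hx]) hxy)), ← Real.log_div (by linarith only [hc0, hc1, hx, hxy]) (by linarith)]
        refine (Real.log_le_sub_one_of_pos (div_pos (by linarith only [hc0, hc1, hx, hxy]) (by linarith only [hc0, hc1, hx]))).trans ?_
        have : y / x ≤ 8 := by rw [div_le_iff₀ (by linarith)]; exact hy
        linarith only [this]
      have i1 : ‖∑ n ∈ Finset.Ioc N N', ee (u * Real.log n) / (n:ℂ)‖ ≤ 15 := by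
        refine (norm_sum_le _ _).trans ?_
        have : ∀ n ∈ Finset.Ioc N N', ‖ee (u * Real.log n) / (n:ℂ)‖ ≤ 1 := by
          intro n hn
          have h1 : (1:ℝ) ≤ n := by exact_mod_cast (by simp at hn; omega : 1 ≤ n)
          rw [norm_div, norm_ee, Complex.norm_natCast]
          exact (div_le_one (by linarith only [hc0, hc1, h1])).2 h1
        refine (Finset.sum_le_card_nsmul _ _ _ this).trans ?_
        simp only [Nat.card_Ioc, nsmul_eq_mul, mul_one]
        exact_mod_cast (by omega : N' - N ≤ 15)
      refine (norm_sub_le _ _).trans ((add_le_add i1 (i2.trans i3)).trans ?_)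
      rw [hN1']; simp; linarith only [hc0, hc1, hC]

/-- Key: with divisibility -/
lemma G0 (A : ℝ) (hA : 1 ≤ A) : ∃ c : ℝ, 0 < c ∧ c < 1/3 ∧ ∃ C : ℝ, 1 ≤ C ∧ ∀ (x y u : ℝ) (D : ℕ), 1 ≤ x → x ≤ y → y ≤ 8*x → 1 ≤ D → (D:ℝ) ≤ x^(1/2:ℝ) → |u| ≤ x^A →
    ‖∑ n ∈ Finset.Ioc ⌊x⌋₊ ⌊y⌋₊ with D ∣ n, ee (u * Real.log n) / (n:ℂ) - (1/D:ℂ) * JJ u (Real.log x) (Real.log y)‖ ≤ C * x^(-c) := by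
  obtain ⟨c, hc0, hc1, C, hC, h⟩ := G0a (2*A) (by linarith)
  refine ⟨c/2, by linarith, by linarith, C, hC, ?_⟩
  intro x y u D hx hxy hy hD hDx hu
  have hD0 : (1:ℝ) ≤ D := by exact_mod_cast hD
  have hxD : x^(1/2:ℝ) ≤ x / D := by
    rw [le_div_iff₀ (by linarith)]
    calc x^(1/2:ℝ) * D ≤ x^(1/2:ℝ) * x^(1/2:ℝ) := by gcongr
      _ = x := by rw [← Real.rpow_add (by linarith)]; norm_num
  have hx1 : 1 ≤ x^(1/2:ℝ) := Real.one_le_rpow hx (by norm_num)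
  have key := h (x/D) (y/D) u (by linarith) (by gcongr) (by rw [← mul_div_assoc]; gcongr)
    (hu.trans (by
      calc x^A = (x^(1/2:ℝ))^(2*A) := by rw [← Real.rpow_mul (by linarith)]; ring_nf
        _ ≤ _ := Real.rpow_le_rpow (by linarith) hxD (by linarith)))
  have e1 : ∑ n ∈ Finset.Ioc ⌊x⌋₊ ⌊y⌋₊ with D ∣ n, ee (u * Real.log n) / (n:ℂ)
      = (1/D:ℂ) * (ee (u * Real.log D) * SS u (x/D) (y/D)) := by
    rw [SS, Finset.mul_sum, Finset.mul_sum]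
    symm
    refine Finset.sum_bij (fun m _ => D * m) ?_ ?_ ?_ ?_
    · intro m hm
      simp only [Finset.mem_Ioc, Finset.mem_filter, dvd_mul_right, and_true] at hm ⊢
      have hm0 : m ≠ 0 := by omega
      have hy0 : 0 ≤ y := by linarith only [hc0, hc1, hx, hxy]
      rw [Nat.floor_lt (by positivity), Nat.le_floor_iff (by positivity)] at hm ⊢
      rw [div_lt_iff₀ (by linarith), le_div_iff₀ (by linarith)] at hm
      push_cast; constructor <;> linarith [hm.1, hm.2, mul_comm (D:ℝ) m]
    · intro a _ b _ hab
      exact Nat.eq_of_mul_eq_mul_left hD hab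
    · intro n hn
      simp only [Finset.mem_Ioc, Finset.mem_filter] at hn
      obtain ⟨hn, m, rfl⟩ := hn
      refine ⟨m, ?_, rfl⟩
      rw [Finset.mem_Ioc]
      rw [Nat.floor_lt (by linarith), Nat.le_floor_iff (by linarith)] at hn
      have hy0 : 0 ≤ y := by linarith
      rw [Nat.floor_lt (by positivity), Nat.le_floor_iff (by positivity), div_lt_iff₀ (by linarith), le_div_iff₀ (by linarith)]
      push_cast at hn; constructor <;> linarith [hn.1, hn.2, mul_comm (D:ℝ) m]
    · intro m hm
      simp only [Finset.mem_Ioc] at hm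
      have hm0 : m ≠ 0 := by omega
      have hD' : (D:ℝ) ≠ 0 := by linarith only [hc0, hc1, hD0]
      push_cast
      rw [Real.log_mul hD' (by exact_mod_cast hm0), mul_add, ee_add]
      field_simp
  have e2 : JJ u (Real.log x) (Real.log y) = ee (u * Real.log D) * JJ u (Real.log (x/D)) (Real.log (y/D)) := by
    rw [JJ_shift, Real.log_div (by linarith only [hc0, hc1, hx]) (by linarith), Real.log_div (by linarith) (by linarith)]
    simp
  rw [e1, e2, ← mul_sub, ← mul_sub, norm_mul, norm_mul, norm_ee, one_mul]
  have hn : ‖(1/D:ℂ)‖ ≤ 1 := by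
    rw [norm_div, norm_one, Complex.norm_natCast]
    exact (div_le_one (by linarith)).2 hD0
  calc _ ≤ 1 * (C * (x/D)^(-c)) := by gcongr
    _ ≤ C * x^(-(c/2)) := by
      rw [one_mul]
      gcongr
      calc (x/D)^(-c) ≤ (x^(1/2:ℝ))^(-c) := Real.rpow_le_rpow_of_nonpos (by linarith) hxD (by linarith)
        _ = _ := by rw [← Real.rpow_mul (by linarith)]; ring_nf
end MR

namespace MR
open MeasureTheory

lemma bdd_int {X : Type*} [MeasurableSpace X] {μ : Measure X} [IsFiniteMeasure μ] {E : Type*} [NormedAddCommGroup E] {f : X → E} (C : ℝ)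
    (hf : AEStronglyMeasurable f μ) (h : ∀ x, ‖f x‖ ≤ C) : Integrable f μ :=
  Integrable.of_bound hf C (Eventually.of_forall h)

/-- Schur test / duality. -/
lemma schur {X : Type*} [MeasurableSpace X] (μ : Measure X) [IsFiniteMeasure μ] (s : Finset ℕ) (b : ℕ → ℝ) (hb : ∀ n ∈ s, 0 < b n)
    (φ : X → ℕ → ℂ) (M : ℝ) (hM : ∀ x n, ‖φ x n‖ ≤ M) (hφ : ∀ n, Measurable (fun x => φ x n)) (R : ℝ) (hR0 : 0 ≤ R)
    (hR : ∀ x, ∫ y, ‖∑ n ∈ s, (b n : ℂ) * (φ x n * (starRingEnd ℂ) (φ y n))‖ ∂μ ≤ R) (a : ℕ → ℂ) :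
    ∫ x, ‖∑ n ∈ s, a n * φ x n‖^2 ∂μ ≤ R * ∑ n ∈ s, ‖a n‖^2 / b n := by
  set A : X → ℂ := fun x => ∑ n ∈ s, a n * φ x n with hA
  have hAm : Measurable A := by
    apply Finset.measurable_fun_sum; intro n _; exact (hφ n).const_mul _
  have hcm : Measurable (starRingEnd ℂ) := Complex.continuous_conj.measurable
  set MA := ∑ n ∈ s, ‖a n‖ * M with hMA
  have hAb : ∀ x, ‖A x‖ ≤ MA := fun x => (norm_sum_le _ _).trans (Finset.sum_le_sum fun n _ => by
    rw [norm_mul]; exact mul_le_mul_of_nonneg_left (hM x n) (norm_nonneg _))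
  set B : ℕ → ℂ := fun n => ∫ x, (starRingEnd ℂ) (φ x n) * A x ∂μ with hB
  have hBint : ∀ n, Integrable (fun x => (starRingEnd ℂ) (φ x n) * A x) μ := fun n =>
    bdd_int (M * MA) ((hcm.comp (hφ n)).mul hAm).aestronglyMeasurable (fun x => by
      rw [norm_mul, RCLike.norm_conj]
      exact mul_le_mul (hM x n) (hAb x) (norm_nonneg _) ((norm_nonneg _).trans (hM x n)))
  set J0 := ∫ x, ‖A x‖^2 ∂μ with hI
  have hI0 : 0 ≤ J0 := integral_nonneg fun x => by positivity
  have e1 : (J0 : ℂ) = ∑ n ∈ s, (starRingEnd ℂ) (a n) * B n := by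
    rw [hI, ← integral_complex_ofReal]
    have : ∀ x, ((‖A x‖^2 : ℝ) : ℂ) = ∑ n ∈ s, (starRingEnd ℂ) (a n) * ((starRingEnd ℂ) (φ x n) * A x) := by
      intro x
      rw [Complex.ofReal_pow, ← Complex.conj_mul', ← Finset.sum_congr rfl (fun n _ => mul_assoc _ _ _), ← Finset.sum_mul]
      congr 1
      simp only [hA, map_sum, map_mul]
    simp_rw [this]
    rw [integral_finsetSum _ (fun n _ => (hBint n).const_mul _)]
    simp_rw [integral_const_mul, hB]
  have e2 : J0 ≤ ∑ n ∈ s, ‖a n‖ * ‖B n‖ := by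
    have : ‖(J0:ℂ)‖ = J0 := by rw [Complex.norm_real, Real.norm_of_nonneg hI0]
    rw [← this, e1]
    refine (norm_sum_le _ _).trans (le_of_eq (Finset.sum_congr rfl fun n _ => ?_))
    rw [norm_mul, RCLike.norm_conj]
  have e3 : J0^2 ≤ (∑ n ∈ s, ‖a n‖^2 / b n) * ∑ n ∈ s, b n * ‖B n‖^2 := by
    refine (pow_le_pow_left₀ hI0 e2 2).trans ?_
    refine Finset.sum_sq_le_sum_mul_sum_of_sq_eq_mul _ (fun n hn => by have := hb n hn; positivity)
      (fun n hn => by have := hb n hn; positivity) (fun n hn => ?_)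
    have := hb n hn
    field_simp
  set K : X → X → ℂ := fun x y => ∑ n ∈ s, (b n : ℂ) * (φ x n * (starRingEnd ℂ) (φ y n)) with hK
  have hKm : Measurable (fun z : X × X => K z.1 z.2) := by
    apply Finset.measurable_fun_sum; intro n _
    exact (((hφ n).comp measurable_fst).mul (hcm.comp ((hφ n).comp measurable_snd))).const_mul _
  set MK := ∑ n ∈ s, |b n| * (M * M) with hMK
  have hKb : ∀ x y, ‖K x y‖ ≤ MK := fun x y => (norm_sum_le _ _).trans (Finset.sum_le_sum fun n _ => by
    rw [norm_mul, norm_mul, RCLike.norm_conj, Complex.norm_real, Real.norm_eq_abs]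
    exact mul_le_mul_of_nonneg_left (mul_le_mul (hM x n) (hM y n) (norm_nonneg _) ((norm_nonneg _).trans (hM x n))) (abs_nonneg _))
  have hKs : ∀ x y, ‖K x y‖ = ‖K y x‖ := by
    intro x y
    rw [← RCLike.norm_conj (K x y)]
    congr 1
    simp only [hK, map_sum, map_mul, Complex.conj_conj, Complex.conj_ofReal]
    exact Finset.sum_congr rfl fun n _ => by ring
  have hMK0 : 0 ≤ MK := Finset.sum_nonneg fun n _ => mul_nonneg (abs_nonneg _) (mul_self_nonneg _)
  have hG : ∀ g : X × X → ℂ, Measurable g → (∀ z, ‖g z‖ ≤ MK * (MA * MA)) → Integrable g (μ.prod μ) := fun g h1 h2 =>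
    bdd_int _ h1.aestronglyMeasurable h2
  have hG' : ∀ g : X × X → ℝ, Measurable g → (∀ z, ‖g z‖ ≤ MK * (MA * MA)) → Integrable g (μ.prod μ) := fun g h1 h2 =>
    bdd_int _ h1.aestronglyMeasurable h2
  have hsq : ∀ x, ‖A x‖^2 ≤ MA * MA := fun x => by
    rw [sq]; exact mul_le_mul (hAb x) (hAb x) (norm_nonneg _) ((norm_nonneg _).trans (hAb x))
  have j1 : Integrable (fun z : X × X => ‖K z.1 z.2‖ * ‖A z.1‖^2) (μ.prod μ) :=
    hG' _ (hKm.norm.mul ((hAm.comp measurable_fst).norm.pow_const 2)) (fun z => by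
      rw [norm_mul, norm_norm, norm_pow, norm_norm]
      exact mul_le_mul (hKb _ _) (hsq _) (by positivity) hMK0)
  have j2 : Integrable (fun z : X × X => ‖K z.1 z.2‖ * ‖A z.2‖^2) (μ.prod μ) :=
    hG' _ (hKm.norm.mul ((hAm.comp measurable_snd).norm.pow_const 2)) (fun z => by
      rw [norm_mul, norm_norm, norm_pow, norm_norm]
      exact mul_le_mul (hKb _ _) (hsq _) (by positivity) hMK0)
  have e4 : ∫ z, ‖K z.1 z.2‖ * ‖A z.1‖^2 ∂(μ.prod μ) ≤ R * J0 := by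
    rw [integral_prod _ j1]
    simp only
    have : ∀ x, ∫ y, ‖K x y‖ * ‖A x‖^2 ∂μ = (∫ y, ‖K x y‖ ∂μ) * ‖A x‖^2 := fun x => integral_mul_const _ _
    rw [hI, ← integral_const_mul]
    refine integral_mono j1.integral_prod_left ?_ (fun x => ?_)
    · exact (bdd_int (MA * MA) (hAm.norm.pow_const 2).aestronglyMeasurable (fun x => by
        rw [norm_pow, norm_norm]; exact hsq x)).const_mul R
    · show ∫ y, ‖K x y‖ * ‖A x‖^2 ∂μ ≤ _
      rw [this]
      exact mul_le_mul_of_nonneg_right (hR x) (by positivity)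
  have e5 : ∫ z, ‖K z.1 z.2‖ * ‖A z.2‖^2 ∂(μ.prod μ) ≤ R * J0 := by
    rw [← integral_prod_swap]
    refine le_of_eq_of_le ?_ e4
    congr 1; ext z
    simp only [Prod.fst_swap, Prod.snd_swap]
    rw [hKs]
  have e6 : ∑ n ∈ s, b n * ‖B n‖^2 ≤ R * J0 := by
    have h0 : 0 ≤ ∑ n ∈ s, b n * ‖B n‖^2 := Finset.sum_nonneg fun n hn => mul_nonneg (hb n hn).le (by positivity)
    have f1 : ((∑ n ∈ s, b n * ‖B n‖^2 : ℝ) : ℂ) = ∫ z, (starRingEnd ℂ (K z.1 z.2)) * (A z.1 * starRingEnd ℂ (A z.2)) ∂(μ.prod μ) := by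
      push_cast
      have : ∀ z : X × X, (starRingEnd ℂ (K z.1 z.2)) * (A z.1 * starRingEnd ℂ (A z.2)) =
          ∑ n ∈ s, (b n : ℂ) * ((starRingEnd ℂ (φ z.1 n) * A z.1) * (φ z.2 n * starRingEnd ℂ (A z.2))) := by
        intro z
        simp only [hK, map_sum, map_mul, Complex.conj_conj, Complex.conj_ofReal]
        rw [Finset.sum_mul]
        exact Finset.sum_congr rfl fun n _ => by ring
      simp_rw [this]
      have hB' : ∀ n, ∫ x, φ x n * starRingEnd ℂ (A x) ∂μ = starRingEnd ℂ (B n) := by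
        intro n
        simp only [hB]
        rw [← integral_conj]
        congr 1; ext x
        simp
      have hBint' : ∀ n, Integrable (fun x => φ x n * starRingEnd ℂ (A x)) μ := fun n => by
        have := (Complex.conjCLE.toContinuousLinearMap.integrable_comp (hBint n))
        refine this.congr (Eventually.of_forall fun x => ?_)
        simp
      rw [integral_finsetSum]
      · refine Finset.sum_congr rfl fun n _ => ?_
        rw [integral_const_mul, integral_prod_mul (fun x => starRingEnd ℂ (φ x n) * A x) (fun x => φ x n * starRingEnd ℂ (A x)), hB', Complex.mul_conj']
      · intro n _
        exact ((hBint n).mul_prod (hBint' n)).const_mul _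
    have f2 : ∑ n ∈ s, b n * ‖B n‖^2 ≤ ∫ z, (‖K z.1 z.2‖ * ‖A z.1‖^2 + ‖K z.1 z.2‖ * ‖A z.2‖^2) / 2 ∂(μ.prod μ) := by
      have : ∑ n ∈ s, b n * ‖B n‖^2 = ‖((∑ n ∈ s, b n * ‖B n‖^2 : ℝ) : ℂ)‖ := by
        rw [Complex.norm_real, Real.norm_of_nonneg h0]
      rw [this, f1]
      refine norm_integral_le_of_norm_le ((j1.add j2).div_const 2) (Eventually.of_forall fun z => ?_)
      rw [norm_mul, RCLike.norm_conj, norm_mul, RCLike.norm_conj]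
      have := two_mul_le_add_sq ‖A z.1‖ ‖A z.2‖
      have hk := norm_nonneg (K z.1 z.2)
      nlinarith
    rw [integral_div, integral_add j1 j2] at f2
    linarith
  have hS : 0 ≤ ∑ n ∈ s, ‖a n‖^2 / b n := Finset.sum_nonneg fun n hn => div_nonneg (by positivity) (hb n hn).le
  rcases hI0.eq_or_lt with h | h
  · rw [← h]; exact mul_nonneg hR0 hS
  · have : J0 * J0 ≤ (R * ∑ n ∈ s, ‖a n‖^2 / b n) * J0 := by
      have := mul_le_mul_of_nonneg_left e6 hS
      nlinarith
    exact le_of_mul_le_mul_right this h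
end MR

namespace MR
open MeasureTheory

noncomputable def tri (N : ℝ) (n : ℕ) : ℝ := max 0 (2 - |Real.log n - Real.log N|)
noncomputable def bb (N : ℝ) (n : ℕ) : ℝ := tri N n / n

lemma tri_int (l : ℝ) : ∫ s in (-2:ℝ)..0, (Set.Ico (l-2) l).indicator (fun _ => (1:ℝ)) s = max 0 (2 - |l|) := by
  rw [intervalIntegral.integral_of_le (by norm_num), ← integral_indicator_one_aux l]
where
  integral_indicator_one_aux (l : ℝ) : ∫ s in Set.Ioc (-2:ℝ) 0, (Set.Ico (l-2) l).indicator (fun _ => (1:ℝ)) s = max 0 (2 - |l|) := by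
    rw [setIntegral_indicator measurableSet_Ico, setIntegral_const, smul_eq_mul, mul_one]
    have : (volume.real (Set.Ioc (-2:ℝ) 0 ∩ Set.Ico (l-2) l)) = volume.real (Set.Ioc (-2:ℝ) 0 ∩ Set.Ioc (l-2) l) := by
      apply measureReal_congr
      exact (ae_eq_refl _).inter Ico_ae_eq_Ioc
    rw [this, Set.Ioc_inter_Ioc, Real.volume_real_Ioc, max_comm]
    congr 1
    rcases le_total 0 l with h | h
    · rw [abs_of_nonneg h]; simp [h]
    · rw [abs_of_nonpos h]; simp [h]; ring

noncomputable def mm (N u : ℝ) : ℂ := ∫ s in (-2:ℝ)..0, JJ u (Real.log N + s) (Real.log N + s + 2)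

lemma JJ_cont (u a b : ℝ) : Continuous fun s => JJ u (a + s) (a + s + b) := by
  have h : (fun s => JJ u (a + s) (a + s + b)) = fun s => ee (u * s) * JJ u a (a + b) := by
    ext s; rw [JJ_shift]; congr 1; ring
  rw [h]; have := continuous_ee; fun_prop

lemma mm_le (N u : ℝ) : ‖mm N u‖ ≤ 8 * (1 + u^2)⁻¹ := by
  have h1 : ‖mm N u‖ ≤ 4 := by
    have := intervalIntegral.norm_integral_le_of_norm_le_const (a := (-2:ℝ)) (b := 0) (C := 2) (f := fun s => JJ u (Real.log N + s) (Real.log N + s + 2))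
      (fun s _ => (norm_JJ_le _ _ _).trans (by simp))
    refine this.trans (by norm_num)
  by_cases hu : u = 0
  · subst hu; simp; linarith
  have h2 : ‖mm N u‖ * u^2 ≤ 4 := by
    have e : mm N u = JJ u (Real.log N) (Real.log N + 2) * JJ u (-2) 0 := by
      have h3 : JJ u (-2) 0 = ∫ s in (-2:ℝ)..0, ee (u * s) := rfl
      rw [mm, mul_comm, h3, ← intervalIntegral.integral_mul_const]
      congr 1; ext s
      rw [JJ_shift]; congr 1; ring
    rw [e, norm_mul]
    have a1 := norm_JJ_le' u (Real.log N) (Real.log N + 2) hu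
    have a2 := norm_JJ_le' u (-2) 0 hu
    have hu' : 0 < |u| := abs_pos.2 hu
    rw [le_div_iff₀ hu'] at a1 a2
    rw [← sq_abs]
    calc _ = (‖JJ u (Real.log N) (Real.log N + 2)‖ * |u|) * (‖JJ u (-2) 0‖ * |u|) := by ring
      _ ≤ 2 * 2 := mul_le_mul a1 a2 (by positivity) (by norm_num)
      _ = 4 := by norm_num
  rw [← div_eq_mul_inv, le_div_iff₀ (by positivity)]
  linarith

noncomputable def TT (N : ℝ) : Finset ℕ := Finset.Ioc ⌊N * Real.exp (-2)⌋₊ ⌊N * Real.exp 2⌋₊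

lemma mem_TT {N : ℝ} (hN : 0 < N) (n : ℕ) : n ∈ TT N ↔ 0 < n ∧ -2 < Real.log n - Real.log N ∧ Real.log n - Real.log N ≤ 2 := by
  rw [TT, Finset.mem_Ioc, Nat.floor_lt (by positivity), Nat.le_floor_iff (by positivity)]
  constructor
  · rintro ⟨h1, h2⟩
    have hn : (0:ℝ) < n := lt_trans (by positivity) h1
    refine ⟨by exact_mod_cast hn, ?_, ?_⟩
    · have := Real.log_lt_log (by positivity) h1
      rw [Real.log_mul hN.ne' (Real.exp_pos _).ne', Real.log_exp] at this; linarith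
    · have := Real.log_le_log hn h2
      rw [Real.log_mul hN.ne' (Real.exp_pos _).ne', Real.log_exp] at this; linarith
  · rintro ⟨h0, h1, h2⟩
    have hn : (0:ℝ) < n := by exact_mod_cast h0
    rw [← Real.log_lt_log_iff (by positivity) hn, ← Real.log_le_log_iff hn (by positivity),
      Real.log_mul hN.ne' (Real.exp_pos _).ne', Real.log_mul hN.ne' (Real.exp_pos _).ne', Real.log_exp, Real.log_exp]
    constructor <;> linarith

lemma smooth_eq (N : ℝ) (hN : 0 < N) (D : ℕ) (u : ℝ) :
    ∑ n ∈ TT N with D ∣ n, (bb N n : ℂ) * ee (u * Real.log n) =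
    ∫ s in (-2:ℝ)..0, ∑ n ∈ Finset.Ioc ⌊N * Real.exp s⌋₊ ⌊N * Real.exp (s+2)⌋₊ with D ∣ n, ee (u * Real.log n) / (n:ℂ)
    ∧ IntervalIntegrable (fun s => ∑ n ∈ Finset.Ioc ⌊N * Real.exp s⌋₊ ⌊N * Real.exp (s+2)⌋₊ with D ∣ n, ee (u * Real.log n) / (n:ℂ)) volume (-2) 0 := by
  have e1 : ∀ s ∈ Set.uIcc (-2:ℝ) 0, ∑ n ∈ Finset.Ioc ⌊N * Real.exp s⌋₊ ⌊N * Real.exp (s+2)⌋₊ with D ∣ n, ee (u * Real.log n) / (n:ℂ)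
     = ∑ n ∈ TT N with D ∣ n, (((Set.Ico (Real.log n - Real.log N -2) (Real.log n - Real.log N)).indicator (fun _ => (1:ℝ)) s : ℝ) : ℂ) * (ee (u * Real.log n) / (n:ℂ)) := by
    intro s hs
    rw [Set.uIcc_of_le (by norm_num)] at hs
    have : ∀ n : ℕ, n ∈ Finset.Ioc ⌊N * Real.exp s⌋₊ ⌊N * Real.exp (s+2)⌋₊ ↔ 0 < n ∧ s < Real.log n - Real.log N ∧ Real.log n - Real.log N ≤ s + 2 := by
      intro n
      rw [Finset.mem_Ioc, Nat.floor_lt (by positivity), Nat.le_floor_iff (by positivity)]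
      constructor
      · rintro ⟨h1, h2⟩
        have hn : (0:ℝ) < n := lt_trans (by positivity) h1
        refine ⟨by exact_mod_cast hn, ?_, ?_⟩
        · have := Real.log_lt_log (by positivity) h1
          rw [Real.log_mul hN.ne' (Real.exp_pos _).ne', Real.log_exp] at this; linarith
        · have := Real.log_le_log hn h2
          rw [Real.log_mul hN.ne' (Real.exp_pos _).ne', Real.log_exp] at this; linarith
      · rintro ⟨h0, h1, h2⟩
        have hn : (0:ℝ) < n := by exact_mod_cast h0
        rw [← Real.log_lt_log_iff (by positivity) hn, ← Real.log_le_log_iff hn (by positivity),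
          Real.log_mul hN.ne' (Real.exp_pos _).ne', Real.log_mul hN.ne' (Real.exp_pos _).ne', Real.log_exp, Real.log_exp]
        constructor <;> linarith
    have hsub : (Finset.Ioc ⌊N * Real.exp s⌋₊ ⌊N * Real.exp (s+2)⌋₊).filter (D ∣ ·) ⊆ (TT N).filter (D ∣ ·) := by
      apply Finset.filter_subset_filter
      intro n hn
      rw [this] at hn
      rw [mem_TT hN]
      refine ⟨hn.1, by linarith [hn.2.1, hs.1], by linarith [hn.2.2, hs.2]⟩
    symm
    rw [← Finset.sum_subset hsub]
    · refine Finset.sum_congr rfl fun n hn => ?_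
      rw [Finset.mem_filter, this] at hn
      rw [Set.indicator_of_mem]; simp
      exact ⟨by linarith [hn.1.2.2], hn.1.2.1⟩
    · intro n hn hn'
      rw [Finset.mem_filter, mem_TT hN] at hn
      rw [Finset.mem_filter, this] at hn'
      rw [Set.indicator_of_notMem]; simp
      intro h
      exact hn' ⟨⟨hn.1.1, h.2, by linarith [h.1]⟩, hn.2⟩
  have hint : ∀ n : ℕ, IntervalIntegrable (fun s => (((Set.Ico (Real.log n - Real.log N -2) (Real.log n - Real.log N)).indicator (fun _ => (1:ℝ)) s : ℝ) : ℂ) * (ee (u * Real.log n) / (n:ℂ))) volume (-2) 0 := by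
    intro n
    apply IntervalIntegrable.mul_const
    rw [intervalIntegrable_iff, Set.uIoc_of_le (by norm_num)]
    apply Integrable.of_bound (C := 1)
    · exact (Complex.measurable_ofReal.comp (measurable_const.indicator measurableSet_Ico)).aestronglyMeasurable
    · refine Eventually.of_forall fun s => ?_
      rw [Complex.norm_real]
      by_cases h : s ∈ Set.Ico (Real.log n - Real.log N -2) (Real.log n - Real.log N)
      · rw [Set.indicator_of_mem h]; simp
      · rw [Set.indicator_of_notMem h]; simp
  constructor
  · rw [intervalIntegral.integral_congr e1, intervalIntegral.integral_finsetSum (fun n _ => hint n)]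
    refine Finset.sum_congr rfl fun n hn => ?_
    rw [intervalIntegral.integral_mul_const, intervalIntegral.integral_ofReal, tri_int, bb, tri]
    push_cast; ring
  · have := IntervalIntegrable.sum ((TT N).filter (D ∣ ·)) (f := fun n s => (((Set.Ico (Real.log n - Real.log N -2) (Real.log n - Real.log N)).indicator (fun _ => (1:ℝ)) s : ℝ) : ℂ) * (ee (u * Real.log n) / (n:ℂ))) (fun n _ => hint n)
    refine this.congr ?_
    intro s hs
    simp only [Finset.sum_apply]
    exact (e1 s (Set.uIoc_subset_uIcc hs)).symm

lemma exp_two_le : Real.exp 2 ≤ 8 := by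
  have : Real.exp 2 = Real.exp 1 ^ 2 := by rw [← Real.exp_nat_mul]; norm_num
  rw [this]
  have h := Real.exp_one_lt_d9
  have h0 := Real.exp_pos 1
  nlinarith

lemma smooth (A : ℝ) (hA : 1 ≤ A) : ∃ c : ℝ, 0 < c ∧ c < 1/3 ∧ ∃ C : ℝ, 1 ≤ C ∧ ∀ (N u : ℝ) (D : ℕ), 8 ≤ N → 1 ≤ D → 8 * (D:ℝ)^2 ≤ N → |u| ≤ (N/8)^A →
    ‖∑ n ∈ TT N with D ∣ n, (bb N n : ℂ) * ee (u * Real.log n) - (1/D:ℂ) * mm N u‖ ≤ C * N^(-c) := by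
  obtain ⟨c, hc0, hc1, C, hC, h⟩ := G0 A hA
  refine ⟨c, hc0, hc1, 16*C, by linarith, ?_⟩
  intro N u D hN hD hDN hu
  have hN0 : 0 < N := by linarith
  set f : ℝ → ℂ := fun s => ∑ n ∈ Finset.Ioc ⌊N * Real.exp s⌋₊ ⌊N * Real.exp (s+2)⌋₊ with D ∣ n, ee (u * Real.log n) / (n:ℂ)
  set g : ℝ → ℂ := fun s => (1/D:ℂ) * JJ u (Real.log N + s) (Real.log N + s + 2)
  have hg : IntervalIntegrable g volume (-2) 0 := ((JJ_cont u (Real.log N) 2).const_mul _ |>.intervalIntegrable _ _)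
  have hfg : ∀ s ∈ Set.uIoc (-2:ℝ) 0, ‖f s - g s‖ ≤ 8*C * N^(-c) := by
    intro s hs
    rw [Set.uIoc_of_le (by norm_num)] at hs
    have hx : N/8 ≤ N * Real.exp s := by
      rw [div_eq_mul_inv]; gcongr
      have := exp_two_le
      calc (8:ℝ)⁻¹ ≤ (Real.exp 2)⁻¹ := by gcongr
        _ = Real.exp (-2) := (Real.exp_neg 2).symm
        _ ≤ _ := Real.exp_le_exp.2 hs.1.le
    have e8 : N * Real.exp (s+2) ≤ 8 * (N * Real.exp s) := by
      rw [Real.exp_add]; have := exp_two_le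
      have : 0 < N * Real.exp s := by positivity
      nlinarith
    have := h (N * Real.exp s) (N * Real.exp (s+2)) u D (by linarith) (by gcongr; linarith) e8 hD
      (by
        rw [← Real.sqrt_eq_rpow]
        apply Real.le_sqrt_of_sq_le
        linarith)
      (hu.trans (Real.rpow_le_rpow (by linarith) hx (by linarith)))
    rw [Real.log_mul hN0.ne' (Real.exp_pos _).ne', Real.log_mul hN0.ne' (Real.exp_pos _).ne', Real.log_exp, Real.log_exp, ← add_assoc] at this
    refine this.trans ?_
    calc C * (N * Real.exp s)^(-c) ≤ C * (N/8)^(-c) := by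
          gcongr 1; exact Real.rpow_le_rpow_of_nonpos (by linarith) hx (by linarith)
      _ = C * (N^(-c) * 8^c) := by rw [Real.div_rpow (by linarith) (by norm_num), Real.rpow_neg (by norm_num : (0:ℝ) ≤ 8), div_inv_eq_mul]
      _ ≤ C * (N^(-c) * 8) := by
          gcongr
          calc (8:ℝ)^c ≤ 8^(1:ℝ) := Real.rpow_le_rpow_of_exponent_le (by norm_num) (by linarith)
            _ = 8 := by norm_num
      _ = _ := by ring
  obtain ⟨he, hf⟩ := smooth_eq N hN0 D u
  rw [he, mm, ← intervalIntegral.integral_const_mul, ← intervalIntegral.integral_sub hf hg]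
  have := intervalIntegral.norm_integral_le_of_norm_le_const hfg
  refine this.trans (le_of_eq ?_)
  norm_num; ring
end MR

namespace MR
open MeasureTheory

noncomputable def S0 (N : ℝ) : Finset ℕ := (TT N).filter (fun n => 0 < bb N n)

lemma bb_nonneg (N : ℝ) (n : ℕ) : 0 ≤ bb N n := div_nonneg (le_max_left _ _) (by positivity)

lemma S0_sum (N : ℝ) (D : ℕ) (f : ℕ → ℂ) : ∑ n ∈ S0 N, (bb N n : ℂ) * (if D ∣ n then f n else 0) = ∑ n ∈ TT N with D ∣ n, (bb N n : ℂ) * f n := by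
  rw [S0, Finset.sum_filter, Finset.sum_filter]
  refine Finset.sum_congr rfl fun n _ => ?_
  by_cases h : 0 < bb N n
  · simp [h]
  · have : bb N n = 0 := le_antisymm (not_lt.1 h) (bb_nonneg N n)
    simp [this]

lemma S0_mem (N : ℝ) (hN : 0 < N) (n : ℕ) (h1 : N < n) (h2 : n ≤ N * Real.exp 1) : n ∈ S0 N ∧ 1/(n:ℝ) ≤ bb N n := by
  have hn : (0:ℝ) < n := hN.trans h1
  have l1 := Real.log_lt_log hN h1
  have l2 := Real.log_le_log hn h2
  rw [Real.log_mul hN.ne' (Real.exp_pos _).ne', Real.log_exp] at l2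
  have h3 : 1/(n:ℝ) ≤ bb N n := by
    unfold bb tri
    gcongr
    apply le_max_of_le_right
    rw [abs_of_pos (by linarith)]; linarith
  refine ⟨?_, h3⟩
  rw [S0, Finset.mem_filter, mem_TT hN]
  exact ⟨⟨by exact_mod_cast hn, by linarith, by linarith⟩, lt_of_lt_of_le (by positivity) h3⟩

lemma sum_ext_S0 (N : ℝ) (hN : 0 < N) (s : Finset ℕ) (hs : ∀ n ∈ s, N < n ∧ n ≤ N * Real.exp 1) (a : ℕ → ℂ) :
    (∀ f : ℕ → ℂ, ∑ n ∈ S0 N, (if n ∈ s then a n else 0) * f n = ∑ n ∈ s, a n * f n) ∧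
    ∑ n ∈ S0 N, ‖if n ∈ s then a n else 0‖^2 / bb N n ≤ ∑ n ∈ s, (n:ℝ) * ‖a n‖^2 := by
  have hsub : s ⊆ S0 N := fun n hn => (S0_mem N hN n (hs n hn).1 (hs n hn).2).1
  constructor
  · intro f
    rw [← Finset.sum_subset hsub]
    · exact Finset.sum_congr rfl fun n hn => by simp [hn]
    · intro n _ hn; simp [hn]
  · rw [← Finset.sum_subset hsub]
    · refine Finset.sum_le_sum fun n hn => ?_
      obtain ⟨h1, h2⟩ := S0_mem N hN n (hs n hn).1 (hs n hn).2
      have hn0 : (0:ℝ) < n := hN.trans (hs n hn).1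
      rw [if_pos hn, div_le_iff₀ (lt_of_lt_of_le (by positivity) h2)]
      calc ‖a n‖^2 = n * ‖a n‖^2 * (1/n) := by field_simp
        _ ≤ _ := by gcongr
    · intro n _ hn; simp [hn]

lemma int_kernel (μ : Measure ℝ) [IsFiniteMeasure μ] (hμ : μ ≤ volume) (t : ℝ) :
    ∫ s, 8 * (1 + (s - t)^2)⁻¹ ∂μ ≤ 26 ∧ Integrable (fun s => 8 * (1 + (s - t)^2)⁻¹) μ := by
  have hi : Integrable (fun s : ℝ => 8 * (1 + (s - t)^2)⁻¹) volume := (integrable_inv_one_add_sq.comp_sub_right t).const_mul 8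
  refine ⟨?_, hi.mono_measure hμ⟩
  refine (integral_mono_measure hμ (Eventually.of_forall fun s => by positivity) hi).trans ?_
  rw [integral_const_mul, integral_sub_right_eq_self (fun s : ℝ => (1 + s^2)⁻¹) t, integral_univ_inv_one_add_sq]
  have := Real.pi_lt_d2
  linarith

lemma freq_bound (N : ℝ) (hN : 8^5 ≤ N) (t s : ℝ) (ht : |t| ≤ N^6) (hs : |s| ≤ N^6) : |s - t| ≤ (N/8)^(8:ℝ) := by
  have h8 : (N/8)^(8:ℝ) = (N/8)^8 := by exact_mod_cast Real.rpow_natCast (N/8) 8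
  rw [h8, div_pow]
  have h1 : |s - t| ≤ 2 * N^6 := (abs_sub _ _).trans (by linarith)
  refine h1.trans ?_
  rw [le_div_iff₀ (by norm_num)]
  have : (2 * 8^8:ℝ) ≤ N^2 := by nlinarith
  calc 2 * N^6 * 8^8 = (2*8^8) * N^6 := by ring
    _ ≤ N^2 * N^6 := by gcongr
    _ = N^8 := by ring

lemma ee_neg_conj (a b l : ℝ) : ee (-a * l) * (starRingEnd ℂ) (ee (-b * l)) = ee ((b - a) * l) := by
  rw [ee_conj, ← ee_add]; congr 1; ring

/-- weighted prime measure -/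
noncomputable def pm (P : Finset ℕ) : Measure ℕ := ∑ p ∈ P, ENNReal.ofReal (1/p) • Measure.dirac p

instance (P : Finset ℕ) : IsFiniteMeasure (pm P) := by
  constructor
  simp only [pm, Measure.coe_finsetSum, Finset.sum_apply, Measure.smul_apply, smul_eq_mul]
  refine ENNReal.sum_lt_top.2 fun p _ => ?_
  simp

lemma pm_int (μ : Measure ℝ) [IsFiniteMeasure μ] (P : Finset ℕ) (f : ℝ × ℕ → ℝ) (M : ℝ) (hf : Measurable f) (hM : ∀ z, ‖f z‖ ≤ M) :
    ∫ z, f z ∂(μ.prod (pm P)) = ∑ p ∈ P, (1/p:ℝ) * ∫ t, f (t, p) ∂μ := by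
  rw [integral_prod_symm _ (bdd_int M hf.aestronglyMeasurable hM), pm, integral_finsetSum_measure]
  · refine Finset.sum_congr rfl fun p _ => ?_
    rw [integral_smul_measure, integral_dirac, ENNReal.toReal_ofReal (by positivity), smul_eq_mul]
  · intro p _
    apply Integrable.smul_measure _ (by simp)
    exact integrable_dirac (by simp)

set_option maxHeartbeats 2000000 in
/-- The two sparse large-sieve inequalities. -/
lemma sparse : ∃ c : ℝ, 0 < c ∧ c < 1/24 ∧ ∃ C : ℝ, 1 ≤ C ∧ ∀ (N : ℝ), 8^5 ≤ N → ∀ (μ : Measure ℝ) [IsFiniteMeasure μ], μ ≤ volume →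
    μ.real Set.univ ≤ N^c → (∀ᵐ t ∂μ, |t| ≤ N^6) → ∀ (s : Finset ℕ), (∀ n ∈ s, N < n ∧ n ≤ N * Real.exp 1) → ∀ a : ℕ → ℂ,
    ∫ t, ‖∑ n ∈ s, a n * ee (-t * Real.log n)‖^2 ∂μ ≤ C * ∑ n ∈ s, (n:ℝ) * ‖a n‖^2 ∧
    ∀ P : Finset ℕ, (∀ p ∈ P, p.Prime ∧ (p:ℝ) ≤ N^c) →
    ∑ p ∈ P, (1/p:ℝ) * ∫ t, ‖∑ n ∈ s, a n * (ee (-t * Real.log n) * (1 - p * if p ∣ n then 1 else 0))‖^2 ∂μ ≤ C * ∑ n ∈ s, (n:ℝ) * ‖a n‖^2 := by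
  obtain ⟨c0, hc0, hc1, C, hC, h⟩ := smooth 8 (by norm_num)
  refine ⟨c0/8, by linarith, by linarith, 26 + 4 * C, by linarith, ?_⟩
  set c := c0/8 with hc
  intro N hN μ _ hμ hmass hsupp s hs a
  have hN0 : 0 < N := by linarith
  have hN1 : 1 ≤ N := by linarith
  obtain ⟨sx1, sx2⟩ := sum_ext_S0 N hN0 s hs a
  have hS : ∀ n ∈ S0 N, 0 < bb N n := fun n hn => (Finset.mem_filter.1 hn).2
  have hcont := continuous_ee
  have hsm : ∀ (D : ℕ) (t t' : ℝ), 1 ≤ D → 8 * (D:ℝ)^2 ≤ N → |t| ≤ N^6 → |t'| ≤ N^6 →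
    ‖∑ n ∈ S0 N, (bb N n : ℂ) * (if D ∣ n then ee ((t' - t) * Real.log n) else 0) - (1/D:ℂ) * mm N (t' - t)‖ ≤ C * N^(-c0) := by
    intro D t t' hD hDN ht ht'
    rw [S0_sum]
    exact h N (t'-t) D (by linarith) hD hDN (freq_bound N hN t t' ht ht')
  constructor
  · have key := schur μ (S0 N) (bb N) hS (fun t n => if |t| ≤ N^6 then ee (-t * Real.log n) else 0) 1
      (fun t n => by split_ifs <;> simp [norm_ee]) (fun n => by
        refine Measurable.ite (measurableSet_le measurable_id.abs measurable_const) (by fun_prop) measurable_const) (26 + 4 * C) (by linarith) ?_ (fun n => if n ∈ s then a n else 0)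
    · refine le_trans (le_of_eq ?_) (key.trans (by gcongr))
      refine integral_congr_ae ?_
      filter_upwards [hsupp] with t ht
      simp only [ht, if_true]
      rw [sx1]
    · intro t
      by_cases ht : |t| ≤ N^6
      · obtain ⟨k1, k2⟩ := int_kernel μ hμ t
        calc ∫ y, ‖∑ n ∈ S0 N, (bb N n : ℂ) * ((if |t| ≤ N^6 then ee (-t * Real.log n) else 0) * (starRingEnd ℂ) (if |y| ≤ N^6 then ee (-y * Real.log n) else 0))‖ ∂μ
          ≤ ∫ y, (8 * (1 + (y - t)^2)⁻¹ + C * N^(-c0)) ∂μ := by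
              refine integral_mono_of_nonneg (Eventually.of_forall fun y => norm_nonneg _) (k2.add (integrable_const _)) (Eventually.of_forall fun y => ?_)
              by_cases hy : |y| ≤ N^6
              · simp only [ht, hy, if_true, ee_neg_conj]
                have := hsm 1 t y le_rfl (by norm_num; linarith) ht hy
                simp only [isUnit_one, IsUnit.dvd, if_true, Nat.cast_one, div_one, one_mul] at this
                have h2 := mm_le N (y - t)
                calc _ ≤ ‖mm N (y-t)‖ + C * N^(-c0) := by
                        have := norm_sub_norm_le (∑ n ∈ S0 N, (bb N n : ℂ) * ee ((y - t) * Real.log n)) (mm N (y-t))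
                        linarith
                  _ ≤ _ := by linarith
              · simp only [hy, if_false, map_zero, mul_zero, Finset.sum_const_zero, norm_zero]
                positivity
        _ ≤ 26 + 4 * C := by
              rw [integral_add k2 (integrable_const _), integral_const, smul_eq_mul]
              have : N^c * (C * N^(-c0)) ≤ C := by
                rw [mul_left_comm, ← Real.rpow_add hN0]
                have : N^(c + -c0) ≤ 1 := Real.rpow_le_one_of_one_le_of_nonpos hN1 (by linarith)
                nlinarith only [this, hc0, hc1, hC]
              have : μ.real Set.univ * (C * N^(-c0)) ≤ N^c * (C * N^(-c0)) := by gcongr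
              linarith
      · simp only [ht, if_false, zero_mul, mul_zero, Finset.sum_const_zero, norm_zero, integral_zero]
        linarith
  · intro P hP
    have hNc : 1 ≤ N^c := Real.one_le_rpow hN1 (by linarith)
    have hcN : N^c ≤ N := by
      calc N^c ≤ N^(1:ℝ) := Real.rpow_le_rpow_of_exponent_le hN1 (by linarith)
        _ = N := Real.rpow_one N
    have hc4 : 8 * (N^c * N^c)^2 ≤ N := by
      have e : (N^c * N^c)^2 = N^(4*c) := by
        rw [← Real.rpow_add hN0, ← Real.rpow_natCast, ← Real.rpow_mul hN0.le]; congr 1; push_cast; ring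
      rw [e]
      have e2 : N^(4*c) ≤ N^(1/2:ℝ) := Real.rpow_le_rpow_of_exponent_le hN1 (by linarith)
      rw [← Real.sqrt_eq_rpow] at e2
      have e3 : 8 ≤ √N := Real.le_sqrt_of_sq_le (by linarith)
      have e4 := Real.mul_self_sqrt hN0.le
      nlinarith only [e, e4, hN, e2, hc0, hc1]
    set ph : ℝ × ℕ → ℕ → ℂ := fun z n => if |z.1| ≤ N^6 ∧ z.2 ∈ P then ee (-z.1 * Real.log n) * (1 - z.2 * if z.2 ∣ n then 1 else 0) else 0 with hph
    have hphb : ∀ z n, ‖ph z n‖ ≤ 1 + N := by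
      intro z n
      simp only [hph]
      split_ifs with h1 h2
      · rw [norm_mul, norm_ee, one_mul]
        refine (norm_sub_le _ _).trans ?_
        have := (hP _ h1.2).2
        simp; linarith
      · simp [norm_ee]; linarith
      · simp; linarith
    have hphm : ∀ n, Measurable (fun z => ph z n) := by
      intro n
      apply measurable_from_prod_countable_left
      intro p
      simp only [hph]
      by_cases hp : p ∈ P
      · simp only [hp, and_true]
        refine Measurable.ite (measurableSet_le measurable_id.abs measurable_const) ?_ measurable_const
        have hm1 : Measurable (fun x : ℝ => ee (-x * Real.log n)) :=
          hcont.measurable.comp (by fun_prop : Measurable fun x : ℝ => -x * Real.log n)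
        exact hm1.mul_const (1 - (p:ℂ) * if p ∣ n then 1 else 0)
      · simp only [hp, and_false, if_false]; exact measurable_const
    have hsumm : ∀ a : ℕ → ℂ, Measurable (fun z => ∑ n ∈ S0 N, a n * ph z n) := fun a => by
      apply Finset.measurable_fun_sum; intro n _; exact (hphm n).const_mul _
    have hsumb : ∀ (a : ℕ → ℂ) z, ‖∑ n ∈ S0 N, a n * ph z n‖ ≤ ∑ n ∈ S0 N, ‖a n‖ * (1+N) := fun a z =>
      (norm_sum_le _ _).trans (Finset.sum_le_sum fun n _ => by rw [norm_mul]; gcongr; exact hphb z n)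
    have key := schur (μ.prod (pm P)) (S0 N) (bb N) hS ph (1+N) hphb hphm (26 + 4 * C) (by linarith) ?_ (fun n => if n ∈ s then a n else 0)
    · refine le_trans (le_of_eq ?_) (key.trans (by gcongr))
      rw [pm_int μ P _ ((∑ n ∈ S0 N, ‖if n ∈ s then a n else 0‖ * (1+N))^2) ((hsumm _).norm.pow_const 2) (fun z => by
        rw [norm_pow, norm_norm]; gcongr; exact hsumb _ z)]
      refine Finset.sum_congr rfl fun p hp => ?_
      congr 1
      refine integral_congr_ae ?_
      filter_upwards [hsupp] with t ht
      rw [sx1]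
      simp only [hph, ht, hp, and_self, if_true]
    · rintro ⟨t, p⟩
      by_cases htp : |t| ≤ N^6 ∧ p ∈ P
      · obtain ⟨ht, hp⟩ := htp
        have hp1 := (hP p hp).1
        have hp0 : (1:ℝ) ≤ p := by exact_mod_cast hp1.one_lt.le
        obtain ⟨k1, k2⟩ := int_kernel μ hμ t
        -- pointwise kernel bound
        have hker : ∀ y : ℝ, ∀ r ∈ P, ‖∑ n ∈ S0 N, (bb N n : ℂ) * (ph (t, p) n * (starRingEnd ℂ) (ph (y, r) n))‖ ≤
            (if r = p then (p:ℝ) * (8 * (1 + (y - t)^2)⁻¹) else 0) + 4 * (N^c * r) * (C * N^(-c0)) := by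
          intro y r hr
          have hr1 := (hP r hr).1
          have hr0 : (1:ℝ) ≤ r := by exact_mod_cast hr1.one_lt.le
          have hCN : 0 ≤ C * N^(-c0) := by positivity
          by_cases hy : |y| ≤ N^6
          · set S : ℕ → ℂ := fun D => ∑ n ∈ S0 N, (bb N n : ℂ) * (if D ∣ n then ee ((y - t) * Real.log n) else 0) with hSd
            have hpp : 8 * ((p*r:ℕ):ℝ)^2 ≤ N := by
              refine le_trans ?_ hc4
              push_cast
              gcongr
              · exact (hP p hp).2
              · exact (hP r hr).2
            have hsq1 : ∀ x y : ℝ, 1 ≤ x → 1 ≤ y → x ≤ x * y := fun x y hx hy => by nlinarith only [hy, hc0, hc1, hx]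
            have hpp' : 8 * (p:ℝ)^2 ≤ N := by
              refine le_trans ?_ hpp; push_cast; gcongr; exact hsq1 _ _ hp0 hr0
            have hrr' : 8 * (r:ℝ)^2 ≤ N := by
              refine le_trans ?_ hpp; push_cast; gcongr; rw [mul_comm]; exact hsq1 _ _ hr0 hp0
            have b1 : ‖S 1 - (1/(1:ℕ):ℂ) * mm N (y-t)‖ ≤ C * N^(-c0) := hsm 1 t y le_rfl (by norm_num; linarith) ht hy
            have b2 : ‖S p - (1/p:ℂ) * mm N (y-t)‖ ≤ C * N^(-c0) := hsm p t y hp1.one_lt.le hpp' ht hy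
            have b3 : ‖S r - (1/r:ℂ) * mm N (y-t)‖ ≤ C * N^(-c0) := hsm r t y hr1.one_lt.le hrr' ht hy
            have b4 : ‖S (p*r) - (1/(p*r:ℕ):ℂ) * mm N (y-t)‖ ≤ C * N^(-c0) := hsm (p*r) t y (Nat.mul_pos hp1.pos hr1.pos) hpp ht hy
            have hpC : (p:ℂ) ≠ 0 := by exact_mod_cast hp1.ne_zero
            have hrC : (r:ℂ) ≠ 0 := by exact_mod_cast hr1.ne_zero
            have hph' : ∀ n, ph (t, p) n * (starRingEnd ℂ) (ph (y, r) n) = ee ((y - t) * Real.log n) * ((1 - p * if p ∣ n then 1 else 0) * (1 - r * if r ∣ n then 1 else 0)) := by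
              intro n
              simp only [hph, ht, hy, hp, hr, and_self, if_true, map_mul, map_sub, map_one, map_natCast]
              rw [← ee_neg_conj]
              have : (starRingEnd ℂ) (if r ∣ n then 1 else 0) = if r ∣ n then 1 else 0 := by split_ifs <;> simp
              rw [this]; ring
            simp_rw [hph']
            have hpN := (hP p hp).2
            by_cases hrp : r = p
            · subst hrp
              rw [if_pos rfl]
              have e : ∑ n ∈ S0 N, (bb N n : ℂ) * (ee ((y - t) * Real.log n) * ((1 - r * if r ∣ n then 1 else 0) * (1 - r * if r ∣ n then 1 else 0)))
                = (S 1 - (1/(1:ℕ):ℂ) * mm N (y-t)) + ((r:ℂ)^2 - 2*r) * (S r - (1/r:ℂ) * mm N (y-t)) + (r - 1) * mm N (y-t) := by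
                have e1 : ∑ n ∈ S0 N, (bb N n : ℂ) * (ee ((y - t) * Real.log n) * ((1 - r * if r ∣ n then 1 else 0) * (1 - r * if r ∣ n then 1 else 0)))
                  = S 1 + ((r:ℂ)^2 - 2*r) * S r := by
                  simp only [hSd]
                  rw [Finset.mul_sum, ← Finset.sum_add_distrib]
                  refine Finset.sum_congr rfl fun n _ => ?_
                  by_cases hd : r ∣ n <;> simp [hd]; ring
                rw [e1]; field_simp; push_cast; ring
              rw [e]
              refine (norm_add₃_le).trans ?_
              rw [norm_mul, norm_mul]
              have n1 : ‖(r:ℂ)^2 - 2*r‖ ≤ (r:ℝ)^2 := by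
                have : (r:ℂ)^2 - 2*r = (((r:ℝ)^2 - 2*r : ℝ) : ℂ) := by push_cast; ring
                rw [this, Complex.norm_real, Real.norm_eq_abs, abs_le]
                have : (2:ℝ) ≤ r := by exact_mod_cast hr1.two_le
                constructor <;> nlinarith only [hr0, hc0, hc1, this]
              have n2 : ‖(r:ℂ) - 1‖ ≤ r := by
                have : (r:ℂ) - 1 = ((r - 1 : ℝ) : ℂ) := by push_cast; ring
                rw [this, Complex.norm_real, Real.norm_eq_abs, abs_le]
                constructor <;> linarith
              have m1 := mul_le_mul n1 b2 (norm_nonneg _) (by positivity)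
              have m2 := mul_le_mul n2 (mm_le N (y-t)) (norm_nonneg _) (by positivity)
              have m3 : (r:ℝ)^2 * (C * N^(-c0)) ≤ (N^c * r) * (C * N^(-c0)) := by rw [sq]; gcongr
              have m4 : 1 * (C * N^(-c0)) ≤ (N^c * r) * (C * N^(-c0)) := by gcongr; nlinarith only [hr0, hNc]
              linarith only [hCN, b1, m1, m2, m3, m4]
            · rw [if_neg hrp]
              have e : ∑ n ∈ S0 N, (bb N n : ℂ) * (ee ((y - t) * Real.log n) * ((1 - p * if p ∣ n then 1 else 0) * (1 - r * if r ∣ n then 1 else 0)))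
                = (S 1 - (1/(1:ℕ):ℂ) * mm N (y-t)) - p * (S p - (1/p:ℂ) * mm N (y-t)) - r * (S r - (1/r:ℂ) * mm N (y-t))
                  + p * r * (S (p*r) - (1/(p*r:ℕ):ℂ) * mm N (y-t)) := by
                have e1 : ∑ n ∈ S0 N, (bb N n : ℂ) * (ee ((y - t) * Real.log n) * ((1 - p * if p ∣ n then 1 else 0) * (1 - r * if r ∣ n then 1 else 0)))
                  = S 1 - p * S p - r * S r + p * r * S (p*r) := by
                  simp only [hSd]
                  rw [Finset.mul_sum, Finset.mul_sum, Finset.mul_sum, ← Finset.sum_sub_distrib, ← Finset.sum_sub_distrib, ← Finset.sum_add_distrib]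
                  refine Finset.sum_congr rfl fun n _ => ?_
                  have hco : p * r ∣ n ↔ p ∣ n ∧ r ∣ n := by
                    have := (Nat.coprime_primes hp1 hr1).2 (Ne.symm hrp)
                    exact ⟨fun h => ⟨(dvd_mul_right _ _).trans h, (dvd_mul_left _ _).trans h⟩, fun h => this.mul_dvd_of_dvd_of_dvd h.1 h.2⟩
                  by_cases hd : p ∣ n <;> by_cases hd' : r ∣ n <;> simp [hd, hd', hco] <;> ring
                rw [e1]; push_cast; field_simp; ring
              rw [e]
              refine (norm_add_le _ _).trans ((add_le_add_left ((norm_sub_le _ _).trans (add_le_add_left (norm_sub_le _ _) _)) _).trans ?_)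
              rw [norm_mul, norm_mul, norm_mul, norm_mul, Complex.norm_natCast, Complex.norm_natCast]
              have m1 := mul_le_mul_of_nonneg_left b2 (by positivity : (0:ℝ) ≤ p)
              have m2 := mul_le_mul_of_nonneg_left b3 (by positivity : (0:ℝ) ≤ r)
              have m3 := mul_le_mul_of_nonneg_left b4 (by positivity : (0:ℝ) ≤ p * r)
              have m4 : (p * r) * (C * N^(-c0)) ≤ (N^c * r) * (C * N^(-c0)) := by gcongr
              have m5 : 1 * (C * N^(-c0)) ≤ (N^c * r) * (C * N^(-c0)) := by gcongr; nlinarith only [hr0, hNc]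
              have m6 : p * (C * N^(-c0)) ≤ (N^c * r) * (C * N^(-c0)) := by gcongr; nlinarith only [hr0, hpN]
              have m7 : r * (C * N^(-c0)) ≤ (N^c * r) * (C * N^(-c0)) := by gcongr; nlinarith only [hNc]
              linarith only [b1, m1, m2, m3, m4, m5, m6, m7]
          · have : ∀ n, ph (y, r) n = 0 := fun n => by simp [hph, hy]
            simp only [this, map_zero, mul_zero, Finset.sum_const_zero, norm_zero]
            split_ifs <;> positivity
        have hKm : Measurable (fun z => ‖∑ n ∈ S0 N, (bb N n : ℂ) * (ph (t, p) n * (starRingEnd ℂ) (ph z n))‖) := by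
          apply Measurable.norm
          apply Finset.measurable_fun_sum; intro n _
          exact (((Complex.continuous_conj.measurable.comp (hphm n)).const_mul _).const_mul _)
        rw [pm_int μ P _ (∑ n ∈ S0 N, |bb N n| * ((1+N) * (1+N))) hKm (fun z => by
          rw [norm_norm]
          refine (norm_sum_le _ _).trans (Finset.sum_le_sum fun n _ => ?_)
          rw [norm_mul, norm_mul, RCLike.norm_conj, Complex.norm_real, Real.norm_eq_abs]
          have := hphb (t,p) n
          have := hphb z n
          gcongr)]
        have hone : ∀ r ∈ P, (1/r:ℝ) * ∫ y, ‖∑ n ∈ S0 N, (bb N n : ℂ) * (ph (t, p) n * (starRingEnd ℂ) (ph (y, r) n))‖ ∂μ ≤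
            (if r = p then 26 else 0) + N^c * (4 * N^c * (C * N^(-c0))) := by
          intro r hr
          have hr0 : (1:ℝ) ≤ r := by exact_mod_cast (hP r hr).1.one_lt.le
          have i1 : Integrable (fun y => (if r = p then (p:ℝ) * (8 * (1 + (y - t)^2)⁻¹) else 0)) μ := by
            split_ifs
            · exact k2.const_mul _
            · exact integrable_const _
          have : ∫ y, ‖∑ n ∈ S0 N, (bb N n : ℂ) * (ph (t, p) n * (starRingEnd ℂ) (ph (y, r) n))‖ ∂μ ≤
              ∫ y, ((if r = p then (p:ℝ) * (8 * (1 + (y - t)^2)⁻¹) else 0) + 4 * (N^c * r) * (C * N^(-c0))) ∂μ :=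
            integral_mono_of_nonneg (Eventually.of_forall fun y => norm_nonneg _) (i1.add (integrable_const _)) (Eventually.of_forall fun y => hker y r hr)
          rw [integral_add i1 (integrable_const _), integral_const, smul_eq_mul] at this
          have h2 : ∫ y, (if r = p then (p:ℝ) * (8 * (1 + (y - t)^2)⁻¹) else 0) ∂μ ≤ r * (if r = p then 26 else 0) := by
            split_ifs with hh
            · rw [integral_const_mul, hh]; gcongr
            · simp
          have h3 : μ.real Set.univ * (4 * (N^c * r) * (C * N^(-c0))) ≤ N^c * (4 * (N^c * r) * (C * N^(-c0))) := by gcongr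
          rw [one_div, inv_mul_le_iff₀ (by linarith)]
          refine this.trans ((add_le_add h2 h3).trans (le_of_eq ?_))
          ring
        refine (Finset.sum_le_sum hone).trans ?_
        rw [Finset.sum_add_distrib, Finset.sum_ite_eq' P p, if_pos hp, Finset.sum_const, nsmul_eq_mul]
        have hcard : (P.card:ℝ) ≤ N^c := by
          have : P ⊆ Finset.Icc 1 ⌊N^c⌋₊ := fun r hr => by
            rw [Finset.mem_Icc]; exact ⟨(hP r hr).1.one_lt.le, Nat.le_floor (hP r hr).2⟩
          have := Finset.card_le_card this
          rw [Nat.card_Icc, Nat.add_sub_cancel] at this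
          exact (Nat.cast_le.2 this).trans (Nat.floor_le (by positivity))
        have : (P.card:ℝ) * (N^c * (4 * N^c * (C * N^(-c0)))) ≤ N^c * (N^c * (4 * N^c * (C * N^(-c0)))) := by gcongr
        have e : N^c * (N^c * (4 * N^c * (C * N^(-c0)))) = 4 * C * (N^(c+c+c+-c0)) := by
          rw [Real.rpow_add hN0, Real.rpow_add hN0, Real.rpow_add hN0]; ring
        have e2 : N^(c+c+c+-c0) ≤ 1 := Real.rpow_le_one_of_one_le_of_nonpos hN1 (by linarith)
        rw [e] at this
        nlinarith only [this, e2, hc0, hc1, hC]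
      · have : ∀ n, ph (t, p) n = 0 := fun n => by simp only [hph]; rw [if_neg htp]
        simp only [this, zero_mul, mul_zero, Finset.sum_const_zero, norm_zero, integral_zero]
        linarith
end MR

namespace MR
open MeasureTheory

noncomputable def ps (x y : ℝ) : ℝ := ∑ p ∈ Finset.Ioc ⌊x⌋₊ ⌊y⌋₊ with p.Prime, (1/p:ℝ)

lemma ps_nonneg (x y : ℝ) : 0 ≤ ps x y := Finset.sum_nonneg fun _ _ => by positivity

lemma ps_add {x y z : ℝ} (h1 : x ≤ y) (h2 : y ≤ z) : ps x y + ps y z = ps x z := by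
  simp only [ps, Finset.sum_filter]
  exact Finset.sum_Ioc_consecutive _ (Nat.floor_le_floor h1) (Nat.floor_le_floor h2)

lemma ps_mono {x y z : ℝ} (h2 : y ≤ z) : ps x y ≤ ps x z := by
  apply Finset.sum_le_sum_of_subset_of_nonneg _ (fun _ _ _ => by positivity)
  exact Finset.filter_subset_filter _ (Finset.Ioc_subset_Ioc_right (Nat.floor_le_floor h2))

lemma theta_sub {x y : ℝ} (h : x ≤ y) : ∑ p ∈ Finset.Ioc ⌊x⌋₊ ⌊y⌋₊ with p.Prime, Real.log p = Chebyshev.theta y - Chebyshev.theta x := by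
  simp only [Chebyshev.theta, Finset.sum_filter]
  rw [← Finset.sum_Ioc_consecutive _ (Nat.zero_le ⌊x⌋₊) (Nat.floor_le_floor h)]; ring

lemma theta_half : ∀ᶠ x : ℝ in atTop, x/2 ≤ Chebyshev.theta x := by
  have h1 : (fun x:ℝ => Real.log (x+2)) =o[atTop] (fun x:ℝ => x + 2) :=
    Real.isLittleO_log_id_atTop.comp_tendsto (tendsto_atTop_add_const_right _ 2 tendsto_id)
  have h2 : (fun x:ℝ => Real.log x) =o[atTop] (fun x:ℝ => x^(1/2:ℝ)) := isLittleO_log_rpow_atTop (by norm_num)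
  filter_upwards [h1.def (show (0:ℝ) < 1/100 by norm_num), h2.def (show (0:ℝ) < 1/100 by norm_num), eventually_ge_atTop 100] with x h1 h2 hx
  have h3 := Chebyshev.theta_ge' (show 1 ≤ x by linarith)
  have h4 := Real.log_two_gt_d9
  rw [Real.norm_of_nonneg (Real.log_nonneg (by linarith)), Real.norm_of_nonneg (by linarith)] at h1
  rw [Real.norm_of_nonneg (Real.log_nonneg (by linarith)), Real.norm_of_nonneg (by positivity), ← Real.sqrt_eq_rpow] at h2
  have h5 : √x * Real.log x ≤ 1/100 * x := by
    calc √x * Real.log x ≤ √x * (1/100 * √x) := by gcongr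
      _ = 1/100 * (√x * √x) := by ring
      _ = _ := by rw [Real.mul_self_sqrt (by linarith)]
  nlinarith only [h1, hx, h3, h4, h5]

lemma ps_lower8 : ∃ x0 : ℝ, 2 ≤ x0 ∧ ∀ x, x0 ≤ x → 1 / (8 * Real.log (8*x)) ≤ ps x (8*x) := by
  obtain ⟨x0, h0⟩ := eventually_atTop.1 theta_half
  refine ⟨max x0 2, le_max_right _ _, fun x hx => ?_⟩
  have hx0 : x0 ≤ x := (le_max_left _ _).trans hx
  have hx2 : 2 ≤ x := (le_max_right _ _).trans hx
  have h1 := h0 (8*x) (by linarith)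
  have h2 := Chebyshev.theta_le_log4_mul_x (show 0 ≤ x by linarith)
  have h3 : Real.log 4 ≤ 1.4 := by
    rw [show (4:ℝ) = 2^2 by norm_num, Real.log_pow]; have := Real.log_two_lt_d9; push_cast; linarith
  have h4 : x ≤ Chebyshev.theta (8*x) - Chebyshev.theta x := by nlinarith
  rw [← theta_sub (by linarith)] at h4
  have hl : 0 < Real.log (8*x) := Real.log_pos (by linarith)
  have h5 : ∑ p ∈ Finset.Ioc ⌊x⌋₊ ⌊8*x⌋₊ with p.Prime, Real.log p ≤ ∑ p ∈ Finset.Ioc ⌊x⌋₊ ⌊8*x⌋₊ with p.Prime, (8 * x * Real.log (8*x)) * (1/p:ℝ) := by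
    refine Finset.sum_le_sum fun p hp => ?_
    simp only [Finset.mem_filter, Finset.mem_Ioc] at hp
    have hp1 : (p:ℝ) ≤ 8*x := (Nat.le_floor_iff (by linarith)).1 hp.1.2
    have hp0 : (0:ℝ) < p := by exact_mod_cast hp.2.pos
    rw [mul_one_div, le_div_iff₀ hp0, mul_comm]
    gcongr
  rw [← Finset.mul_sum] at h5
  rw [div_le_iff₀ (by positivity)]
  have : x * 1 ≤ x * (ps x (8*x) * (8 * Real.log (8*x))) := by
    rw [ps]; linarith
  exact le_of_mul_le_mul_left this (by linarith)

lemma ps_lower : ∃ P0 c : ℝ, 2 ≤ P0 ∧ 0 < c ∧ ∀ P, P0 ≤ P → ∀ j : ℕ, c * j ≤ ps P (P^(2^j)) := by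
  obtain ⟨x0, hx0, h0⟩ := ps_lower8
  have hl8 : 0 < Real.log 8 := Real.log_pos (by norm_num)
  set c := 1/(64 * Real.log 8) with hc
  have h1 : ∀ P, max x0 64 ≤ P → c ≤ ps P (P^2) := by
    intro P hP
    have hP0 : x0 ≤ P := (le_max_left _ _).trans hP
    have hP8 : 64 ≤ P := (le_max_right _ _).trans hP
    have hlP : 2 * Real.log 8 ≤ Real.log P := by
      rw [show 2 * Real.log 8 = Real.log 64 by rw [show (64:ℝ) = 8^2 by norm_num, Real.log_pow]; norm_num]
      exact Real.log_le_log (by norm_num) hP8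
    set j := ⌊Real.log P / Real.log 8⌋₊ with hj
    have hj1 : (j:ℝ) ≤ Real.log P / Real.log 8 := Nat.floor_le (div_nonneg (by linarith) hl8.le)
    have hj2 : Real.log P / Real.log 8 < j + 1 := Nat.lt_floor_add_one _
    have hj8 : (8:ℝ)^j ≤ P := by
      rw [← Real.log_le_log_iff (by positivity) (by linarith), Real.log_pow]
      exact (le_div_iff₀ hl8).1 hj1
    have h2 : ∀ i : ℕ, i ≤ j → i * (1/(16*Real.log P)) ≤ ps P (8^i * P) := by
      intro i
      induction i with
      | zero => intro _; simp [ps]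
      | succ i ih =>
        intro hi
        have h8i : (1:ℝ) ≤ 8^i := one_le_pow₀ (by norm_num)
        have h3 : P ≤ 8^i * P := by nlinarith only [h8i, hx0, hP0]
        rw [← ps_add h3 (show 8^i * P ≤ 8^(i+1) * P by rw [pow_succ]; nlinarith only [hP8, h3])]
        have h4 := h0 (8^i * P) (by linarith)
        rw [show 8 * (8^i * P) = 8^(i+1) * P by ring] at h4
        have h5 : 8^(i+1) * P ≤ P^2 := by
          rw [sq]; gcongr
          exact (pow_le_pow_right₀ (by norm_num) hi).trans hj8
        have h6 : Real.log (8^(i+1) * P) ≤ 2 * Real.log P := by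
          have := Real.log_le_log (by positivity) h5
          rwa [Real.log_pow] at this
        have h7 : 0 < Real.log (8^(i+1) * P) := Real.log_pos (by rw [pow_succ]; nlinarith only [hP8, h3])
        have h8 : 1/(16*Real.log P) ≤ 1 / (8 * Real.log (8^(i+1) * P)) := by
          apply one_div_le_one_div_of_le <;> linarith
        have := ih (by omega)
        push_cast; linarith
    have h3 := h2 j le_rfl
    refine le_trans ?_ (h3.trans (ps_mono (by rw [sq]; gcongr)))
    have h9 : Real.log P / (4 * Real.log 8) ≤ j := by
      have : 2 ≤ Real.log P / Real.log 8 := by rwa [le_div_iff₀ hl8]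
      have : Real.log P / (4 * Real.log 8) = (Real.log P / Real.log 8)/4 := by field_simp
      linarith
    have hlP0 : 0 < Real.log P := by linarith
    calc c = Real.log P / (4 * Real.log 8) * (1/(16*Real.log P)) := by rw [hc]; field_simp; norm_num
      _ ≤ _ := by gcongr
  refine ⟨max x0 64, c, hx0.trans (le_max_left _ _), by positivity, fun P hP j => ?_⟩
  have hP1 : 1 ≤ P := by linarith [(le_max_right x0 64).trans hP]
  induction j with
  | zero => simp [ps]
  | succ j ih =>
    rw [← ps_add (y := P^(2^j)) (le_self_pow₀ hP1 (by positivity)) (pow_le_pow_right₀ hP1 (Nat.pow_le_pow_right (by norm_num) (by omega)))]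
    have h2 := h1 (P^(2^j)) (hP.trans (le_self_pow₀ hP1 (by positivity)))
    rw [← pow_mul, ← pow_succ] at h2
    push_cast; linarith

lemma ps_upper {P : ℝ} (hP : 2 ≤ P) : ps P (P^2) ≤ 8 := by
  have hl2 := Real.log_two_gt_d9
  have hl2' := Real.log_two_lt_d9
  have hlP : Real.log 2 ≤ Real.log P := Real.log_le_log (by norm_num) hP
  have h1 : ∀ x, P ≤ x → ps x (2*x) ≤ 2*Real.log 4 / Real.log P := by
    intro x hx
    have hx0 : 0 < x := by linarith
    have h2 := Chebyshev.theta_le_log4_mul_x (show 0 ≤ 2*x by linarith)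
    have h3 := Chebyshev.theta_nonneg x
    have h4 := theta_sub (show x ≤ 2*x by linarith)
    have h5 : ∑ p ∈ Finset.Ioc ⌊x⌋₊ ⌊2*x⌋₊ with p.Prime, (x * Real.log P) * (1/p:ℝ) ≤ ∑ p ∈ Finset.Ioc ⌊x⌋₊ ⌊2*x⌋₊ with p.Prime, Real.log p := by
      refine Finset.sum_le_sum fun p hp => ?_
      simp only [Finset.mem_filter, Finset.mem_Ioc] at hp
      have hp1 : x < p := (Nat.floor_lt hx0.le).1 hp.1.1
      rw [mul_one_div, div_le_iff₀ (by linarith), mul_comm]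
      have : Real.log P ≤ Real.log p := Real.log_le_log (by linarith) (by linarith)
      gcongr
    rw [← Finset.mul_sum] at h5
    rw [le_div_iff₀ (by linarith)]
    have : x * (ps x (2*x) * Real.log P) ≤ x * (2 * Real.log 4) := by rw [ps]; nlinarith only [h2, h3, h4, h5]
    exact le_of_mul_le_mul_left this hx0
  have h2 : ∀ i : ℕ, ps P (2^i * P) ≤ i * (2*Real.log 4 / Real.log P) := by
    intro i
    induction i with
    | zero => simp [ps]
    | succ i ih =>
      have h8i : (1:ℝ) ≤ 2^i := one_le_pow₀ (by norm_num)
      have h3 : P ≤ 2^i * P := by nlinarith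
      rw [← ps_add h3 (show 2^i * P ≤ 2^(i+1) * P by rw [pow_succ]; nlinarith only [hP, hl2, hl2', h3])]
      have h4 := h1 _ h3
      rw [show 2 * (2^i * P) = 2^(i+1) * P by ring] at h4
      push_cast; linarith
  set j := ⌈Real.log P / Real.log 2⌉₊ with hj
  have hj1 : Real.log P / Real.log 2 ≤ j := Nat.le_ceil _
  have hj2 : (j:ℝ) < Real.log P / Real.log 2 + 1 := Nat.ceil_lt_add_one (div_nonneg (by linarith) (by linarith))
  have hjP : P ≤ 2^j := by
    rw [← Real.log_le_log_iff (by linarith) (by positivity), Real.log_pow]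
    exact (div_le_iff₀ (by linarith)).1 hj1
  have h4 : Real.log 4 = 2 * Real.log 2 := by rw [show (4:ℝ) = 2^2 by norm_num, Real.log_pow]; norm_num
  have hl0 : 0 < Real.log P := by linarith
  calc ps P (P^2) ≤ ps P (2^j * P) := ps_mono (by rw [sq]; gcongr)
    _ ≤ j * (2*Real.log 4 / Real.log P) := h2 j
    _ ≤ (2 * Real.log P / Real.log 2) * (2*Real.log 4 / Real.log P) := by
      have : 1 ≤ Real.log P / Real.log 2 := by rwa [one_le_div (by linarith)]
      have h5 : 0 ≤ 2*Real.log 4 / Real.log P := by rw [h4]; positivity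
      refine mul_le_mul_of_nonneg_right ?_ h5
      rw [mul_div_assoc]; linarith only [hj2, this]
    _ = 8 := by rw [h4]; field_simp; norm_num

lemma ps_S {y : ℝ} (hy : 3 ≤ y) : ps 1 y ≤ 17 * (1 + Real.log (Real.log y)) := by
  have hly : 1 ≤ Real.log y := by
    rw [Real.le_log_iff_exp_le (by linarith)]; linarith [Real.exp_one_lt_d9]
  have hll : 0 ≤ Real.log (Real.log y) := Real.log_nonneg hly
  have h1 : ∀ j : ℕ, ps 1 (2^(2^j)) ≤ 1/2 + 8 * j := by
    intro j
    induction j with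
    | zero =>
      simp only [ps, pow_zero, pow_one, Nat.floor_one, Nat.floor_ofNat]
      rw [show (Finset.Ioc 1 2).filter Nat.Prime = {2} by decide]; simp
    | succ j ih =>
      rw [← ps_add (y := 2^(2^j)) (one_le_pow₀ (by norm_num)) (pow_le_pow_right₀ (by norm_num) (Nat.pow_le_pow_right (by norm_num) (by omega)))]
      have h2 := ps_upper (P := 2^(2^j)) (le_self_pow₀ (by norm_num) (by positivity))
      rw [← pow_mul, ← pow_succ] at h2
      push_cast; linarith
  have hl2 := Real.log_two_gt_d9
  set j := ⌈2 * Real.log (Real.log y)⌉₊ + 1 with hj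
  have hj1 : 2 * Real.log (Real.log y) ≤ ⌈2 * Real.log (Real.log y)⌉₊ := Nat.le_ceil _
  have hj2 := Nat.ceil_lt_add_one (show 0 ≤ 2 * Real.log (Real.log y) by linarith)
  have h2 : y ≤ 2^(2^j) := by
    rw [← Real.log_le_log_iff (by linarith) (by positivity), Real.log_pow]
    have : Real.log y ≤ 2^⌈2 * Real.log (Real.log y)⌉₊ := by
      rw [← Real.log_le_log_iff (by linarith) (by positivity), Real.log_pow]
      nlinarith only [hj1, hl2]
    push_cast
    rw [hj, pow_succ]
    nlinarith only [hly, hl2, this, show (0:ℝ) < 2^⌈2 * Real.log (Real.log y)⌉₊ by positivity]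
  refine (ps_mono h2).trans ((h1 j).trans ?_)
  rw [hj]; push_cast; linarith
end MR

namespace MR
open MeasureTheory

lemma mu_sum (m l : ℕ) (hm : Squarefree m) (hl : 0 < l) :
    ∑ d ∈ m.divisors with l ∣ d, ((ArithmeticFunction.moebius d : ℤ) : ℝ) = if m = l then ((ArithmeticFunction.moebius l : ℤ) : ℝ) else 0 := by
  have hm0 := hm.ne_zero
  by_cases hlm : l ∣ m
  · obtain ⟨k, rfl⟩ := hlm
    have hk0 : k ≠ 0 := by rintro rfl; simp at hm0
    have hcop : Nat.Coprime l k := (Nat.squarefree_mul_iff.1 hm).1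
    have h1 : ((l*k).divisors.filter (fun d => l ∣ d)) = k.divisors.image (fun e => l * e) := by
      ext d
      simp only [Finset.mem_filter, Nat.mem_divisors, Finset.mem_image]
      constructor
      · rintro ⟨⟨h, _⟩, e, rfl⟩
        exact ⟨e, ⟨Nat.dvd_of_mul_dvd_mul_left hl h, hk0⟩, rfl⟩
      · rintro ⟨e, ⟨h, _⟩, rfl⟩
        exact ⟨⟨Nat.mul_dvd_mul_left l h, hm0⟩, dvd_mul_right _ _⟩
    rw [h1, Finset.sum_image (fun a _ b _ h => Nat.eq_of_mul_eq_mul_left hl h)]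
    have h2 : ∀ e ∈ k.divisors, ((ArithmeticFunction.moebius (l*e) : ℤ) : ℝ) = (ArithmeticFunction.moebius l : ℤ) * ((ArithmeticFunction.moebius e : ℤ) : ℝ) := by
      intro e he
      rw [ArithmeticFunction.isMultiplicative_moebius.map_mul_of_coprime (hcop.coprime_dvd_right (Nat.dvd_of_mem_divisors he))]
      push_cast; ring
    rw [Finset.sum_congr rfl h2, ← Finset.mul_sum]
    have h3 : ∑ e ∈ k.divisors, ((ArithmeticFunction.moebius e : ℤ) : ℝ) = if k = 1 then 1 else 0 := by
      have := congrArg (fun f : ArithmeticFunction ℤ => f k) ArithmeticFunction.coe_zeta_mul_moebius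
      simp only [ArithmeticFunction.coe_zeta_mul_apply, ArithmeticFunction.one_apply] at this
      rw [← Int.cast_sum, this]; split_ifs <;> simp
    rw [h3]
    by_cases hk : k = 1
    · simp [hk]
    · have : l * k ≠ l := by
        intro h; apply hk
        exact Nat.eq_of_mul_eq_mul_left hl (by omega)
      simp [hk, this]
  · have h1 : (m.divisors.filter (fun d => l ∣ d)) = ∅ := by
      ext d; simp only [Finset.mem_filter, Nat.mem_divisors, Finset.notMem_empty, iff_false]
      rintro ⟨⟨h, _⟩, h'⟩; exact hlm (h'.trans h)
    rw [h1, if_neg (by rintro rfl; exact hlm dvd_rfl)]; simp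

lemma sqf_sum (R : ℕ) : Real.log (R+1) ≤ 2 * ∑ m ∈ Finset.Icc 1 R with Squarefree m, (1/m:ℝ) := by
  have h1 := log_add_one_le_harmonic R
  rw [harmonic_eq_sum_Icc] at h1
  push_cast at h1
  refine h1.trans ?_
  choose! f g hf using (fun (n:ℕ) (hn : 0 < n) => Nat.sq_mul_squarefree_of_pos hn)
  have hsq : ∑ k ∈ Finset.Icc 1 R, (1/(k:ℝ)^2) ≤ 2 := by
    have : ∀ n : ℕ, 1 ≤ n → ∑ k ∈ Finset.Icc 1 n, (1/(k:ℝ)^2) ≤ 2 - 1/(n:ℝ) := by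
      intro n hn
      induction n, hn using Nat.le_induction with
      | base => norm_num
      | succ n hn ih =>
        rw [Finset.sum_Icc_succ_top (by omega)]
        have hn' : (0:ℝ) < n := by exact_mod_cast hn
        have : 1/((n:ℝ)+1)^2 ≤ 1/(n:ℝ) - 1/((n:ℝ)+1) := by
          rw [div_sub_div _ _ hn'.ne' (by positivity), div_le_div_iff₀ (by positivity) (by positivity)]
          nlinarith only [hn']
        push_cast; linarith
    rcases Nat.eq_zero_or_pos R with rfl | hR
    · simp
    · exact (this R hR).trans (by have : (0:ℝ) ≤ 1/R := by positivity
                                  linarith)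
  calc ∑ n ∈ Finset.Icc 1 R, ((n:ℝ))⁻¹ = ∑ n ∈ Finset.Icc 1 R, (1/((g n:ℝ))^2) * (1/(f n:ℝ)) := by
        refine Finset.sum_congr rfl fun n hn => ?_
        have := (hf n (Finset.mem_Icc.1 hn).1).2.2.1
        rw [div_mul_div_comm, one_mul, one_div]; congr 1; exact_mod_cast this.symm
    _ = ∑ z ∈ (Finset.Icc 1 R).image (fun n => (g n, f n)), (1/((z.1:ℝ))^2) * (1/(z.2:ℝ)) := by
        rw [Finset.sum_image]
        intro a ha b hb h
        simp only [Prod.mk.injEq] at h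
        rw [← (hf a (Finset.mem_Icc.1 ha).1).2.2.1, ← (hf b (Finset.mem_Icc.1 hb).1).2.2.1, h.1, h.2]
    _ ≤ ∑ z ∈ (Finset.Icc 1 R) ×ˢ ((Finset.Icc 1 R).filter Squarefree), (1/((z.1:ℝ))^2) * (1/(z.2:ℝ)) := by
        refine Finset.sum_le_sum_of_subset_of_nonneg ?_ (fun _ _ _ => by positivity)
        intro z hz
        obtain ⟨n, hn, rfl⟩ := Finset.mem_image.1 hz
        obtain ⟨h1, h2, h3, h4⟩ := hf n (Finset.mem_Icc.1 hn).1
        have h5 := (Finset.mem_Icc.1 hn).2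
        simp only [Finset.mem_product, Finset.mem_filter, Finset.mem_Icc]
        have : g n ≤ g n ^ 2 * f n := by nlinarith only [h2, h1, Nat.mul_le_mul h2 h1, Nat.mul_le_mul_left (g n) (Nat.mul_le_mul h2 h1)]
        have : f n ≤ g n ^ 2 * f n := Nat.le_mul_of_pos_left _ (by positivity)
        refine ⟨⟨h2, by omega⟩, ⟨h1, by omega⟩, h4⟩
    _ = (∑ k ∈ Finset.Icc 1 R, (1/(k:ℝ)^2)) * ∑ m ∈ Finset.Icc 1 R with Squarefree m, (1/m:ℝ) := by
        rw [Finset.sum_mul_sum, Finset.sum_product]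
    _ ≤ _ := by gcongr

noncomputable def hs (m : ℕ) : ℝ := if Squarefree m then 1 / (Nat.totient m : ℝ) else 0

lemma hs_nonneg (m : ℕ) : 0 ≤ hs m := by unfold hs; split_ifs <;> positivity

lemma hs_mul (l m : ℕ) : hs (l * m) ≤ hs l * hs m := by
  by_cases h : Squarefree (l * m)
  · obtain ⟨h1, h2, h3⟩ := Nat.squarefree_mul_iff.1 h
    simp only [hs, h, h2, h3, if_true]
    rw [Nat.totient_mul h1]; push_cast; rw [div_mul_div_comm, one_mul]
  · rw [hs, if_neg h]; exact mul_nonneg (hs_nonneg _) (hs_nonneg _)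

lemma hs_tot {l : ℕ} (hl : 0 < l) : (Nat.totient l : ℝ) * (hs l)^2 ≤ hs l := by
  have hp : (0:ℝ) < Nat.totient l := by exact_mod_cast Nat.totient_pos.2 hl
  simp only [hs]; split_ifs
  · rw [sq]; field_simp; exact le_rfl
  · simp

lemma hs_dvd (R l : ℕ) (hl : 0 < l) : ∑ m ∈ Finset.Icc 1 R with l ∣ m, hs m ≤ hs l * ∑ m ∈ Finset.Icc 1 R, hs m := by
  rw [Finset.mul_sum]
  calc ∑ m ∈ Finset.Icc 1 R with l ∣ m, hs m ≤ ∑ m ∈ Finset.Icc 1 R with l ∣ m, hs l * hs (m / l) := by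
        refine Finset.sum_le_sum fun m hm => ?_
        refine le_trans (le_of_eq ?_) (hs_mul l (m/l))
        rw [Nat.mul_div_cancel' (Finset.mem_filter.1 hm).2]
    _ = ∑ m ∈ ((Finset.Icc 1 R).filter (fun m => l ∣ m)).image (fun m => m / l), hs l * hs m := by
        rw [Finset.sum_image]
        intro a ha b hb h
        rw [← Nat.div_mul_cancel (Finset.mem_filter.1 ha).2, ← Nat.div_mul_cancel (Finset.mem_filter.1 hb).2]
        simp only at h; rw [h]
    _ ≤ _ := by
        refine Finset.sum_le_sum_of_subset_of_nonneg ?_ fun m _ _ => mul_nonneg (hs_nonneg _) (hs_nonneg _)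
        intro m hm
        obtain ⟨n, hn, rfl⟩ := Finset.mem_image.1 hm
        simp only [Finset.mem_filter, Finset.mem_Icc] at hn ⊢
        exact ⟨Nat.div_pos (Nat.le_of_dvd hn.1.1 hn.2) hl, (Nat.div_le_self _ _).trans hn.1.2⟩

lemma hs_upper (R : ℕ) : ∑ m ∈ Finset.Icc 1 R, hs m ≤ Real.exp (2 * ps 1 R) := by
  set Q := (Finset.Ioc 1 R).filter Nat.Prime with hQ
  calc ∑ m ∈ Finset.Icc 1 R, hs m = ∑ m ∈ Finset.Icc 1 R with Squarefree m, ∏ p ∈ m.primeFactors, (1/((p:ℝ)-1)) := by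
        rw [Finset.sum_filter]
        refine Finset.sum_congr rfl fun m hm => ?_
        unfold hs; split_ifs with h
        · have h1 := Nat.totient_eq_div_primeFactors_mul m
          rw [Nat.prod_primeFactors_of_squarefree h, Nat.div_self (Finset.mem_Icc.1 hm).1, one_mul] at h1
          rw [h1, Nat.cast_prod, Finset.prod_div_distrib, Finset.prod_const_one]
          congr 1
          refine Finset.prod_congr rfl fun p hp => ?_
          rw [Nat.cast_sub (Nat.prime_of_mem_primeFactors hp).one_le]; simp
        · rfl
    _ = ∑ T ∈ ((Finset.Icc 1 R).filter Squarefree).image Nat.primeFactors, ∏ p ∈ T, (1/((p:ℝ)-1)) := by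
        rw [Finset.sum_image]
        intro a ha b hb h
        rw [← Nat.prod_primeFactors_of_squarefree (Finset.mem_filter.1 ha).2, ← Nat.prod_primeFactors_of_squarefree (Finset.mem_filter.1 hb).2, h]
    _ ≤ ∑ T ∈ Q.powerset, ∏ p ∈ T, (1/((p:ℝ)-1)) := by
        refine Finset.sum_le_sum_of_subset_of_nonneg ?_ fun T hT _ => ?_
        · intro T hT
          obtain ⟨m, hm, rfl⟩ := Finset.mem_image.1 hT
          rw [Finset.mem_powerset]
          intro p hp
          simp only [hQ, Finset.mem_filter, Finset.mem_Ioc, Finset.mem_Icc] at hm ⊢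
          have := Nat.prime_of_mem_primeFactors hp
          exact ⟨⟨this.one_lt, (Nat.le_of_mem_primeFactors hp).trans hm.1.2⟩, this⟩
        · refine Finset.prod_nonneg fun p hp => ?_
          have h1 := Finset.mem_powerset.1 hT hp
          have : (1:ℝ) < p := by exact_mod_cast (Finset.mem_filter.1 h1).2.one_lt
          exact div_nonneg zero_le_one (by linarith)
    _ = ∏ p ∈ Q, (1 + 1/((p:ℝ)-1)) := (Finset.prod_one_add _).symm
    _ ≤ ∏ p ∈ Q, Real.exp (2 * (1/p:ℝ)) := by
        refine Finset.prod_le_prod (fun p hp => ?_) (fun p hp => ?_)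
        · have : (1:ℝ) < p := by exact_mod_cast (Finset.mem_filter.1 hp).2.one_lt
          have : 0 ≤ 1/((p:ℝ)-1) := div_nonneg zero_le_one (by linarith)
          linarith
        · have : (2:ℝ) ≤ p := by exact_mod_cast (Finset.mem_filter.1 hp).2.two_le
          have h2 : 1/((p:ℝ)-1) ≤ 2 * (1/p:ℝ) := by
            rw [mul_one_div, div_le_div_iff₀ (by linarith) (by linarith)]; linarith
          linarith [Real.add_one_le_exp (2 * (1/p:ℝ))]
    _ = _ := by
        rw [← Real.exp_sum, ← Finset.mul_sum, ps]; simp [hQ]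

lemma lcm_form (R : ℕ) (r : ℕ → ℝ) : ∑ d ∈ Finset.Icc 1 R, ∑ e ∈ Finset.Icc 1 R, (d * r d) * (e * r e) / (Nat.lcm d e : ℝ) =
    ∑ l ∈ Finset.Icc 1 R, (Nat.totient l : ℝ) * (∑ d ∈ Finset.Icc 1 R with l ∣ d, r d)^2 := by
  have h1 : ∀ d ∈ Finset.Icc 1 R, ∀ e ∈ Finset.Icc 1 R, (d * r d) * (e * r e) / (Nat.lcm d e : ℝ) = ∑ l ∈ Finset.Icc 1 R, (Nat.totient l : ℝ) * ((if l ∣ d then r d else 0) * (if l ∣ e then r e else 0)) := by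
    intro d hd e he
    have hd1 := Finset.mem_Icc.1 hd
    have he1 := Finset.mem_Icc.1 he
    have hg : (Nat.gcd d e : ℝ) = ∑ l ∈ Finset.Icc 1 R, if l ∣ d ∧ l ∣ e then (Nat.totient l : ℝ) else 0 := by
      rw [← Finset.sum_filter]
      have : (Finset.Icc 1 R).filter (fun l => l ∣ d ∧ l ∣ e) = (Nat.gcd d e).divisors := by
        ext l
        simp only [Finset.mem_filter, Finset.mem_Icc, Nat.mem_divisors, Nat.dvd_gcd_iff]
        constructor
        · rintro ⟨_, h⟩; exact ⟨h, (Nat.gcd_pos_of_pos_left _ hd1.1).ne'⟩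
        · rintro ⟨h, _⟩; exact ⟨⟨Nat.pos_of_dvd_of_pos h.1 hd1.1, (Nat.le_of_dvd hd1.1 h.1).trans hd1.2⟩, h⟩
      rw [this]; exact_mod_cast (Nat.sum_totient _).symm
    have hl : (Nat.gcd d e : ℝ) * Nat.lcm d e = d * e := by exact_mod_cast Nat.gcd_mul_lcm d e
    have hl0 : (0:ℝ) < Nat.lcm d e := by exact_mod_cast Nat.lcm_pos hd1.1 he1.1
    rw [div_eq_iff hl0.ne']
    calc _ = (d * e) * (r d * r e) := by ring
      _ = (Nat.gcd d e : ℝ) * (r d * r e) * Nat.lcm d e := by rw [← hl]; ring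
      _ = _ := by
        rw [hg, Finset.sum_mul]
        congr 1
        refine Finset.sum_congr rfl fun l _ => ?_
        by_cases ha : l ∣ d <;> by_cases hb : l ∣ e <;> simp [ha, hb]
  rw [Finset.sum_congr rfl fun d hd => Finset.sum_congr rfl fun e he => h1 d hd e he]
  simp_rw [sq, Finset.sum_filter, Finset.sum_mul_sum, Finset.mul_sum]
  rw [Finset.sum_comm' (t' := Finset.Icc 1 R) (s' := fun _ => Finset.Icc 1 R) (by tauto)]
  rw [Finset.sum_comm]
  conv_rhs => rw [Finset.sum_comm]
  rw [Finset.sum_comm]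
  refine Finset.sum_congr rfl fun d _ => ?_
  rw [Finset.sum_comm]
  refine Finset.sum_congr rfl fun x _ => Finset.sum_congr rfl fun y _ => by ring

lemma selberg (R : ℕ) (hR : 1 ≤ R) : ∃ w : ℕ → ℝ, w 1 = 1 ∧
    0 ≤ ∑ d ∈ Finset.Icc 1 R, ∑ e ∈ Finset.Icc 1 R, w d * w e / (Nat.lcm d e : ℝ) ∧ ∑ d ∈ Finset.Icc 1 R, ∑ e ∈ Finset.Icc 1 R, w d * w e / (Nat.lcm d e : ℝ) ≤ 2 / Real.log (R+1) ∧
    ∑ d ∈ Finset.Icc 1 R, ∑ e ∈ Finset.Icc 1 R, |w d| * |w e| / (Nat.lcm d e : ℝ) ≤ Real.exp (6 * ps 1 R) := by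
  set h : ℕ → ℝ := hs with hh
  have hh0 := hs_nonneg
  set G := ∑ m ∈ Finset.Icc 1 R, h m with hG
  have hlog : 0 < Real.log (R+1) := Real.log_pos (by have : (1:ℝ) ≤ R := by exact_mod_cast hR
                                                     linarith)
  have hGl : Real.log (R+1) ≤ 2 * G := by
    refine (sqf_sum R).trans ?_
    rw [hG, Finset.sum_filter]
    gcongr with m hm
    simp only [hh, hs]
    split_ifs with hsq
    · have : 0 < Nat.totient m := Nat.totient_pos.2 (Finset.mem_Icc.1 hm).1
      have : (Nat.totient m : ℝ) ≤ m := by exact_mod_cast Nat.totient_le m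
      gcongr
    · exact le_rfl
  have hG0 : 0 < G := by linarith
  set r : ℕ → ℝ := fun d => ((ArithmeticFunction.moebius d : ℤ) : ℝ) * (∑ m ∈ Finset.Icc 1 R with d ∣ m, h m) / G with hr
  have hy : ∀ l ∈ Finset.Icc 1 R, ∑ d ∈ Finset.Icc 1 R with l ∣ d, r d = ((ArithmeticFunction.moebius l : ℤ) : ℝ) * h l / G := by
    intro l hl
    simp only [hr]
    rw [← Finset.sum_div]
    congr 1
    calc ∑ d ∈ Finset.Icc 1 R with l ∣ d, ((ArithmeticFunction.moebius d : ℤ) : ℝ) * (∑ m ∈ Finset.Icc 1 R with d ∣ m, h m)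
        = ∑ m ∈ Finset.Icc 1 R, h m * ∑ d ∈ m.divisors with l ∣ d, ((ArithmeticFunction.moebius d : ℤ) : ℝ) := by
          simp_rw [Finset.mul_sum]
          rw [Finset.sum_comm' (t' := Finset.Icc 1 R) (s' := fun m => m.divisors.filter (fun d => l ∣ d))]
          · simp_rw [mul_comm]
          · intro d m
            simp only [Finset.mem_filter, Finset.mem_Icc, Nat.mem_divisors]
            constructor
            · rintro ⟨⟨h1, h2⟩, h3, h4⟩; exact ⟨⟨⟨h4, by omega⟩, h2⟩, h3⟩
            · rintro ⟨⟨⟨h1, h2⟩, h3⟩, h4⟩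
              have := Nat.le_of_dvd h4.1 h1
              exact ⟨⟨⟨Nat.pos_of_dvd_of_pos h1 h4.1, by omega⟩, h3⟩, h4, h1⟩
      _ = ∑ m ∈ Finset.Icc 1 R, if m = l then ((ArithmeticFunction.moebius l : ℤ) : ℝ) * h l else 0 := by
          refine Finset.sum_congr rfl fun m hm => ?_
          by_cases hsq : Squarefree m
          · rw [mu_sum m l hsq (Finset.mem_Icc.1 hl).1]
            split_ifs with h1
            · rw [h1]; ring
            · simp
          · have : h m = 0 := by rw [hh, hs, if_neg hsq]
            rw [this, zero_mul]
            split_ifs with h1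
            · rw [← h1, this]; simp
            · rfl
      _ = _ := by rw [Finset.sum_ite_eq' _ l, if_pos hl]
  have hrh : ∀ d, 0 < d → |r d| ≤ h d := by
    intro d hd
    have h1 : |((ArithmeticFunction.moebius d : ℤ) : ℝ)| ≤ 1 := by exact_mod_cast ArithmeticFunction.abs_moebius_le_one
    have h2 : 0 ≤ ∑ m ∈ Finset.Icc 1 R with d ∣ m, h m := Finset.sum_nonneg fun m _ => hh0 m
    have h3 : ∑ m ∈ Finset.Icc 1 R with d ∣ m, h m ≤ h d * G := hs_dvd R d hd
    simp only [hr]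
    rw [abs_div, abs_mul, abs_of_pos hG0, abs_of_nonneg h2, div_le_iff₀ hG0]
    calc _ ≤ 1 * (h d * G) := by gcongr
      _ = _ := one_mul _
  refine ⟨fun d => d * r d, ?_, ?_, ?_, ?_⟩
  · simp [hr, ← hG, hG0.ne']
  · rw [lcm_form]; exact Finset.sum_nonneg fun l _ => by positivity
  · rw [lcm_form]
    have h3 : ∑ l ∈ Finset.Icc 1 R, (Nat.totient l : ℝ) * (∑ d ∈ Finset.Icc 1 R with l ∣ d, r d)^2 ≤ ∑ l ∈ Finset.Icc 1 R, h l / G^2 := by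
      refine Finset.sum_le_sum fun l hl => ?_
      rw [hy l hl]
      have h1 : |((ArithmeticFunction.moebius l : ℤ) : ℝ)| ≤ 1 := by exact_mod_cast ArithmeticFunction.abs_moebius_le_one
      have h4 := hs_tot (Finset.mem_Icc.1 hl).1
      rw [div_pow, mul_pow, ← mul_div_assoc]
      gcongr
      have := (sq_le_one_iff_abs_le_one _).2 h1
      have hp : (0:ℝ) ≤ Nat.totient l * (h l)^2 := by positivity
      nlinarith only [h4, this, hp]
    refine h3.trans ?_
    rw [← Finset.sum_div, ← hG, div_le_div_iff₀ (by positivity) hlog]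
    nlinarith
  · have e1 : ∀ d : ℕ, |(d:ℝ) * r d| = d * |r d| := fun d => by rw [abs_mul, Nat.abs_cast]
    simp only [e1]
    rw [lcm_form]
    calc ∑ l ∈ Finset.Icc 1 R, (Nat.totient l : ℝ) * (∑ d ∈ Finset.Icc 1 R with l ∣ d, |r d|)^2 ≤ ∑ l ∈ Finset.Icc 1 R, h l * G^2 := by
          refine Finset.sum_le_sum fun l hl => ?_
          have hl0 := (Finset.mem_Icc.1 hl).1
          have e2 : ∑ d ∈ Finset.Icc 1 R with l ∣ d, |r d| ≤ h l * G := by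
            refine le_trans (Finset.sum_le_sum fun d hd => hrh d ?_) (hs_dvd R l hl0)
            exact (Finset.mem_Icc.1 (Finset.mem_filter.1 hd).1).1
          calc _ ≤ (Nat.totient l : ℝ) * (h l * G)^2 := by
                gcongr
            _ = ((Nat.totient l : ℝ) * (h l)^2) * G^2 := by ring
            _ ≤ _ := by gcongr; exact hs_tot hl0
      _ = G^3 := by rw [← Finset.sum_mul, ← hG]; ring
      _ ≤ (Real.exp (2 * ps 1 R))^3 := by gcongr; exact hs_upper R
      _ = _ := by rw [← Real.exp_nat_mul]; congr 1; push_cast; ring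

lemma dvd_reindex (x y : ℝ) {D : ℕ} (hD : 1 ≤ D) (g : ℕ → ℂ) :
    ∑ n ∈ Finset.Ioc ⌊x⌋₊ ⌊y⌋₊ with D ∣ n, g n = ∑ m ∈ Finset.Ioc ⌊x/D⌋₊ ⌊y/D⌋₊, g (D * m) := by
  rw [Nat.floor_div_natCast, Nat.floor_div_natCast]
  symm
  refine Finset.sum_bij (fun m _ => D * m) ?_ ?_ ?_ ?_
  · intro m hm
    simp only [Finset.mem_Ioc, Finset.mem_filter] at hm ⊢
    refine ⟨⟨?_, ?_⟩, dvd_mul_right _ _⟩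
    · rw [mul_comm]; exact (Nat.div_lt_iff_lt_mul hD).1 hm.1
    · rw [mul_comm]; exact (Nat.le_div_iff_mul_le hD).1 hm.2
  · intro a _ b _ h; exact Nat.eq_of_mul_eq_mul_left hD h
  · rintro n hn
    simp only [Finset.mem_Ioc, Finset.mem_filter] at hn
    obtain ⟨⟨h1, h2⟩, m, rfl⟩ := hn
    refine ⟨m, ?_, rfl⟩
    rw [Finset.mem_Ioc, Nat.div_lt_iff_lt_mul hD, Nat.le_div_iff_mul_le hD, mul_comm m]
    exact ⟨h1, h2⟩
  · intro _ _; rfl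

lemma G1 (A : ℝ) (hA : 1 ≤ A) : ∃ c : ℝ, 0 < c ∧ ∃ C : ℝ, 1 ≤ C ∧ ∀ (x y u : ℝ) (D : ℕ), 1 ≤ x → x ≤ y → y ≤ 8*x → 1 ≤ D → (D:ℝ) ≤ x^(1/2:ℝ) → |u| ≤ x^A →
    ‖∑ n ∈ Finset.Ioc ⌊x⌋₊ ⌊y⌋₊ with D ∣ n, ee (u*Real.log n)/(n:ℂ) - (1/D:ℂ) * JJ u (Real.log x) (Real.log y)‖ ≤ (1/D:ℝ) * (C * x^(-c)) := by
  obtain ⟨c, hc0, hc1, C, hC, hG⟩ := G0 (2*A) (by linarith)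
  refine ⟨c/2, by linarith, C, hC, fun x y u D hx hxy hy hD hDx hu => ?_⟩
  have hx0 : 0 < x := by linarith
  have hD0 : (0:ℝ) < D := by exact_mod_cast hD
  have hxD : x^(1/2:ℝ) ≤ x / D := by
    rw [le_div_iff₀ hD0]
    calc x^(1/2:ℝ) * D ≤ x^(1/2:ℝ) * x^(1/2:ℝ) := by gcongr
      _ = x := by rw [← Real.rpow_add hx0]; norm_num
  have h1 : (1:ℝ) ≤ x / D := (Real.one_le_rpow hx (by norm_num)).trans hxD
  have h := hG (x/D) (y/D) u 1 h1 (by gcongr) (by rw [← mul_div_assoc]; gcongr) le_rfl (by simpa using Real.one_le_rpow h1 (by norm_num)) (by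
    refine hu.trans ?_
    calc x^A = (x^(1/2:ℝ))^(2*A) := by rw [← Real.rpow_mul hx0.le]; congr 1; ring
      _ ≤ _ := by gcongr)
  rw [dvd_reindex x y hD]
  simp only [one_dvd, Finset.filter_true, Nat.cast_one, div_one, one_mul] at h
  have e1 : ∑ m ∈ Finset.Ioc ⌊x/D⌋₊ ⌊y/D⌋₊, ee (u*Real.log ((D*m : ℕ):ℝ))/((D*m : ℕ):ℂ) = (1/D:ℂ) * (ee (u * Real.log D) * ∑ m ∈ Finset.Ioc ⌊x/D⌋₊ ⌊y/D⌋₊, ee (u*Real.log m)/(m:ℂ)) := by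
    rw [Finset.mul_sum, Finset.mul_sum]
    refine Finset.sum_congr rfl fun m hm => ?_
    have hm0 : (0:ℝ) < m := by exact_mod_cast lt_of_le_of_lt (Nat.zero_le _) (Finset.mem_Ioc.1 hm).1
    push_cast
    rw [Real.log_mul hD0.ne' hm0.ne', mul_add, ee_add]
    field_simp
  have e2 : JJ u (Real.log x) (Real.log y) = ee (u * Real.log D) * JJ u (Real.log (x/D)) (Real.log (y/D)) := by
    have := JJ_shift u (Real.log (x/D)) (Real.log (y/D)) (Real.log D)
    rw [this, Real.log_div hx0.ne' hD0.ne', Real.log_div (by linarith only [hc0, hc1, hx, hxy]) hD0.ne']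
    congr 1 <;> ring
  rw [e1, e2, ← mul_sub, ← mul_sub, norm_mul, norm_mul, norm_ee, one_mul]
  have e3 : ‖(1/D:ℂ)‖ = 1/D := by simp
  rw [e3]
  gcongr
  refine h.trans ?_
  gcongr
  calc (x/D)^(-c) ≤ (x^(1/2:ℝ))^(-c) := Real.rpow_le_rpow_of_nonpos (by positivity) hxD (by linarith only [hc0])
    _ = _ := by rw [← Real.rpow_mul hx0.le]; congr 1; ring

lemma block (A : ℝ) (hA : 1 ≤ A) : ∃ c : ℝ, 0 < c ∧ ∃ x0 : ℝ, 1 < x0 ∧ ∀ (x y u : ℝ) (K : ℕ) (β : ℕ → ℂ), x0 ≤ x → x ≤ y → y ≤ 8 * x →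
    (∀ k, ‖β k‖ ≤ 1) → u ≠ 0 → K * |u| ≤ x^A →
    ∑ p ∈ Finset.Ioc ⌊x⌋₊ ⌊y⌋₊ with p.Prime, (1/p:ℝ) * ‖∑ k ∈ Finset.range K, β k * ee (-(k*u) * Real.log p)‖^2
      ≤ 32 / Real.log x * (K * (Real.log y - Real.log x) + 2 * K^2 / |u|) + K^2 * x^(-c) := by
  obtain ⟨c, hc0, C, hC, hG⟩ := G1 A hA
  have hpoly : ∀ᶠ x : ℝ in atTop, C * Real.exp (6 * (17 * (1 + Real.log (Real.log x)))) ≤ x^(c/2) := by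
    have h1 : (fun x:ℝ => Real.log x) =o[atTop] (fun x:ℝ => x^(c/2/102)) := isLittleO_log_rpow_atTop (by positivity)
    filter_upwards [h1.def (show (0:ℝ) < 1/(C * Real.exp 102) by positivity), eventually_gt_atTop 3] with x hx h3
    have hlx : 1 ≤ Real.log x := by
      rw [Real.le_log_iff_exp_le (by linarith)]; linarith [Real.exp_one_lt_d9]
    rw [Real.norm_of_nonneg (by linarith), Real.norm_of_nonneg (by positivity)] at hx
    have e1 : Real.exp (6 * (17 * (1 + Real.log (Real.log x)))) = Real.exp 102 * Real.log x ^ 102 := by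
      rw [← Real.exp_log (show 0 < Real.log x by linarith), ← Real.exp_nat_mul, ← Real.exp_add, Real.log_exp]
      congr 1; push_cast; ring
    have hK1 : 1 ≤ C * Real.exp 102 := by nlinarith [Real.one_le_exp (show (0:ℝ) ≤ 102 by norm_num)]
    rw [e1, ← mul_assoc]
    calc C * Real.exp 102 * Real.log x^102 ≤ C * Real.exp 102 * (1/(C * Real.exp 102) * x^(c/2/102))^102 := by gcongr
      _ = (C * Real.exp 102) * (1/(C * Real.exp 102))^102 * x^(c/2) := by
        rw [mul_pow, ← Real.rpow_natCast (x^(c/2/102)), ← Real.rpow_mul (by linarith)]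
        rw [show c/2/102*((102:ℕ):ℝ) = c/2 by push_cast; ring]; ring
      _ ≤ 1 * x^(c/2) := by
        gcongr
        rw [one_div, inv_pow, ← div_eq_mul_inv, div_le_one (by positivity)]
        exact le_self_pow₀ hK1 (by norm_num)
      _ = _ := one_mul _
  obtain ⟨x0, hx0'⟩ := eventually_atTop.1 hpoly
  refine ⟨c/2, by linarith, max x0 (3^16), lt_of_lt_of_le (by norm_num) (le_max_right _ _), ?_⟩
  intro x y u K β hxx0 hxy hy hβ hu hKu
  have hx316 : (3:ℝ)^16 ≤ x := (le_max_right _ _).trans hxx0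
  have hx : 1 < x := lt_of_lt_of_le (by norm_num) hx316
  have hx0 : 0 < x := by linarith
  have hlx : 0 < Real.log x := Real.log_pos hx
  have hlxy : Real.log x ≤ Real.log y := Real.log_le_log hx0 hxy
  set R := ⌊x^(1/16:ℝ)⌋₊ with hR
  have hR3 : 3 ≤ R := Nat.le_floor (by
    calc ((3:ℕ):ℝ) = ((3:ℝ)^16)^(1/16:ℝ) := by rw [← Real.rpow_natCast, ← Real.rpow_mul (by norm_num)]; norm_num
      _ ≤ _ := by gcongr)
  have hR1 : 1 ≤ R := by omega
  have hRx : (R:ℝ) ≤ x^(1/16:ℝ) := Nat.floor_le (by positivity)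
  have hRx' : x^(1/16:ℝ) < R + 1 := Nat.lt_floor_add_one _
  have hRx1 : x^(1/16:ℝ) ≤ x := by
    calc x^(1/16:ℝ) ≤ x^(1:ℝ) := Real.rpow_le_rpow_of_exponent_le hx.le (by norm_num)
      _ = x := Real.rpow_one x
  obtain ⟨w, hw1, hV0, hV, hw2⟩ := selberg R hR1
  set V := ∑ d ∈ Finset.Icc 1 R, ∑ e ∈ Finset.Icc 1 R, w d * w e / (Nat.lcm d e : ℝ) with hVdef
  have hV' : V ≤ 32 / Real.log x := by
    refine hV.trans ?_
    have : 1/16 * Real.log x ≤ Real.log (R+1) := by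
      rw [← Real.log_rpow hx0]; exact Real.log_le_log (by positivity) hRx'.le
    calc 2 / Real.log (R+1) ≤ 2 / (1/16 * Real.log x) := by gcongr
      _ = _ := by field_simp; norm_num
  set S : ℕ → ℂ := fun n => ∑ k ∈ Finset.range K, β k * ee (-(k*u) * Real.log n) with hS
  set nu : ℕ → ℝ := fun n => ∑ d ∈ Finset.Icc 1 R, (if d ∣ n then w d else 0) with hnu
  have h1 : ∑ p ∈ Finset.Ioc ⌊x⌋₊ ⌊y⌋₊ with p.Prime, (1/p:ℝ) * ‖S p‖^2 ≤ ∑ n ∈ Finset.Ioc ⌊x⌋₊ ⌊y⌋₊, nu n ^2 * ((1/n:ℝ) * ‖S n‖^2) := by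
    rw [Finset.sum_filter]
    refine Finset.sum_le_sum fun p hp => ?_
    split_ifs with hpp
    · have : nu p = 1 := by
        simp only [hnu]
        rw [Finset.sum_eq_single_of_mem 1 (Finset.mem_Icc.2 ⟨le_rfl, hR1⟩)]
        · simp [hw1]
        · intro d hd hd1
          rw [if_neg]
          intro hdp
          rcases (Nat.dvd_prime hpp).1 hdp with h | h
          · exact hd1 h
          · have h3 : R ≤ ⌊x⌋₊ := Nat.floor_le_floor hRx1
            have := (Finset.mem_Icc.1 hd).2
            have := (Finset.mem_Ioc.1 hp).1
            omega
      rw [this]; simp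
    · positivity
  refine h1.trans ?_
  set E : ℕ → ℕ → ℂ := fun k l => ∑ d ∈ Finset.Icc 1 R, ∑ e ∈ Finset.Icc 1 R, ((w d : ℂ) * w e) * ∑ n ∈ Finset.Ioc ⌊x⌋₊ ⌊y⌋₊ with Nat.lcm d e ∣ n, ee (((l:ℝ)-k)*u * Real.log n)/(n:ℂ) with hE
  have h2 : ((∑ n ∈ Finset.Ioc ⌊x⌋₊ ⌊y⌋₊, nu n ^2 * ((1/n:ℝ) * ‖S n‖^2) : ℝ) : ℂ) = ∑ k ∈ Finset.range K, ∑ l ∈ Finset.range K, β k * (starRingEnd ℂ) (β l) * E k l := by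
    have e1 : ∀ n : ℕ, ((nu n ^2 * ((1/n:ℝ) * ‖S n‖^2) : ℝ) : ℂ) = ∑ k ∈ Finset.range K, ∑ l ∈ Finset.range K, ∑ d ∈ Finset.Icc 1 R, ∑ e ∈ Finset.Icc 1 R,
        β k * (starRingEnd ℂ) (β l) * (((w d : ℂ) * w e) * if Nat.lcm d e ∣ n then ee (((l:ℝ)-k)*u * Real.log n)/(n:ℂ) else 0) := by
      intro n
      have e2 : ((nu n ^2 : ℝ) : ℂ) = ∑ d ∈ Finset.Icc 1 R, ∑ e ∈ Finset.Icc 1 R, ((w d : ℂ) * w e) * if Nat.lcm d e ∣ n then 1 else 0 := by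
        simp only [hnu, sq, Finset.sum_mul_sum]
        push_cast
        refine Finset.sum_congr rfl fun d _ => Finset.sum_congr rfl fun e _ => ?_
        by_cases ha : d ∣ n <;> by_cases hb : e ∣ n <;> simp [ha, hb, Nat.lcm_dvd_iff]
      have e3 : ((‖S n‖^2 : ℝ) : ℂ) = ∑ k ∈ Finset.range K, ∑ l ∈ Finset.range K, β k * (starRingEnd ℂ) (β l) * ee (((l:ℝ)-k)*u * Real.log n) := by
        push_cast
        rw [← Complex.mul_conj', hS, map_sum, Finset.sum_mul_sum]
        refine Finset.sum_congr rfl fun k _ => Finset.sum_congr rfl fun l _ => ?_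
        rw [map_mul, ee_conj, mul_mul_mul_comm, ← ee_add]
        congr 2; ring
      rw [Complex.ofReal_mul, e2, Complex.ofReal_mul, e3]
      push_cast
      rw [← mul_assoc, mul_comm]
      simp_rw [Finset.sum_mul, Finset.mul_sum]
      refine Finset.sum_congr rfl fun k _ => Finset.sum_congr rfl fun l _ => Finset.sum_congr rfl fun d _ => Finset.sum_congr rfl fun e _ => ?_
      split_ifs <;> ring
    rw [Complex.ofReal_sum, Finset.sum_congr rfl fun n _ => e1 n]
    simp only [hE, Finset.sum_filter, Finset.mul_sum]
    rw [Finset.sum_comm]; refine Finset.sum_congr rfl fun k _ => ?_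
    rw [Finset.sum_comm]; refine Finset.sum_congr rfl fun l _ => ?_
    rw [Finset.sum_comm]; refine Finset.sum_congr rfl fun d _ => ?_
    rw [Finset.sum_comm]
  have hR2 : Real.exp (6 * ps 1 R) * (C * x^(-c)) ≤ x^(-(c/2)) := by
    have e1 : ps 1 R ≤ 17 * (1 + Real.log (Real.log x)) :=
      (ps_mono (hRx.trans hRx1)).trans (ps_S (by linarith only [hx316, show (3:ℝ) ≤ 3^16 by norm_num]))
    calc _ ≤ Real.exp (6 * (17 * (1 + Real.log (Real.log x)))) * (C * x^(-c)) := by gcongr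
      _ = (C * Real.exp (6 * (17 * (1 + Real.log (Real.log x))))) * x^(-c) := by ring
      _ ≤ x^(c/2) * x^(-c) := by gcongr; exact hx0' x ((le_max_left _ _).trans hxx0)
      _ = x^(-(c/2)) := by rw [← Real.rpow_add hx0]; congr 1; ring
  have h3 : ∀ k ∈ Finset.range K, ∀ l ∈ Finset.range K, ‖E k l - V * JJ (((l:ℝ)-k)*u) (Real.log x) (Real.log y)‖ ≤ x^(-(c/2)) := by
    intro k hk l hl
    have e1 : E k l - V * JJ (((l:ℝ)-k)*u) (Real.log x) (Real.log y) = ∑ d ∈ Finset.Icc 1 R, ∑ e ∈ Finset.Icc 1 R, ((w d : ℂ) * w e) *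
      (∑ n ∈ Finset.Ioc ⌊x⌋₊ ⌊y⌋₊ with Nat.lcm d e ∣ n, ee (((l:ℝ)-k)*u * Real.log n)/(n:ℂ) - (1/(Nat.lcm d e : ℕ):ℂ) * JJ (((l:ℝ)-k)*u) (Real.log x) (Real.log y)) := by
      simp only [hE, hVdef, mul_sub, Finset.sum_sub_distrib]
      congr 1
      push_cast
      simp_rw [Finset.sum_mul]
      refine Finset.sum_congr rfl fun d _ => Finset.sum_congr rfl fun e _ => ?_
      ring
    rw [e1]
    have e2 : ∀ d ∈ Finset.Icc 1 R, ∀ e ∈ Finset.Icc 1 R, ‖((w d : ℂ) * w e) *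
      (∑ n ∈ Finset.Ioc ⌊x⌋₊ ⌊y⌋₊ with Nat.lcm d e ∣ n, ee (((l:ℝ)-k)*u * Real.log n)/(n:ℂ) - (1/(Nat.lcm d e : ℕ):ℂ) * JJ (((l:ℝ)-k)*u) (Real.log x) (Real.log y))‖ ≤ |w d| * |w e| / (Nat.lcm d e : ℝ) * (C * x^(-c)) := by
      intro d hd e he
      rw [norm_mul, norm_mul, Complex.norm_real, Complex.norm_real, div_eq_mul_one_div (|w d| * |w e|), mul_assoc (|w d| * |w e|)]
      have hd1 := Finset.mem_Icc.1 hd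
      have he1 := Finset.mem_Icc.1 he
      refine mul_le_mul_of_nonneg_left ?_ (by positivity)
      · refine hG x y _ _ hx.le hxy hy (Nat.lcm_pos hd1.1 he1.1) ?_ ?_
        · calc ((Nat.lcm d e : ℕ):ℝ) ≤ (R:ℝ) * R := by
                exact_mod_cast (Nat.le_of_dvd (Nat.mul_pos hd1.1 he1.1) (Nat.lcm_dvd_mul d e)).trans (Nat.mul_le_mul hd1.2 he1.2)
            _ ≤ x^(1/16:ℝ) * x^(1/16:ℝ) := by gcongr
            _ = x^(1/16+1/16:ℝ) := (Real.rpow_add hx0 _ _).symm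
            _ ≤ _ := Real.rpow_le_rpow_of_exponent_le hx.le (by norm_num)
        · rw [abs_mul]
          refine le_trans ?_ hKu
          gcongr
          have h4 : (k:ℝ) < K := by exact_mod_cast Finset.mem_range.1 hk
          have h5 : (l:ℝ) < K := by exact_mod_cast Finset.mem_range.1 hl
          have h6 : (0:ℝ) ≤ k := by positivity
          have h7 : (0:ℝ) ≤ l := by positivity
          rw [abs_le]; constructor <;> linarith only [h4, h5]
    refine (norm_sum_le_of_le _ fun d hd => norm_sum_le_of_le _ (e2 d hd)).trans ?_
    simp only [← Finset.sum_mul]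
    refine le_trans ?_ hR2
    gcongr
  have h4 : ∀ k ∈ Finset.range K, ∀ l ∈ Finset.range K, ‖β k * (starRingEnd ℂ) (β l) * E k l‖ ≤ (V * (if k = l then (Real.log y - Real.log x) else 0) + V * (2/|u|)) + x^(-(c/2)) := by
    intro k hk l hl
    rw [norm_mul, norm_mul, RCLike.norm_conj]
    have e1 : ‖JJ (((l:ℝ)-k)*u) (Real.log x) (Real.log y)‖ ≤ (if k = l then (Real.log y - Real.log x) else 0) + 2/|u| := by
      split_ifs with hkl
      · refine (norm_JJ_le _ _ _).trans ?_
        rw [abs_of_nonneg (by linarith only [hlxy])]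
        have : 0 ≤ 2/|u| := by positivity
        linarith only [this]
      · rw [zero_add]
        have hlk : (1:ℝ) ≤ |(l:ℝ)-k| := by
          have : (1:ℤ) ≤ |(l:ℤ)-k| := Int.one_le_abs (by omega)
          exact_mod_cast this
        refine (norm_JJ_le' _ _ _ (mul_ne_zero (by rintro h; rw [h] at hlk; norm_num at hlk) hu)).trans ?_
        rw [abs_mul]
        have : 0 < |u| := abs_pos.2 hu
        gcongr
        nlinarith only [hlk, this]
    have e2 : ‖E k l‖ ≤ x^(-(c/2)) + V * ((if k = l then (Real.log y - Real.log x) else 0) + 2/|u|) := by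
      have := norm_le_norm_sub_add (E k l) (V * JJ (((l:ℝ)-k)*u) (Real.log x) (Real.log y))
      refine this.trans (add_le_add (h3 k hk l hl) ?_)
      rw [norm_mul, Complex.norm_real, Real.norm_of_nonneg hV0]
      gcongr
    calc _ ≤ 1 * 1 * ‖E k l‖ := by gcongr <;> exact hβ _
      _ ≤ _ := by linarith only [e2]
  have h5 : (∑ n ∈ Finset.Ioc ⌊x⌋₊ ⌊y⌋₊, nu n ^2 * ((1/n:ℝ) * ‖S n‖^2)) ≤ ∑ k ∈ Finset.range K, ∑ l ∈ Finset.range K, ((V * (if k = l then (Real.log y - Real.log x) else 0) + V * (2/|u|)) + x^(-(c/2))) := by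
    refine le_trans (Real.le_norm_self _) ?_
    rw [← Complex.norm_real, h2]
    exact norm_sum_le_of_le _ fun k hk => norm_sum_le_of_le _ (h4 k hk)
  refine h5.trans ?_
  simp only [Finset.sum_add_distrib, ← Finset.mul_sum, Finset.sum_ite_eq, Finset.sum_const, Finset.card_range, nsmul_eq_mul]
  have h6 : ∑ k ∈ Finset.range K, (if k ∈ Finset.range K then (Real.log y - Real.log x) else 0) = K * (Real.log y - Real.log x) := by
    rw [Finset.sum_congr rfl fun k hk => if_pos hk]; simp; ring
  rw [h6]
  have h7 : V * (K * (Real.log y - Real.log x) + 2 * K^2 / |u|) ≤ 32 / Real.log x * (K * (Real.log y - Real.log x) + 2 * K^2 / |u|) := by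
    have : 0 ≤ (K:ℝ) * (Real.log y - Real.log x) := mul_nonneg (by positivity) (by linarith only [hlxy])
    gcongr
  calc _ = V * (K * (Real.log y - Real.log x) + 2 * K^2 / |u|) + K^2 * x^(-(c/2)) := by ring
    _ ≤ _ := by gcongr
end MR

namespace MR
open MeasureTheory

noncomputable def vv (H p : ℕ) : ℕ := ⌈(H:ℝ) * Real.log p⌉₊ - 1

lemma vv_bd {H p : ℕ} (hH : 1 ≤ H) (hp : 2 ≤ p) : (vv H p : ℝ) < H * Real.log p ∧ H * Real.log p ≤ vv H p + 1 := by
  have hl : 0 < (H:ℝ) * Real.log p := mul_pos (by exact_mod_cast hH) (Real.log_pos (by exact_mod_cast hp))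
  have h1 : 1 ≤ ⌈(H:ℝ) * Real.log p⌉₊ := Nat.one_le_ceil_iff.2 hl
  have h2 := Nat.ceil_lt_add_one hl.le
  have h3 := Nat.le_ceil ((H:ℝ) * Real.log p)
  rw [vv, Nat.cast_sub h1]; push_cast; constructor <;> linarith

noncomputable def xv (H v : ℕ) : ℝ := Real.exp ((v:ℝ)/H)

lemma xv_pos (H v : ℕ) : 0 < xv H v := Real.exp_pos _
lemma xv_mono (H : ℕ) : Monotone (xv H) := fun a b h => Real.exp_le_exp.2 (by gcongr)
lemma log_xv (H v : ℕ) : Real.log (xv H v) = v/H := Real.log_exp _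
lemma xv_mul (H v k : ℕ) : xv H (v * k) = (xv H v)^k := by rw [xv, xv, ← Real.exp_nat_mul]; congr 1; push_cast; ring
lemma one_le_xv (H v : ℕ) : 1 ≤ xv H v := Real.one_le_exp (by positivity)

lemma vv_eq {H p v : ℕ} (hH : 1 ≤ H) (hp : p ∈ Finset.Ioc ⌊xv H v⌋₊ ⌊xv H (v+1)⌋₊) : vv H p = v := by
  rw [Finset.mem_Ioc, Nat.floor_lt (xv_pos _ _).le, Nat.le_floor_iff (xv_pos _ _).le] at hp
  have hp1 : (1:ℝ) < p := (one_le_xv H v).trans_lt hp.1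
  have hH0 : (0:ℝ) < H := by exact_mod_cast hH
  have h1 : (v:ℝ) < H * Real.log p := by
    have := Real.log_lt_log (xv_pos _ _) hp.1
    rw [log_xv, div_lt_iff₀ hH0] at this; linarith
  have h2 : H * Real.log p ≤ v + 1 := by
    have := Real.log_le_log (by linarith) hp.2
    rw [log_xv, le_div_iff₀ hH0] at this; push_cast at this; linarith
  have h3 : ⌈(H:ℝ) * Real.log p⌉₊ = v + 1 := by
    apply le_antisymm
    · exact Nat.ceil_le.2 (by push_cast; exact h2)
    · exact Nat.lt_ceil.2 h1
  rw [vv, h3]; rfl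

lemma sum_blocks (m : ℕ → ℕ) (hm : Monotone m) (a k : ℕ) (f : ℕ → ℝ) :
    ∑ n ∈ Finset.Ioc (m a) (m (a+k)), f n = ∑ i ∈ Finset.range k, ∑ n ∈ Finset.Ioc (m (a+i)) (m (a+i+1)), f n := by
  induction k with
  | zero => simp
  | succ k ih =>
    rw [Finset.sum_range_succ, ← ih, ← Finset.sum_Ioc_consecutive f (hm (Nat.le_add_right a k)) (hm (show a+k ≤ a+(k+1) by omega))]
    rfl

lemma piece (A : ℝ) (hA : 1 ≤ A) (K H : ℕ) (hK : 1 ≤ K) (hH : 1 ≤ H) : ∃ (v1 : ℕ) (T0 : ℝ), 1 ≤ T0 ∧ ∀ v0, v1 ≤ v0 → ∀ u : ℝ, T0 ≤ |u| → K * |u| ≤ (xv H v0)^A →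
    ∀ β : ℕ → ℕ → ℂ, (∀ v k, ‖β v k‖ ≤ 1) →
    ∑ p ∈ Finset.Ioc ⌊xv H v0⌋₊ ⌊(xv H v0)^2⌋₊ with p.Prime, (1/p:ℝ) * ‖∑ k ∈ Finset.range K, β (vv H p) k * ee (-(k*u) * Real.log p)‖^2 ≤ 33 * (K:ℝ) := by
  obtain ⟨c, hc, x0, hx0, hb⟩ := block A hA
  have hH0 : (0:ℝ) < H := by exact_mod_cast hH
  have hK0 : (1:ℝ) ≤ K := by exact_mod_cast hK
  have ht : Tendsto (fun v : ℕ => (K:ℝ)^2 * ((v:ℝ) * Real.exp (-(c/H) * v))) atTop (𝓝 ((K:ℝ)^2 * 0)) := by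
    apply Tendsto.const_mul
    have h1 := (Real.tendsto_pow_mul_exp_neg_atTop_nhds_zero 1).comp ((tendsto_id.const_mul_atTop (show 0 < c/H by positivity)).comp tendsto_natCast_atTop_atTop)
    have h2 := h1.const_mul (H/c:ℝ)
    rw [mul_zero] at h2
    refine h2.congr fun v => ?_
    simp only [Function.comp, id, pow_one]
    rw [neg_mul]; field_simp
  rw [mul_zero] at ht
  have hxt : Tendsto (fun v : ℕ => xv H v) atTop atTop :=
    Real.tendsto_exp_atTop.comp (tendsto_natCast_atTop_atTop.atTop_div_const hH0)
  obtain ⟨v1, hv1⟩ := eventually_atTop.1 ((ht.eventually_le_const (show (0:ℝ) < 1/2 by norm_num)).and ((hxt.eventually_ge_atTop x0).and (eventually_ge_atTop 1)))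
  refine ⟨v1, 128 * K^2 * H + 1, by linarith [show (0:ℝ) ≤ 128 * K^2 * H by positivity], fun v0 hv0 u hu hKu β hβ => ?_⟩
  obtain ⟨h1, h2, h3⟩ := hv1 v0 hv0
  have hv0' : (0:ℝ) < v0 := by exact_mod_cast h3
  have hu0 : 0 < |u| := by linarith [show (0:ℝ) ≤ 128 * K^2 * H by positivity]
  rw [← xv_mul, mul_two, Finset.sum_filter]
  rw [sum_blocks (fun v => ⌊xv H v⌋₊) (fun a b h => Nat.floor_le_floor (xv_mono H h))]
  have key : ∀ i ∈ Finset.range v0, (∑ p ∈ Finset.Ioc ⌊xv H (v0+i)⌋₊ ⌊xv H (v0+i+1)⌋₊, if p.Prime then (1/p:ℝ) * ‖∑ k ∈ Finset.range K, β (vv H p) k * ee (-(k*u) * Real.log p)‖^2 else 0)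
      ≤ 32 * H / v0 * (K * (1/H) + 2 * K^2 / |u|) + K^2 * Real.exp (-(c/H) * v0) := by
    intro i _
    have hm : xv H v0 ≤ xv H (v0+i) := xv_mono H (by omega)
    have e1 := hb (xv H (v0+i)) (xv H (v0+i+1)) u K (β (v0+i)) (h2.trans hm) (xv_mono H (by omega)) (by
      rw [xv, xv, ← Real.exp_log (show (0:ℝ) < 8 by norm_num), ← Real.exp_add, Real.exp_le_exp]
      have h8 : (1:ℝ) ≤ Real.log 8 := by
        rw [Real.le_log_iff_exp_le (by norm_num)]; linarith [Real.exp_one_lt_d9]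
      push_cast
      rw [add_div]
      have : (1:ℝ)/H ≤ 1 := by rw [div_le_one hH0]; exact_mod_cast hH
      linarith) (hβ _) (abs_pos.1 hu0) (hKu.trans (by have := xv_pos H v0; gcongr))
    rw [Finset.sum_filter] at e1
    rw [Finset.sum_congr rfl fun p hp => by rw [vv_eq hH hp]]
    refine e1.trans ?_
    have e2 : Real.log (xv H (v0+i+1)) - Real.log (xv H (v0+i)) = 1/H := by
      rw [log_xv, log_xv]; push_cast; ring
    rw [e2, log_xv]
    have e4 : 32 / (((v0+i:ℕ):ℝ)/H) ≤ 32 * H / v0 := by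
      rw [div_div_eq_mul_div]; gcongr; omega
    have e5 : xv H (v0+i) ^ (-c) ≤ Real.exp (-(c/H) * v0) := by
      calc xv H (v0+i) ^ (-c) ≤ xv H v0 ^ (-c) := Real.rpow_le_rpow_of_nonpos (xv_pos _ _) hm (by linarith)
        _ = Real.exp (-(c/H) * v0) := by
          rw [xv, ← Real.exp_mul]; congr 1; ring
    exact add_le_add (mul_le_mul_of_nonneg_right e4 (by positivity)) (mul_le_mul_of_nonneg_left e5 (by positivity))
  refine (Finset.sum_le_sum key).trans ?_
  rw [Finset.sum_const, Finset.card_range, nsmul_eq_mul]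
  have e3 : 64 * K^2 * H / |u| ≤ 1/2 := by
    rw [div_le_iff₀ hu0]; linarith
  calc (v0:ℝ) * (32 * H / v0 * (K * (1/H) + 2 * K^2 / |u|) + K^2 * Real.exp (-(c/H) * v0))
      = 32 * (K:ℝ) + 64 * K^2 * H / |u| + K^2 * (v0 * Real.exp (-(c/H) * v0)) := by
        have : (v0:ℝ) * (32 * H / v0 * (K * (1/H) + 2 * K^2 / |u|)) = 32 * (K:ℝ) + 64 * K^2 * H / |u| := by
          field_simp; ring
        rw [mul_add, this]; ring
    _ ≤ 33 * (K:ℝ) := by linarith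

lemma unit_w (a b : ℂ) : ∃ w : ℂ, ‖w‖ = 1 ∧ ∀ z : ℂ, ‖z‖ = 1 → ‖z - w‖ * ‖a‖ ≤ 2 * ‖a + z * b‖ := by
  have key : ∀ c : ℂ, ∃ w : ℂ, ‖w‖ = 1 ∧ c = w * ‖c‖ := fun c => by
    by_cases h : c = 0
    · exact ⟨1, by simp, by simp [h]⟩
    · have : ‖c‖ ≠ 0 := norm_ne_zero_iff.2 h
      exact ⟨c / ‖c‖, by simp [this], (div_mul_cancel₀ c (by exact_mod_cast this)).symm⟩
  obtain ⟨w1, h1, ha⟩ := key a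
  obtain ⟨w2, h2, hb⟩ := key b
  refine ⟨-(w1 * (starRingEnd ℂ) w2), by simp [h1, h2], fun z hz => ?_⟩
  set w := -(w1 * (starRingEnd ℂ) w2) with hw
  have hw2 : w2 * (starRingEnd ℂ) w2 = 1 := by rw [Complex.mul_conj', h2]; simp
  have e1 : ‖a + z * b‖ = ‖z * ‖b‖ - w * ‖a‖‖ := by
    have : a + z * b = w2 * (z * ‖b‖ - w * ‖a‖) := by
      conv_lhs => rw [ha, hb]
      rw [hw]; linear_combination (w1 * ‖a‖) * (-hw2)
    rw [this, norm_mul, h2, one_mul]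
  have hwn : ‖w‖ = 1 := by simp [hw, h1, h2]
  have e2 : ‖z - w‖ * ‖a‖ = ‖z * (‖a‖ - ‖b‖ : ℝ) + (z * ‖b‖ - w * ‖a‖)‖ := by
    rw [← norm_norm a, ← Complex.norm_real, ← norm_mul]; congr 1; push_cast; simp; ring
  have e3 : |‖a‖ - ‖b‖| ≤ ‖z * ‖b‖ - w * ‖a‖‖ := by
    have := abs_norm_sub_norm_le (z * (‖b‖:ℂ)) (w * ‖a‖)
    rw [norm_mul, norm_mul, hz, hwn, Complex.norm_real, Complex.norm_real, norm_norm, norm_norm, one_mul, one_mul, abs_sub_comm] at this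
    exact this
  rw [e2, e1]
  refine (norm_add_le _ _).trans ?_
  rw [norm_mul, hz, Complex.norm_real, one_mul, Real.norm_eq_abs]; linarith

lemma pow_sub_one_le (b : ℂ) (hb : ‖b‖ = 1) (k : ℕ) : ‖b^k - 1‖ ≤ k * ‖b - 1‖ := by
  induction k with
  | zero => simp
  | succ k ih =>
    have : b^(k+1) - 1 = b * (b^k - 1) + (b - 1) := by ring
    rw [this]; refine (norm_add_le _ _).trans ?_
    rw [norm_mul, hb, one_mul]; push_cast; linarith

lemma geo_low (z w : ℂ) (hz : ‖z‖ = 1) (hw : ‖w‖ = 1) (φ K : ℕ) :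
    (K:ℝ)^2/2 - ((K:ℝ)^2 * φ * ‖z - w‖)^2 ≤ ‖∑ k ∈ Finset.range K, (((starRingEnd ℂ) w)^φ)^k * (z^φ)^k‖^2 := by
  set b := ((starRingEnd ℂ) w * z)^φ with hb
  have hn : ‖(starRingEnd ℂ) w * z‖ = 1 := by simp [hz, hw]
  have hbn : ‖b‖ = 1 := by rw [hb, norm_pow, hn, one_pow]
  have hb1 : ‖b - 1‖ ≤ φ * ‖z - w‖ := by
    refine (pow_sub_one_le _ hn φ).trans ?_
    have : (starRingEnd ℂ) w * z - 1 = (starRingEnd ℂ) w * (z - w) := by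
      rw [mul_sub, Complex.conj_mul', hw]; simp
    rw [this, norm_mul]; simp [hw]
  have e1 : ∑ k ∈ Finset.range K, (((starRingEnd ℂ) w)^φ)^k * (z^φ)^k = ∑ k ∈ Finset.range K, b^k :=
    Finset.sum_congr rfl fun k _ => by rw [hb, ← mul_pow, ← mul_pow]
  rw [e1]
  have e2 : ‖∑ k ∈ Finset.range K, b^k - K‖ ≤ (K:ℝ)^2 * φ * ‖z - w‖ := by
    have : ∑ k ∈ Finset.range K, b^k - K = ∑ k ∈ Finset.range K, (b^k - 1) := by simp
    rw [this]
    calc _ ≤ ∑ k ∈ Finset.range K, (K:ℝ) * (φ * ‖z - w‖) := norm_sum_le_of_le _ fun k hk => by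
          refine (pow_sub_one_le b hbn k).trans ?_
          have : (k:ℝ) ≤ K := by exact_mod_cast (Finset.mem_range.1 hk).le
          gcongr
      _ = _ := by simp; ring
  have e3 : (K:ℝ) ≤ ‖∑ k ∈ Finset.range K, b^k‖ + (K:ℝ)^2 * φ * ‖z - w‖ := by
    have := norm_sub_norm_le (K:ℂ) (∑ k ∈ Finset.range K, b^k)
    rw [norm_sub_rev, Complex.norm_natCast] at this; linarith
  have e4 : (K:ℝ)^2 ≤ (‖∑ k ∈ Finset.range K, b^k‖ + (K:ℝ)^2 * φ * ‖z - w‖)^2 := by gcongr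
  nlinarith [sq_nonneg (‖∑ k ∈ Finset.range K, b^k‖ - (K:ℝ)^2 * φ * ‖z - w‖)]
end MR

namespace MR
open MeasureTheory

lemma PW (φ : ℕ) (hφ : 1 ≤ φ) : ∃ δ : ℝ, 0 < δ ∧ ∀ A : ℝ, 1 ≤ A → ∀ H : ℕ, 1 ≤ H → ∃ (v1 : ℕ) (T0 : ℝ), ∀ v0, v1 ≤ v0 → ∀ t : ℝ, T0 ≤ |t| → |t| ≤ (xv H v0)^A →
    ∀ z : ℕ → ℂ, (∀ p : ℕ, p.Prime → xv H v0 < p → ‖z p‖ = 1 ∧ (z p)^φ = ee (-(φ*t) * Real.log p)) → ∀ (a : ℂ) (b : ℕ → ℂ),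
    δ * ps (xv H v0) ((xv H v0)^2) * ‖a‖^2 ≤ ∑ p ∈ Finset.Ioc ⌊xv H v0⌋₊ ⌊(xv H v0)^2⌋₊ with p.Prime, (1/p:ℝ) * ‖a + z p * b (vv H p)‖^2 := by
  obtain ⟨P0, cW, hP0, hcW, hps⟩ := ps_lower
  set K := ⌈132/cW⌉₊ + 1 with hK
  have hKc : 132 ≤ K * cW := by
    have := Nat.le_ceil (132/cW)
    rw [div_le_iff₀ hcW] at this
    rw [hK]; push_cast; nlinarith only [hcW, this]
  have hK1 : 1 ≤ K := by omega
  have hK0 : (1:ℝ) ≤ K := by exact_mod_cast hK1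
  have hφ0 : (1:ℝ) ≤ φ := by exact_mod_cast hφ
  refine ⟨1/(16*K^2*φ^2), by positivity, fun A hA H hH => ?_⟩
  obtain ⟨v1, T0, hT0, hpc⟩ := piece (A+1) (by linarith) K H hK1 hH
  have hH0 : (0:ℝ) < H := by exact_mod_cast hH
  have hxt : Tendsto (fun v : ℕ => xv H v) atTop atTop :=
    Real.tendsto_exp_atTop.comp (tendsto_natCast_atTop_atTop.atTop_div_const hH0)
  obtain ⟨v2, hv2⟩ := eventually_atTop.1 ((hxt.eventually_ge_atTop P0).and (hxt.eventually_ge_atTop (K*φ:ℝ)))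
  refine ⟨max v1 v2, T0, fun v0 hv0 t ht1 ht2 z hz a b => ?_⟩
  obtain ⟨h1, h2⟩ := hv2 v0 (le_of_max_le_right hv0)
  choose w hw1 hw2 using fun v => unit_w a (b v)
  set x := xv H v0 with hx
  have hx0 : 0 < x := xv_pos _ _
  have hu : |(φ:ℝ)*t| = φ*|t| := by rw [abs_mul, Nat.abs_cast]
  have hp := hpc v0 (le_of_max_le_left hv0) (φ*t) (by rw [hu]; nlinarith only [hφ0, ht1, hT0, abs_nonneg t]) (by
    rw [hu, Real.rpow_add hx0, Real.rpow_one]; have := Real.rpow_nonneg hx0.le A; nlinarith only [ht2, h2, hcW, hφ, hx0, abs_nonneg t, mul_le_mul ht2 h2 (by positivity) (by positivity)])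
    (fun v k => (((starRingEnd ℂ) (w v))^φ)^k) (fun v k => by simp [hw1])
  rw [← hx] at hp
  set s := Finset.filter Nat.Prime (Finset.Ioc ⌊x⌋₊ ⌊x^2⌋₊) with hs
  have hmem : ∀ p ∈ s, p.Prime ∧ x < p := fun p hp => by
    rw [hs, Finset.mem_filter, Finset.mem_Ioc, Nat.floor_lt hx0.le] at hp; exact ⟨hp.2, hp.1.1⟩
  have hW : cW ≤ ps x (x^2) := by simpa using hps x h1 1
  have hWe : ps x (x^2) = ∑ p ∈ s, (1/p:ℝ) := rfl
  set D := ∑ p ∈ s, (1/p:ℝ) * ‖z p - w (vv H p)‖^2 with hD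
  have e1 : (K:ℝ)^2/2 * ps x (x^2) - K^4*φ^2*D ≤ 33*K := by
    refine le_trans ?_ hp
    rw [hWe, hD, Finset.mul_sum, Finset.mul_sum, ← Finset.sum_sub_distrib]
    refine Finset.sum_le_sum fun p hp => ?_
    obtain ⟨hpp, hxp⟩ := hmem p hp
    obtain ⟨hz1, hz2⟩ := hz p hpp hxp
    have := geo_low (z p) (w (vv H p)) hz1 (hw1 _) φ K
    have e : ∀ k : ℕ, ee (-(k*(φ*t)) * Real.log p) = ((z p)^φ)^k := fun k => by
      rw [hz2, ee, ee, ← Complex.exp_nat_mul]; congr 1; push_cast; ring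
    simp_rw [e]
    calc _ = (1/p:ℝ) * ((K:ℝ)^2/2 - ((K:ℝ)^2 * φ * ‖z p - w (vv H p)‖)^2) := by ring
      _ ≤ _ := by gcongr
  have e2 : ‖a‖^2/4 * D ≤ ∑ p ∈ s, (1/p:ℝ) * ‖a + z p * b (vv H p)‖^2 := by
    rw [hD, Finset.mul_sum]
    refine Finset.sum_le_sum fun p hp => ?_
    obtain ⟨hpp, hxp⟩ := hmem p hp
    have h3 := hw2 (vv H p) (z p) (hz p hpp hxp).1
    have h4 : (‖z p - w (vv H p)‖ * ‖a‖)^2 ≤ (2*‖a + z p * b (vv H p)‖)^2 := by gcongr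
    calc _ = (1/p:ℝ) * ((‖z p - w (vv H p)‖ * ‖a‖)^2/4) := by ring
      _ ≤ _ := by gcongr; linarith only [h4]
  refine le_trans ?_ e2
  have e3 : ps x (x^2) * K^2/4 ≤ K^4*φ^2*D := by
    nlinarith only [e1, hW, hcW, hKc, mul_le_mul_of_nonneg_left hW (show (0:ℝ) ≤ K^2 by positivity)]
  have e4 : ps x (x^2) / (4*K^2*φ^2) ≤ D := by
    rw [div_le_iff₀ (by positivity)]
    have : (0:ℝ) < K^2 := by positivity
    refine le_of_mul_le_mul_left ?_ this
    nlinarith only [e3]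
  calc _ = ‖a‖^2/4 * (ps x (x^2) / (4*K^2*φ^2)) := by field_simp; ring
    _ ≤ _ := by gcongr

lemma PWJ (φ : ℕ) (hφ : 1 ≤ φ) : ∃ δ : ℝ, 0 < δ ∧ ∀ A : ℝ, 1 ≤ A → ∀ H : ℕ, 1 ≤ H → ∃ (v1 : ℕ) (T0 : ℝ), ∀ v0, v1 ≤ v0 → ∀ t : ℝ, T0 ≤ |t| → |t| ≤ (xv H v0)^A →
    ∀ z : ℕ → ℂ, (∀ p : ℕ, p.Prime → xv H v0 < p → ‖z p‖ = 1 ∧ (z p)^φ = ee (-(φ*t) * Real.log p)) → ∀ (a : ℂ) (b : ℕ → ℂ) (J : ℕ),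
    δ * ps (xv H v0) ((xv H v0)^(2^J)) * ‖a‖^2 ≤ ∑ p ∈ Finset.Ioc ⌊xv H v0⌋₊ ⌊(xv H v0)^(2^J)⌋₊ with p.Prime, (1/p:ℝ) * ‖a + z p * b (vv H p)‖^2 := by
  obtain ⟨δ, hδ, h⟩ := PW φ hφ
  refine ⟨δ, hδ, fun A hA H hH => ?_⟩
  obtain ⟨v1, T0, h⟩ := h A hA H hH
  refine ⟨v1, T0, fun v0 hv0 t ht1 ht2 z hz a b J => ?_⟩
  induction J with
  | zero => simp [ps]
  | succ J ih =>
    have hx1 := one_le_xv H v0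
    have hv : v0 ≤ v0 * 2^J := Nat.le_mul_of_pos_right _ (by positivity)
    have hxx := xv_mono H hv
    have h1 := h (v0*2^J) (hv0.trans hv) t ht1 (ht2.trans (by have := xv_pos H v0; gcongr)) z (fun p hp hxp => hz p hp (hxx.trans_lt hxp)) a b
    rw [xv_mul, ← pow_mul, ← pow_succ] at h1
    rw [xv_mul] at hxx
    have hx2 : xv H v0 ^ 2^J ≤ xv H v0 ^ 2^(J+1) := pow_le_pow_right₀ hx1 (Nat.pow_le_pow_right (by norm_num) (by omega))
    rw [← ps_add hxx hx2, Finset.sum_filter, ← Finset.sum_Ioc_consecutive _ (Nat.floor_le_floor hxx) (Nat.floor_le_floor hx2), ← Finset.sum_filter, ← Finset.sum_filter]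
    linarith

lemma win_sum {a b : ℝ} (ha : 0 < a) (hab : a ≤ b) : ∑ n ∈ Finset.Ioc ⌊a⌋₊ ⌊b⌋₊, (1/n:ℝ) ≤ (b - a + 1)/a := by
  calc _ ≤ ∑ n ∈ Finset.Ioc ⌊a⌋₊ ⌊b⌋₊, (1/a:ℝ) := Finset.sum_le_sum fun n hn => by
        rw [Finset.mem_Ioc, Nat.floor_lt ha.le] at hn
        gcongr; exact hn.1.le
    _ ≤ _ := by
      rw [Finset.sum_const, Nat.card_Ioc, nsmul_eq_mul, Nat.cast_sub (Nat.floor_le_floor hab), mul_one_div]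
      gcongr
      have := Nat.floor_le (ha.le.trans hab); have := Nat.lt_floor_add_one a; linarith

noncomputable def FF (f : ℕ → ℂ) (η Y t : ℝ) : ℂ := ∑ n ∈ Finset.Ioc ⌊Y⌋₊ ⌊Y * Real.exp η⌋₊, (f n/n) * ee (-t * Real.log n)

end MR

namespace MR
open MeasureTheory

lemma edge {f : ℕ → ℂ} (hf : ∀ n, ‖f n‖ ≤ 1) {η Y : ℝ} (hη : 0 ≤ η) (hη' : η ≤ 1/2) {H p : ℕ} (hH : 2 ≤ H) (hp : H ≤ p) (hN : (p:ℝ) ≤ Y/p) :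
    ∃ a : ℕ → ℂ, (∑ n ∈ Finset.Ioc ⌊Y/p⌋₊ ⌊Y/p * Real.exp 1⌋₊, (n:ℝ) * ‖a n‖^2 ≤ 9/H) ∧
      ∀ t, (∑ m ∈ Finset.Ioc ⌊Y/p⌋₊ ⌊Y * Real.exp η/p⌋₊ with ¬ p ∣ m, (f m/m) * ee (-t * Real.log m)) - FF f η (Y / xv H (vv H p)) t =
        ∑ n ∈ Finset.Ioc ⌊Y/p⌋₊ ⌊Y/p * Real.exp 1⌋₊, a n * ee (-t * Real.log n) := by
  have hH0 : (2:ℝ) ≤ H := by exact_mod_cast hH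
  have hp0 : (H:ℝ) ≤ p := by exact_mod_cast hp
  have hpp : (0:ℝ) < p := by linarith
  set N := Y/p with hNd
  have hN0 : 0 < N := by linarith
  have hY : Y = N * p := by rw [hNd]; field_simp
  obtain ⟨hv1, hv2⟩ := vv_bd (H := H) (p := p) (by omega) (by omega)
  set v := vv H p
  have hHi : (1:ℝ)/H ≤ 1/2 := by gcongr
  set Yv := Y / xv H v with hYv
  have hx1 : xv H v < p := by
    rw [xv, ← Real.lt_log_iff_exp_lt hpp, div_lt_iff₀ (by linarith)]; linarith
  have hx2 : p ≤ xv H v * Real.exp (1/H) := by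
    rw [xv, ← Real.exp_add, ← Real.log_le_iff_le_exp hpp, ← add_div, le_div_iff₀ (by linarith)]; linarith
  have hY0 : 0 < Y := by rw [hY]; positivity
  have hyv1 : N ≤ Yv := by rw [hNd, hYv]; have := xv_pos H v; gcongr
  have hyv2 : Yv ≤ N * Real.exp (1/H) := by
    rw [hYv, div_le_iff₀ (xv_pos _ _), hY]; nlinarith only [hx2, hN]
  have hexp : Real.exp (1/H:ℝ) - 1 ≤ 2 * (1/H) := by
    have := (abs_le.1 (Real.abs_exp_sub_one_le (x := (1/H:ℝ)) (by rw [abs_of_nonneg (by positivity)]; linarith))).2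
    rwa [abs_of_nonneg (show (0:ℝ) ≤ 1/H by positivity)] at this
  have hη1 : 1 ≤ Real.exp η := Real.one_le_exp hη
  have hYe : Y * Real.exp η / p = N * Real.exp η := by rw [hY]; field_simp
  have he1 : N * Real.exp η ≤ N * Real.exp 1 := by gcongr; linarith
  have he2 : Yv * Real.exp η ≤ N * Real.exp 1 := by
    calc Yv * Real.exp η ≤ N * Real.exp (1/H) * Real.exp η := by gcongr
      _ = N * Real.exp (1/H + η) := by rw [Real.exp_add]; ring
      _ ≤ _ := by gcongr; linarith
  set s := Finset.Ioc ⌊N⌋₊ ⌊N * Real.exp 1⌋₊ with hs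
  let i1 : ℕ → ℂ := fun n => if n ∈ Finset.Ioc ⌊N⌋₊ ⌊N * Real.exp η⌋₊ ∧ ¬ p ∣ n then 1 else 0
  let i2 : ℕ → ℂ := fun n => if n ∈ Finset.Ioc ⌊Yv⌋₊ ⌊Yv * Real.exp η⌋₊ then 1 else 0
  refine ⟨fun n => f n/n * (i1 n - i2 n), ?_, fun t => ?_⟩
  · let g : ℕ → ℝ := fun n => (if n ∈ Finset.Ioc ⌊N⌋₊ ⌊Yv⌋₊ then 1 else 0) + (if n ∈ Finset.Ioc ⌊N * Real.exp η⌋₊ ⌊Yv * Real.exp η⌋₊ then 1 else 0) + (if p ∣ n then 1 else 0)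
    have h1 : ∀ n ∈ s, (n:ℝ) * ‖f n/n * (i1 n - i2 n)‖^2 ≤ 1/n * g n := by
      intro n hn
      have hn0 : (0:ℝ) < n := by
        rw [hs, Finset.mem_Ioc, Nat.floor_lt hN0.le] at hn; linarith [hn.1]
      have h2 : ‖i1 n - i2 n‖^2 ≤ g n := by
        have := Nat.floor_le_floor hyv1
        have := Nat.floor_le_floor (show N * Real.exp η ≤ Yv * Real.exp η by gcongr)
        rw [hs, Finset.mem_Ioc] at hn
        simp only [i1, i2, g, Finset.mem_Ioc]
        split_ifs <;> norm_num <;> omega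
      calc (n:ℝ) * ‖f n/n * (i1 n - i2 n)‖^2 = 1/n * (‖f n‖^2 * ‖i1 n - i2 n‖^2) := by
            rw [norm_mul, norm_div, Complex.norm_natCast]; field_simp
        _ ≤ 1/n * (1 * g n) := by
            gcongr; exact pow_le_one₀ (norm_nonneg _) (hf n)
        _ = _ := by ring
    refine (Finset.sum_le_sum h1).trans ?_
    simp only [g, mul_add, Finset.sum_add_distrib, mul_ite, mul_one, mul_zero, ← Finset.sum_filter]
    have ind : ∀ a b : ℝ, (∑ n ∈ s with n ∈ Finset.Ioc ⌊a⌋₊ ⌊b⌋₊, (1/n:ℝ)) ≤ ∑ n ∈ Finset.Ioc ⌊a⌋₊ ⌊b⌋₊, (1/n:ℝ) := fun a b =>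
      Finset.sum_le_sum_of_subset_of_nonneg (fun n hn => (Finset.mem_filter.1 hn).2) fun _ _ _ => by positivity
    have wi : ∀ a b : ℝ, N ≤ a → a ≤ b → b ≤ a * Real.exp (1/H) → ∑ n ∈ Finset.Ioc ⌊a⌋₊ ⌊b⌋₊, (1/n:ℝ) ≤ 3/H := fun a b ha hab hb => by
      refine (win_sum (by linarith) hab).trans ?_
      rw [div_le_iff₀ (by linarith)]
      have h3 : 1 ≤ a * (1/H) := by rw [mul_one_div, le_div_iff₀ (by linarith)]; linarith
      have h4 : b - a ≤ a * (2 * (1/H)) := by nlinarith only [hb, hexp, hN, ha]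
      calc b - a + 1 ≤ a * (2 * (1/H)) + a * (1/H) := by linarith
        _ = _ := by ring
    have w1 := (ind N Yv).trans (wi N Yv le_rfl hyv1 hyv2)
    have w2 := (ind (N*Real.exp η) (Yv*Real.exp η)).trans (wi _ _ (by nlinarith only [hη1, hN]) (by gcongr) (by nlinarith only [hyv2, hη1]))
    have w3 : ∑ n ∈ s with p ∣ n, (1/n:ℝ) ≤ 3/H := by
      have h3 := dvd_reindex N (N * Real.exp 1) (D := p) (by omega) (fun n => ((1/n:ℝ):ℂ))
      have h4 : ∑ n ∈ s with p ∣ n, (1/n:ℝ) = ∑ m ∈ Finset.Ioc ⌊N/p⌋₊ ⌊N * Real.exp 1/p⌋₊, (1/(p * m : ℕ):ℝ) := by exact_mod_cast h3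
      have h5 : ∑ m ∈ Finset.Ioc ⌊N/p⌋₊ ⌊N * Real.exp 1/p⌋₊, (1/(p * m : ℕ):ℝ) = 1/p * ∑ m ∈ Finset.Ioc ⌊N/p⌋₊ ⌊N * Real.exp 1/p⌋₊, (1/m:ℝ) := by
        rw [Finset.mul_sum]; refine Finset.sum_congr rfl fun m _ => by push_cast; rw [one_div_mul_one_div]
      rw [h4, h5]
      have h6 := win_sum (a := N/p) (b := N * Real.exp 1/p) (by positivity) (by gcongr; nlinarith only [he1, hη1, hN, Real.add_one_le_exp 1])
      have h7 : (N * Real.exp 1/p - N/p + 1)/(N/p) ≤ 3 := by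
        rw [div_le_iff₀ (by positivity)]
        have : 1 ≤ N/p := by rw [le_div_iff₀ hpp]; linarith only [hN]
        have h8 : N * Real.exp 1/p = N/p * Real.exp 1 := by ring
        rw [h8]; nlinarith only [this, Real.exp_one_lt_d9]
      calc _ ≤ 1/(p:ℝ) * 3 := by gcongr; exact h6.trans h7
        _ ≤ 1/(H:ℝ) * 3 := by gcongr
        _ = _ := by ring
    calc _ ≤ 3/(H:ℝ) + 3/H + 3/H := by linarith only [w1, w2, w3]
      _ = _ := by ring
  · rw [FF, hYe, Finset.sum_filter]
    have m1 : ∀ n, n ∈ Finset.Ioc ⌊N⌋₊ ⌊N * Real.exp η⌋₊ → n ∈ s := fun n => by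
      rw [hs, Finset.mem_Ioc, Finset.mem_Ioc]; have := Nat.floor_le_floor he1; omega
    have m2 : ∀ n, n ∈ Finset.Ioc ⌊Yv⌋₊ ⌊Yv * Real.exp η⌋₊ → n ∈ s := fun n => by
      rw [hs, Finset.mem_Ioc, Finset.mem_Ioc]; have := Nat.floor_le_floor he2; have := Nat.floor_le_floor hyv1; omega
    rw [← Finset.inter_eq_right.2 m1, ← Finset.inter_eq_right.2 m2, ← Finset.sum_ite_mem, ← Finset.sum_ite_mem, ← Finset.sum_sub_distrib]
    refine Finset.sum_congr rfl fun n _ => ?_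
    simp only [i1, i2, ite_and]
    split_ifs <;> ring

lemma FF_cont (f : ℕ → ℂ) (η Y : ℝ) : Continuous (FF f η Y) := by
  unfold FF; have := continuous_ee; fun_prop

lemma FF_bd {f : ℕ → ℂ} (hf : ∀ n, ‖f n‖ ≤ 1) {η Y : ℝ} (hη : 0 ≤ η) (hη' : η ≤ 1/2) (hY : 1 ≤ Y) (t : ℝ) : ‖FF f η Y t‖ ≤ 3 := by
  calc _ ≤ ∑ n ∈ Finset.Ioc ⌊Y⌋₊ ⌊Y * Real.exp η⌋₊, (1/n:ℝ) := norm_sum_le_of_le _ fun n _ => by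
        rw [norm_mul, norm_ee, norm_div, Complex.norm_natCast, mul_one]; gcongr; exact hf n
    _ ≤ _ := by
      refine (win_sum (by linarith) (by nlinarith [Real.add_one_le_exp η])).trans ?_
      rw [div_le_iff₀ (by linarith)]
      have : Real.exp η ≤ Real.exp 1 := Real.exp_le_exp.2 (by linarith)
      nlinarith [Real.exp_one_lt_d9]
end MR

namespace MR
open MeasureTheory

lemma FF_div {f χ : ℕ → ℂ} {p : ℕ} (hp : p.Prime) (h : ∀ m, f (p*m) = if p ∣ m then 0 else -χ p * f m) (η Y t : ℝ) :
    ∑ n ∈ Finset.Ioc ⌊Y⌋₊ ⌊Y * Real.exp η⌋₊, f n/n * (ee (-t * Real.log n) * (1 - p * if p ∣ n then 1 else 0)) =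
    FF f η Y t + χ p * ee (-t * Real.log p) * ∑ m ∈ Finset.Ioc ⌊Y/p⌋₊ ⌊Y * Real.exp η/p⌋₊ with ¬ p ∣ m, (f m/m) * ee (-t * Real.log m) := by
  have h1 : ∀ n : ℕ, f n/n * (ee (-t * Real.log n) * (1 - p * if p ∣ n then 1 else 0)) = f n/n * ee (-t * Real.log n) - p * (if p ∣ n then f n/n * ee (-t * Real.log n) else 0) := fun n => by
    split_ifs <;> ring
  simp_rw [h1, Finset.sum_sub_distrib, ← Finset.mul_sum, ← Finset.sum_filter, FF]
  rw [dvd_reindex _ _ hp.one_le, sub_eq_add_neg, Finset.sum_filter, Finset.mul_sum, Finset.mul_sum, ← Finset.sum_neg_distrib]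
  congr 1
  refine Finset.sum_congr rfl fun m hm => ?_
  have hm0 : (m:ℝ) ≠ 0 := Nat.cast_ne_zero.2 (by have := (Finset.mem_Ioc.1 hm).1; omega)
  have hp0 : (p:ℝ) ≠ 0 := by exact_mod_cast hp.ne_zero
  have hp0' : (p:ℂ) ≠ 0 := by exact_mod_cast hp.ne_zero
  have hm0' : (m:ℂ) ≠ 0 := by exact_mod_cast hm0
  rw [h]; push_cast
  rw [Real.log_mul hp0 hm0, mul_add, ee_add]
  by_cases hd : p ∣ m
  · simp [hd]
  · simp only [hd, if_false, not_false_eq_true, if_true]; field_simp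

lemma nsq_sub (a b : ℂ) : ‖a - b‖^2 ≤ 2*‖a‖^2 + 2*‖b‖^2 := by
  have h2 : ‖a - b‖^2 ≤ (‖a‖ + ‖b‖)^2 := by gcongr; exact norm_sub_le a b
  nlinarith [sq_nonneg (‖a‖ - ‖b‖)]

set_option maxHeartbeats 1000000 in
theorem final1 : ∃ c : ℝ, 0 < c ∧ c < 1/24 ∧ ∀ η : ℝ, 0 < η → η ≤ 1/2 → ∀ (f χ : ℕ → ℂ) (φ q0 : ℕ), 1 ≤ φ → (∀ n, ‖f n‖ ≤ 1) →
    (∀ p : ℕ, p.Prime → q0 < p → ‖χ p‖ = 1 ∧ χ p^φ = 1 ∧ ∀ m, f (p*m) = if p ∣ m then 0 else -χ p * f m) →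
    ∀ ε : ℝ, 0 < ε → ∃ T0 Y0 : ℝ, ∀ Y, Y0 ≤ Y → ∀ (μ : Measure ℝ) [IsFiniteMeasure μ], μ ≤ volume → μ.real Set.univ ≤ Y^c →
    (∀ᵐ t ∂μ, T0 ≤ |t| ∧ |t| ≤ Y^3) → ∫ t, ‖FF f η Y t‖^2 ∂μ ≤ ε := by
  obtain ⟨c0, hc0, hc0', C0, hC0, hsp⟩ := sparse
  refine ⟨c0/2, by linarith, by linarith, fun η hη hη' f χ φ q0 hφ hf hχ ε hε => ?_⟩
  obtain ⟨δ, hδ, hPW⟩ := PWJ φ hφ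
  obtain ⟨P0, cW, hP0, hcW, hps⟩ := ps_lower
  obtain ⟨J, hJ⟩ := exists_nat_ge (12*C0/(δ*cW*ε) + 1)
  obtain ⟨H, hH⟩ := exists_nat_ge (36*C0/(δ*ε) + 2)
  have hH2 : (2:ℝ) ≤ H := le_trans (by linarith [show 0 ≤ 36*C0/(δ*ε) by positivity]) hH
  have hH2' : 2 ≤ H := by exact_mod_cast hH2
  have hJ1 : (1:ℝ) ≤ J := le_trans (by linarith [show 0 ≤ 12*C0/(δ*cW*ε) by positivity]) hJ
  have hB : (0:ℝ) < 2^J := by positivity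
  obtain ⟨v1, T0, hPW⟩ := hPW (6*2^J/c0) (by rw [le_div_iff₀ hc0]; nlinarith only [hc0', hB, one_le_pow₀ (n := J) (show (1:ℝ) ≤ 2 by norm_num)]) H (by omega)
  have hxt : Tendsto (fun v : ℕ => xv H v) atTop atTop :=
    Real.tendsto_exp_atTop.comp (tendsto_natCast_atTop_atTop.atTop_div_const (by linarith))
  obtain ⟨v2, hv2⟩ := eventually_atTop.1 (hxt.eventually_ge_atTop (P0 + q0 + H))
  have hvt : Tendsto (fun Y : ℝ => H * (c0 * Real.log Y/2^J)) atTop atTop :=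
    Tendsto.const_mul_atTop (by linarith) ((Real.tendsto_log_atTop.const_mul_atTop hc0).atTop_div_const hB)
  obtain ⟨Y0, hY0⟩ := eventually_atTop.1 ((hvt.eventually_ge_atTop (max v1 v2 + 2 : ℝ)).and (eventually_ge_atTop ((8:ℝ)^10 + H^2)))
  refine ⟨T0, Y0, fun Y hY μ _ hμ hmass hsupp => ?_⟩
  obtain ⟨hv, hY8⟩ := hY0 Y hY
  have hY8' : (8:ℝ)^10 ≤ Y := by linarith [sq_nonneg (H:ℝ)]
  have hY1 : 1 ≤ Y := le_trans (by norm_num) hY8'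
  have hYp : 0 < Y := by linarith
  set v0 := ⌊H * (c0 * Real.log Y/2^J)⌋₊ with hv0
  have hv01 : (v0:ℝ) ≤ H * (c0 * Real.log Y/2^J) := Nat.floor_le (by linarith only [hc0, hc0', hv, show (0:ℝ) ≤ max (v1:ℝ) v2 from le_max_of_le_left (by positivity)])
  have hv02 : H * (c0 * Real.log Y/2^J) < v0 + 1 := Nat.lt_floor_add_one _
  have hvm : max v1 v2 ≤ v0 := by
    have : ((max v1 v2 : ℕ):ℝ) ≤ v0 := by linarith
    exact_mod_cast this
  have hx := hv2 v0 (le_of_max_le_right hvm)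
  set x := xv H v0 with hxd
  have hq0' : (0:ℝ) ≤ q0 := by positivity
  have hlx : Real.log x = v0/H := log_xv H v0
  have hx0 : 0 < x := xv_pos _ _
  have hxJ : x^(2^J) ≤ Y^c0 := by
    rw [← Real.log_le_log_iff (by positivity) (by positivity), Real.log_pow, Real.log_rpow hYp, hlx, div_eq_mul_inv, ← div_eq_mul_inv, mul_div_assoc', div_le_iff₀ (by linarith)]
    calc _ ≤ ((2^J:ℕ):ℝ) * (H * (c0 * Real.log Y/2^J)) := by gcongr
      _ = _ := by push_cast; field_simp
  have hxA : Y^3 ≤ x^(6*2^J/c0) := by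
    rw [← Real.log_le_log_iff (by positivity) (by positivity), Real.log_pow, Real.log_rpow hx0, hlx]
    have h1 : H * (c0 * Real.log Y/2^J) ≤ 2 * v0 := by
      have : (max v1 v2 : ℝ) ≥ 0 := le_max_of_le_left (by positivity)
      have : (1:ℝ) ≤ v0 := by linarith
      linarith only [hv, hv02]
    have h2 : (6*2^J/c0) * (H * (c0 * Real.log Y/2^J)/H) ≤ (6*2^J/c0) * (2 * v0/H) := by gcongr
    have h3 : (6*2^J/c0) * (H * (c0 * Real.log Y/2^J)/H) = 6 * Real.log Y := by field_simp
    rw [h3] at h2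
    have h4 : (6*2^J/c0) * (2 * v0/H) = 2 * ((6*2^J/c0) * (v0/H)) := by ring
    push_cast; linarith only [h2, h4]
  set P := Finset.filter Nat.Prime (Finset.Ioc ⌊x⌋₊ ⌊x^(2^J)⌋₊) with hP
  have hmem : ∀ p ∈ P, p.Prime ∧ x < p ∧ (p:ℝ) ≤ Y^c0 := fun p hp => by
    rw [hP, Finset.mem_filter, Finset.mem_Ioc, Nat.floor_lt hx0.le, Nat.le_floor_iff (by positivity)] at hp; exact ⟨hp.2, hp.1.1, hp.1.2.trans hxJ⟩
  set W := ps x (x^(2^J)) with hW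
  have hWe : W = ∑ p ∈ P, (1/p:ℝ) := rfl
  have hW1 : cW * J ≤ W := hps x (by linarith) J
  have hW0 : 0 < W := (mul_pos hcW (by linarith)).trans_le hW1
  have hc0Y : Y^c0 ≤ Y^(1/2:ℝ) := Real.rpow_le_rpow_of_exponent_le hY1 (by linarith)
  have hs2 : Y^(1/2:ℝ) * Y^(1/2:ℝ) = Y := by rw [← Real.rpow_add hYp]; norm_num
  have hs0 : 0 < Y^(1/2:ℝ) := by positivity
  have hae : ∀ᵐ t ∂μ, |t| ≤ Y^3 := hsupp.mono fun t h => h.2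
  -- step 1
  have S1 := (hsp Y (by linarith only [hc0, hc0', hY8', show (8:ℝ)^5 ≤ 8^10 by norm_num]) μ hμ (hmass.trans (Real.rpow_le_rpow_of_exponent_le hY1 (by linarith only [hc0]))) (hae.mono fun t h => h.trans (pow_le_pow_right₀ hY1 (by norm_num)))
    (Finset.Ioc ⌊Y⌋₊ ⌊Y * Real.exp η⌋₊) (fun n hn => by
      rw [Finset.mem_Ioc, Nat.floor_lt hYp.le, Nat.le_floor_iff (by positivity)] at hn
      refine ⟨hn.1, hn.2.trans ?_⟩; gcongr; linarith only [hc0, hc0', hη']) (fun n => f n/n)).2 P (fun p hp => ⟨(hmem p hp).1, (hmem p hp).2.2⟩)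
  have S1b : ∑ n ∈ Finset.Ioc ⌊Y⌋₊ ⌊Y * Real.exp η⌋₊, (n:ℝ) * ‖f n/n‖^2 ≤ 3 := by
    calc _ ≤ ∑ n ∈ Finset.Ioc ⌊Y⌋₊ ⌊Y * Real.exp η⌋₊, (1/n:ℝ) := Finset.sum_le_sum fun n hn => by
          have : (n:ℝ) ≠ 0 := Nat.cast_ne_zero.2 (by have := (Finset.mem_Ioc.1 hn).1; omega)
          rw [norm_div, Complex.norm_natCast, div_pow]
          have h2 : ‖f n‖^2 ≤ 1 := pow_le_one₀ (norm_nonneg _) (hf n)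
          calc (n:ℝ) * (‖f n‖^2/n^2) = 1/(n:ℝ) * ‖f n‖^2 := by field_simp
            _ ≤ 1/(n:ℝ) * 1 := by gcongr
            _ = _ := by ring
      _ ≤ _ := by
        refine (win_sum hYp (le_mul_of_one_le_right hYp.le (Real.one_le_exp hη.le))).trans ?_
        rw [div_le_iff₀ (by linarith only [hc0, hc0', hY8'])]
        have : Real.exp η ≤ 2.8 := (Real.exp_le_exp.2 (show η ≤ 1 by linarith only [hc0, hc0', hη'])).trans (by linarith only [hc0, hc0', Real.exp_one_lt_d9])
        have := mul_le_mul_of_nonneg_left this hYp.le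
        linarith only [hc0, hc0', hY8', this]
  replace S1 := S1.trans (mul_le_mul_of_nonneg_left S1b (by linarith only [hc0, hc0', hC0]))
  set z : ℝ → ℕ → ℂ := fun t p => χ p * ee (-t * Real.log p) with hz
  set b : ℝ → ℕ → ℂ := fun t v => FF f η (Y / xv H v) t with hb
  set g : ℕ → ℝ → ℂ := fun p t => ∑ n ∈ Finset.Ioc ⌊Y⌋₊ ⌊Y * Real.exp η⌋₊, f n/n * (ee (-t * Real.log n) * (1 - p * if p ∣ n then 1 else 0)) with hg
  have hcee := continuous_ee
  have int_fin : ∀ (s : Finset ℕ) (a : ℕ → ℂ), Integrable (fun t => ‖∑ n ∈ s, a n * ee (-t * Real.log n)‖^2) μ := fun s a => by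
    refine bdd_int ((∑ n ∈ s, ‖a n‖)^2) (Continuous.aestronglyMeasurable (by fun_prop)) fun t => ?_
    rw [Real.norm_of_nonneg (by positivity)]; gcongr
    exact norm_sum_le_of_le _ fun n _ => by rw [norm_mul, norm_ee, mul_one]
  have S2 : ∀ p ∈ P, Integrable (fun t => ‖FF f η Y t + z t p * b t (vv H p)‖^2) μ ∧ ∫ t, ‖FF f η Y t + z t p * b t (vv H p)‖^2 ∂μ ≤ 2 * ∫ t, ‖g p t‖^2 ∂μ + 18*C0/H := by
    intro p hp
    obtain ⟨hpp, hxp, hpY⟩ := hmem p hp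
    obtain ⟨hχ1, hχ2, hχ3⟩ := hχ p hpp (by exact_mod_cast (show (q0:ℝ) < p by linarith only [hc0, hc0', hP0, hH2, hx, hxp]))
    have hp0 : (0:ℝ) < p := by linarith only [hc0, hc0', hP0, hH2, hx, hxp]
    have hN : Y^(1/2:ℝ) ≤ Y/p := by rw [le_div_iff₀ hp0]; exact (mul_le_mul_of_nonneg_left (hpY.trans hc0Y) hs0.le).trans hs2.le
    obtain ⟨a, ha1, ha2⟩ := edge hf hη.le hη' hH2' (by exact_mod_cast (show (H:ℝ) ≤ p by linarith only [hc0, hc0', hP0, hx, hxp])) ((hpY.trans hc0Y).trans hN)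
    have hN1 : 1 ≤ Y/p := le_trans (Real.one_le_rpow hY1 (by norm_num)) hN
    have hNs : Y ≤ (Y/p)^2 := by rw [sq]; exact hs2.ge.trans (mul_le_mul hN hN hs0.le (by positivity))
    have E := (hsp (Y/p) (le_trans (by rw [show (8:ℝ)^5 = ((8:ℝ)^10)^(1/2:ℝ) by rw [← Real.rpow_natCast, ← Real.rpow_natCast, ← Real.rpow_mul (by norm_num)]; norm_num]; gcongr) hN) μ hμ (hmass.trans (by
        calc Y^(c0/2) = (Y^(1/2:ℝ))^c0 := by rw [← Real.rpow_mul hYp.le]; congr 1; ring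
          _ ≤ _ := by gcongr)) (hae.mono fun t h => h.trans (by
            calc Y^3 ≤ ((Y/p)^2)^3 := by gcongr
              _ = _ := by ring)) (Finset.Ioc ⌊Y/p⌋₊ ⌊Y/p * Real.exp 1⌋₊) (fun n hn => by
      rw [Finset.mem_Ioc, Nat.floor_lt (by positivity), Nat.le_floor_iff (by positivity)] at hn; exact hn) a).1
    set e : ℝ → ℂ := fun t => ∑ n ∈ Finset.Ioc ⌊Y/p⌋₊ ⌊Y/p * Real.exp 1⌋₊, a n * ee (-t * Real.log n) with he
    have hid : ∀ t, FF f η Y t + z t p * b t (vv H p) = g p t - z t p * e t := fun t => by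
      rw [hg]; simp only []
      rw [FF_div hpp hχ3, he]; simp only []
      rw [← ha2 t]; ring
    have hz1 : ∀ t, ‖z t p‖ = 1 := fun t => by rw [hz]; simp [norm_ee, hχ1]
    have ig : Integrable (fun t => ‖g p t‖^2) μ := by
      have : ∀ t, g p t = ∑ n ∈ Finset.Ioc ⌊Y⌋₊ ⌊Y * Real.exp η⌋₊, (f n/n * (1 - p * if p ∣ n then 1 else 0)) * ee (-t * Real.log n) := fun t =>
        Finset.sum_congr rfl fun n _ => by ring
      simp_rw [this]; exact int_fin _ _
    have hle : ∀ t, ‖FF f η Y t + z t p * b t (vv H p)‖^2 ≤ 2*‖g p t‖^2 + 2*‖e t‖^2 := fun t => by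
      rw [hid]
      have := nsq_sub (g p t) (z t p * e t)
      rwa [norm_mul, hz1, one_mul] at this
    have ii : Integrable (fun t => 2*‖g p t‖^2 + 2*‖e t‖^2) μ := (ig.const_mul 2).add ((int_fin _ a).const_mul 2)
    have hI : Integrable (fun t => ‖FF f η Y t + z t p * b t (vv H p)‖^2) μ := by
      refine ii.mono (Continuous.aestronglyMeasurable ?_) (ae_of_all _ fun t => ?_)
      · have := FF_cont f η; fun_prop
      · rw [Real.norm_of_nonneg (by positivity), Real.norm_of_nonneg (by positivity)]; exact hle t
    refine ⟨hI, (integral_mono hI ii hle).trans ?_⟩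
    rw [integral_add (ig.const_mul 2) ((int_fin _ a).const_mul 2), integral_const_mul, integral_const_mul]
    have : C0 * ∑ n ∈ Finset.Ioc ⌊Y/p⌋₊ ⌊Y/p * Real.exp 1⌋₊, (n:ℝ) * ‖a n‖^2 ≤ C0 * (9/H) := by gcongr
    have h9 : 18*C0/H = 2*(C0 * (9/H)) := by ring
    linarith only [E, this, h9]
  have S3 : ∑ p ∈ P, (1/p:ℝ) * ∫ t, ‖FF f η Y t + z t p * b t (vv H p)‖^2 ∂μ ≤ 6*C0 + 18*C0/H*W := by
    calc _ ≤ ∑ p ∈ P, ((2 * ((1/p:ℝ) * ∫ t, ‖g p t‖^2 ∂μ)) + 18*C0/H * (1/p:ℝ)) := Finset.sum_le_sum fun p hp => by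
          calc _ ≤ (1/p:ℝ) * (2 * ∫ t, ‖g p t‖^2 ∂μ + 18*C0/H) := by gcongr; exact (S2 p hp).2
            _ = _ := by ring
      _ ≤ _ := by
        rw [Finset.sum_add_distrib, ← Finset.mul_sum, ← Finset.mul_sum, ← hWe]; linarith only [S1]
  have S4 : δ * W * ∫ t, ‖FF f η Y t‖^2 ∂μ ≤ 6*C0 + 18*C0/H*W := by
    refine le_trans ?_ S3
    rw [← integral_const_mul]
    simp_rw [← integral_const_mul]
    rw [← integral_finsetSum _ fun p hp => (S2 p hp).1.const_mul _]
    refine integral_mono_ae ((int_fin _ _).const_mul _) (integrable_finsetSum _ fun p hp => (S2 p hp).1.const_mul _) (hsupp.mono fun t ht => ?_)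
    refine hPW v0 (le_of_max_le_left hvm) t ht.1 (ht.2.trans hxA) (z t) (fun p hpp hxp => ?_) _ (b t) J
    obtain ⟨hχ1, hχ2, hχ3⟩ := hχ p hpp (by exact_mod_cast (show (q0:ℝ) < p by linarith only [hc0, hc0', hP0, hH2, hx, hxp]))
    refine ⟨by rw [hz]; simp [norm_ee, hχ1], ?_⟩
    rw [hz]; simp only [mul_pow, hχ2, one_mul]
    rw [ee, ee, ← Complex.exp_nat_mul]; congr 1; push_cast; ring
  have S5 : 6*C0 ≤ δ*W*(ε/2) := by
    have : 12*C0/(δ*cW*ε) ≤ J := by linarith only [hc0, hc0', hJ]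
    rw [div_le_iff₀ (by positivity)] at this
    calc 6*C0 ≤ δ*(cW*J)*(ε/2) := by linarith only [this]
      _ ≤ _ := by gcongr
  have S6 : 18*C0/H ≤ δ*(ε/2) := by
    have : 36*C0/(δ*ε) ≤ H := by linarith only [hc0, hc0', hH]
    rw [div_le_iff₀ (by positivity)] at this
    rw [div_le_iff₀ (by linarith only [hc0, hc0', hH2])]; linarith only [this]
  have S7 : δ*W*∫ t, ‖FF f η Y t‖^2 ∂μ ≤ δ*W*ε := by
    have := mul_le_mul_of_nonneg_right S6 hW0.le
    linarith only [S4, S5, this]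
  exact le_of_mul_le_mul_left S7 (by positivity)

theorem final : ∃ c : ℝ, 0 < c ∧ c < 1/24 ∧ ∀ η : ℝ, 0 < η → η ≤ 1/2 → ∀ (f χ : ℕ → ℂ) (φ q0 : ℕ), 1 ≤ φ → (∀ n, ‖f n‖ ≤ 1) →
    (∀ p : ℕ, p.Prime → q0 < p → ‖χ p‖ = 1 ∧ χ p^φ = 1 ∧ ∀ m, f (p*m) = if p ∣ m then 0 else -χ p * f m) →
    (∀ t, Tendsto (fun Y => FF f η Y t) atTop (𝓝 0)) →
    ∀ ε : ℝ, 0 < ε → ∃ Y0 : ℝ, ∀ Y, Y0 ≤ Y → ∀ (μ : Measure ℝ) [IsFiniteMeasure μ], μ ≤ volume → μ.real Set.univ ≤ Y^c →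
    (∀ᵐ t ∂μ, |t| ≤ Y^3) → ∫ t, ‖FF f η Y t‖^2 ∂μ ≤ ε := by
  obtain ⟨c, hc, hc', hfin⟩ := final1
  refine ⟨c, hc, hc', fun η hη hη' f χ φ q0 hφ hf hχ hlim ε hε => ?_⟩
  obtain ⟨T0, Y0, h⟩ := hfin η hη hη' f χ φ q0 hφ hf hχ (ε/2) (by linarith)
  set B : Set ℝ := {t | T0 ≤ |t|} with hB
  have hBm : MeasurableSet B := measurableSet_le measurable_const measurable_norm
  have hBc : volume Bᶜ < ⊤ := by
    refine (measure_mono (fun t ht => ?_)).trans_lt (measure_Ioo_lt_top (a := -T0) (b := T0))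
    simp only [hB, Set.mem_compl_iff, Set.mem_ofPred_eq, not_le] at ht
    exact abs_lt.1 ht
  have : IsFiniteMeasure (volume.restrict Bᶜ) := ⟨by rw [Measure.restrict_apply_univ]; exact hBc⟩
  have hd : Tendsto (fun Y => ∫ t in Bᶜ, ‖FF f η Y t‖^2) atTop (𝓝 (∫ t in Bᶜ, (0:ℝ))) := by
    refine tendsto_integral_filter_of_dominated_convergence (fun _ => (9:ℝ)) (Eventually.of_forall fun Y => ((FF_cont f η Y).norm.pow 2).aestronglyMeasurable) ?_ (integrable_const _) (ae_of_all _ fun t => ?_)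
    · filter_upwards [eventually_ge_atTop 1] with Y hY
      refine ae_of_all _ fun t => ?_
      rw [Real.norm_of_nonneg (by positivity)]
      nlinarith only [hf, hη, hη', hY, hc, hc', FF_bd hf hη.le hη' hY t, norm_nonneg (FF f η Y t)]
    · simpa using ((hlim t).norm.pow 2)
  rw [integral_zero] at hd
  obtain ⟨Y1, hY1⟩ := eventually_atTop.1 ((hd.eventually_le_const (show 0 < ε/2 by linarith)).and (eventually_ge_atTop 1))
  refine ⟨max Y0 Y1, fun Y hY μ _ hμ hmass hsupp => ?_⟩
  obtain ⟨h1, h2⟩ := hY1 Y (le_of_max_le_right hY)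
  have hint : ∀ (ρ : Measure ℝ) [IsFiniteMeasure ρ], Integrable (fun t => ‖FF f η Y t‖^2) ρ := fun ρ _ =>
    bdd_int 9 ((FF_cont f η Y).norm.pow 2).aestronglyMeasurable fun t => by
      rw [Real.norm_of_nonneg (by positivity)]
      nlinarith only [hf, hη, hη', h2, hc, hc', FF_bd hf hη.le hη' h2 t, norm_nonneg (FF f η Y t)]
  rw [← integral_add_compl hBm (hint μ)]
  have e1 := h Y (le_of_max_le_left hY) (μ.restrict B) (Measure.restrict_le_self.trans hμ) (le_trans (by
      rw [measureReal_restrict_apply_univ]; exact measureReal_mono (Set.subset_univ _)) hmass) (by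
      filter_upwards [ae_restrict_mem hBm, ae_restrict_of_ae hsupp] with t ht1 ht2 using ⟨ht1, ht2⟩)
  have e2 : ∫ t in Bᶜ, ‖FF f η Y t‖^2 ∂μ ≤ ∫ t in Bᶜ, ‖FF f η Y t‖^2 :=
    integral_mono_measure (Measure.restrict_mono le_rfl hμ) (ae_of_all _ fun t => by positivity) (hint _)
  linarith
end MR

namespace MR
open MeasureTheory

lemma tri_half (κ y : ℝ) (hy : y ≠ 0) : ∫ τ in (0:ℝ)..κ, ((κ - τ : ℝ):ℂ) * ee (y*τ) = -(ee (y*κ) - 1)/y^2 + κ * Complex.I/y := by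
  have hy' : (y:ℂ) ≠ 0 := by exact_mod_cast hy
  have hd : ∀ τ ∈ Set.uIcc 0 κ, HasDerivAt (fun τ : ℝ => ((κ - τ : ℝ):ℂ) * ee (y*τ) / (y * Complex.I) + ee (y*τ)/(y*Complex.I)^2) (((κ - τ : ℝ):ℂ) * ee (y*τ)) τ := by
    intro τ _
    have h1 : HasDerivAt (fun τ : ℝ => ee (y*τ)) (ee (y*τ) * (y * Complex.I)) τ := by
      unfold ee
      have h0 : HasDerivAt (fun τ : ℝ => ((y*τ:ℝ):ℂ) * Complex.I) (y * Complex.I) τ := by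
        have := ((hasDerivAt_id τ).const_mul y).ofReal_comp.mul_const Complex.I
        simpa using this
      exact h0.cexp
    have h2 : HasDerivAt (fun τ : ℝ => ((κ - τ : ℝ):ℂ)) (-1) τ := by
      have := ((hasDerivAt_id τ).const_sub κ).ofReal_comp; simpa using this
    refine (((h2.mul h1).div_const (y*Complex.I)).add (h1.div_const ((y*Complex.I)^2))).congr_deriv ?_
    have hI := Complex.I_ne_zero
    generalize ee (y*τ) = E
    field_simp
    ring
  have hc := continuous_ee
  rw [intervalIntegral.integral_eq_sub_of_hasDerivAt hd (Continuous.intervalIntegrable (by fun_prop) _ _)]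
  simp only [sub_self, mul_zero, ee_zero, mul_pow, Complex.I_sq]
  have hI := Complex.I_ne_zero
  push_cast
  field_simp
  linear_combination (-κ * y : ℂ) * Complex.I_sq

lemma tri_ft (κ y : ℝ) (hy : y ≠ 0) (hκ : 0 ≤ κ) : ∫ τ in (-κ)..κ, ((κ - |τ| : ℝ):ℂ) * ee (y*τ) = (((2 - 2 * Real.cos (κ*y))/y^2 : ℝ):ℂ) := by
  have hc := continuous_ee
  rw [← intervalIntegral.integral_add_adjacent_intervals (b := 0) (Continuous.intervalIntegrable (by fun_prop) _ _) (Continuous.intervalIntegrable (by fun_prop) _ _)]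
  have h1 : ∫ τ in (0:ℝ)..κ, ((κ - |τ| : ℝ):ℂ) * ee (y*τ) = ∫ τ in (0:ℝ)..κ, ((κ - τ : ℝ):ℂ) * ee (y*τ) :=
    intervalIntegral.integral_congr fun τ hτ => by
      rw [Set.uIcc_of_le hκ] at hτ; simp only [abs_of_nonneg hτ.1]
  have h2 : ∫ τ in (-κ)..0, ((κ - |τ| : ℝ):ℂ) * ee (y*τ) = ∫ τ in (0:ℝ)..κ, ((κ - τ : ℝ):ℂ) * ee ((-y)*τ) := by
    have := intervalIntegral.integral_comp_neg (a := -κ) (b := 0) (fun τ => ((κ - τ : ℝ):ℂ) * ee ((-y)*τ))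
    rw [neg_zero, neg_neg] at this
    rw [← this]
    refine intervalIntegral.integral_congr fun τ hτ => ?_
    rw [Set.uIcc_of_le (by linarith)] at hτ; simp only [abs_of_nonpos hτ.2]; congr 2; ring
  rw [h1, h2, tri_half _ _ hy, tri_half _ _ (neg_ne_zero.2 hy)]
  have hy' : (y:ℂ) ≠ 0 := by exact_mod_cast hy
  have h3 : ee (y*κ) + ee (-y*κ) = 2 * Complex.cos (κ*y) := by
    rw [ee, ee, Complex.cos]; push_cast; ring_nf
  generalize ee (y*κ) = E at *
  generalize ee (-y*κ) = E' at *
  push_cast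
  generalize Complex.cos (κ*y) = E'' at *
  field_simp
  linear_combination -h3

noncomputable def fe (y : ℝ) : ℝ := (2 - 2 * Real.cos y)/y^2

lemma fe_nn (y : ℝ) : 0 ≤ fe y := div_nonneg (by linarith [Real.cos_le_one y]) (by positivity)
lemma fe_le_one (y : ℝ) : fe y ≤ 1 := by
  unfold fe
  by_cases h : y = 0
  · simp [h]
  · rw [div_le_one (by positivity)]; linarith [Real.one_sub_sq_div_two_le_cos (x := y)]
lemma fe_le (y : ℝ) : fe y ≤ 8 * (1+y^2)⁻¹ := by
  rw [← div_eq_mul_inv, le_div_iff₀ (by positivity)]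
  by_cases h : y = 0
  · simp [h, fe]
  have h1 := fe_le_one y
  have h2 : fe y * y^2 ≤ 4 := by
    rw [fe, div_mul_cancel₀ _ (by positivity)]; linarith [Real.neg_one_le_cos y]
  linarith
lemma fe_meas : Measurable fe := by unfold fe; fun_prop
lemma fe_int : Integrable fe := (integrable_inv_one_add_sq.const_mul 8).mono' fe_meas.aestronglyMeasurable
  (ae_of_all _ fun y => by rw [Real.norm_of_nonneg (fe_nn y)]; exact fe_le y)
lemma fe_int' {B : ℝ} (hB : 0 < B) (x : ℝ) : Integrable fun u => fe (B*(x-u)) :=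
  ((fe_int.comp_mul_left' hB.ne').comp_sub_left x)
lemma fe_pos : 0 < ∫ y, fe y := by
  rw [integral_pos_iff_support_of_nonneg fe_nn fe_int]
  refine lt_of_lt_of_le ?_ (measure_mono (s := Set.Ioo 0 1) fun y hy => ?_)
  · simp
  · have : Real.cos y < 1 := by
      rw [← Real.cos_zero]; exact Real.cos_lt_cos_of_nonneg_of_le_pi le_rfl (by linarith [hy.2, Real.pi_gt_three]) hy.1
    exact (div_pos (by linarith) (by have := hy.1; positivity)).ne'

noncomputable def aa (h : ℕ → ℂ) (u : ℝ) : ℂ := (∑ n ∈ Finset.Icc 1 ⌊Real.exp u⌋₊, h n) * (Real.exp (-u):ℝ)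

lemma aa_sum {h : ℕ → ℂ} (hh : ∀ n, ‖h n‖ ≤ 1) (m : ℕ) : ‖∑ n ∈ Finset.Icc 1 m, h n‖ ≤ m := by
  refine (norm_sum_le_of_le _ fun n _ => hh n).trans (by simp)
lemma aa_bd {h : ℕ → ℂ} (hh : ∀ n, ‖h n‖ ≤ 1) (u : ℝ) : ‖aa h u‖ ≤ 1 := by
  rw [aa, norm_mul, Complex.norm_real, Real.norm_of_nonneg (Real.exp_pos _).le, Real.exp_neg, ← div_eq_mul_inv, div_le_one (Real.exp_pos _)]
  exact (aa_sum hh _).trans (Nat.floor_le (Real.exp_pos _).le)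
lemma aa_meas (h : ℕ → ℂ) : Measurable (aa h) := by
  unfold aa
  have h1 : Measurable fun m : ℕ => ∑ n ∈ Finset.Icc 1 m, h n := measurable_from_top
  exact (h1.comp (Nat.measurable_floor.comp Real.measurable_exp)).mul (by fun_prop)
lemma aa_neg (h : ℕ → ℂ) {u : ℝ} (hu : u < 0) : aa h u = 0 := by
  have : ⌊Real.exp u⌋₊ = 0 := Nat.floor_eq_zero.2 (by simpa using hu)
  simp [aa, this]
lemma aa_slow {h : ℕ → ℂ} (hh : ∀ n, ‖h n‖ ≤ 1) (x y : ℝ) (hxy : x ≤ y) : ‖aa h y - aa h x‖ ≤ 2*(y-x) + Real.exp (-y) := by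
  have hm : ⌊Real.exp x⌋₊ ≤ ⌊Real.exp y⌋₊ := Nat.floor_le_floor (Real.exp_le_exp.2 hxy)
  have h1 : aa h y - aa h x = (∑ n ∈ Finset.Ioc ⌊Real.exp x⌋₊ ⌊Real.exp y⌋₊, h n) * (Real.exp (-y):ℝ) - aa h x * ((1 - Real.exp (x-y) : ℝ):ℂ) := by
    have e1 : ∀ m, ∑ n ∈ Finset.Icc 1 m, h n = ∑ n ∈ Finset.Ioc 0 m, h n := fun m => rfl
    rw [aa, aa, e1, e1, ← Finset.sum_Ioc_consecutive h (Nat.zero_le _) hm, show x - y = x + -y by ring, Real.exp_add]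
    have : ((Real.exp (-x):ℝ):ℂ) * ((Real.exp x:ℝ):ℂ) = 1 := by rw [← Complex.ofReal_mul, ← Real.exp_add]; simp
    push_cast at this ⊢
    linear_combination (-(∑ n ∈ Finset.Ioc 0 ⌊Real.exp x⌋₊, h n) * Complex.exp (-y)) * this
  have h2 : 1 - Real.exp (x-y) ≤ y - x := by linarith [Real.add_one_le_exp (x-y)]
  have h3 : 0 ≤ 1 - Real.exp (x-y) := by linarith [Real.exp_le_one_iff.2 (show x-y ≤ 0 by linarith)]
  rw [h1]
  refine (norm_sub_le _ _).trans ?_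
  rw [norm_mul, norm_mul, Complex.norm_real, Complex.norm_real, Real.norm_of_nonneg (Real.exp_pos _).le, Real.norm_of_nonneg h3]
  have h4 : ‖∑ n ∈ Finset.Ioc ⌊Real.exp x⌋₊ ⌊Real.exp y⌋₊, h n‖ ≤ Real.exp y - Real.exp x + 1 := by
    refine (norm_sum_le_of_le _ fun n _ => hh n).trans ?_
    rw [Finset.sum_const, Nat.card_Ioc, nsmul_eq_mul, mul_one, Nat.cast_sub hm]
    have := Nat.floor_le (Real.exp_pos y).le; have := Nat.lt_floor_add_one (Real.exp x); linarith
  have h5 : (Real.exp y - Real.exp x + 1) * Real.exp (-y) = 1 - Real.exp (x-y) + Real.exp (-y) := by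
    rw [show x - y = x + -y by ring, Real.exp_add]
    have : Real.exp y * Real.exp (-y) = 1 := by rw [← Real.exp_add]; simp
    linear_combination this
  have h6 := mul_le_mul_of_nonneg_right h4 (Real.exp_pos (-y)).le
  have h7 := mul_le_mul (aa_bd hh x) h2 h3 zero_le_one
  linarith

lemma aa_lap {h : ℕ → ℂ} (hh : ∀ n, ‖h n‖ ≤ 1) {s : ℂ} (hs : 1 < s.re) :
    ∫ u in Set.Ioi (0:ℝ), aa h u * Complex.exp (-(s-1)*u) = LSeries h s / s := by
  have hs0 : s ≠ 0 := by rintro rfl; simp at hs; linarith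
  have hO : (fun n ↦ ∑ k ∈ Finset.Icc 1 n, ‖h k‖) =O[atTop] fun n : ℕ ↦ (n : ℝ) ^ (1:ℝ) := by
    refine Asymptotics.IsBigO.of_bound 1 (Eventually.of_forall fun n => ?_)
    rw [Real.rpow_one, Real.norm_of_nonneg (by positivity), Real.norm_of_nonneg (by positivity), one_mul]
    exact (Finset.sum_le_sum fun k _ => hh k).trans (by simp)
  rw [LSeries_eq_mul_integral' h zero_le_one hs hO, mul_div_cancel_left₀ _ hs0]
  have him : Real.exp '' Set.Ioi 0 = Set.Ioi 1 := by
    ext t; constructor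
    · rintro ⟨u, hu, rfl⟩; exact Real.one_lt_exp_iff.2 hu
    · intro ht
      have h0 : (1:ℝ) < t := ht
      exact ⟨Real.log t, Real.log_pos ht, Real.exp_log (by linarith)⟩
  rw [← him, integral_image_eq_integral_abs_deriv_smul measurableSet_Ioi (fun u _ => (Real.hasDerivAt_exp u).hasDerivWithinAt) Real.exp_injective.injOn]
  refine setIntegral_congr_fun measurableSet_Ioi fun u _ => ?_
  simp only [aa]
  rw [abs_of_pos (Real.exp_pos u), Complex.real_smul, Complex.cpow_def_of_ne_zero (by exact_mod_cast (Real.exp_pos u).ne'), ← Complex.ofReal_log (Real.exp_pos u).le, Real.log_exp]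
  push_cast
  rw [mul_assoc, ← Complex.exp_add, mul_left_comm, ← Complex.exp_add]
  congr 2; ring
end MR

namespace MR
open MeasureTheory

lemma wie1 {h : ℕ → ℂ} (hh : ∀ n, ‖h n‖ ≤ 1) {B δ : ℝ} (hB : 0 < B) (hδ : 0 < δ) (x : ℝ) :
    ∫ u in Set.Ioi (0:ℝ), aa h u * Real.exp (-δ*u) * fe (B*(x-u)) =
    ∫ τ in Set.Ioc (-1:ℝ) 1, ((1 - |τ| : ℝ):ℂ) * ee (B*x*τ) * (LSeries h (1+δ+B*τ*Complex.I)/(1+δ+B*τ*Complex.I)) := by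
  have hc := continuous_ee
  have hma := aa_meas h
  have e1 : ∫ u in Set.Ioi (0:ℝ), aa h u * Real.exp (-δ*u) * fe (B*(x-u)) =
      ∫ u in Set.Ioi (0:ℝ), ∫ τ in Set.Ioc (-1:ℝ) 1, aa h u * Real.exp (-δ*u) * (((1 - |τ| : ℝ):ℂ) * ee (B*(x-u)*τ)) := by
    refine setIntegral_congr_ae measurableSet_Ioi ?_
    filter_upwards [compl_mem_ae_iff.2 (measure_singleton x)] with u hu _
    have hu' : B*(x-u) ≠ 0 := mul_ne_zero hB.ne' (sub_ne_zero.2 fun h => hu h.symm)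
    have := tri_ft 1 _ hu' zero_le_one
    rw [intervalIntegral.integral_of_le (by norm_num)] at this
    rw [integral_const_mul, this, fe, one_mul]
  rw [e1, integral_integral_swap]
  · refine setIntegral_congr_fun measurableSet_Ioc fun τ _ => ?_
    have := aa_lap hh (s := 1+δ+B*τ*Complex.I) (by simpa using hδ)
    rw [← this]
    rw [← integral_const_mul]
    congr 1; ext u
    have : ee (B*(x-u)*τ) * Real.exp (-δ*u) = ee (B*x*τ) * Complex.exp (-(1+δ+B*τ*Complex.I-1)*u) := by
      rw [ee, ee, Complex.ofReal_exp, ← Complex.exp_add, ← Complex.exp_add]; congr 1; push_cast; ring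
    linear_combination (aa h u * ((1 - |τ| : ℝ):ℂ)) * this
  · have hi : Integrable (fun u : ℝ => Real.exp (-δ*u)) (volume.restrict (Set.Ioi 0)) := integrableOn_exp_mul_Ioi (by linarith) 0
    have hk : Integrable (fun _ : ℝ => (1:ℝ)) (volume.restrict (Set.Ioc (-1:ℝ) 1)) := integrable_const _
    refine (hi.mul_prod hk).mono' ?_ ?_
    · refine Measurable.aestronglyMeasurable ?_
      have h1 : Measurable fun z : ℝ × ℝ => aa h z.1 := hma.comp measurable_fst
      have h2 : Measurable fun z : ℝ × ℝ => ee (B*(x-z.1)*z.2) := (hc.comp (by fun_prop)).measurable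
      unfold Function.uncurry; fun_prop
    · rw [Measure.prod_restrict]
      refine (ae_restrict_iff' (measurableSet_Ioi.prod measurableSet_Ioc)).2 (Eventually.of_forall ?_)
      rintro ⟨u, τ⟩ ⟨_, h1, h2⟩
      simp only [Function.uncurry, norm_mul, norm_ee, Complex.norm_real, mul_one]
      rw [Real.norm_of_nonneg (Real.exp_pos _).le]
      have : ‖1-|τ|‖ ≤ 1 := by
        have := abs_le.2 ⟨h1.le, h2⟩; rw [Real.norm_of_nonneg] <;> linarith [abs_nonneg τ]
      have hb := aa_bd hh u
      calc _ ≤ 1 * Real.exp (-δ*u) * 1 := by gcongr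
        _ = _ := by ring

lemma wie2 {h : ℕ → ℂ} (hh : ∀ n, ‖h n‖ ≤ 1) {B : ℝ} (hB : 0 < B) (E : ℂ → ℂ)
    (hE : ContinuousOn E {s | 1 ≤ s.re}) (hEL : ∀ s, 1 < s.re → E s = LSeries h s / s) (x : ℝ) :
    ∫ u in Set.Ioi (0:ℝ), aa h u * fe (B*(x-u)) =
    ∫ τ in Set.Ioc (-1:ℝ) 1, ((1 - |τ| : ℝ):ℂ) * ee (B*x*τ) * E (1+B*τ*Complex.I) := by
  have hma := aa_meas h
  have hfm := fe_meas
  have hc := continuous_ee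
  have hEc : ContinuousOn (fun z : ℝ × ℝ => E (1+z.1+B*z.2*Complex.I)) (Set.Icc 0 1 ×ˢ Set.Icc (-1) 1) := by
    refine hE.comp (by fun_prop) fun z hz => ?_
    simpa using hz.1.1
  obtain ⟨K, hK⟩ := (isCompact_Icc.prod isCompact_Icc).exists_bound_of_continuousOn hEc
  have hd : Tendsto (fun n : ℕ => 1/((n:ℝ)+1)) atTop (𝓝 0) := tendsto_one_div_add_atTop_nhds_zero_nat
  have l1 : Tendsto (fun n : ℕ => ∫ u in Set.Ioi (0:ℝ), aa h u * Real.exp (-(1/((n:ℝ)+1))*u) * fe (B*(x-u))) atTop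
      (𝓝 (∫ u in Set.Ioi (0:ℝ), aa h u * fe (B*(x-u)))) := by
    refine tendsto_integral_of_dominated_convergence (fun u => fe (B*(x-u))) (fun n => Measurable.aestronglyMeasurable (by fun_prop)) (fe_int' hB x).restrict ?_ ?_
    · intro n
      refine (ae_restrict_iff' measurableSet_Ioi).2 (Eventually.of_forall fun u hu => ?_)
      rw [norm_mul, norm_mul, Complex.norm_real, Complex.norm_real, Real.norm_of_nonneg (fe_nn _), Real.norm_of_nonneg (Real.exp_pos _).le]
      have h1 : Real.exp (-(1/((n:ℝ)+1))*u) ≤ 1 := Real.exp_le_one_iff.2 (by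
        have : 0 ≤ 1/((n:ℝ)+1)*u := mul_nonneg (by positivity) (le_of_lt hu)
        linarith)
      have := aa_bd hh u
      calc _ ≤ 1 * 1 * fe (B*(x-u)) := by have := fe_nn (B*(x-u)); gcongr
        _ = _ := by ring
    · refine Eventually.of_forall fun u => ?_
      have : Tendsto (fun n : ℕ => Real.exp (-(1/((n:ℝ)+1))*u)) atTop (𝓝 1) := by
        have := (Real.continuous_exp.tendsto _).comp (hd.neg.mul_const u)
        simpa [Function.comp_def] using this
      have := (((Complex.continuous_ofReal.tendsto _).comp this).const_mul (aa h u)).mul_const (fe (B*(x-u)) : ℂ)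
      simpa [Function.comp_def] using this
  have l2 : Tendsto (fun n : ℕ => ∫ u in Set.Ioi (0:ℝ), aa h u * Real.exp (-(1/((n:ℝ)+1))*u) * fe (B*(x-u))) atTop
      (𝓝 (∫ τ in Set.Ioc (-1:ℝ) 1, ((1 - |τ| : ℝ):ℂ) * ee (B*x*τ) * E (1+B*τ*Complex.I))) := by
    have hn : ∀ n : ℕ, (0:ℝ) < 1/((n:ℝ)+1) ∧ 1/((n:ℝ)+1) ≤ 1 := fun n => ⟨by positivity, by
      rw [div_le_one (by positivity)]; linarith [n.cast_nonneg (α := ℝ)]⟩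
    have : ∀ n : ℕ, ∫ u in Set.Ioi (0:ℝ), aa h u * Real.exp (-(1/((n:ℝ)+1))*u) * fe (B*(x-u)) =
      ∫ τ in Set.Ioc (-1:ℝ) 1, ((1 - |τ| : ℝ):ℂ) * ee (B*x*τ) * E (1+(1/((n:ℝ)+1) : ℝ)+B*τ*Complex.I) := fun n => by
      rw [wie1 hh hB (hn n).1]
      congr 1; ext τ
      rw [hEL _ (by have := (hn n).1; simp only [Complex.add_re, Complex.one_re, Complex.ofReal_re, Complex.mul_I_re]; simpa using this)]
    simp_rw [this]
    refine tendsto_integral_of_dominated_convergence (fun _ => K) ?_ (integrable_const _) ?_ ?_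
    · intro n
      refine ContinuousOn.aestronglyMeasurable ?_ measurableSet_Ioc
      refine (Continuous.continuousOn (by fun_prop)).mul (hEc.comp (f := fun τ : ℝ => ((1/((n:ℝ)+1) : ℝ), τ)) (by fun_prop) fun τ hτ => ⟨⟨(hn n).1.le, (hn n).2⟩, hτ.1.le, hτ.2⟩)
    · intro n
      refine (ae_restrict_iff' measurableSet_Ioc).2 (Eventually.of_forall fun τ hτ => ?_)
      have := hK ((1/((n:ℝ)+1) : ℝ), τ) ⟨⟨(hn n).1.le, (hn n).2⟩, hτ.1.le, hτ.2⟩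
      rw [norm_mul, norm_mul, norm_ee, Complex.norm_real, mul_one]
      have h1 : ‖1-|τ|‖ ≤ 1 := by
        have := abs_le.2 ⟨hτ.1.le, hτ.2⟩; rw [Real.norm_of_nonneg] <;> linarith [abs_nonneg τ]
      calc _ ≤ 1 * K := by gcongr
        _ = K := one_mul _
    · refine (ae_restrict_iff' measurableSet_Ioc).2 (Eventually.of_forall fun τ hτ => ?_)
      refine Tendsto.const_mul _ ?_
      have h0 := (hEc (0, τ) ⟨⟨le_rfl, zero_le_one⟩, hτ.1.le, hτ.2⟩).tendsto
      have h1 : Tendsto (fun n : ℕ => ((1/((n:ℝ)+1) : ℝ), τ)) atTop (𝓝[Set.Icc 0 1 ×ˢ Set.Icc (-1) 1] ((0:ℝ), τ)) :=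
        tendsto_nhdsWithin_iff.2 ⟨hd.prodMk_nhds tendsto_const_nhds, Eventually.of_forall fun n => ⟨⟨(hn n).1.le, (hn n).2⟩, hτ.1.le, hτ.2⟩⟩
      simpa [Function.comp_def] using h0.comp h1
  exact tendsto_nhds_unique l1 l2

lemma wie3 {h : ℕ → ℂ} (hh : ∀ n, ‖h n‖ ≤ 1) {B : ℝ} (hB : 0 < B) (E : ℂ → ℂ)
    (hE : ContinuousOn E {s | 1 ≤ s.re}) (hEL : ∀ s, 1 < s.re → E s = LSeries h s / s) :
    Tendsto (fun x => ∫ u in Set.Ioi (0:ℝ), aa h u * fe (B*(x-u))) atTop (𝓝 0) := by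
  simp_rw [wie2 hh hB E hE hEL]
  have h0 := Real.tendsto_integral_exp_smul_cocompact (Set.indicator (Set.Ioc (-1:ℝ) 1) fun τ => ((1 - |τ| : ℝ):ℂ) * E (1+B*τ*Complex.I))
  have h1 : Tendsto (fun x : ℝ => -(B/(2*Real.pi))*x) atTop (cocompact ℝ) :=
    (tendsto_id.const_mul_atTop_of_neg (by have := Real.pi_pos; have : 0 < B/(2*Real.pi) := by positivity
                                           linarith)).mono_right atBot_le_cocompact
  refine (h0.comp h1).congr fun x => ?_
  rw [Function.comp, ← integral_indicator measurableSet_Ioc]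
  congr 1; ext τ
  by_cases hτ : τ ∈ Set.Ioc (-1:ℝ) 1
  · rw [Set.indicator_of_mem hτ, Set.indicator_of_mem hτ, Circle.smul_def, Real.fourierChar_apply, smul_eq_mul, ee]
    have : (2 * Real.pi * -(τ * (-(B/(2*Real.pi))*x)) : ℝ) = B*x*τ := by have := Real.pi_ne_zero; field_simp
    rw [this]; ring
  · rw [Set.indicator_of_notMem hτ, Set.indicator_of_notMem hτ, smul_zero]

lemma fe_cl (y : ℝ) : fe y * y^2 ≤ 4 := by
  unfold fe
  by_cases h : y = 0
  · simp [h]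
  rw [div_mul_cancel₀ _ (by positivity)]; linarith [Real.neg_one_le_cos y]

lemma wie4 {h : ℕ → ℂ} (hh : ∀ n, ‖h n‖ ≤ 1) {B δ : ℝ} (hB : 0 < B) (hδ : 0 < δ) (hδ1 : δ ≤ 1) (x : ℝ) :
    ‖aa h x‖ * ((∫ y, fe y)/B) ≤ ‖∫ u in Set.Ioi (0:ℝ), aa h u * fe (B*(x-u))‖ + (2*δ+Real.exp (δ-x)) * ((∫ y, fe y)/B) + 16/(δ^2*B^2)*Real.pi := by
  have hfm := fe_meas
  have hma := aa_meas h
  have hi := fe_int' hB x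
  have hJ : ∫ u, fe (B*(x-u)) = (∫ y, fe y)/B := by
    rw [integral_sub_left_eq_self (fun u => fe (B*u)), Measure.integral_comp_mul_left, abs_of_pos (by positivity), smul_eq_mul]; ring
  have hC : ∫ u in Set.Ioi (0:ℝ), aa h u * fe (B*(x-u)) = ∫ u, aa h u * fe (B*(x-u)) := by
    refine setIntegral_eq_integral_of_ae_compl_eq_zero ?_
    filter_upwards [compl_mem_ae_iff.2 (measure_singleton (0:ℝ))] with u hu hu'
    rw [aa_neg h (lt_of_le_of_ne (not_lt.1 hu') hu), zero_mul]
  have hi1 : Integrable fun u => aa h u * (fe (B*(x-u)) : ℂ) := by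
    refine hi.mono' (Measurable.aestronglyMeasurable (by fun_prop)) (Eventually.of_forall fun u => ?_)
    rw [norm_mul, Complex.norm_real, Real.norm_of_nonneg (fe_nn _)]
    exact mul_le_of_le_one_left (fe_nn _) (aa_bd hh u)
  have hi2 : Integrable fun u => aa h x * (fe (B*(x-u)) : ℂ) := hi.ofReal.const_mul _
  have hq : Integrable fun u : ℝ => (1+(x-u)^2)⁻¹ := integrable_inv_one_add_sq.comp_sub_left x
  have e : aa h x * ((∫ y, fe y)/B : ℝ) = (∫ u, aa h u * (fe (B*(x-u)) : ℂ)) + ∫ u, (aa h x - aa h u) * (fe (B*(x-u)) : ℂ) := by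
    rw [← hJ, ← integral_complex_ofReal, ← integral_const_mul, ← integral_add hi1 ((hi2.sub hi1).congr (Eventually.of_forall fun u => (sub_mul _ _ _).symm))]
    congr 1; ext u; ring
  have hpos : 0 ≤ (∫ y, fe y)/B := div_nonneg fe_pos.le hB.le
  have key : ‖∫ u, (aa h x - aa h u) * (fe (B*(x-u)) : ℂ)‖ ≤ (2*δ+Real.exp (δ-x)) * ((∫ y, fe y)/B) + 16/(δ^2*B^2)*Real.pi := by
    have h2 : ∫ u : ℝ, (1+(x-u)^2)⁻¹ = Real.pi := by
      rw [integral_sub_left_eq_self (fun u : ℝ => (1+u^2)⁻¹), integral_univ_inv_one_add_sq]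
    rw [← hJ, ← h2, ← integral_const_mul, ← integral_const_mul, ← integral_add (hi.const_mul _) (hq.const_mul _)]
    refine norm_integral_le_of_norm_le ((hi.const_mul _).add (hq.const_mul _)) (Eventually.of_forall fun u => ?_)
    rw [norm_mul, Complex.norm_real, Real.norm_of_nonneg (fe_nn _)]
    have hf := fe_nn (B*(x-u))
    have hE := Real.exp_pos (δ-x)
    by_cases hu : |x-u| ≤ δ
    · have : ‖aa h x - aa h u‖ ≤ 2*δ + Real.exp (δ-x) := by
        have := abs_le.1 hu
        rcases le_total u x with hux | hux
        · refine (aa_slow hh u x hux).trans (add_le_add (by linarith) (Real.exp_le_exp.2 (by linarith)))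
        · rw [norm_sub_rev]
          refine (aa_slow hh x u hux).trans (add_le_add (by linarith) (Real.exp_le_exp.2 (by linarith)))
      have h3 : 0 ≤ 16/(δ^2*B^2)*(1+(x-u)^2)⁻¹ := by positivity
      linarith [mul_le_mul_of_nonneg_right this hf]
    · push Not at hu
      have h1 : δ^2 ≤ (x-u)^2 := by rw [← sq_abs (x-u)]; gcongr
      have h4 : ‖aa h x - aa h u‖ ≤ 2 := (norm_sub_le _ _).trans (by linarith [aa_bd hh x, aa_bd hh u])
      have h5 : fe (B*(x-u)) ≤ 8/(δ^2*B^2)*(1+(x-u)^2)⁻¹ := by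
        have h6 := fe_cl (B*(x-u))
        rw [div_mul_eq_mul_div, le_div_iff₀ (by positivity), ← div_eq_mul_inv, le_div_iff₀ (by positivity)]
        have h7 : δ^2*(1+(x-u)^2) ≤ 2*(x-u)^2 := by
          have : δ^2 ≤ 1 := by nlinarith only [hδ1, hδ]
          nlinarith only [h1, this, mul_le_mul_of_nonneg_right this (sq_nonneg (x-u))]
        calc _ = fe (B*(x-u)) * B^2 * (δ^2*(1+(x-u)^2)) := by ring
          _ ≤ fe (B*(x-u)) * B^2 * (2*(x-u)^2) := by gcongr
          _ = 2 * (fe (B*(x-u)) * (B*(x-u))^2) := by ring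
          _ ≤ _ := by linarith
      calc _ ≤ 2 * (8/(δ^2*B^2)*(1+(x-u)^2)⁻¹) := by gcongr
        _ = 16/(δ^2*B^2)*(1+(x-u)^2)⁻¹ := by ring
        _ ≤ _ := le_add_of_nonneg_left (by positivity)
  have := congrArg norm e
  rw [norm_mul, Complex.norm_real, Real.norm_of_nonneg hpos] at this
  rw [this, hC]
  refine (norm_add_le _ _).trans ?_
  linarith only [key]

lemma wiener {h : ℕ → ℂ} (hh : ∀ n, ‖h n‖ ≤ 1) (E : ℂ → ℂ)
    (hE : ContinuousOn E {s | 1 ≤ s.re}) (hEL : ∀ s, 1 < s.re → E s = LSeries h s / s) :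
    Tendsto (aa h) atTop (𝓝 0) := by
  rw [NormedAddGroup.tendsto_nhds_zero]
  intro ε hε
  have hI := fe_pos
  set J := ∫ y, fe y
  set δ := min 1 (ε/8) with hδ
  have hδ0 : 0 < δ := lt_min one_pos (by linarith)
  have hδ8 : δ ≤ ε/8 := min_le_right _ _
  have hpi := Real.pi_pos
  set B := 64*Real.pi/(δ^2*J*ε) with hBd
  have hB : 0 < B := by positivity
  have hC := wie3 hh hB E hE hEL
  rw [NormedAddGroup.tendsto_nhds_zero] at hC
  have hx : Tendsto (fun x => Real.exp (δ-x)) atTop (𝓝 0) :=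
    Real.tendsto_exp_atBot.comp (tendsto_atBot_add_const_left _ δ tendsto_neg_atTop_atBot)
  filter_upwards [hC (ε/4*(J/B)) (by positivity), hx.eventually (gt_mem_nhds (by linarith : (0:ℝ) < ε/4))] with x h1 h2
  have h3 := wie4 hh hB hδ0 (min_le_left _ _) x
  have h4 : 16/(δ^2*B^2)*Real.pi = ε/4*(J/B) := by
    have : B * (δ^2*J*ε) = 64*Real.pi := by rw [hBd]; field_simp
    field_simp
    linear_combination -this
  have hJB : 0 < J/B := by positivity
  have h5 : (2*δ+Real.exp (δ-x)) * (J/B) < (ε/2) * (J/B) := mul_lt_mul_of_pos_right (by linarith only [hδ8, h2]) hJB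
  exact lt_of_mul_lt_mul_right (by rw [h4] at h3; linarith only [h1, h3, h5]) hJB.le

end MR

namespace MR
open MeasureTheory

lemma FF_tend {h : ℕ → ℂ} (h0 : h 0 = 0) (ha : Tendsto (aa h) atTop (𝓝 0)) {η : ℝ} (hη : 0 ≤ η) (t : ℝ) :
    Tendsto (fun Y => FF h η Y t) atTop (𝓝 0) := by
  rw [NormedAddGroup.tendsto_nhds_zero] at ha ⊢
  intro ε hε
  set K := 3 + (1+|t|) * Real.exp η with hK
  have hK0 : 0 < K := by positivity
  have hS : ∀ᶠ u : ℝ in atTop, ∀ v ≥ u, ‖∑ n ∈ Finset.Icc 0 ⌊v⌋₊, h n‖ ≤ ε/K * v := by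
    rw [eventually_forall_ge_atTop]
    filter_upwards [Real.tendsto_log_atTop.eventually (ha (ε/K) (by positivity)), eventually_gt_atTop 0] with v hv hv0
    rw [aa, Real.exp_log hv0, norm_mul, Complex.norm_real, Real.norm_of_nonneg (Real.exp_pos _).le, Real.exp_neg, Real.exp_log hv0, ← div_eq_mul_inv, div_lt_iff₀ hv0] at hv
    rw [← Finset.add_sum_Ioc_eq_sum_Icc (Nat.zero_le _), h0, zero_add]
    exact hv.le
  filter_upwards [hS, eventually_ge_atTop 1] with Y hY hY1
  have hY0 : 0 < Y := by linarith
  have he1 : 1 ≤ Real.exp η := Real.one_le_exp hη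
  have hYe : Y ≤ Y * Real.exp η := le_mul_of_one_le_right hY0.le he1
  set s : ℂ := -(1 + t*Complex.I) with hs
  have hsr : s.re = -1 := by simp [hs]
  have hs0 : s ≠ 0 := fun h => by rw [h] at hsr; norm_num at hsr
  have hder : ∀ u : ℝ, 0 < u → HasDerivAt (fun u : ℝ => (u:ℂ)^s) (s*(u:ℂ)^(s-1)) u := fun u hu => by
    have := hasDerivAt_ofReal_cpow_const hu.ne' hs0
    exact this
  have hn : ‖s‖ ≤ 1+|t| := by rw [hs, norm_neg]; refine (norm_add_le _ _).trans (by simp)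
  have e : FF h η Y t = ∑ n ∈ Finset.Ioc ⌊Y⌋₊ ⌊Y * Real.exp η⌋₊, ((n:ℝ):ℂ)^s * h n := by
    refine Finset.sum_congr rfl fun n hn => ?_
    have hn0 : 0 < n := (Nat.zero_le _).trans_lt (Finset.mem_Ioc.1 hn).1
    have hn' : ((n:ℝ):ℂ) ≠ 0 := by exact_mod_cast hn0.ne'
    rw [hs, neg_add, Complex.cpow_add _ _ hn', Complex.cpow_neg_one, Complex.cpow_def_of_ne_zero hn', ee, ← Complex.ofReal_log (by positivity)]
    push_cast
    rw [show Complex.log n * -(t*Complex.I) = -t * Complex.log n * Complex.I by ring]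
    ring
  rw [e, sum_mul_eq_sub_sub_integral_mul _ hY0.le hYe (fun u hu => (hder u (hY0.trans_le hu.1)).differentiableAt)]
  · have bb : ∀ u ≥ Y, ‖(u:ℂ)^s * ∑ k ∈ Finset.Icc 0 ⌊u⌋₊, h k‖ ≤ ε/K := fun u hu => by
      have hu0 : 0 < u := hY0.trans_le hu
      rw [norm_mul, Complex.norm_cpow_eq_rpow_re_of_pos hu0, hsr, Real.rpow_neg_one, inv_mul_le_iff₀ hu0, mul_comm]
      exact hY u hu
    have b1 : ‖((Y * Real.exp η : ℝ):ℂ)^s * ∑ k ∈ Finset.Icc 0 ⌊Y * Real.exp η⌋₊, h k‖ ≤ ε/K := bb _ hYe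
    have b2 : ‖(Y:ℂ)^s * ∑ k ∈ Finset.Icc 0 ⌊Y⌋₊, h k‖ ≤ ε/K := bb _ le_rfl
    have b3 : ‖∫ u in Set.Ioc Y (Y * Real.exp η), deriv (fun u : ℝ => (u:ℂ)^s) u * ∑ k ∈ Finset.Icc 0 ⌊u⌋₊, h k‖ ≤ ε/K*((1+|t|)*Real.exp η) := by
      have : ∀ u ∈ Set.Ioc Y (Y * Real.exp η), ‖deriv (fun u : ℝ => (u:ℂ)^s) u * ∑ k ∈ Finset.Icc 0 ⌊u⌋₊, h k‖ ≤ (1+|t|)*(ε/K)/Y := fun u hu => by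
        have hu0 : 0 < u := hY0.trans hu.1
        rw [(hder u hu0).deriv, Complex.cpow_sub _ _ (by exact_mod_cast hu0.ne'), Complex.cpow_one, mul_assoc, div_mul_eq_mul_div, norm_mul, norm_div, Complex.norm_real, Real.norm_of_nonneg hu0.le, mul_div_assoc]
        have := bb u hu.1.le
        gcongr; exact hu.1.le
      refine (norm_setIntegral_le_of_norm_le_const (by simp) this).trans ?_
      rw [Real.volume_real_Ioc_of_le hYe, div_mul_eq_mul_div, div_le_iff₀ hY0]
      have h3 : 0 ≤ (1+|t|)*(ε/K)*Y := by positivity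
      linarith
    calc _ ≤ ε/K + ε/K + ε/K*((1+|t|)*Real.exp η) := (norm_sub_le _ _).trans (add_le_add ((norm_sub_le _ _).trans (add_le_add b1 b2)) b3)
      _ < ε/K*K := by have : 0 < ε/K := by positivity
                      rw [hK]; linarith
      _ = ε := by field_simp
  · have : ContinuousOn (fun u : ℝ => s*(u:ℂ)^(s-1)) (Set.Icc Y (Y * Real.exp η)) := fun u hu =>
      (continuousAt_const.mul (Complex.continuousAt_ofReal_cpow_const _ _ (.inr (hY0.trans_le hu.1).ne'))).continuousWithinAt
    exact (this.congr fun u hu => (hder u (hY0.trans_le hu.1)).deriv).integrableOn_Icc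

open DirichletCharacter in
lemma mu_char {N : ℕ} [NeZero N] (χ : DirichletCharacter ℂ N) : Tendsto (aa fun n => χ n * (ArithmeticFunction.moebius n : ℂ)) atTop (𝓝 0) := by
  have hL : ∀ s : ℂ, 1 < s.re → LSeries (fun n => χ n * (ArithmeticFunction.moebius n : ℂ)) s = (LFunction χ s)⁻¹ := fun s hs => by
    rw [LFunction_eq_LSeries χ hs]
    exact eq_inv_of_mul_eq_one_right (LSeries.mul_mu_eq_one χ hs)
  have hb : ∀ n : ℕ, ‖χ n * (ArithmeticFunction.moebius n : ℂ)‖ ≤ 1 := fun n => by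
    rw [norm_mul]
    refine mul_le_one₀ (χ.norm_le_one _) (norm_nonneg _) ?_
    rw [Complex.norm_intCast]; exact_mod_cast ArithmeticFunction.abs_moebius_le_one
  have hr : ∀ s : ℂ, 1 ≤ s.re → s ≠ 0 := by rintro _ hs rfl; norm_num at hs
  by_cases hχ : χ = 1
  · subst hχ
    refine wiener hb (fun s => (s-1)/(LFunctionTrivChar₁ N s)/s) ?_ ?_
    · refine ((by fun_prop : ContinuousOn (fun s : ℂ => s-1) _).div (differentiable_LFunctionTrivChar₁ N).continuous.continuousOn fun s hs => ?_).div continuousOn_id fun s hs => hr s hs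
      by_cases h1 : s = 1
      · rw [h1]; exact LFunctionTrivChar₁_apply_one_ne_zero N
      · rw [LFunctionTrivChar₁, Function.update_of_ne h1]
        exact mul_ne_zero (sub_ne_zero.2 h1) (LFunction_ne_zero_of_one_le_re 1 (.inr h1) hs)
    · intro s hs
      have h1 : s ≠ 1 := by rintro rfl; norm_num at hs
      have := sub_ne_zero.2 h1
      rw [hL s hs, LFunctionTrivChar₁, Function.update_of_ne h1, LFunctionTrivChar]
      field_simp
  · refine wiener hb (fun s => (LFunction χ s)⁻¹/s) ?_ fun s hs => by rw [hL s hs]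
    exact ((differentiable_LFunction hχ).continuous.continuousOn.inv₀ fun s hs => LFunction_ne_zero_of_one_le_re χ (.inl hχ) hs).div continuousOn_id fun s hs => hr s hs

end MR

namespace MR
open MeasureTheory

noncomputable def kk (k : ℕ) (κ : ℝ) (m n : ℕ) : ℝ :=
  if m.Coprime k ∧ n.Coprime k ∧ m ≡ n [MOD k] then max 0 (κ - |Real.log m - Real.log n|) else 0

structure Sy {Ω : Type*} [MeasurableSpace Ω] (ν : Measure Ω) (ψ : ℕ → Ω → ℂ) (k : ℕ) (κ : ℝ) : Prop where
  k1 : 1 ≤ k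
  κ0 : 0 < κ
  fin : IsFiniteMeasure ν
  meas : ∀ n, Measurable (ψ n)
  mul : ∀ m n ω, ψ (m*n) ω = ψ m ω * ψ n ω
  bd : ∀ n ω, ‖ψ n ω‖ ≤ 1
  cor : ∀ m n, 1 ≤ m → 1 ≤ n → ∫ ω, ψ m ω * starRingEnd ℂ (ψ n ω) ∂ν = kk k κ m n

lemma kk_nn (k : ℕ) (κ : ℝ) (m n : ℕ) : 0 ≤ kk k κ m n := by
  unfold kk; split_ifs; exacts [le_max_left _ _, le_rfl]
lemma kk_symm (k : ℕ) (κ : ℝ) (m n : ℕ) : kk k κ m n = kk k κ n m := by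
  unfold kk; rw [abs_sub_comm]; congr 1
  exact propext ⟨fun h => ⟨h.2.1, h.1, h.2.2.symm⟩, fun h => ⟨h.2.1, h.1, h.2.2.symm⟩⟩

lemma log_close {κ Z : ℝ} {m n : ℕ} (hm : 1 ≤ m) (hn : 1 ≤ n) (hmZ : (m:ℝ) ≤ Z) (h : Real.log m - Real.log n < κ) (hκ : 0 < κ) : (m:ℝ) - n ≤ κ*Z := by
  have hm0 : (0:ℝ) < m := by exact_mod_cast hm
  have hn0 : (0:ℝ) < n := by exact_mod_cast hn
  have h1 := Real.one_sub_inv_le_log_of_pos (div_pos hm0 hn0)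
  rw [Real.log_div hm0.ne' hn0.ne', inv_div] at h1
  have h2 : (m:ℝ) - n = m * (1 - n/m) := by field_simp
  rw [h2]
  calc _ ≤ (m:ℝ) * κ := by gcongr; linarith
    _ ≤ κ*Z := by rw [mul_comm]; gcongr

lemma kk_row {k : ℕ} {κ Z : ℝ} (hk : 1 ≤ k) (hκ : 0 < κ) (s : Finset ℕ) (hs : ∀ n ∈ s, 1 ≤ n ∧ (n:ℝ) ≤ Z) (n : ℕ) (hn : n ∈ s) :
    ∑ m ∈ s, kk k κ m n ≤ if n.Coprime k then κ*(1+2*κ*Z/k) else 0 := by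
  split_ifs with hc
  swap
  · exact (Finset.sum_eq_zero fun m _ => if_neg fun h => hc h.2.1).le
  have hk0 : (0:ℝ) < k := by exact_mod_cast hk
  have hZ : 0 ≤ Z := (Nat.cast_nonneg n).trans (hs n hn).2
  set t := s.filter fun m => m ≡ n [MOD k] ∧ |Real.log m - Real.log n| < κ
  set T := κ*Z/k
  have hT : 0 ≤ T := by positivity
  have h1 : ∑ m ∈ s, kk k κ m n ≤ t.card * κ := by
    rw [← nsmul_eq_mul, ← Finset.sum_const, Finset.sum_filter]
    refine Finset.sum_le_sum fun m _ => ?_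
    unfold kk
    split_ifs with h2 h3 h3
    · exact max_le hκ.le (by linarith [abs_nonneg (Real.log m - Real.log n)])
    · refine max_le le_rfl ?_
      by_contra h4; exact h3 ⟨h2.2.2, by linarith⟩
    · exact hκ.le
    · rfl
  have h2 : t.card ≤ 2*⌊T⌋₊+1 := by
    have h3 : (Finset.Icc (-(⌊T⌋₊:ℤ)) ⌊T⌋₊).card = 2*⌊T⌋₊+1 := by rw [Int.card_Icc]; omega
    rw [← h3]
    have hdv : ∀ m ∈ t, (k:ℤ) ∣ m - n := fun m hm => (Nat.modEq_iff_dvd.1 (Finset.mem_filter.1 hm).2.1.symm)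
    refine Finset.card_le_card_of_injOn (fun m => ((m:ℤ)-n)/k) (fun m hm => ?_) fun m hm m' hm' h => ?_
    · obtain ⟨c, hc⟩ := hdv m hm
      obtain ⟨hms, _, hab⟩ := Finset.mem_filter.1 hm
      have hab := abs_lt.1 hab
      have u1 := log_close (hs m hms).1 (hs n hn).1 (hs m hms).2 hab.2 hκ
      have u2 := log_close (hs n hn).1 (hs m hms).1 (hs n hn).2 (by linarith) hκ
      have hcR : (m:ℝ) - n = k*c := by exact_mod_cast hc
      have hk' : (k:ℤ) ≠ 0 := by exact_mod_cast hk0.ne'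
      simp only [hc, Int.mul_ediv_cancel_left _ hk', Finset.coe_Icc, Set.mem_Icc]
      have : |(c:ℝ)| ≤ T := by
        have h6 : |(c:ℝ)| * k = |(m:ℝ)-n| := by rw [hcR, abs_mul, abs_of_pos hk0, mul_comm]
        rw [le_div_iff₀ hk0, h6, abs_le]
        constructor <;> linarith
      have h5 : c.natAbs ≤ ⌊T⌋₊ := Nat.le_floor (by rw [Nat.cast_natAbs]; exact_mod_cast this)
      omega
    · have := congrArg (· * (k:ℤ)) h
      simp only [Int.ediv_mul_cancel (hdv m hm), Int.ediv_mul_cancel (hdv m' hm')] at this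
      omega
  have h4 : (t.card:ℝ) ≤ 1 + 2*T := by
    calc (t.card:ℝ) ≤ 2*⌊T⌋₊+1 := by exact_mod_cast h2
      _ ≤ _ := by linarith [Nat.floor_le hT]
  calc _ ≤ _ := h1
    _ ≤ (1+2*T)*κ := by gcongr
    _ = _ := by rw [mul_comm]; congr 2; ring

variable {Ω : Type*} [MeasurableSpace Ω] {ν : Measure Ω} {ψ : ℕ → Ω → ℂ} {k : ℕ} {κ : ℝ}

lemma Sy.quad (S : Sy ν ψ k κ) (s : Finset ℕ) (hs : ∀ n ∈ s, 1 ≤ n) (a : ℕ → ℂ) :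
    ((∫ ω, ‖∑ n ∈ s, a n * ψ n ω‖^2 ∂ν : ℝ) : ℂ) = ∑ m ∈ s, ∑ n ∈ s, a m * starRingEnd ℂ (a n) * kk k κ m n := by
  have := S.fin
  have hi : ∀ m n, Integrable (fun ω => a m * starRingEnd ℂ (a n) * (ψ m ω * starRingEnd ℂ (ψ n ω))) ν := fun m n =>
    (bdd_int 1 ((S.meas m).mul (Complex.continuous_conj.measurable.comp (S.meas n))).aestronglyMeasurable fun ω => by
      simp only [Function.comp, Pi.mul_apply, norm_mul, RCLike.norm_conj]
      exact mul_le_one₀ (S.bd m ω) (norm_nonneg _) (S.bd n ω)).const_mul _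
  rw [← integral_complex_ofReal]
  have e : ∀ ω, ((‖∑ n ∈ s, a n * ψ n ω‖^2 : ℝ):ℂ) = ∑ m ∈ s, ∑ n ∈ s, a m * starRingEnd ℂ (a n) * (ψ m ω * starRingEnd ℂ (ψ n ω)) := fun ω => by
    rw [Complex.ofReal_pow, ← Complex.mul_conj', map_sum, Finset.sum_mul_sum]
    refine Finset.sum_congr rfl fun m _ => Finset.sum_congr rfl fun n _ => ?_
    rw [map_mul]; ring
  simp_rw [e]
  rw [integral_finsetSum _ fun m _ => integrable_finsetSum _ fun n _ => hi m n]
  refine Finset.sum_congr rfl fun m hm => ?_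
  rw [integral_finsetSum _ fun n _ => hi m n]
  refine Finset.sum_congr rfl fun n hn => ?_
  rw [integral_const_mul, S.cor m n (hs m hm) (hs n hn)]

lemma Sy.ls (S : Sy ν ψ k κ) {Z : ℝ} (s : Finset ℕ) (hs : ∀ n ∈ s, 1 ≤ n ∧ (n:ℝ) ≤ Z) (a : ℕ → ℂ) :
    ∫ ω, ‖∑ n ∈ s, a n * ψ n ω‖^2 ∂ν ≤ κ*(1+2*κ*Z/k) * ∑ n ∈ s with n.Coprime k, ‖a n‖^2 := by
  have h1 := S.quad s (fun n hn => (hs n hn).1) a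
  have h2 : ∫ ω, ‖∑ n ∈ s, a n * ψ n ω‖^2 ∂ν ≤ ∑ m ∈ s, ∑ n ∈ s, (‖a m‖^2/2 + ‖a n‖^2/2) * kk k κ m n := by
    calc _ ≤ ‖((∫ ω, ‖∑ n ∈ s, a n * ψ n ω‖^2 ∂ν : ℝ) : ℂ)‖ := by rw [Complex.norm_real]; exact le_abs_self _
      _ ≤ _ := by
        rw [h1]
        refine norm_sum_le_of_le _ fun m _ => norm_sum_le_of_le _ fun n _ => ?_
        rw [norm_mul, norm_mul, RCLike.norm_conj, Complex.norm_real, Real.norm_of_nonneg (kk_nn _ _ _ _)]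
        have := kk_nn k κ m n
        gcongr
        nlinarith [sq_nonneg (‖a m‖-‖a n‖)]
  have h3 : ∑ m ∈ s, ∑ n ∈ s, (‖a m‖^2/2 + ‖a n‖^2/2) * kk k κ m n = ∑ n ∈ s, ‖a n‖^2 * ∑ m ∈ s, kk k κ m n := by
    simp_rw [add_mul, Finset.sum_add_distrib, Finset.mul_sum]
    rw [Finset.sum_comm (f := fun m n => ‖a n‖^2/2 * kk k κ m n), ← Finset.sum_add_distrib]
    refine Finset.sum_congr rfl fun m _ => ?_
    rw [← Finset.sum_add_distrib]
    refine Finset.sum_congr rfl fun n _ => ?_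
    rw [kk_symm k κ m n]; ring
  rw [h3] at h2
  refine h2.trans ?_
  rw [Finset.mul_sum, Finset.sum_filter]
  refine Finset.sum_le_sum fun n hn => ?_
  have := mul_le_mul_of_nonneg_left (kk_row S.k1 S.κ0 s hs n hn) (sq_nonneg ‖a n‖)
  refine this.trans (le_of_eq ?_)
  split_ifs <;> ring

end MR

namespace MR
open MeasureTheory

lemma cop0 {k : ℕ} (hk : 1 ≤ k) (M : ℕ) : |(∑ n ∈ Finset.Ioc 0 M, if n.Coprime k then (1:ℝ) else 0) - M*k.totient/k| ≤ k.totient := by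
  have hk0 : (0:ℝ) < k := by exact_mod_cast hk
  rw [← Finset.sum_filter, Finset.sum_const, nsmul_one]
  have e : ∀ j, (((Finset.Ioc 0 (k*j)).filter fun n => n.Coprime k).card) = k.totient*j := fun j => by
    induction j with
    | zero => simp
    | succ j ih =>
      have h1 : ((Finset.Ico (k*j+1) (k*j+1+k)).filter fun n => n.Coprime k).card = k.totient := by
        rw [← Nat.filter_coprime_Ico_eq_totient k (k*j+1)]
        exact congrArg _ (Finset.filter_congr fun n _ => Nat.coprime_comm)
      have h2 : Finset.Ioc 0 (k*(j+1)) = Finset.Ioc 0 (k*j) ∪ Finset.Ico (k*j+1) (k*j+1+k) := by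
        ext n; simp only [Finset.mem_Ioc, Finset.mem_union, Finset.mem_Ico, mul_add, mul_one]; omega
      rw [h2, Finset.filter_union, Finset.card_union_of_disjoint, ih, h1]; · ring
      refine Finset.disjoint_filter_filter (Finset.disjoint_left.2 fun n h3 h4 => ?_)
      simp only [Finset.mem_Ioc, Finset.mem_Ico] at h3 h4; omega
  have h1 := Nat.div_add_mod M k
  have h2 := Nat.mod_lt M hk
  have m1 : k*(M/k) ≤ M := by omega
  have m2 : M ≤ k*(M/k+1) := by rw [mul_add]; omega
  have l1 := e (M/k) ▸ Finset.card_le_card (Finset.filter_subset_filter (fun n : ℕ => n.Coprime k) (Finset.Ioc_subset_Ioc_right m1 (a := 0)))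
  have l2 := e (M/k+1) ▸ Finset.card_le_card (Finset.filter_subset_filter (fun n : ℕ => n.Coprime k) (Finset.Ioc_subset_Ioc_right m2 (a := 0)))
  have l1' : (k.totient:ℝ)*((M/k:ℕ):ℝ) ≤ ((Finset.Ioc 0 M).filter fun n => n.Coprime k).card := by exact_mod_cast l1
  have l2' : (((Finset.Ioc 0 M).filter fun n => n.Coprime k).card:ℝ) ≤ k.totient*(((M/k:ℕ):ℝ)+1) := by exact_mod_cast l2
  have m1' : (k:ℝ)*((M/k:ℕ):ℝ) ≤ M := by exact_mod_cast m1
  have m2' : (M:ℝ) ≤ k*(((M/k:ℕ):ℝ)+1) := by exact_mod_cast m2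
  have f1 : (k.totient:ℝ)*((M/k:ℕ):ℝ) ≤ M*k.totient/k := by
    rw [le_div_iff₀ hk0]
    calc _ = k.totient*((k:ℝ)*((M/k:ℕ):ℝ)) := by ring
      _ ≤ k.totient*M := by gcongr
      _ = _ := by ring
  have f2 : (M*k.totient/k:ℝ) ≤ k.totient*(((M/k:ℕ):ℝ)+1) := by
    rw [div_le_iff₀ hk0]
    calc (M*k.totient:ℝ) ≤ (k*(((M/k:ℕ):ℝ)+1))*k.totient := by gcongr
      _ = _ := by ring
  rw [abs_le]; constructor <;> linarith only [l1', f2, l2', f1]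

noncomputable def cnt (k D : ℕ) (a b : ℝ) : ℝ := ∑ n ∈ Finset.Ioc ⌊a⌋₊ ⌊b⌋₊ with D ∣ n, if n.Coprime k then (1:ℝ) else 0

lemma cnt_bd {k D : ℕ} (hk : 1 ≤ k) (hD : 1 ≤ D) (hDk : D.Coprime k) {a b : ℝ} (ha : 0 ≤ a) (hab : a ≤ b) :
    |cnt k D a b - (b-a)*k.totient/k*(1/D)| ≤ 4*k := by
  have h := dvd_reindex a b hD (fun n => ((if n.Coprime k then (1:ℝ) else 0 : ℝ):ℂ))
  rw [← Complex.ofReal_sum, ← Complex.ofReal_sum] at h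
  replace h := Complex.ofReal_injective h
  have e0 : ∀ m : ℕ, (D*m).Coprime k ↔ m.Coprime k := fun m => by rw [Nat.coprime_mul_iff_left]; exact and_iff_right hDk
  simp_rw [e0] at h
  have hk0 : (0:ℝ) < k := by exact_mod_cast hk
  have hD0 : (0:ℝ) < D := by exact_mod_cast hD
  have hft : (k.totient:ℝ) ≤ k := by exact_mod_cast Nat.totient_le k
  have hk1 : (1:ℝ) ≤ k := by exact_mod_cast hk
  have hr : ∀ x : ℝ, 0 ≤ x → |(∑ n ∈ Finset.Ioc 0 ⌊x/D⌋₊, if n.Coprime k then (1:ℝ) else 0) - x/D*k.totient/k| ≤ 2*k := fun x hx => by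
    have h1 := abs_le.1 (cop0 hk ⌊x/D⌋₊)
    have h2 := Nat.floor_le (div_nonneg hx hD0.le)
    have h3 := (Nat.lt_floor_add_one (x/D)).le
    have hfk : (k.totient:ℝ)/k ≤ 1 := (div_le_one hk0).2 hft
    have h4 : (⌊x/D⌋₊:ℝ)*k.totient/k ≤ x/D*k.totient/k := by gcongr
    have h5 : x/D*k.totient/k ≤ (⌊x/D⌋₊:ℝ)*k.totient/k + k.totient/k := by
      rw [← add_div, ← add_one_mul]; gcongr
    rw [abs_le]; constructor <;> linarith only [hft, hk1, h1, hfk, h5, hk0, h4]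
  have e : cnt k D a b = (∑ n ∈ Finset.Ioc 0 ⌊b/D⌋₊, if n.Coprime k then (1:ℝ) else 0) - ∑ n ∈ Finset.Ioc 0 ⌊a/D⌋₊, if n.Coprime k then (1:ℝ) else 0 := by
    have hle : ⌊a/D⌋₊ ≤ ⌊b/D⌋₊ := by gcongr
    rw [cnt, h, eq_sub_iff_add_eq', ← Finset.sum_union]
    · rw [Finset.Ioc_union_Ioc_eq_Ioc (Nat.zero_le _) hle]
    · exact Finset.disjoint_left.2 fun n h1 h2 => by simp only [Finset.mem_Ioc] at h1 h2; omega
  have h1 := abs_le.1 (hr a ha)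
  have h2 := abs_le.1 (hr b (ha.trans hab))
  have e2 : (b-a)*k.totient/k*(1/D) = b/D*k.totient/k - a/D*k.totient/k := by field_simp
  rw [e, e2, abs_le]; constructor <;> linarith only [h1, h2]

lemma TK {k : ℕ} (hk : 1 ≤ k) (s : Finset ℕ) (D : ℕ → ℕ) (hD : ∀ p ∈ s, 1 ≤ D p ∧ (D p).Coprime k)
    (hc : ∀ p ∈ s, ∀ p' ∈ s, p ≠ p' → (D p).Coprime (D p')) {a b : ℝ} (ha : 0 ≤ a) (hab : a ≤ b) (W : ℝ) (hW : W = ∑ p ∈ s, (1/D p:ℝ)) :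
    ∑ n ∈ Finset.Ioc ⌊a⌋₊ ⌊b⌋₊ with n.Coprime k, ((∑ p ∈ s, if D p ∣ n then (1:ℝ) else 0) - W)^2 ≤ (b-a)*k.totient/k*W + 16*k*s.card^2 := by
  set X := (b-a)*k.totient/k with hX
  have hX0 : 0 ≤ X := by have := sub_nonneg.2 hab; positivity
  have hW0 : 0 ≤ W := by rw [hW]; positivity
  have hWc : W ≤ s.card := by
    rw [hW, ← nsmul_one, ← Finset.sum_const]
    refine Finset.sum_le_sum fun p hp => ?_
    rw [div_le_one (by exact_mod_cast (hD p hp).1)]; exact_mod_cast (hD p hp).1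
  have hcnt : ∀ d, cnt k d a b = ∑ n ∈ Finset.Ioc ⌊a⌋₊ ⌊b⌋₊ with n.Coprime k, if d ∣ n then (1:ℝ) else 0 := fun d => by
    rw [cnt, ← Finset.sum_filter, ← Finset.sum_filter, Finset.filter_comm]
  have e : ∑ n ∈ Finset.Ioc ⌊a⌋₊ ⌊b⌋₊ with n.Coprime k, ((∑ p ∈ s, if D p ∣ n then (1:ℝ) else 0) - W)^2 =
      (∑ p ∈ s, ∑ p' ∈ s, ∑ n ∈ Finset.Ioc ⌊a⌋₊ ⌊b⌋₊ with n.Coprime k, (if D p ∣ n then (1:ℝ) else 0) * if D p' ∣ n then 1 else 0)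
      - 2*W*(∑ p ∈ s, cnt k (D p) a b) + W^2*cnt k 1 a b := by
    have hA : ∀ f : ℕ → ℕ → ℝ, ∑ p ∈ s, ∑ p' ∈ s, ∑ n ∈ Finset.Ioc ⌊a⌋₊ ⌊b⌋₊ with n.Coprime k, f p n * f p' n =
        ∑ n ∈ Finset.Ioc ⌊a⌋₊ ⌊b⌋₊ with n.Coprime k, (∑ p ∈ s, f p n)^2 := fun f => by
      simp_rw [sq, Finset.sum_mul_sum]
      exact (Finset.sum_comm.trans (Finset.sum_congr rfl fun p _ => Finset.sum_comm)).symm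
    rw [hA fun p n => if D p ∣ n then (1:ℝ) else 0]
    simp_rw [hcnt]
    rw [Finset.sum_comm (s := s), Finset.mul_sum, Finset.mul_sum, ← Finset.sum_sub_distrib, ← Finset.sum_add_distrib]
    refine Finset.sum_congr rfl fun n _ => ?_
    rw [if_pos (one_dvd n)]; ring
  have p1 : ∀ p ∈ s, ∀ p' ∈ s, (∑ n ∈ Finset.Ioc ⌊a⌋₊ ⌊b⌋₊ with n.Coprime k, (if D p ∣ n then (1:ℝ) else 0) * if D p' ∣ n then 1 else 0) ≤
      X*(1/D p)*(1/D p') + (if p = p' then X*(1/D p) else 0) + 4*k := fun p hp p' hp' => by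
    by_cases h : p = p'
    · subst h
      have := (abs_le.1 (cnt_bd hk (hD p hp).1 (hD p hp).2 ha hab)).2
      simp only [mul_ite, mul_one, mul_zero, if_true, ← ite_and, and_self]
      rw [← hcnt]
      have : 0 ≤ X*(1/D p)*(1/D p) := by positivity
      linarith
    · have hco := hc p hp p' hp' h
      have := (abs_le.1 (cnt_bd hk (Nat.mul_pos (hD p hp).1 (hD p' hp').1) (Nat.Coprime.mul_left (hD p hp).2 (hD p' hp').2) ha hab)).2
      rw [hcnt] at this
      simp only [if_neg h, mul_ite, mul_one, mul_zero, ← ite_and]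
      have e3 : ∀ n, D p' ∣ n ∧ D p ∣ n ↔ D p * D p' ∣ n := fun n => ⟨fun h => hco.mul_dvd_of_dvd_of_dvd h.2 h.1, fun h => ⟨(Dvd.intro_left _ rfl).trans h, (Dvd.intro _ rfl).trans h⟩⟩
      simp_rw [e3]
      have e4 : X*(1/D p)*(1/D p') = X*(1/((D p*D p':ℕ):ℝ)) := by push_cast; rw [one_div, one_div, one_div, mul_inv]; ring
      linarith only [this, e4]
  have p2 : X*W - 4*k*s.card ≤ ∑ p ∈ s, cnt k (D p) a b := by
    rw [hW, Finset.mul_sum, mul_comm (4*(k:ℝ)), ← nsmul_eq_mul, ← Finset.sum_const, ← Finset.sum_sub_distrib]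
    exact Finset.sum_le_sum fun p hp => by linarith [(abs_le.1 (cnt_bd hk (hD p hp).1 (hD p hp).2 ha hab)).1]
  have p3 : cnt k 1 a b ≤ X + 4*k := by
    have := (abs_le.1 (cnt_bd hk le_rfl (Nat.coprime_one_left k) ha hab)).2
    rw [Nat.cast_one, div_one, mul_one] at this; linarith
  have p4 : (∑ p ∈ s, ∑ p' ∈ s, ∑ n ∈ Finset.Ioc ⌊a⌋₊ ⌊b⌋₊ with n.Coprime k, (if D p ∣ n then (1:ℝ) else 0) * if D p' ∣ n then 1 else 0) ≤ X*W^2 + X*W + 4*k*s.card^2 := by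
    refine (Finset.sum_le_sum fun p hp => Finset.sum_le_sum fun p' hp' => p1 p hp p' hp').trans (le_of_eq ?_)
    simp_rw [Finset.sum_add_distrib, Finset.sum_ite_eq, Finset.sum_const, nsmul_eq_mul, ← Finset.mul_sum, ← Finset.sum_mul]
    rw [← hW, Finset.sum_congr rfl fun p hp => if_pos hp, ← Finset.mul_sum, ← hW]
    ring
  rw [e]
  have q1 := mul_le_mul_of_nonneg_left p2 (by positivity : 0 ≤ 2*W)
  have q2 := mul_le_mul_of_nonneg_left p3 (by positivity : 0 ≤ W^2)
  have q3 : W^2 ≤ (s.card:ℝ)^2 := by gcongr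
  have q4 : W*s.card ≤ (s.card:ℝ)^2 := by rw [sq]; gcongr
  have q5 := mul_le_mul_of_nonneg_left q3 (by positivity : (0:ℝ) ≤ 4*k)
  have q6 := mul_le_mul_of_nonneg_left q4 (by positivity : (0:ℝ) ≤ 8*k)
  linarith

lemma TK2 {k : ℕ} (hk : 1 ≤ k) (s : Finset ℕ) (D : ℕ → ℕ) (hD : ∀ p ∈ s, 1 ≤ D p ∧ (D p).Coprime k)
    (hc : ∀ p ∈ s, ∀ p' ∈ s, p ≠ p' → (D p).Coprime (D p')) {a b : ℝ} (ha : 0 ≤ a) (hab : a ≤ b) (W : ℝ) (hW : W = ∑ p ∈ s, (1/D p:ℝ)) :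
    ∑ n ∈ Finset.Ioc ⌊a⌋₊ ⌊b⌋₊ with n.Coprime k, (∑ p ∈ s, if D p ∣ n then (1:ℝ) else 0)^2 ≤ (b-a)*k.totient/k*(2*W+2*W^2) + 32*k*s.card^2 + 8*k*W^2 := by
  have h := TK hk s D hD hc ha hab W hW
  have p3 : cnt k 1 a b ≤ (b-a)*k.totient/k + 4*k := by
    have := (abs_le.1 (cnt_bd hk le_rfl (Nat.coprime_one_left k) ha hab)).2
    rw [Nat.cast_one, div_one, mul_one] at this; linarith
  have hcnt : cnt k 1 a b = ∑ n ∈ Finset.Ioc ⌊a⌋₊ ⌊b⌋₊ with n.Coprime k, (1:ℝ) := by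
    rw [cnt, ← Finset.sum_filter, Finset.filter_true_of_mem (p := fun n => 1 ∣ n) fun _ _ => one_dvd _]
  have : ∑ n ∈ Finset.Ioc ⌊a⌋₊ ⌊b⌋₊ with n.Coprime k, (∑ p ∈ s, if D p ∣ n then (1:ℝ) else 0)^2 ≤
      2 * ∑ n ∈ Finset.Ioc ⌊a⌋₊ ⌊b⌋₊ with n.Coprime k, ((∑ p ∈ s, if D p ∣ n then (1:ℝ) else 0) - W)^2 + 2*W^2*cnt k 1 a b := by
    rw [hcnt, Finset.mul_sum, Finset.mul_sum, ← Finset.sum_add_distrib]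
    refine Finset.sum_le_sum fun n _ => ?_
    nlinarith only [sq_nonneg ((∑ p ∈ s, if D p ∣ n then (1:ℝ) else 0) - 2*W)]
  have q2 := mul_le_mul_of_nonneg_left p3 (by positivity : 0 ≤ 2*W^2)
  linarith only [h, this, q2]

end MR

namespace MR
open MeasureTheory

variable {Ω : Type*} [MeasurableSpace Ω] {ν : Measure Ω} {ψ : ℕ → Ω → ℂ} {k : ℕ} {κ : ℝ}

lemma xv_p {H p : ℕ} (hH : 1 ≤ H) (hp : 2 ≤ p) : xv H (vv H p) < p ∧ (p:ℝ) ≤ xv H (vv H p) * Real.exp (1/H) := by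
  have h := vv_bd hH hp
  have hH0 : (0:ℝ) < H := by exact_mod_cast hH
  have hp0 : (0:ℝ) < p := by exact_mod_cast (by omega : 0 < p)
  constructor
  · rw [xv, ← Real.lt_log_iff_exp_lt hp0, div_lt_iff₀ hH0]; linarith
  · rw [xv, ← Real.exp_add, ← Real.log_le_iff_le_exp hp0, ← add_div, le_div_iff₀ hH0]; linarith

noncomputable def JI (η Y x : ℝ) : Finset ℕ := Finset.Ioc ⌊Y/x⌋₊ ⌊Y*Real.exp η/x⌋₊
noncomputable def RR (g : ℕ → ℂ) (ψ : ℕ → Ω → ℂ) (η Y x : ℝ) (ω : Ω) : ℂ := ∑ m ∈ JI η Y x, (g m/m) * ψ m ω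
noncomputable def FT (g : ℕ → ℂ) (ψ : ℕ → Ω → ℂ) (η Y : ℝ) (H : ℕ) (s : Finset ℕ) (ω : Ω) : ℂ :=
  ∑ p ∈ s, (1/p * ψ p ω) * RR g ψ η Y (xv H (vv H p)) ω

lemma mem_JI {η Y x : ℝ} (hY : 0 < Y) (hx : 0 < x) (n : ℕ) : n ∈ JI η Y x ↔ Y < x*n ∧ x*n ≤ Y*Real.exp η := by
  rw [JI, Finset.mem_Ioc, Nat.floor_lt (by positivity), Nat.le_floor_iff (by positivity), div_lt_iff₀ hx, le_div_iff₀ hx, mul_comm x]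

noncomputable def cc (g : ℕ → ℂ) (η Y : ℝ) (H : ℕ) (s : Finset ℕ) (W : ℝ) (n : ℕ) : ℂ :=
  (if n ∈ JI η Y 1 then g n else 0) + (W:ℂ)⁻¹ * ∑ p ∈ s, if p ∣ n ∧ n/p ∈ JI η Y (xv H (vv H p)) then g (n/p) else 0

lemma cc_sum (hmul : ∀ m n ω, ψ (m*n) ω = ψ m ω * ψ n ω) (g : ℕ → ℂ) {η Y : ℝ} (hY : 1 ≤ Y) {H : ℕ} (hH : 1 ≤ H) (s : Finset ℕ) (hs : ∀ p ∈ s, 2 ≤ p) (W : ℝ) (ω : Ω) :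
    RR g ψ η Y 1 ω + (W:ℂ)⁻¹ * FT g ψ η Y H s ω = ∑ n ∈ JI (η+1/H) Y 1, (cc g η Y H s W n/n) * ψ n ω := by
  have hY0 : 0 < Y := by linarith
  simp_rw [cc, add_div, add_mul, Finset.sum_add_distrib]
  congr 1
  · simp_rw [ite_div, ite_mul, zero_div, zero_mul, ← Finset.sum_filter]
    refine Finset.sum_congr ?_ fun _ _ => rfl
    ext n
    simp only [Finset.mem_filter, mem_JI hY0 one_pos, one_mul]
    have : Real.exp η ≤ Real.exp (η+1/H) := Real.exp_le_exp.2 (by linarith [show (0:ℝ) ≤ 1/H by positivity])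
    exact ⟨fun h => ⟨⟨h.1, h.2.trans (by gcongr)⟩, h⟩, fun h => h.2⟩
  · simp_rw [mul_div_assoc, mul_assoc, ← Finset.mul_sum]
    congr 1
    simp_rw [Finset.sum_div, Finset.sum_mul]
    rw [Finset.sum_comm, FT]
    refine Finset.sum_congr rfl fun p hp => ?_
    have hp2 := hs p hp
    have hp0 : 0 < p := by omega
    obtain ⟨x1, x2⟩ := xv_p hH hp2
    have hx := xv_pos H (vv H p)
    simp_rw [ite_div, ite_mul, zero_div, zero_mul, ← Finset.sum_filter]
    rw [RR, Finset.mul_sum]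
    refine Finset.sum_nbij' (fun m => p*m) (fun n => n/p) (fun m hm => ?_) (fun n hn => (Finset.mem_filter.1 hn).2.2) (fun m _ => Nat.mul_div_cancel_left _ hp0)
      (fun n hn => Nat.mul_div_cancel' (Finset.mem_filter.1 hn).2.1) fun m _ => ?_
    · refine Finset.mem_filter.2 ⟨?_, Dvd.intro _ rfl, by rwa [Nat.mul_div_cancel_left _ hp0]⟩
      rw [mem_JI hY0 hx] at hm
      rw [mem_JI hY0 one_pos, one_mul, Real.exp_add]
      push_cast
      refine ⟨hm.1.trans_le (by gcongr), ?_⟩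
      calc (p:ℝ)*m ≤ (xv H (vv H p) * Real.exp (1/H))*m := by gcongr
        _ = xv H (vv H p)*m*Real.exp (1/H) := by ring
        _ ≤ (Y*Real.exp η)*Real.exp (1/H) := mul_le_mul_of_nonneg_right hm.2 (Real.exp_pos _).le
        _ = _ := by ring
    · simp only [Nat.mul_div_cancel_left _ hp0, hmul]
      push_cast; rw [mul_comm (p:ℂ) m, ← div_div]; ring

lemma cc_bd {g : ℕ → ℂ} (hg : ∀ n, ‖g n‖ ≤ 1) {η Y : ℝ} (hη : 0 ≤ η) (hY : 1 ≤ Y) {H : ℕ} (hH : 1 ≤ H) (s : Finset ℕ) (hs : ∀ p ∈ s, 2 ≤ p)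
    (hgp : ∀ p ∈ s, ∀ m, g (p*m) = if p ∣ m then 0 else - g m) {W : ℝ} (hW : 0 < W) (n : ℕ) (hn : Y < n) :
    W^2 * ‖cc g η Y H s W n‖^2 ≤ 3*(if n ∈ JI η Y 1 then ((∑ p ∈ s, if p ∣ n then (1:ℝ) else 0) - W)^2 else 0)
      + 3*(if n ∈ JI (1/H) Y 1 ∪ JI (1/H) (Y*Real.exp η) 1 then (∑ p ∈ s, if p ∣ n then (1:ℝ) else 0)^2 else 0)
      + 3*(∑ p ∈ s, if p^2 ∣ n then (1:ℝ) else 0)^2 := by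
  have hY0 : 0 < Y := by linarith
  have hWc : (W:ℂ) ≠ 0 := by exact_mod_cast hW.ne'
  set E : Prop := n ∈ JI (1/H) Y 1 ∪ JI (1/H) (Y*Real.exp η) 1 with hE
  set D : Prop := n ∈ JI η Y 1 with hD
  have he := Real.exp_pos η
  have key : ∀ p ∈ s, ‖(if p ∣ n ∧ n/p ∈ JI η Y (xv H (vv H p)) then g (n/p) else 0) + (if D then g n else 0) * if p ∣ n then 1 else 0‖ ≤
      (if E then 1 else 0)*(if p ∣ n then 1 else 0) + if p^2 ∣ n then (1:ℝ) else 0 := by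
    intro p hp
    by_cases hpn : p ∣ n
    swap
    · simp only [hpn, false_and, if_false, mul_zero, add_zero, norm_zero, zero_add]; split_ifs <;> norm_num
    obtain ⟨m, rfl⟩ := hpn
    have hp2 := hs p hp
    have hp0 : 0 < p := by omega
    obtain ⟨x1, x2⟩ := xv_p hH hp2
    have hx := xv_pos H (vv H p)
    simp only [Nat.mul_div_cancel_left _ hp0, dvd_mul_right, true_and, if_true, mul_one, sq, Nat.mul_dvd_mul_iff_left hp0, hgp p hp m]
    have hgm := hg m
    by_cases hpm : p ∣ m
    · simp only [hpm, if_true, ite_self, add_zero]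
      split_ifs <;> simp <;> linarith
    · simp only [hpm, if_false, add_zero]
      simp only [hD, mem_JI hY0 hx, mem_JI hY0 one_pos, one_mul]
      have hEE : ¬ E → ¬ (((p*m:ℕ):ℝ) ≤ Y * Real.exp (1/H)) ∧ (Y*Real.exp η < (p*m:ℕ) → ¬ (((p*m:ℕ):ℝ) ≤ Y*Real.exp η * Real.exp (1/H))) := by
        rw [hE, Finset.mem_union, mem_JI hY0 one_pos, mem_JI (by positivity) one_pos, one_mul]; tauto
      by_cases hEv : E
      · simp only [if_pos hEv]; split_ifs <;> simp <;> linarith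
      · obtain ⟨h1, h2⟩ := hEE hEv
        rw [if_neg hEv]
        push_cast at h1 h2 hn ⊢
        have hm0 : (0:ℝ) ≤ m := m.cast_nonneg
        have a1 : (p:ℝ)*m ≤ xv H (vv H p) * m*Real.exp (1/H) := by
          calc _ ≤ (xv H (vv H p) * Real.exp (1/H))*m := by gcongr
            _ = _ := by ring
        have a2 : xv H (vv H p) * m ≤ p*m := by gcongr
        have b1 : Y < xv H (vv H p) * m := by
          by_contra h; push Not at h; exact h1 (a1.trans (by gcongr))
        have b2 : (xv H (vv H p) * m ≤ Y*Real.exp η) ↔ (p:ℝ)*m ≤ Y*Real.exp η :=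
          ⟨fun h => by by_contra h'; push Not at h'; exact h2 h' (a1.trans (by gcongr)), fun h => a2.trans h⟩
        simp only [b1, b2, hn, true_and]
        split_ifs <;> simp
  set ω := ∑ p ∈ s, if p ∣ n then (1:ℝ) else 0 with hω
  set ω2 := ∑ p ∈ s, if p^2 ∣ n then (1:ℝ) else 0
  have hωc : (ω:ℂ) = ∑ p ∈ s, if p ∣ n then (1:ℂ) else 0 := by rw [hω, Complex.ofReal_sum]; exact Finset.sum_congr rfl fun p _ => by split_ifs <;> simp
  have e : W * cc g η Y H s W n = (if D then g n else 0) * (W - ω) + ∑ p ∈ s, ((if p ∣ n ∧ n/p ∈ JI η Y (xv H (vv H p)) then g (n/p) else 0) + (if D then g n else 0) * if p ∣ n then 1 else 0) := by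
    rw [cc, Finset.sum_add_distrib, ← Finset.mul_sum, ← hωc, mul_add, mul_inv_cancel_left₀ hWc]; ring
  have n1 : ‖∑ p ∈ s, ((if p ∣ n ∧ n/p ∈ JI η Y (xv H (vv H p)) then g (n/p) else 0) + (if D then g n else 0) * if p ∣ n then 1 else 0)‖ ≤ (if E then 1 else 0)*ω + ω2 := by
    refine (norm_sum_le_of_le _ key).trans (le_of_eq ?_)
    rw [Finset.sum_add_distrib, ← Finset.mul_sum]
  have n2 : ‖(if D then g n else 0) * ((W:ℂ) - ω)‖ ≤ (if D then 1 else 0)*|ω - W| := by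
    rw [norm_mul, ← Complex.ofReal_sub, Complex.norm_real, Real.norm_eq_abs, abs_sub_comm]
    gcongr
    split_ifs; exacts [hg n, by simp]
  have n3 : W * ‖cc g η Y H s W n‖ ≤ (if D then 1 else 0)*|ω - W| + ((if E then 1 else 0)*ω + ω2) := by
    have := congrArg norm e
    rw [norm_mul, Complex.norm_real, Real.norm_of_nonneg hW.le] at this
    rw [this]; exact (norm_add_le _ _).trans (add_le_add n2 n1)
  have n4 : ∀ x y z : ℝ, (x+(y+z))^2 ≤ 3*x^2+3*y^2+3*z^2 := fun x y z => by nlinarith [sq_nonneg (x-y), sq_nonneg (x-z), sq_nonneg (y-z)]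
  rw [← mul_pow]
  refine (pow_le_pow_left₀ (by positivity) n3 2).trans ((n4 _ _ _).trans (le_of_eq ?_))
  rw [mul_pow, mul_pow, sq_abs]
  split_ifs <;> ring

end MR

namespace MR
open MeasureTheory

variable {Ω : Type*} [MeasurableSpace Ω] {ν : Measure Ω} {ψ : ℕ → Ω → ℂ} {k : ℕ} {κ : ℝ}

lemma exp_half : Real.exp (1/2) ≤ 2 := by
  have h : Real.exp (1/2)^2 = Real.exp 1 := by rw [← Real.exp_nat_mul]; norm_num
  nlinarith [Real.exp_one_lt_d9, Real.exp_pos (1/2)]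

lemma exp_inv {H : ℕ} (hH : 1 ≤ H) : Real.exp (1/H) - 1 ≤ 2/H ∧ 1 ≤ Real.exp (1/H) := by
  have h1 : (1:ℝ)/H ≤ 1 := by rw [div_le_one (by exact_mod_cast hH)]; exact_mod_cast hH
  have h0 : (0:ℝ) ≤ 1/H := by positivity
  have := abs_le.1 (Real.abs_exp_sub_one_sub_id_le (x := 1/H) (by rwa [abs_of_nonneg h0]))
  refine ⟨?_, Real.one_le_exp h0⟩
  rw [show (2:ℝ)/H = 2*(1/H) by ring]; nlinarith

lemma Sy.cf (k1 : 1 ≤ k) {L Y c : ℝ} (hL : 1 ≤ L) (hY : 0 < Y) {Z : ℝ} (hZ : Z ≤ c*Y) (hκ : κ = L*k/Y) : κ*(1+2*κ*Z/k) ≤ (2*c+1)*(L^2*k/Y) := by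
  have hk : (0:ℝ) < k := by exact_mod_cast k1
  have e : κ*(1+2*κ*Z/k) = (L*k/Y)*(1+2*L*(Z/Y)) := by rw [hκ]; field_simp
  have : Z/Y ≤ c := by rwa [div_le_iff₀ hY]
  rw [e, show (2*c+1)*(L^2*k/Y) = (L*k/Y)*(L+2*L*c) by ring]
  gcongr

set_option maxHeartbeats 2000000 in
lemma Sy.D1 (S : Sy ν ψ k κ) {g : ℕ → ℂ} (hg : ∀ n, ‖g n‖ ≤ 1) {η Y L P : ℝ} (hη : 0 ≤ η) (hη1 : η ≤ 1/2) (hY : 1 ≤ Y) (hL : 1 ≤ L) (hκ : κ = L*k/Y) {H : ℕ} (hH : 1 ≤ H)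
    (s : Finset ℕ) (hP : 1 ≤ P) (hs : ∀ p ∈ s, p.Prime ∧ P ≤ p ∧ p.Coprime k) (hgp : ∀ p ∈ s, ∀ m, g (p*m) = if p ∣ m then 0 else - g m)
    {W : ℝ} (hWd : W = ∑ p ∈ s, (1/p:ℝ)) (hW : 1 ≤ W) (hb : (k:ℝ)^2*s.card^2*H ≤ Y) :
    ∫ ω, ‖RR g ψ η Y 1 ω + (W:ℂ)⁻¹ * FT g ψ η Y H s ω‖^2 ∂ν ≤ 5280*(k.totient*L^2/Y^2)*(1/W+1/H+1/P) := by
  have k1 := S.k1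
  have hk : (0:ℝ) < k := by exact_mod_cast k1
  have hY0 : 0 < Y := by linarith
  have hH0 : (0:ℝ) < H := by exact_mod_cast hH
  have hs2 : ∀ p ∈ s, 2 ≤ p := fun p hp => (hs p hp).1.two_le
  have hφ : (1:ℝ) ≤ k.totient := by exact_mod_cast Nat.totient_pos.2 k1
  obtain ⟨eH, eH1⟩ := exp_inv hH
  have eη : Real.exp η ≤ 2 := (Real.exp_le_exp.2 hη1).trans exp_half
  have eη1 : 1 ≤ Real.exp η := Real.one_le_exp hη
  have eH3 : Real.exp (1/H) ≤ 2.72 := by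
    have : (1:ℝ)/H ≤ 1 := by rw [div_le_one hH0]; exact_mod_cast hH
    exact (Real.exp_le_exp.2 this).trans (by linarith [Real.exp_one_lt_d9])
  have hx : Real.exp (1/2) ≤ 1.65 := by
    have h : Real.exp (1/2)^2 = Real.exp 1 := by rw [← Real.exp_nat_mul]; norm_num
    nlinarith only [h, Real.exp_one_lt_d9, Real.exp_pos (1/2)]
  have eηH : Real.exp (η+1/H) ≤ 5 := by
    rw [Real.exp_add]; nlinarith only [eH3, hη1, hx, eH1, eη, (Real.exp_le_exp.2 hη1).trans hx]
  simp_rw [cc_sum S.mul g hY hH s hs2 W]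
  set N := JI (η+1/H) Y 1 with hN
  have hNm : ∀ n ∈ N, Y < n ∧ (n:ℝ) ≤ 5*Y := fun n hn => by
    rw [hN, mem_JI hY0 one_pos, one_mul] at hn
    exact ⟨hn.1, hn.2.trans (by nlinarith only [eηH, hY])⟩
  set T := Y*k.totient/k with hT
  have hT0 : 0 < T := by positivity
  have err : (k:ℝ)*s.card^2 ≤ T/H := by
    rw [hT, div_div, le_div_iff₀ (by positivity)]
    calc _ = (k:ℝ)^2*s.card^2*H := by ring
      _ ≤ Y*1 := by rwa [mul_one]
      _ ≤ _ := by gcongr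
  have errk : (k:ℝ) ≤ T/H := by
    refine le_trans ?_ err
    have : (1:ℝ) ≤ s.card := by
      rcases s.eq_empty_or_nonempty with h | h
      · rw [h] at hWd; simp at hWd; linarith
      · exact_mod_cast h.card_pos
    exact le_mul_of_one_le_right hk.le (one_le_pow₀ this)
  have hTH : 0 < T/H := by positivity
  have hc1 : ∀ p ∈ s, ∀ p' ∈ s, p ≠ p' → p.Coprime p' := fun p hp p' hp' h => (Nat.coprime_primes (hs p hp).1 (hs p' hp').1).2 h
  have hD1 : ∀ p ∈ s, 1 ≤ p ∧ p.Coprime k := fun p hp => ⟨(hs p hp).1.one_le, (hs p hp).2.2⟩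
  have tA := TK k1 s (fun p => p) hD1 hc1 hY0.le (le_mul_of_one_le_right hY0.le eη1) W hWd
  have tB := TK2 k1 s (fun p => p) hD1 hc1 hY0.le (le_mul_of_one_le_right hY0.le eH1) W hWd
  have hYe : 0 < Y*Real.exp η := by positivity
  have tB' := TK2 k1 s (fun p => p) hD1 hc1 hYe.le (le_mul_of_one_le_right hYe.le eH1) W hWd
  set W2 := ∑ p ∈ s, (1/(p^2:ℕ):ℝ) with hW2
  have tC := TK2 k1 s (fun p => p^2) (fun p hp => ⟨Nat.one_le_pow _ _ (hD1 p hp).1, (hD1 p hp).2.pow_left 2⟩) (fun p hp p' hp' h => (hc1 p hp p' hp' h).pow 2 2) hY0.le (le_mul_of_one_le_right hY0.le (Real.one_le_exp (show 0 ≤ η+1/H by positivity))) W2 hW2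
  have hW20 : 0 ≤ W2 := Finset.sum_nonneg fun _ _ => by positivity
  have hW2P : W2 ≤ W*(1/P) := by
    rw [hW2, hWd, Finset.sum_mul]
    refine Finset.sum_le_sum fun p hp => ?_
    have hPp := (hs p hp).2.1
    push_cast
    rw [sq, ← one_div_mul_one_div]; gcongr
  have iP0 : 0 < 1/P := by positivity
  have iP : 1/P ≤ 1 := by rw [div_le_one] <;> linarith only [hP]
  set iH := T/H with hiH
  have eT : ∀ x, x*Y*k.totient/k = x*T := fun x => by rw [hT]; ring
  have bA : ∑ n ∈ JI η Y 1 with n.Coprime k, ((∑ p ∈ s, if p ∣ n then (1:ℝ) else 0) - W)^2 ≤ T*W + 16*iH := by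
    rw [JI, div_one, div_one]
    refine tA.trans ?_
    rw [show Y*Real.exp η - Y = (Real.exp η-1)*Y by ring, eT]
    have : (Real.exp η - 1)*T*W ≤ 1*T*W := by gcongr; linarith only [eη]
    linarith only [err, this]
  have q1 : iH ≤ iH*W^2 := le_mul_of_one_le_right hTH.le (one_le_pow₀ hW)
  have hB : ∀ c : ℝ, 0 ≤ c → ∀ x : ℝ, x ≤ c*(2/H) → x*T*(2*W+2*W^2) + 32*k*s.card^2+8*k*W^2 ≤ (8*c+40)*iH*W^2 := fun c hc x hx => by
    have h1 : x*T*(2*W+2*W^2) ≤ c*(2/H)*T*(2*W+2*W^2) := by gcongr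
    have h2 : c*(2/H)*T*(2*W+2*W^2) = 4*c*iH*(W+W^2) := by rw [hiH]; ring
    have h3 : c*iH*(W+W^2) ≤ c*iH*(2*W^2) := by gcongr; linarith [le_mul_of_one_le_right (show 0 ≤ W by linarith only [hW]) hW, sq W]
    have h4 : (k:ℝ)*W^2 ≤ iH*W^2 := by gcongr
    linarith only [err, q1, h1, h2, h3, h4]
  have bB : ∑ n ∈ JI (1/H) Y 1 with n.Coprime k, (∑ p ∈ s, if p ∣ n then (1:ℝ) else 0)^2 ≤ 48*iH*W^2 := by
    rw [JI, div_one, div_one]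
    refine tB.trans ?_
    rw [show Y*Real.exp (1/H) - Y = (Real.exp (1/H)-1)*Y by ring, eT]
    refine (hB 1 zero_le_one _ (by linarith only [eH])).trans (le_of_eq (by ring))
  have bB' : ∑ n ∈ JI (1/H) (Y*Real.exp η) 1 with n.Coprime k, (∑ p ∈ s, if p ∣ n then (1:ℝ) else 0)^2 ≤ 56*iH*W^2 := by
    rw [JI, div_one, div_one]
    refine tB'.trans ?_
    rw [show Y*Real.exp η*Real.exp (1/H) - Y*Real.exp η = (Real.exp η*(Real.exp (1/H)-1))*Y by ring, eT]
    refine (hB 2 zero_le_two _ ?_).trans (le_of_eq (by ring))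
    exact mul_le_mul eη eH (by linarith only [eH1]) (by norm_num)
  have bC : ∑ n ∈ N with n.Coprime k, (∑ p ∈ s, if p^2 ∣ n then (1:ℝ) else 0)^2 ≤ 16*T*W^2*(1/P) + 40*iH*W^2 := by
    have hW2W : W2 ≤ W := hW2P.trans (mul_le_of_le_one_right (by linarith only [hW]) iP)
    rw [hN, JI, div_one, div_one]
    refine tC.trans ?_
    rw [show Y*Real.exp (η+1/H) - Y = (Real.exp (η+1/H)-1)*Y by ring, eT]
    have h1 : (Real.exp (η+1/H)-1)*T*(2*W2+2*W2^2) ≤ 4*T*(2*(W2*W)+2*(W2*W)) := by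
      gcongr
      · linarith only [eηH]
      · exact le_mul_of_one_le_right hW20 hW
      · rw [sq]; gcongr
    have h2 : T*(W2*W) ≤ T*(W*(1/P)*W) := by gcongr
    have h4 : (k:ℝ)*W2^2 ≤ iH*W^2 := by gcongr
    linarith only [err, q1, h1, h2, h4]
  have hmain : ∑ n ∈ N with n.Coprime k, W^2*‖cc g η Y H s W n‖^2 ≤ 480*T*W^2*(1/W+1/H+1/P) := by
    have hnn : ∀ (M : Finset ℕ) (f : ℕ → ℝ), (∀ n, 0 ≤ f n) → ∑ n ∈ N with n.Coprime k, (if n ∈ M then f n else 0) ≤ ∑ n ∈ M with n.Coprime k, f n := fun M f hf => by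
      rw [← Finset.sum_filter]
      refine Finset.sum_le_sum_of_subset_of_nonneg (fun n hn => ?_) fun _ _ _ => hf _
      simp only [Finset.mem_filter] at hn ⊢; exact ⟨hn.2, hn.1.2⟩
    have h0 := Finset.sum_le_sum fun n (hn : n ∈ N.filter (·.Coprime k)) => cc_bd hg hη hY hH s hs2 hgp (show 0 < W by linarith only [hW]) n (hNm n (Finset.mem_filter.1 hn).1).1
    refine h0.trans ?_
    rw [Finset.sum_add_distrib, Finset.sum_add_distrib, ← Finset.mul_sum, ← Finset.mul_sum, ← Finset.mul_sum]
    have h1 := hnn (JI η Y 1) (fun n => ((∑ p ∈ s, if p ∣ n then (1:ℝ) else 0) - W)^2) fun _ => sq_nonneg _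
    have h2 := hnn (JI (1/H) Y 1 ∪ JI (1/H) (Y*Real.exp η) 1) (fun n => (∑ p ∈ s, if p ∣ n then (1:ℝ) else 0)^2) fun _ => sq_nonneg _
    rw [Finset.filter_union] at h2
    have h3 := h2.trans ((le_add_of_nonneg_right (Finset.sum_nonneg fun _ _ => sq_nonneg _)).trans_eq Finset.sum_union_inter)
    have : 480*T*W^2*(1/W+1/H+1/P) = 480*T*W + 480*iH*W^2 + 480*(T*W^2*(1/P)) := by rw [hiH]; field_simp
    rw [this]
    have q2 : 0 < T*W^2*(1/P) := by positivity
    have q3 : 0 < T*W := by positivity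
    linarith only [bA, q1, bB, bB', bC, h1, h3, q2, q3]
  have hls := S.ls N (Z := 5*Y) (fun n hn => ⟨by have := (hNm n hn).1; exact_mod_cast (by linarith only [hY, this] : (1:ℝ) ≤ n), (hNm n hn).2⟩) (fun n => cc g η Y H s W n/n)
  refine hls.trans ?_
  have h5 : ∑ n ∈ N with n.Coprime k, ‖cc g η Y H s W n/n‖^2 ≤ 1/(W^2*Y^2) * (480*T*W^2*(1/W+1/H+1/P)) := by
    refine le_trans ?_ (mul_le_mul_of_nonneg_left hmain (by positivity))
    rw [Finset.mul_sum]
    refine Finset.sum_le_sum fun n hn => ?_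
    have h := (hNm n (Finset.mem_filter.1 hn).1).1
    have : ‖cc g η Y H s W n/n‖^2 ≤ ‖cc g η Y H s W n‖^2/Y^2 := by
      rw [norm_div, div_pow, Complex.norm_natCast]; gcongr
    refine this.trans (le_of_eq ?_); field_simp
  calc _ ≤ (2*5+1)*(L^2*k/Y) * (1/(W^2*Y^2) * (480*T*W^2*(1/W+1/H+1/P))) := by
        exact mul_le_mul (Sy.cf k1 hL hY0 le_rfl hκ) h5 (Finset.sum_nonneg fun _ _ => sq_nonneg _) (by positivity)
    _ = _ := by rw [hT]; field_simp; ring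
end MR

namespace MR
open MeasureTheory

variable {Ω : Type*} [MeasurableSpace Ω] {ν : Measure Ω} {ψ : ℕ → Ω → ℂ} {k : ℕ} {κ : ℝ}

noncomputable def om (B : Finset ℕ) (n : ℕ) : ℝ := ∑ p ∈ B, if p ∣ n then (1:ℝ) else 0

lemma om_nn (B : Finset ℕ) (n : ℕ) : 0 ≤ om B n := Finset.sum_nonneg fun _ _ => by split_ifs <;> norm_num

lemma om_exp (B : Finset ℕ) (hB : ∀ p ∈ B, p.Prime) : ∀ Z : ℝ, 0 ≤ Z → ∑ n ∈ Finset.Ioc 0 ⌊Z⌋₊, Real.exp (om B n) ≤ Z*Real.exp (2*∑ p ∈ B, (1/p:ℝ)) := by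
  induction B using Finset.induction_on with
  | empty => intro Z hZ; simpa [om] using Nat.floor_le hZ
  | insert p B hp ih =>
    intro Z hZ
    have hpp := hB p (Finset.mem_insert_self _ _)
    have hp0 : (0:ℝ) < p := by exact_mod_cast hpp.pos
    have ih := ih fun r hr => hB r (Finset.mem_insert_of_mem hr)
    have h1 : ∀ n, Real.exp (om (insert p B) n) ≤ Real.exp (om B n) + if p ∣ n then 2*Real.exp (om B n) else 0 := fun n => by
      rw [om, Finset.sum_insert hp, Real.exp_add, ← om]
      split_ifs
      · nlinarith [Real.exp_one_lt_d9, Real.exp_pos (om B n)]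
      · simp
    refine (Finset.sum_le_sum fun n _ => h1 n).trans ?_
    rw [Finset.sum_add_distrib, ← Finset.sum_filter, ← Finset.mul_sum]
    have h2 : ∑ n ∈ Finset.Ioc 0 ⌊Z⌋₊ with p ∣ n, Real.exp (om B n) = ∑ m ∈ Finset.Ioc 0 ⌊Z/p⌋₊, Real.exp (om B m) := by
      symm
      refine Finset.sum_nbij' (fun m => p*m) (fun n => n/p) (fun m hm => ?_) (fun n hn => ?_) (fun m _ => Nat.mul_div_cancel_left _ hpp.pos)
        (fun n hn => Nat.mul_div_cancel' (Finset.mem_filter.1 hn).2) fun m _ => ?_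
      · rw [Finset.mem_Ioc, Nat.le_floor_iff (by positivity), le_div_iff₀ hp0] at hm
        simp only [Finset.mem_filter, Finset.mem_Ioc, dvd_mul_right, and_true]
        refine ⟨Nat.mul_pos hpp.pos hm.1, Nat.le_floor ?_⟩
        push_cast; linarith
      · simp only [Finset.mem_filter, Finset.mem_Ioc] at hn
        obtain ⟨⟨h0, h1⟩, m, rfl⟩ := hn
        rw [Nat.mul_div_cancel_left _ hpp.pos, Finset.mem_Ioc]
        refine ⟨Nat.pos_of_mul_pos_left h0, Nat.le_floor ?_⟩
        rw [le_div_iff₀ hp0]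
        have := (Nat.le_floor_iff hZ).1 h1
        push_cast at this; linarith
      · congr 1
        refine Finset.sum_congr rfl fun r hr => ?_
        have : r ∣ p*m ↔ r ∣ m := by
          refine ⟨fun h => ((Nat.coprime_primes (hB r (Finset.mem_insert_of_mem hr)) hpp).2 ?_).dvd_of_dvd_mul_left h, fun h => h.mul_left p⟩
          rintro rfl; exact hp hr
        simp only [this]
    rw [h2, Finset.sum_insert hp]
    have h3 := ih Z hZ
    have h4 := ih (Z/p) (by positivity)
    set E := Real.exp (2*∑ p ∈ B, (1/p:ℝ))
    calc _ ≤ Z*E + 2*(Z/p*E) := by linarith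
      _ = Z*((2*(1/p)+1)*E) := by ring
      _ ≤ Z*(Real.exp (2*(1/p))*E) := by gcongr; exact Real.add_one_le_exp _
      _ = _ := by rw [← Real.exp_add, mul_add]

/-- coefficients of (Σ_B ψ p/p)^l * Σ b m/m ψ m -/
noncomputable def cB (B : Finset ℕ) (b : ℕ → ℂ) : ℕ → ℕ → ℂ
  | 0, n => b n
  | l+1, n => ∑ p ∈ B, if p ∣ n then cB B b l (n/p) else 0

lemma cB_bd (B : Finset ℕ) (hB : ∀ p ∈ B, p.Prime) {b : ℕ → ℂ} (hb : ∀ n, ‖b n‖ ≤ 1) (l n : ℕ) : ‖cB B b l n‖ ≤ om B n^l := by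
  induction l generalizing n with
  | zero => simpa [cB] using hb n
  | succ l ih =>
    rw [cB, pow_succ', om, Finset.sum_mul, ← om]
    refine norm_sum_le_of_le _ fun p hp => ?_
    split_ifs with h
    · obtain ⟨m, rfl⟩ := h
      rw [Nat.mul_div_cancel_left _ (hB p hp).pos, one_mul]
      refine (ih m).trans (pow_le_pow_left₀ (om_nn _ _) (Finset.sum_le_sum fun r _ => ?_) _)
      by_cases h : r ∣ m
      · simp [h, h.mul_left p]
      · simp only [h, if_false]; split_ifs <;> norm_num
    · simp

lemma cB_sum (hmul : ∀ m n ω, ψ (m*n) ω = ψ m ω * ψ n ω) (B : Finset ℕ) {u w : ℝ} (hu : 1 ≤ u) (hB : ∀ p ∈ B, p.Prime ∧ u < p ∧ (p:ℝ) ≤ w) {b : ℕ → ℂ} {y z : ℝ} (hz : 0 ≤ z) (hy : 0 ≤ y)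
    (hb0 : ∀ n, b n ≠ 0 → y < n ∧ (n:ℝ) ≤ z) (l : ℕ) (ω : Ω) :
    (∑ p ∈ B, (1/p:ℂ)*ψ p ω)^l * ∑ n ∈ Finset.Ioc 0 ⌊z⌋₊, b n/n*ψ n ω = ∑ n ∈ Finset.Ioc 0 ⌊z*w^l⌋₊, cB B b l n/n*ψ n ω ∧ ∀ n, cB B b l n ≠ 0 → y*u^l < n ∧ (n:ℝ) ≤ z*w^l := by
  rcases B.eq_empty_or_nonempty with hE | ⟨p0, hp0⟩
  · subst hE
    cases l with
    | zero => simpa [cB] using hb0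
    | succ l => simp [cB]
  have hw : 0 ≤ w := by linarith [hB p0 hp0]
  induction l with
  | zero => simpa [cB] using hb0
  | succ l ih =>
    have e2 : ∀ n, cB B b (l+1) n ≠ 0 → y*u^(l+1) < n ∧ (n:ℝ) ≤ z*w^(l+1) := by
      intro n hn
      rw [cB] at hn
      obtain ⟨p, hp, h⟩ := Finset.exists_ne_zero_of_sum_ne_zero hn
      split_ifs at h with hd
      · obtain ⟨m, rfl⟩ := hd
        rw [Nat.mul_div_cancel_left _ (hB p hp).1.pos] at h
        obtain ⟨h1, h2⟩ := ih.2 m h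
        obtain ⟨_, h3, h4⟩ := hB p hp
        push_cast
        constructor
        · calc y*u^(l+1) = u*(y*u^l) := by ring
            _ ≤ p*(y*u^l) := by gcongr
            _ < p*m := by gcongr; linarith
        · calc (p:ℝ)*m ≤ w*(z*w^l) := by gcongr
            _ = _ := by ring
      · exact absurd rfl h
    refine ⟨?_, e2⟩
    rw [pow_succ', mul_assoc, ih.1, Finset.sum_mul]
    simp_rw [cB, Finset.sum_div, Finset.sum_mul]
    rw [Finset.sum_comm]
    refine Finset.sum_congr rfl fun p hp => ?_
    obtain ⟨hpp, _, h4⟩ := hB p hp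
    have hpr : (0:ℝ) < p := by exact_mod_cast hpp.pos
    simp_rw [ite_div, ite_mul, zero_div, zero_mul, ← Finset.sum_filter]
    rw [Finset.mul_sum]
    have hzw : 0 ≤ z*w^l := by positivity
    have hzw' : 0 ≤ z*w^(l+1) := by positivity
    have hin : ∀ m : ℕ, 0 < m → (m:ℝ) ≤ z*w^l → p*m ∈ (Finset.Ioc 0 ⌊z*w^(l+1)⌋₊).filter (p ∣ ·) := fun m h0 h => by
      simp only [Finset.mem_filter, Finset.mem_Ioc, dvd_mul_right, and_true]
      refine ⟨Nat.mul_pos hpp.pos h0, Nat.le_floor ?_⟩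
      push_cast
      calc (p:ℝ)*m ≤ w*(z*w^l) := by gcongr
        _ = _ := by ring
    refine Finset.sum_of_injOn (fun m => p*m) (fun m _ m' _ h => Nat.eq_of_mul_eq_mul_left hpp.pos h) (fun m hm => ?_) (fun n hn hn' => ?_) fun m hm => ?_
    · have := Finset.mem_Ioc.1 hm
      exact hin m this.1 ((Nat.le_floor_iff hzw).1 this.2)
    · simp only [Finset.mem_filter, Finset.mem_Ioc] at hn
      obtain ⟨⟨h0, -⟩, m, rfl⟩ := hn
      rw [Nat.mul_div_cancel_left _ hpp.pos]
      by_cases hc : cB B b l m = 0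
      · simp [hc]
      · exact absurd ⟨m, by simpa using ⟨Nat.pos_of_mul_pos_left h0, Nat.le_floor (ih.2 m hc).2⟩, rfl⟩ hn'
    · simp only [Nat.mul_div_cancel_left _ hpp.pos, hmul]
      push_cast; rw [mul_comm (p:ℂ) m, ← div_div]; ring
end MR

namespace MR
open MeasureTheory

variable {Ω : Type*} [MeasurableSpace Ω] {ν : Measure Ω} {ψ : ℕ → Ω → ℂ} {k : ℕ} {κ : ℝ}

lemma Sy.mom (S : Sy ν ψ k κ) {η Y L : ℝ} (hY : 1 ≤ Y) (hL : 1 ≤ L) (hκ : κ = L*k/Y) {b : ℕ → ℂ} (hb : ∀ n, ‖b n‖ ≤ 1)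
    {x u w z : ℝ} (hx : 0 < x) (hu : 1 ≤ u) (B : Finset ℕ) (hB : ∀ p ∈ B, p.Prime ∧ u < p ∧ (p:ℝ) ≤ w) (hWB : ∑ p ∈ B, (1/p:ℝ) ≤ 3)
    {l : ℕ} (hl : x ≤ u^l) (hz1 : 1 ≤ z) (hz : Real.exp η/x*w^l ≤ z) :
    ∫ ω, ‖(∑ p ∈ B, (1/p:ℂ)*ψ p ω)^l * RR b ψ η Y x ω‖^2 ∂ν ≤ 3*z^2*Real.exp 6*(2*l).factorial*(L^2*k/Y^2) := by
  have hY0 : 0 < Y := by linarith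
  set b' : ℕ → ℂ := fun n => if n ∈ JI η Y x then b n else 0 with hb'
  set z0 := Y*Real.exp η/x with hz0
  have hz00 : 0 < z0 := by positivity
  have hRR : ∀ ω, RR b ψ η Y x ω = ∑ n ∈ Finset.Ioc 0 ⌊z0⌋₊, b' n/n*ψ n ω := fun ω => by
    simp_rw [hb', ite_div, ite_mul, zero_div, zero_mul, ← Finset.sum_filter]
    refine Finset.sum_congr ?_ fun _ _ => rfl
    ext n
    simp only [JI, Finset.mem_filter, Finset.mem_Ioc]
    exact ⟨fun h => ⟨⟨by omega, h.2⟩, h⟩, fun h => h.2⟩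
  have hsup : ∀ n, b' n ≠ 0 → Y/x < n ∧ (n:ℝ) ≤ z0 := fun n hn => by
    by_cases h : n ∈ JI η Y x
    · rw [mem_JI hY0 hx] at h
      rw [hz0, div_lt_iff₀ hx, le_div_iff₀ hx, mul_comm]; exact h
    · simp [hb', h] at hn
  have hc := fun ω => cB_sum S.mul B hu hB hz00.le (show 0 ≤ Y/x by positivity) hsup l ω
  have hb1 : ∀ n, ‖b' n‖ ≤ 1 := fun n => by rw [hb']; dsimp only; split_ifs; exacts [hb n, by simp]
  simp_rw [hRR, (hc _).1]
  have hsup2 : ∀ n, cB B b' l n ≠ 0 → Y < n := fun n hn => by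
    by_cases hΩ : Nonempty Ω
    · refine lt_of_le_of_lt ?_ ((hc hΩ.some).2 n hn).1
      rw [div_mul_eq_mul_div, le_div_iff₀ hx]; gcongr
    · have hc := cB_sum (ψ := fun _ (_ : Unit) => (0:ℂ)) (by simp) B hu hB hz00.le (show 0 ≤ Y/x by positivity) hsup l ()
      refine lt_of_le_of_lt ?_ (hc.2 n hn).1
      rw [div_mul_eq_mul_div, le_div_iff₀ hx]; gcongr
  have hZ : z0*w^l ≤ z*Y := by
    calc _ = Real.exp η/x*w^l*Y := by rw [hz0]; ring
      _ ≤ _ := by gcongr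
  refine (S.ls (Z := z*Y) _ (fun n hn => ?_) _).trans ?_
  · have := Finset.mem_Ioc.1 hn
    exact ⟨this.1, ((Nat.le_floor_iff' (by omega)).1 this.2).trans hZ⟩
  have h1 : ∀ n : ℕ, ‖cB B b' l n/n‖^2 ≤ (2*l).factorial/Y^2*Real.exp (om B n) := fun n => by
    by_cases h : cB B b' l n = 0
    · simp [h]; positivity
    have hn := hsup2 n h
    rw [norm_div, div_pow, Complex.norm_natCast, div_mul_eq_mul_div]
    gcongr
    have h2 := cB_bd B (fun p hp => (hB p hp).1) hb1 l n
    have h3 := Real.pow_div_factorial_le_exp _ (om_nn B n) (2*l)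
    rw [div_le_iff₀ (by positivity)] at h3
    calc _ ≤ (om B n^l)^2 := by gcongr
      _ = om B n^(2*l) := by ring
      _ ≤ _ := by linarith
  have h2 : ∑ n ∈ Finset.Ioc 0 ⌊z0*w^l⌋₊ with n.Coprime k, ‖cB B b' l n/n‖^2 ≤ (2*l).factorial/Y^2*(z*Y*Real.exp 6) := by
    refine (Finset.sum_le_sum fun n _ => h1 n).trans ?_
    rw [← Finset.mul_sum]
    gcongr
    calc _ ≤ ∑ n ∈ Finset.Ioc 0 ⌊z*Y⌋₊, Real.exp (om B n) := Finset.sum_le_sum_of_subset_of_nonneg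
          ((Finset.filter_subset _ _).trans (Finset.Ioc_subset_Ioc_right (Nat.floor_le_floor hZ))) fun _ _ _ => (Real.exp_pos _).le
      _ ≤ z*Y*Real.exp (2*∑ p ∈ B, (1/p:ℝ)) := om_exp B (fun p hp => (hB p hp).1) _ (by positivity)
      _ ≤ _ := by gcongr; linarith
  calc _ ≤ ((2*z+1)*(L^2*k/Y))*((2*l).factorial/Y^2*(z*Y*Real.exp 6)) :=
        mul_le_mul (Sy.cf S.k1 hL hY0 le_rfl hκ) h2 (Finset.sum_nonneg fun _ _ => sq_nonneg _) (by positivity)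
    _ ≤ ((3*z)*(L^2*k/Y))*((2*l).factorial/Y^2*(z*Y*Real.exp 6)) := by gcongr; linarith
    _ = _ := by field_simp

noncomputable def QQ (ψ : ℕ → Ω → ℂ) (H : ℕ) (s : Finset ℕ) (v : ℕ) (ω : Ω) : ℂ := ∑ p ∈ s with vv H p = v, (1/p:ℂ)*ψ p ω

lemma FT_eq (g : ℕ → ℂ) (η Y : ℝ) (H : ℕ) (s : Finset ℕ) (ω : Ω) :
    FT g ψ η Y H s ω = ∑ v ∈ s.image (vv H), QQ ψ H s v ω * RR g ψ η Y (xv H v) ω := by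
  rw [FT, ← Finset.sum_fiberwise_of_maps_to fun p hp => Finset.mem_image_of_mem (vv H) hp]
  refine Finset.sum_congr rfl fun v _ => ?_
  rw [QQ, Finset.sum_mul]
  refine Finset.sum_congr rfl fun p hp => by rw [(Finset.mem_filter.1 hp).2]

/-- context -/
structure Cx (ν : Measure Ω) (ψ : ℕ → Ω → ℂ) (k : ℕ) (κ : ℝ) (g : ℕ → ℂ) (η Y L : ℝ) : Prop extends Sy ν ψ k κ where
  hg : ∀ n, ‖g n‖ ≤ 1
  hη : 0 < η
  hη1 : η ≤ 1/2
  hY : 1 ≤ Y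
  hL : 1 ≤ L
  hκ : κ = L*k/Y

/-- stage -/
structure Stg (k : ℕ) (g : ℕ → ℂ) (Y : ℝ) (s : Finset ℕ) (H : ℕ) (a b W : ℝ) : Prop where
  hH : 1 ≤ H
  ha : 2 ≤ a
  hs : ∀ p ∈ s, p.Prime ∧ Real.exp a < p ∧ (p:ℝ) ≤ Real.exp b ∧ p.Coprime k
  hgp : ∀ p ∈ s, ∀ m, g (p*m) = if p ∣ m then 0 else - g m
  hW : W = ∑ p ∈ s, (1/p:ℝ)
  hW1 : 1 ≤ W
  hY : (k:ℝ)^2*s.card^2*H ≤ Y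

def UU (ψ : ℕ → Ω → ℂ) (H : ℕ) (s : Finset ℕ) (α : ℝ) : Set Ω := ⋃ v ∈ s.image (vv H), {ω | Real.exp (-(α*(v/H))) < ‖QQ ψ H s v ω‖}

variable {g : ℕ → ℂ} {η Y L : ℝ} {s : Finset ℕ} {H : ℕ} {a b W α : ℝ}

lemma Sy.mRR (S : Sy ν ψ k κ) (x : ℝ) : Measurable (RR g ψ η Y x) := Finset.measurable_sum _ fun n _ => (S.meas n).const_mul _
lemma Sy.mQQ (S : Sy ν ψ k κ) (v : ℕ) : Measurable (QQ ψ H s v) := Finset.measurable_sum _ fun n _ => (S.meas n).const_mul _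
lemma Sy.mUU (S : Sy ν ψ k κ) : MeasurableSet (UU ψ H s α) :=
  Finset.measurableSet_biUnion _ fun v _ => measurableSet_lt measurable_const (S.mQQ v).norm

lemma Sy.bRR (S : Sy ν ψ k κ) (x : ℝ) (ω : Ω) : ‖RR g ψ η Y x ω‖ ≤ ∑ m ∈ JI η Y x, ‖g m/m‖ :=
  norm_sum_le_of_le _ fun n _ => by rw [norm_mul]; exact mul_le_of_le_one_right (norm_nonneg _) (S.bd n ω)
lemma Sy.bQQ (S : Sy ν ψ k κ) (v : ℕ) (ω : Ω) : ‖QQ ψ H s v ω‖ ≤ ∑ p ∈ s with vv H p = v, ‖(1/p:ℂ)‖ :=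
  norm_sum_le_of_le _ fun n _ => by rw [norm_mul]; exact mul_le_of_le_one_right (norm_nonneg _) (S.bd n ω)

lemma Stg.vb (T : Stg k g Y s H a b W) {v : ℕ} (hv : v ∈ s.image (vv H)) : a/2 ≤ v/H ∧ (v/H:ℝ) ≤ b := by
  obtain ⟨p, hp, rfl⟩ := Finset.mem_image.1 hv
  obtain ⟨h1, h2, h3, -⟩ := T.hs p hp
  have hH : (0:ℝ) < H := by exact_mod_cast T.hH
  have hH1 : (1:ℝ) ≤ H := by exact_mod_cast T.hH
  have hp0 : (0:ℝ) < p := by exact_mod_cast h1.pos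
  obtain ⟨v1, v2⟩ := vv_bd T.hH h1.two_le
  have l1 := (Real.lt_log_iff_exp_lt hp0).2 h2
  have l2 := (Real.log_le_iff_le_exp hp0).2 h3
  have := T.ha
  rw [le_div_iff₀ hH, div_le_iff₀ hH]
  constructor <;> nlinarith

lemma Stg.sn (T : Stg k g Y s H a b W) : s.Nonempty := by
  rcases s.eq_empty_or_nonempty with h | h
  · have := T.hW; have := T.hW1; simp_all; linarith
  · exact h

lemma Stg.ab (T : Stg k g Y s H a b W) : a ≤ b := by
  obtain ⟨p, hp⟩ := T.sn
  obtain ⟨_, h2, h3, -⟩ := T.hs p hp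
  exact Real.exp_le_exp.1 (h2.le.trans h3)

lemma Stg.N (T : Stg k g Y s H a b W) : ((s.image (vv H)).card:ℝ) ≤ 2*H*b := by
  have hH : (0:ℝ) < H := by exact_mod_cast T.hH
  have hH1 : (1:ℝ) ≤ H := by exact_mod_cast T.hH
  have hb := T.ab; have ha := T.ha
  have h : s.image (vv H) ⊆ Finset.range (⌊H*b⌋₊+1) := fun v hv => by
    have := (T.vb hv).2
    rw [div_le_iff₀ hH] at this
    rw [Finset.mem_range, Nat.lt_succ_iff]; exact Nat.le_floor (by linarith)
  have h2 := Finset.card_le_card h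
  rw [Finset.card_range] at h2
  have h3 : ((s.image (vv H)).card:ℝ) ≤ ⌊H*b⌋₊+1 := by exact_mod_cast h2
  have h4 := Nat.floor_le (mul_nonneg hH.le (by linarith : 0 ≤ b))
  nlinarith

lemma Stg.blk (T : Stg k g Y s H a b W) (v : ℕ) : (∀ p ∈ s.filter (vv H · = v), p.Prime ∧ xv H v < p ∧ (p:ℝ) ≤ xv H v*Real.exp (1/H)) ∧ ∑ p ∈ s with vv H p = v, (1/p:ℝ) ≤ 3 := by
  have h1 : ∀ p ∈ s.filter (vv H · = v), p.Prime ∧ xv H v < p ∧ (p:ℝ) ≤ xv H v*Real.exp (1/H) := fun p hp => by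
    obtain ⟨hp', rfl⟩ := Finset.mem_filter.1 hp
    have := (T.hs p hp').1
    exact ⟨this, xv_p T.hH this.two_le⟩
  refine ⟨h1, ?_⟩
  have hx := one_le_xv H v
  obtain ⟨e1, e2⟩ := exp_inv T.hH
  have e3 : Real.exp (1/H) ≤ 3 := by
    have : (1:ℝ)/H ≤ 1 := by rw [div_le_one (by exact_mod_cast T.hH)]; exact_mod_cast T.hH
    exact (Real.exp_le_exp.2 this).trans (by linarith [Real.exp_one_lt_d9])
  refine le_trans ?_ ((win_sum (a := xv H v) (b := xv H v*Real.exp (1/H)) (by linarith) (by nlinarith)).trans ?_)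
  · refine Finset.sum_le_sum_of_subset_of_nonneg (fun p hp => ?_) fun _ _ _ => by positivity
    obtain ⟨_, h2, h3⟩ := h1 p hp
    rw [Finset.mem_Ioc, Nat.floor_lt (by linarith)]
    exact ⟨h2, Nat.le_floor h3⟩
  · rw [div_le_iff₀ (by linarith)]; nlinarith
end MR

namespace MR
open MeasureTheory

variable {Ω : Type*} [MeasurableSpace Ω] {ν : Measure Ω} {ψ : ℕ → Ω → ℂ} {k : ℕ} {κ : ℝ}
variable {g : ℕ → ℂ} {η Y L : ℝ} {s : Finset ℕ} {H : ℕ} {a b W α : ℝ}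

lemma Sy.intsq (S : Sy ν ψ k κ) {f : Ω → ℂ} (hm : Measurable f) {C : ℝ} (h : ∀ ω, ‖f ω‖ ≤ C) : Integrable (fun ω => ‖f ω‖^2) ν :=
  haveI := S.fin
  Integrable.of_bound (hm.norm.pow_const 2).aestronglyMeasurable (C^2) (ae_of_all _ fun ω => by
    rw [Real.norm_of_nonneg (by positivity)]; exact pow_le_pow_left₀ (norm_nonneg _) (h ω) 2)

lemma Sy.iRR (S : Sy ν ψ k κ) (x : ℝ) : Integrable (fun ω => ‖RR g ψ η Y x ω‖^2) ν := S.intsq (S.mRR x) (S.bRR x)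
lemma Sy.iQR (S : Sy ν ψ k κ) (v l : ℕ) (x : ℝ) : Integrable (fun ω => ‖QQ ψ H s v ω^l * RR g ψ η Y x ω‖^2) ν :=
  S.intsq (((S.mQQ v).pow_const l).mul (S.mRR x)) (fun ω => by
    rw [norm_mul, norm_pow]; exact mul_le_mul (pow_le_pow_left₀ (norm_nonneg _) (S.bQQ v ω) l) (S.bRR x ω) (norm_nonneg _) (pow_nonneg (Finset.sum_nonneg fun _ _ => norm_nonneg _) _))

lemma Cx.split (X : Cx ν ψ k κ g η Y L) (T : Stg k g Y s H a b W) {A : Set Ω} (hA : MeasurableSet A) :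
    ∫ ω in A, ‖RR g ψ η Y 1 ω‖^2 ∂ν ≤ ∫ ω in UU ψ H s α, ‖RR g ψ η Y 1 ω‖^2 ∂ν + 10560*(k.totient*L^2/Y^2)*(1/W+1/H+Real.exp (-a))
      + 2*(2*H*b)*∑ v ∈ s.image (vv H), ∫ ω in A \ UU ψ H s α, ‖QQ ψ H s v ω^1 * RR g ψ η Y (xv H v) ω‖^2 ∂ν := by
  have S := X.toSy
  have hU : MeasurableSet (UU ψ H s α) := S.mUU
  have iF : Integrable (fun ω => ‖RR g ψ η Y 1 ω‖^2) ν := S.iRR 1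
  have hW1 := T.hW1
  rw [← integral_inter_add_diff hU iF.integrableOn, add_assoc]
  refine add_le_add (setIntegral_mono_set iF.integrableOn (ae_of_all _ fun ω => sq_nonneg _) Set.inter_subset_right.eventuallyLE) ?_
  have hFT : FT g ψ η Y H s = fun ω => ∑ v ∈ s.image (vv H), QQ ψ H s v ω^1 * RR g ψ η Y (xv H v) ω := by
    funext ω; rw [FT_eq]; simp_rw [pow_one]
  have iD : Integrable (fun ω => ‖RR g ψ η Y 1 ω + (W:ℂ)⁻¹ * FT g ψ η Y H s ω‖^2) ν := by
    refine S.intsq (C := ∑ n ∈ JI (η+1/H) Y 1, ‖cc g η Y H s W n/n‖) ?_ fun ω => ?_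
    · refine (S.mRR 1).add (Measurable.const_mul ?_ _)
      rw [hFT]; exact Finset.measurable_sum _ fun v _ => ((S.mQQ v).pow_const 1).mul (S.mRR _)
    · rw [cc_sum S.mul g X.hY T.hH s (fun p hp => (T.hs p hp).1.two_le) W]
      exact norm_sum_le_of_le _ fun n _ => by rw [norm_mul]; exact mul_le_of_le_one_right (norm_nonneg _) (S.bd n ω)
  have hD := S.D1 X.hg X.hη.le X.hη1 X.hY X.hL X.hκ T.hH s (P := Real.exp a) (Real.one_le_exp (by linarith [T.ha]))
    (fun p hp => ⟨(T.hs p hp).1, (T.hs p hp).2.1.le, (T.hs p hp).2.2.2⟩) T.hgp T.hW hW1 T.hY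
  have pt : ∀ ω, ‖RR g ψ η Y 1 ω‖^2 ≤ 2*‖RR g ψ η Y 1 ω + (W:ℂ)⁻¹ * FT g ψ η Y H s ω‖^2 + 2*(2*H*b)*∑ v ∈ s.image (vv H), ‖QQ ψ H s v ω^1 * RR g ψ η Y (xv H v) ω‖^2 := fun ω => by
    have h1 := nsq_sub (RR g ψ η Y 1 ω + (W:ℂ)⁻¹ * FT g ψ η Y H s ω) ((W:ℂ)⁻¹ * FT g ψ η Y H s ω)
    rw [add_sub_cancel_right] at h1
    refine h1.trans ?_
    rw [mul_assoc 2 (2*H*b)]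
    gcongr
    have h2 : ‖(W:ℂ)⁻¹ * FT g ψ η Y H s ω‖ ≤ ∑ v ∈ s.image (vv H), ‖QQ ψ H s v ω^1 * RR g ψ η Y (xv H v) ω‖ := by
      rw [norm_mul, norm_inv, Complex.norm_real, Real.norm_of_nonneg (by linarith), hFT]
      exact (mul_le_of_le_one_left (norm_nonneg _) (inv_le_one_of_one_le₀ hW1)).trans (norm_sum_le _ _)
    refine (pow_le_pow_left₀ (norm_nonneg _) h2 2).trans (sq_sum_le_card_mul_sum_sq.trans ?_)
    gcongr; exact T.N
  have iS : Integrable (fun ω => ∑ v ∈ s.image (vv H), ‖QQ ψ H s v ω^1 * RR g ψ η Y (xv H v) ω‖^2) ν := integrable_finsetSum _ fun v _ => S.iQR v 1 _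
  calc _ ≤ ∫ ω in A \ UU ψ H s α, (2*‖RR g ψ η Y 1 ω + (W:ℂ)⁻¹ * FT g ψ η Y H s ω‖^2 + 2*(2*H*b)*∑ v ∈ s.image (vv H), ‖QQ ψ H s v ω^1 * RR g ψ η Y (xv H v) ω‖^2) ∂ν :=
        integral_mono_of_nonneg (ae_of_all _ fun _ => sq_nonneg _) (Integrable.add (iD.const_mul 2).restrict (iS.const_mul (2*(2*H*b))).restrict) (ae_of_all _ pt)
    _ = 2*∫ ω in A \ UU ψ H s α, ‖RR g ψ η Y 1 ω + (W:ℂ)⁻¹ * FT g ψ η Y H s ω‖^2 ∂ν + 2*(2*H*b)*∑ v ∈ s.image (vv H), ∫ ω in A \ UU ψ H s α, ‖QQ ψ H s v ω^1 * RR g ψ η Y (xv H v) ω‖^2 ∂ν := by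
        rw [integral_add (iD.const_mul 2).integrableOn (iS.const_mul _).integrableOn, integral_const_mul, integral_const_mul, integral_finsetSum _ fun v _ => (S.iQR v 1 _).integrableOn]
    _ ≤ _ := by
        refine add_le_add ?_ le_rfl
        have := (setIntegral_le_integral iD (ae_of_all _ fun ω => sq_nonneg _) (s := A \ UU ψ H s α)).trans hD
        rw [Real.exp_neg, ← one_div (Real.exp a)]; linarith

/-- on the complement of U -/
lemma Cx.offU (X : Cx ν ψ k κ g η Y L) (f : Ω → ℂ) (hf : Integrable (fun ω => ‖f ω‖^2) ν) {A : Set Ω} (hA : MeasurableSet A) {v : ℕ} (hv : v ∈ s.image (vv H)) :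
    ∫ ω in A \ UU ψ H s α, ‖QQ ψ H s v ω^1 * f ω‖^2 ∂ν ≤ Real.exp (-(2*α*(v/H)))*∫ ω in A, ‖f ω‖^2 ∂ν := by
  rw [← integral_const_mul]
  calc _ ≤ ∫ ω in A \ UU ψ H s α, Real.exp (-(2*α*(v/H)))*‖f ω‖^2 ∂ν := by
        refine integral_mono_of_nonneg (ae_of_all _ fun _ => sq_nonneg _) (hf.const_mul _).integrableOn ?_
        filter_upwards [ae_restrict_mem (hA.diff X.toSy.mUU)] with ω hω
        have : ‖QQ ψ H s v ω‖ ≤ Real.exp (-(α*(v/H))) := by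
          by_contra h
          exact hω.2 (Set.mem_biUnion hv (not_le.1 h))
        rw [pow_one, norm_mul, mul_pow, show -(2*α*(v/H)) = ((2:ℕ):ℝ)*(-(α*(v/H))) by push_cast; ring, Real.exp_nat_mul]
        gcongr
    _ ≤ _ := setIntegral_mono_set (hf.const_mul _).integrableOn (ae_of_all _ fun ω => by positivity) Set.sdiff_subset.eventuallyLE

lemma Cx.first (X : Cx ν ψ k κ g η Y L) (T : Stg k g Y s H a b W) (hα : 0 ≤ α) (hbL : Real.exp b ≤ L) (hbY : 4*(k:ℝ)^2*Real.exp b ≤ Y) :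
    ∫ ω, ‖RR g ψ η Y 1 ω‖^2 ∂ν ≤ ∫ ω in UU ψ H s α, ‖RR g ψ η Y 1 ω‖^2 ∂ν + 10560*(k.totient*L^2/Y^2)*(1/W+1/H+Real.exp (-a))
      + 80*(H*b)^2*Real.exp (-(α*a))*(k.totient*L^2/Y^2) := by
  have S := X.toSy
  have hY0 : 0 < Y := by linarith [X.hY]
  have hL := X.hL
  have hk : (0:ℝ) < k := by exact_mod_cast S.k1
  have hφ : (1:ℝ) ≤ k.totient := by exact_mod_cast Nat.totient_pos.2 S.k1
  have eη : Real.exp η ≤ 2 := (Real.exp_le_exp.2 X.hη1).trans exp_half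
  have hb0 : 0 ≤ b := by linarith [T.ab, T.ha]
  have h := X.split T (α := α) MeasurableSet.univ
  rw [setIntegral_univ] at h
  refine h.trans (add_le_add le_rfl ?_)
  have key : ∀ v ∈ s.image (vv H), ∫ ω in Set.univ \ UU ψ H s α, ‖QQ ψ H s v ω^1 * RR g ψ η Y (xv H v) ω‖^2 ∂ν ≤ Real.exp (-(α*a))*(10*(k.totient*L^2/Y^2)) := by
    intro v hv
    obtain ⟨v1, v2⟩ := T.vb hv
    refine (X.offU _ (S.iRR _) MeasurableSet.univ hv).trans ?_
    rw [setIntegral_univ]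
    have hx := xv_pos H v
    have hxb : xv H v ≤ Real.exp b := Real.exp_le_exp.2 v2
    gcongr ?_ * ?_
    · refine Real.exp_le_exp.2 (neg_le_neg ?_)
      nlinarith
    set x := xv H v
    have hm : ∀ n ∈ JI η Y x, Y/x < n ∧ (n:ℝ) ≤ 2*Y/x := fun n hn => by
      rw [mem_JI hY0 hx] at hn
      rw [div_lt_iff₀ hx, le_div_iff₀ hx]
      constructor <;> nlinarith
    refine (S.ls (Z := 2*Y/x) (JI η Y x) (fun n hn => ⟨?_, (hm n hn).2⟩) _).trans ?_
    · have h1 := (hm n hn).1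
      exact_mod_cast (show (0:ℝ) < n from lt_trans (by positivity) h1)
    have h1 : κ*(1+2*κ*(2*Y/x)/k) ≤ 5*L^2*k/(Y*x) := by
      rw [X.hκ]
      have : L*k/Y*(1+2*(L*k/Y)*(2*Y/x)/k) = (L*k/(Y*x))*(x+4*L) := by field_simp; ring
      rw [this, show 5*L^2*k/(Y*x) = (L*k/(Y*x))*(L+4*L) by ring]
      gcongr; linarith
    have h2 : ∑ n ∈ JI η Y x with n.Coprime k, ‖g n/n‖^2 ≤ (x/Y)^2*(2*(Y/x*k.totient/k)) := by
      have c := (abs_le.1 (cnt_bd (D := 1) S.k1 le_rfl (Nat.coprime_one_left k) (show 0 ≤ Y/x by positivity) (show Y/x ≤ Y*Real.exp η/x by gcongr; exact le_mul_of_one_le_right hY0.le (Real.one_le_exp X.hη.le)))).2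
      have e4 : 4*(k:ℝ) ≤ Y/x*k.totient/k := by
        rw [le_div_iff₀ hk, div_mul_eq_mul_div, le_div_iff₀ hx]
        calc 4*(k:ℝ)*k*x = 4*(k:ℝ)^2*x := by ring
          _ ≤ 4*(k:ℝ)^2*Real.exp b := by gcongr
          _ ≤ Y*1 := by linarith
          _ ≤ _ := by gcongr
      have e5 : cnt k 1 (Y/x) (Y*Real.exp η/x) ≤ 2*(Y/x*k.totient/k) := by
        have : (Y*Real.exp η/x - Y/x)*k.totient/k*(1/(1:ℕ)) ≤ (Y*2/x - Y/x)*k.totient/k*1 := by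
          rw [Nat.cast_one, div_one]; gcongr
        have e6 : (Y*2/x - Y/x)*k.totient/k*1 = Y/x*k.totient/k := by ring
        linarith
      rw [cnt] at e5
      simp only [one_dvd, Finset.filter_true] at e5
      rw [← Finset.sum_filter] at e5
      refine le_trans ?_ (mul_le_mul_of_nonneg_left e5 (by positivity))
      rw [Finset.mul_sum]
      refine Finset.sum_le_sum fun n hn => ?_
      have h := (hm n (Finset.mem_filter.1 hn).1).1
      rw [norm_div, div_pow, Complex.norm_natCast, mul_one, show (x/Y)^2 = 1^2/(Y/x)^2 by field_simp]
      gcongr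
      exact X.hg n
    calc _ ≤ 5*L^2*k/(Y*x)*((x/Y)^2*(2*(Y/x*k.totient/k))) := mul_le_mul h1 h2 (Finset.sum_nonneg fun _ _ => sq_nonneg _) (by positivity)
      _ = _ := by field_simp; norm_num
  have h2 := Finset.sum_le_card_nsmul _ _ _ key
  rw [nsmul_eq_mul] at h2
  calc _ ≤ 2*(2*H*b)*((2*H*b)*(Real.exp (-(α*a))*(10*(k.totient*L^2/Y^2)))) := by
        gcongr
        exact h2.trans (by gcongr; exact T.N)
    _ = _ := by ring
end MR

namespace MR
open MeasureTheory

variable {Ω : Type*} [MeasurableSpace Ω] {ν : Measure Ω} {ψ : ℕ → Ω → ℂ} {k : ℕ} {κ : ℝ}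
variable {g : ℕ → ℂ} {η Y L : ℝ} {s s' : Finset ℕ} {H H' : ℕ} {a b W α a' b' W' α' : ℝ}

lemma Sy.onU (S : Sy ν ψ k κ) (f : Ω → ℂ) (l : ℕ → ℕ) (hf : ∀ v, Integrable (fun ω => ‖QQ ψ H s v ω^l v * f ω‖^2) ν) :
    ∫ ω in UU ψ H s α, ‖f ω‖^2 ∂ν ≤ ∑ v ∈ s.image (vv H), Real.exp (2*α*(l v*(v/H)))*∫ ω, ‖QQ ψ H s v ω^l v * f ω‖^2 ∂ν := by
  simp_rw [← integral_const_mul]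
  rw [← integral_finsetSum _ fun v _ => (hf v).const_mul _]
  have hi : Integrable (fun ω => ∑ v ∈ s.image (vv H), Real.exp (2*α*(l v*(v/H))) * ‖QQ ψ H s v ω^l v * f ω‖^2) ν := integrable_finsetSum _ fun v _ => (hf v).const_mul _
  refine le_trans (integral_mono_of_nonneg (ae_of_all _ fun _ => sq_nonneg _) hi.restrict ?_) (setIntegral_le_integral hi (ae_of_all _ fun ω => Finset.sum_nonneg fun _ _ => by positivity))
  filter_upwards [ae_restrict_mem S.mUU] with ω hω
  obtain ⟨v, hv, h⟩ := Set.mem_iUnion₂.1 hω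
  refine le_trans ?_ (Finset.single_le_sum (f := fun v => Real.exp (2*α*(l v*(v/H))) * ‖QQ ψ H s v ω^l v * f ω‖^2) (fun _ _ => by positivity) hv)
  have h1 : 1 ≤ Real.exp (α*(v/H))*‖QQ ψ H s v ω‖ := by
    have h2 : Real.exp (-(α*(v/H))) < ‖QQ ψ H s v ω‖ := h
    rw [Real.exp_neg, inv_lt_iff_one_lt_mul₀ (Real.exp_pos _)] at h2; linarith
  calc ‖f ω‖^2 ≤ (Real.exp (α*(v/H))*‖QQ ψ H s v ω‖)^(l v*2)*‖f ω‖^2 := le_mul_of_one_le_left (sq_nonneg _) (one_le_pow₀ h1)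
    _ = _ := by
      rw [mul_pow, ← Real.exp_nat_mul, norm_mul, norm_pow, mul_pow, ← pow_mul, mul_assoc]
      congr 2; push_cast; ring

lemma fact_exp (n : ℕ) : (n.factorial:ℝ) ≤ Real.exp (n*Real.log n) := by
  rcases Nat.eq_zero_or_pos n with rfl | h
  · simp
  rw [Real.exp_nat_mul, Real.exp_log (by exact_mod_cast h)]
  exact_mod_cast Nat.factorial_le_pow n

lemma numst {V V' : ℝ} {l : ℕ} (ha : 2 ≤ a) (ha' : 2 ≤ a') (h1 : a/2 ≤ V) (h2 : V ≤ b) (h3 : a'/2 ≤ V') (h4 : V' ≤ b') (hl : l = ⌈V/V'⌉₊)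
    (hα0 : 0 ≤ α') (hα1 : α' ≤ 1) (hΔ : α - α' ≤ 1) (c1 : 8*(1+Real.log (8*b)) ≤ (α-α')*a') (c2 : 16*b' ≤ (α-α')*a) :
    Real.exp (-(2*α*V))*(Real.exp (2*α'*(l*V'))*(3*(2*Real.exp (V'+l))^2*Real.exp 6*(2*l).factorial)) ≤ 12*Real.exp 6*Real.exp (-((α-α')*a/4)) := by
  have hV' : 0 < V' := by linarith
  have hV : 0 < V := by linarith
  have ha0' : 0 < a' := by linarith
  have hΔ0 : 0 ≤ α - α' := by
    by_contra h; push Not at h; nlinarith only [ha', h3, h4, c2, h, ha]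
  have hVV : V' ≤ V := by nlinarith only [ha, h1, h4, hΔ, c2]
  have e1 : (l:ℝ) < V/V'+1 := by rw [hl]; exact Nat.ceil_lt_add_one (by positivity)
  have e2 : (l:ℝ)*V' ≤ V+V' := by
    have : (V/V'+1)*V' = V+V' := by field_simp
    nlinarith only [e1, this, ha', h3]
  have e3 : (l:ℝ) ≤ 4*V/a' := by
    rw [le_div_iff₀ (by linarith)]
    have : (l:ℝ)*a' ≤ l*(2*V') := by gcongr; linarith
    linarith
  have e4 : (2*l:ℝ) ≤ 8*b := by
    have : 4*V/a' ≤ 4*V/2 := by gcongr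
    linarith
  have l1 : 1 ≤ l := by rw [hl]; exact Nat.ceil_pos.2 (by positivity)
  have l1' : (1:ℝ) ≤ l := by exact_mod_cast l1
  have e5 : Real.log (2*l) ≤ Real.log (8*b) := Real.log_le_log (by positivity) e4
  have e6 : 2*(l:ℝ)*(1+Real.log (8*b)) ≤ (α-α')*V := by
    have hlog : 0 ≤ Real.log (8*b) := Real.log_nonneg (by linarith)
    calc _ ≤ 2*(4*V/a')*(1+Real.log (8*b)) := by gcongr
      _ = (8*(1+Real.log (8*b)))*(V/a') := by ring
      _ ≤ ((α-α')*a')*(V/a') := by gcongr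
      _ = _ := by field_simp
  have hf := fact_exp (2*l)
  push_cast at hf
  calc _ ≤ Real.exp (-(2*α*V))*(Real.exp (2*α'*(l*V'))*(3*(2*Real.exp (V'+l))^2*Real.exp 6*Real.exp (2*l*Real.log (2*l)))) := by gcongr
    _ = 12*Real.exp 6*Real.exp (-(2*α*V)+2*α'*(l*V')+2*(V'+l)+2*l*Real.log (2*l)) := by
      rw [mul_pow, ← Real.exp_nat_mul, Real.exp_add, Real.exp_add, Real.exp_add]; push_cast; ring
    _ ≤ _ := by
      gcongr
      have q1 : 2*α'*(l*V') ≤ 2*α'*V + 2*V' := by nlinarith only [hα1, ha', h3, hα0, e2]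
      have q2 : 2*(l:ℝ)*Real.log (2*l) ≤ 2*l*Real.log (8*b) := by gcongr
      have q3 : (α-α')*(a/2) ≤ (α-α')*V := by gcongr
      linarith only [h4, c2, e6, q1, q2, q3]

lemma Cx.step (X : Cx ν ψ k κ g η Y L) (T' : Stg k g Y s' H' a' b' W') (T : Stg k g Y s H a b W)
    (hα0 : 0 ≤ α') (hα1 : α' ≤ 1) (hΔ : α - α' ≤ 1) (c1 : 8*(1+Real.log (8*b)) ≤ (α-α')*a') (c2 : 16*b' ≤ (α-α')*a) :
    ∫ ω in UU ψ H' s' α', ‖RR g ψ η Y 1 ω‖^2 ∂ν ≤ ∫ ω in UU ψ H s α, ‖RR g ψ η Y 1 ω‖^2 ∂ν + 10560*(k.totient*L^2/Y^2)*(1/W+1/H+Real.exp (-a))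
      + 192*Real.exp 6*(H'*b')*(H*b)^2*Real.exp (-((α-α')*a/4))*(L^2*k/Y^2) := by
  have S := X.toSy
  have hb0 : 0 ≤ b := by linarith [T.ab, T.ha]
  have hb0' : 0 ≤ b' := by linarith [T'.ab, T'.ha]
  have eη : Real.exp η ≤ 2 := (Real.exp_le_exp.2 X.hη1).trans exp_half
  have hU' : MeasurableSet (UU ψ H' s' α') := S.mUU
  refine (X.split T (α := α) hU').trans (add_le_add le_rfl ?_)
  set E := 12*Real.exp 6*Real.exp (-((α-α')*a/4)) with hE
  have key : ∀ v ∈ s.image (vv H), ∫ ω in UU ψ H' s' α' \ UU ψ H s α, ‖QQ ψ H s v ω^1 * RR g ψ η Y (xv H v) ω‖^2 ∂ν ≤ (2*H'*b')*(E*(L^2*k/Y^2)) := by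
    intro v hv
    obtain ⟨v1, v2⟩ := T.vb hv
    refine (X.offU _ (S.iRR _) hU' hv).trans ?_
    set l : ℕ → ℕ := fun v' => ⌈(v/H:ℝ)/(v'/H')⌉₊
    refine (mul_le_mul_of_nonneg_left (S.onU _ l fun v' => S.iQR _ _ _) (Real.exp_pos _).le).trans ?_
    rw [Finset.mul_sum]
    refine (Finset.sum_le_card_nsmul _ _ (E*(L^2*k/Y^2)) fun v' hv' => ?_).trans (by rw [nsmul_eq_mul]; gcongr; exact T'.N)
    obtain ⟨w1, w2⟩ := T'.vb hv'
    have hw0 : (0:ℝ) < v'/H' := by linarith [T'.ha]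
    have hll : (v/H:ℝ) ≤ l v'*(v'/H') := by rw [← div_le_iff₀ hw0]; exact Nat.le_ceil _
    have hlu : (l v':ℝ)*(v'/H') ≤ v/H + v'/H' := by
      have : (l v':ℝ) < (v/H:ℝ)/(v'/H')+1 := Nat.ceil_lt_add_one (div_nonneg (by linarith [T.ha]) hw0.le)
      calc _ ≤ ((v/H:ℝ)/(v'/H')+1)*(v'/H') := by gcongr
        _ = _ := by rw [add_mul, div_mul_cancel₀ _ hw0.ne', one_mul]
    have hn := numst T.ha T'.ha v1 v2 w1 w2 (l := l v') rfl hα0 hα1 hΔ c1 c2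
    obtain ⟨B1, B2⟩ := T'.blk v'
    have iH : (1/H':ℝ) ≤ 1 := by rw [div_le_one (by exact_mod_cast T'.hH)]; exact_mod_cast T'.hH
    have hm := S.mom (η := η) X.hY X.hL X.hκ X.hg (x := xv H v) (z := 2*Real.exp (v'/H'+l v')) (xv_pos _ _) (one_le_xv _ _) _ B1 B2 (l := l v')
      (by rw [xv, xv, ← Real.exp_nat_mul]; exact Real.exp_le_exp.2 hll) (by linarith only [hw0, Real.one_le_exp (show (0:ℝ) ≤ v'/H'+l v' by positivity)]) (by
        rw [xv, xv, ← Real.exp_add, ← Real.exp_nat_mul, ← Real.exp_sub, ← Real.exp_add]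
        have := (Real.exp_le_exp.2 X.hη1).trans exp_half
        calc _ ≤ Real.exp (η + (v'/H'+l v')) := by
              refine Real.exp_le_exp.2 ?_
              have : (l v':ℝ)*(1/H') ≤ l v'*1 := by gcongr
              linarith only [hlu, this]
          _ ≤ _ := by rw [Real.exp_add]; gcongr)
    calc _ ≤ Real.exp (-(2*α*(v/H)))*(Real.exp (2*α'*(l v'*(v'/H')))*(3*(2*Real.exp (v'/H'+l v'))^2*Real.exp 6*(2*l v').factorial*(L^2*k/Y^2))) := by
          gcongr; exact hm
      _ = (Real.exp (-(2*α*(v/H)))*(Real.exp (2*α'*(l v'*(v'/H')))*(3*(2*Real.exp (v'/H'+l v'))^2*Real.exp 6*(2*l v').factorial)))*(L^2*k/Y^2) := by ring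
      _ ≤ _ := by gcongr
  have h2 := Finset.sum_le_card_nsmul _ _ _ key
  rw [nsmul_eq_mul] at h2
  calc _ ≤ 2*(2*H*b)*((2*H*b)*((2*H'*b')*(E*(L^2*k/Y^2)))) := by
        gcongr
        exact h2.trans (by gcongr; exact T.N)
    _ = _ := by rw [hE]; ring

lemma Cx.mass (X : Cx ν ψ k κ g η Y L) (T : Stg k g Y s H a b W) (hα0 : 0 ≤ α) {l0 : ℕ} (hl0 : (Real.log Y + 1)/(a/2)+1 ≤ l0) :
    ν.real (UU ψ H s α) ≤ (2*H*b)*(Real.exp (2*α*(Real.log Y+1+b))*(3*Real.exp (1+b+l0)^2*Real.exp 6*(2*l0).factorial*(L^2*k/Y^2))) := by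
  have S := X.toSy
  haveI := S.fin
  have hY0 : 0 < Y := by linarith [X.hY]
  have hlY := Real.log_nonneg X.hY
  have ha := T.ha
  have hb0 : 0 ≤ b := by linarith [T.ab]
  set l : ℕ → ℕ := fun v => ⌈(Real.log Y+1)/(v/H)⌉₊
  have hR : ∀ ω, RR 1 ψ η Y (Y*Real.exp η) ω = ψ 1 ω := fun ω => by
    have : JI η Y (Y*Real.exp η) = {1} := by
      ext n
      rw [mem_JI hY0 (by positivity), Finset.mem_singleton]
      have e := Real.one_lt_exp_iff.2 X.hη
      constructor
      · rintro ⟨h1, h2⟩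
        have h3 : (n:ℝ) ≤ 1 := by
          by_contra h; push Not at h; have : 0 < Y*Real.exp η := by positivity
          nlinarith only [h2, hY0, h, h1]
        have h4 : 0 < n := by
          rcases Nat.eq_zero_or_pos n with rfl | h
          · simp at h1; linarith
          · exact h
        have : n ≤ 1 := by exact_mod_cast h3
        omega
      · rintro rfl; simp; nlinarith
    rw [RR, this]; simp
  have hQ : ∀ v n ω, 1 ≤ n → QQ ψ H s v ω^n*1 = QQ ψ H s v ω^n * RR 1 ψ η Y (Y*Real.exp η) ω := fun v n ω hn => by
    have : QQ ψ H s v ω*ψ 1 ω = QQ ψ H s v ω := by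
      rw [QQ, Finset.sum_mul]
      exact Finset.sum_congr rfl fun p _ => by rw [mul_assoc, ← S.mul, mul_one]
    obtain ⟨m, rfl⟩ : ∃ m, n = m+1 := ⟨n-1, by omega⟩
    rw [hR, pow_succ, mul_assoc, mul_assoc, this, mul_one]
  have hi : ∀ v, Integrable (fun ω => ‖QQ ψ H s v ω^l v * 1‖^2) ν := fun v =>
    S.intsq (((S.mQQ v).pow_const _).mul_const _) (fun ω => by
      rw [mul_one, norm_pow]; exact pow_le_pow_left₀ (norm_nonneg _) (S.bQQ v ω) _)
  have h1 := S.onU (s := s) (H := H) (α := α) (fun _ => 1) l hi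
  simp only [norm_one, one_pow, integral_const, smul_eq_mul, mul_one, measureReal_restrict_apply_univ] at h1
  refine h1.trans ?_
  refine (Finset.sum_le_card_nsmul _ _ (Real.exp (2*α*(Real.log Y+1+b))*(3*Real.exp (1+b+l0)^2*Real.exp 6*(2*l0).factorial*(L^2*k/Y^2))) fun v hv => ?_).trans (by rw [nsmul_eq_mul]; gcongr; exact T.N)
  obtain ⟨w1, w2⟩ := T.vb hv
  have hw0 : (0:ℝ) < v/H := by linarith [T.ha]
  have hll : (Real.log Y+1) ≤ l v*(v/H) := by rw [← div_le_iff₀ hw0]; exact Nat.le_ceil _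
  have hlt : (l v:ℝ) < (Real.log Y+1)/(v/H)+1 := Nat.ceil_lt_add_one (div_nonneg (by linarith) hw0.le)
  have hlu : (l v:ℝ)*(v/H) ≤ Real.log Y+1 + b := by
    calc _ ≤ ((Real.log Y+1)/(v/H)+1)*(v/H) := by gcongr
      _ = Real.log Y+1 + v/H := by rw [add_mul, div_mul_cancel₀ _ hw0.ne', one_mul]
      _ ≤ _ := by linarith
  have hl00 : l v ≤ l0 := by
    have : (Real.log Y+1)/(v/H) ≤ (Real.log Y + 1)/(a/2) := by gcongr
    exact_mod_cast (show (l v:ℝ) ≤ l0 by linarith only [hl0, hlt, this])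
  have hl1 : 1 ≤ l v := Nat.ceil_pos.2 (div_pos (by linarith only [hlY]) hw0)
  obtain ⟨B1, B2⟩ := T.blk v
  have iH : (1/H:ℝ) ≤ 1 := by rw [div_le_one (by exact_mod_cast T.hH)]; exact_mod_cast T.hH
  have hm := S.mom (η := η) X.hY X.hL X.hκ (b := 1) (by simp) (x := Y*Real.exp η) (z := Real.exp (1+b+l0)) (by positivity) (one_le_xv _ _) _ B1 B2 (l := l v)
      (by
        rw [xv, ← Real.exp_nat_mul]
        calc _ = Real.exp (Real.log Y + η) := by rw [Real.exp_add, Real.exp_log hY0]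
          _ ≤ _ := Real.exp_le_exp.2 (by linarith only [hll, X, X.hη1])) (Real.one_le_exp (by positivity)) (by
        rw [xv, ← Real.exp_add, ← Real.exp_nat_mul, show Real.exp η/(Y*Real.exp η) = Real.exp (-Real.log Y) by rw [Real.exp_neg, Real.exp_log hY0]; field_simp, ← Real.exp_add]
        refine Real.exp_le_exp.2 ?_
        have : (l v:ℝ)*(1/H) ≤ l v*1 := by gcongr
        have : (l v:ℝ) ≤ l0 := by exact_mod_cast hl00
        linarith)
  refine mul_le_mul (Real.exp_le_exp.2 (by gcongr)) ?_ (integral_nonneg fun _ => sq_nonneg _) (Real.exp_pos _).le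
  calc _ = ∫ ω, ‖(∑ p ∈ s with vv H p = v, (1/p:ℂ)*ψ p ω)^l v * RR 1 ψ η Y (Y*Real.exp η) ω‖^2 ∂ν := by
        refine integral_congr_ae (ae_of_all _ fun ω => ?_)
        have := hQ v (l v) ω hl1
        rw [mul_one] at this
        dsimp only; rw [this, QQ]
    _ ≤ _ := hm
    _ ≤ _ := by gcongr
end MR

namespace MR
open MeasureTheory

variable {k q : ℕ} {g : ℕ → ℂ} {Y a b : ℝ} {H : ℕ}

noncomputable def sP (q : ℕ) (a b : ℝ) : Finset ℕ := (Finset.Ioc ⌊Real.exp a⌋₊ ⌊Real.exp b⌋₊).filter fun p => p.Prime ∧ ¬ p ∣ q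
noncomputable def sW (q : ℕ) (a b : ℝ) : ℝ := ∑ p ∈ sP q a b, (1/p:ℝ)
noncomputable def pf (q : ℕ) : ℝ := ∑ p ∈ q.primeFactors, (1/p:ℝ)

lemma stg_mk (hk : k ∣ q) (hg : ∀ p : ℕ, p.Prime → ¬ p ∣ q → ∀ m, g (p*m) = if p ∣ m then 0 else - g m) (hH : 1 ≤ H) (ha : 2 ≤ a)
    (hW : 1 ≤ sW q a b) (hY : (k:ℝ)^2*Real.exp (2*b)*H ≤ Y) : Stg k g Y (sP q a b) H a b (sW q a b) where
  hH := hH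
  ha := ha
  hs p hp := by
    simp only [sP, Finset.mem_filter, Finset.mem_Ioc] at hp
    obtain ⟨⟨h1, h2⟩, h3, h4⟩ := hp
    refine ⟨h3, (Nat.floor_lt (Real.exp_pos _).le).1 h1, (Nat.le_floor_iff (Real.exp_pos _).le).1 h2, ?_⟩
    exact (h3.coprime_iff_not_dvd).2 fun h => h4 (h.trans hk)
  hgp p hp := by
    simp only [sP, Finset.mem_filter] at hp
    exact hg p hp.2.1 hp.2.2
  hW := rfl
  hW1 := hW
  hY := by
    refine le_trans ?_ hY
    have : ((sP q a b).card:ℝ) ≤ Real.exp b := by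
      refine le_trans ?_ (Nat.floor_le (Real.exp_pos b).le)
      exact_mod_cast (Finset.card_filter_le _ _).trans (by rw [Nat.card_Ioc]; omega)
    rw [show 2*b = (2:ℕ)*b by push_cast; ring, Real.exp_nat_mul]
    gcongr

lemma sW_ge (hq : 1 ≤ q) (a b : ℝ) : ps (Real.exp a) (Real.exp b) - pf q ≤ sW q a b := by
  rw [sub_le_iff_le_add, ps, sW, pf, sP]
  refine le_trans ?_ ((le_add_of_nonneg_right (Finset.sum_nonneg fun p _ => by positivity)).trans_eq Finset.sum_union_inter)
  refine Finset.sum_le_sum_of_subset_of_nonneg (fun p hp => ?_) fun _ _ _ => by positivity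
  simp only [Finset.mem_filter, Finset.mem_union, Nat.mem_primeFactors] at hp ⊢
  by_cases h : p ∣ q
  · exact Or.inr ⟨hp.2, h, by omega⟩
  · exact Or.inl ⟨hp.1, hp.2, h⟩

lemma sW_eq (hq : 1 ≤ q) (hqa : (q:ℝ) ≤ Real.exp a) : sW q a b = ps (Real.exp a) (Real.exp b) := by
  rw [sW, ps, sP]
  refine Finset.sum_congr (Finset.filter_congr fun p hp => ?_) fun _ _ => rfl
  refine and_iff_left fun h => ?_
  have h1 := (Nat.floor_lt (Real.exp_pos _).le).1 (Finset.mem_Ioc.1 hp).1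
  have h2 := Nat.le_of_dvd hq h
  have : (p:ℝ) ≤ q := by exact_mod_cast h2
  linarith

lemma tot_bd (hq : 1 ≤ q) (hk : k ∣ q) : (k:ℝ) ≤ k.totient*Real.exp (2*pf q) := by
  have hk0 : k ≠ 0 := fun h => by rw [h, zero_dvd_iff] at hk; omega
  have h := Nat.totient_eq_mul_prod_factors k
  have h' : (k.totient:ℝ) = k*∏ p ∈ k.primeFactors, (1-(p:ℝ)⁻¹) := by
    have := congrArg (Rat.cast : ℚ → ℝ) h
    push_cast at this
    exact this
  have h1 : ∏ p ∈ k.primeFactors, Real.exp (-(2*(1/p))) ≤ ∏ p ∈ k.primeFactors, (1-(p:ℝ)⁻¹) := by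
    refine Finset.prod_le_prod (fun _ _ => (Real.exp_pos _).le) fun p hp => ?_
    have hp2 : (2:ℝ) ≤ p := by exact_mod_cast (Nat.prime_of_mem_primeFactors hp).two_le
    rw [one_div]
    have hy : (p:ℝ)⁻¹ ≤ 1/2 := by rw [inv_le_comm₀ (by linarith) (by norm_num)]; rw [show ((1:ℝ)/2)⁻¹ = 2 by norm_num]; exact hp2
    have hy0 : 0 < (p:ℝ)⁻¹ := by positivity
    set y := (p:ℝ)⁻¹
    have := Real.quadratic_le_exp_of_nonneg (show 0 ≤ 2*y by linarith)
    rw [Real.exp_neg, inv_le_iff_one_le_mul₀ (Real.exp_pos _)]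
    have h5 : (1+2*y+(2*y)^2/2)*(1-y) ≤ Real.exp (2*y)*(1-y) := mul_le_mul_of_nonneg_right this (by linarith)
    nlinarith [mul_pos hy0 hy0]
  rw [← Real.exp_sum] at h1
  have h2 : ∑ p ∈ k.primeFactors, -(2*(1/(p:ℝ))) ≥ -(2*pf q) := by
    rw [Finset.sum_neg_distrib, ← Finset.mul_sum, pf]
    have := Finset.sum_le_sum_of_subset_of_nonneg (f := fun p : ℕ => (1/p:ℝ)) (Nat.primeFactors_mono hk (by omega)) fun _ _ _ => by positivity
    linarith
  have h3 := (Real.exp_le_exp.2 h2).trans h1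
  rw [h', mul_assoc]
  refine le_mul_of_one_le_right (Nat.cast_nonneg _) ?_
  calc (1:ℝ) = Real.exp (-(2*pf q))*Real.exp (2*pf q) := by rw [← Real.exp_add]; simp
    _ ≤ _ := by gcongr

/-- lower bound for prime sums -/
lemma ps_log : ∃ c Λ : ℝ, 0 < c ∧ 1 ≤ Λ ∧ ∀ l ≥ Λ, c*Real.log l ≤ ps (Real.exp l) (Real.exp (l^2)) := by
  obtain ⟨P0, c, h2, hc, h⟩ := ps_lower
  refine ⟨c/2, max (Real.log P0) (Real.exp 4), by positivity, le_trans (Real.one_le_exp (by norm_num)) (le_max_right _ _), fun l hl => ?_⟩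
  have h1 : P0 ≤ Real.exp l := by
    rw [← Real.log_le_iff_le_exp (by linarith)]; exact (le_max_left _ _).trans hl
  have h4 : Real.exp 4 ≤ l := (le_max_right _ _).trans hl
  have hl0 : 0 < l := (Real.exp_pos 4).trans_le h4
  have hlog : 4 ≤ Real.log l := by rwa [Real.le_log_iff_exp_le hl0]
  set j := ⌊Real.log l⌋₊
  have hj : (j:ℝ) ≤ Real.log l := Nat.floor_le (by linarith)
  have hj' := Nat.lt_floor_add_one (Real.log l)
  have hj2 : (2:ℝ)^j ≤ l := by
    calc (2:ℝ)^j ≤ Real.exp 1^j := by gcongr; linarith [Real.exp_one_gt_d9]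
      _ = Real.exp j := by rw [← Real.exp_nat_mul, mul_one]
      _ ≤ Real.exp (Real.log l) := Real.exp_le_exp.2 hj
      _ = l := Real.exp_log hl0
  have h5 := h (Real.exp l) h1 j
  have h6 : (Real.exp l)^(2^j) ≤ Real.exp (l^2) := by
    rw [← Real.exp_nat_mul]; refine Real.exp_le_exp.2 ?_; push_cast; nlinarith
  have h7 : ps (Real.exp l) ((Real.exp l)^(2^j)) ≤ ps (Real.exp l) (Real.exp (l^2)) := by
    refine Finset.sum_le_sum_of_subset_of_nonneg (Finset.filter_subset_filter _ (Finset.Ioc_subset_Ioc_right (Nat.floor_le_floor h6))) fun _ _ _ => by positivity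
  refine le_trans ?_ (h5.trans h7)
  rw [div_mul_eq_mul_div, mul_div_assoc]
  have : Real.log l < j+1 := hj'
  gcongr; linarith
end MR

namespace MR
open MeasureTheory

lemma ev_exp (n : ℕ) (C : ℝ) {c : ℝ} (hc : 0 < c) : ∀ᶠ l : ℝ in atTop, C*l^n*Real.exp (-(c*l)) ≤ 1 := by
  have h := (isLittleO_pow_exp_pos_mul_atTop n hc).bound (show 0 < 1/(|C|+1) by positivity)
  filter_upwards [h, eventually_ge_atTop 0] with l hl h0
  rw [Real.norm_of_nonneg (by positivity), Real.norm_of_nonneg (by positivity), div_mul_eq_mul_div, one_mul, le_div_iff₀ (by positivity)] at hl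
  rw [Real.exp_neg, ← div_eq_mul_inv, div_le_one (Real.exp_pos _)]
  have : 0 ≤ l^n := by positivity
  nlinarith [le_abs_self C]

lemma ev_log (C : ℝ) {c : ℝ} (hc : 0 < c) : ∀ᶠ l : ℝ in atTop, C*(1+Real.log l)^2 ≤ c*l := by
  have h := (Real.isLittleO_pow_log_id_atTop (n := 2)).bound (show 0 < c/(4*(|C|+1)) by positivity)
  filter_upwards [h, eventually_ge_atTop (Real.exp 1)] with l hl h0
  have hl0 : 0 < l := (Real.exp_pos 1).trans_le h0
  have h1 : 1 ≤ Real.log l := by rwa [Real.le_log_iff_exp_le hl0]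
  rw [Real.norm_of_nonneg (by positivity), id, Real.norm_of_nonneg hl0.le, div_mul_eq_mul_div, le_div_iff₀ (by positivity)] at hl
  have h2 : (1+Real.log l)^2 ≤ 4*Real.log l^2 := by nlinarith
  have := le_abs_self C
  have h3 := mul_le_mul_of_nonneg_left h2 (show 0 ≤ |C|+1 by positivity)
  nlinarith only [hl, h1, h2, h3, this, sq_nonneg (1+Real.log l)]

variable {Ω : Type*} [MeasurableSpace Ω] {ν : Measure Ω} {ψ : ℕ → Ω → ℂ} {k q : ℕ} {κ : ℝ} {g : ℕ → ℂ} {η Y L : ℝ}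

/-- context with modulus -/
structure Cq (ν : Measure Ω) (ψ : ℕ → Ω → ℂ) (k : ℕ) (κ : ℝ) (g : ℕ → ℂ) (η Y L : ℝ) (q : ℕ) : Prop extends Cx ν ψ k κ g η Y L where
  hq : 1 ≤ q
  hk : k ∣ q
  hgq : ∀ p : ℕ, p.Prime → ¬ p ∣ q → ∀ m, g (p*m) = if p ∣ m then 0 else - g m
  hYk : ∀ x : ℝ, 1 ≤ x → x^3 ≤ Real.log Y^2 → (k:ℝ)^2*Real.exp (2*x)*(2*x) ≤ Y

noncomputable def Th (k : ℕ) (L Y : ℝ) : ℝ := k.totient*L^2/Y^2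
noncomputable def Iu (ν : Measure Ω) (ψ : ℕ → Ω → ℂ) (g : ℕ → ℂ) (η Y : ℝ) (q H : ℕ) (a b α : ℝ) : ℝ := ∫ ω in UU ψ H (sP q a b) α, ‖RR g ψ η Y 1 ω‖^2 ∂ν
noncomputable def Il (ν : Measure Ω) (ψ : ℕ → Ω → ℂ) (g : ℕ → ℂ) (η Y : ℝ) (q : ℕ) (σ l : ℝ) : ℝ := Iu ν ψ g η Y q ⌈l⌉₊ l (l^2) (σ*(1-1/Real.log l))

lemma Cq.st (X : Cq ν ψ k κ g η Y L q) {c l : ℝ} (hl : 2 ≤ l) (hc : c*Real.log l ≤ ps (Real.exp l) (Real.exp (l^2))) (hc2 : 2 ≤ c*Real.log l) (hp : pf q ≤ c/2*Real.log l)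
    (hlY : l^6 ≤ Real.log Y^2) : Stg k g Y (sP q l (l^2)) ⌈l⌉₊ l (l^2) (sW q l (l^2)) ∧ c/2*Real.log l ≤ sW q l (l^2) := by
  have h := sW_ge X.hq l (l^2)
  have hW : c/2*Real.log l ≤ sW q l (l^2) := by linarith
  refine ⟨stg_mk X.hk X.hgq (Nat.one_le_ceil_iff.2 (by linarith)) hl (by linarith) (le_trans ?_ (X.hYk (l^2) (by nlinarith only [hl]) (by rw [← pow_mul]; exact hlY))), hW⟩
  gcongr
  have := Nat.ceil_lt_add_one (show 0 ≤ l by linarith)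
  nlinarith only [hl, this]

lemma Cq.th (X : Cq ν ψ k κ g η Y L q) {K : ℝ} (hK : Real.exp (2*pf q) ≤ K) : L^2*k/Y^2 ≤ K*Th k L Y := by
  have := (tot_bd X.hq X.hk).trans (mul_le_mul_of_nonneg_left hK (Nat.cast_nonneg _))
  have hL := X.hL
  rw [Th, mul_div_assoc', mul_comm (L^2), mul_left_comm, ← mul_assoc]
  gcongr

set_option maxHeartbeats 1000000 in
lemma tower {c Λ0 σ : ℝ} (hc : 0 < c) (hc1 : c ≤ 1) (hc0 : ∀ l ≥ Λ0, c*Real.log l ≤ ps (Real.exp l) (Real.exp (l^2))) (hσ : 0 < σ) (hσ1 : σ ≤ 1/2) :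
    ∃ Λ ≥ Λ0, Real.exp 1 ≤ Λ ∧ (2 ≤ c*Real.log Λ) ∧ ∀ l ≥ Λ, ∀ {Ω : Type} [MeasurableSpace Ω] {ν : Measure Ω} {ψ : ℕ → Ω → ℂ} {k q : ℕ} {κ : ℝ} {g : ℕ → ℂ} {η Y L : ℝ}, Cq ν ψ k κ g η Y L q →
      pf q ≤ c/2*Real.log l → l^18 ≤ Real.log Y^2 →
      Il ν ψ g η Y q σ l ≤ Il ν ψ g η Y q σ (l^3) + (10560*(2/c+2)+1)*(Th k L Y/Real.log l) := by
  have hlg : ∀ᶠ l : ℝ in atTop, 2/c ≤ Real.log l := Real.tendsto_log_atTop.eventually_ge_atTop _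
  obtain ⟨Λ, hΛ⟩ := eventually_atTop.1 ((((ev_log 48 (show 0 < 2*σ/3 by positivity)).and (ev_exp 23 (1536*Real.exp 6) (show 0 < σ/6 by positivity))).and hlg).and ((eventually_ge_atTop Λ0).and (eventually_ge_atTop 3)))
  have e1 := Real.exp_one_lt_d9
  obtain ⟨⟨_, b3⟩, b4, b5⟩ := hΛ Λ le_rfl
  refine ⟨Λ, b4, by linarith, by rwa [div_le_iff₀' hc] at b3, fun l hl => ?_⟩
  obtain ⟨⟨⟨h1, h2⟩, h3⟩, h4, h5⟩ := hΛ l hl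
  intro Ω _ ν ψ k q κ g η Y L X hp hY
  have hl0 : 0 < l := by linarith only [hσ, hσ1, b5, hl]
  have hlog1 : 1 ≤ Real.log l := by rw [Real.le_log_iff_exp_le hl0]; linarith only [hσ, hσ1, e1, b5, hl]
  have hlogl : Real.log l ≤ l := (Real.log_le_sub_one_of_pos hl0).trans (by linarith)
  rw [div_le_iff₀' hc] at h3
  have hl3 : l ≤ l^3 := le_self_pow₀ (by linarith) (by norm_num)
  have elog : Real.log (l^3) = 3*Real.log l := by rw [Real.log_pow]; norm_num
  have hx : 0 ≤ c*Real.log l := by linarith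
  have T' := (X.st (by linarith) (hc0 l h4) h3 hp ((pow_le_pow_right₀ (by linarith only [hσ, hσ1, b5, hl]) (by norm_num)).trans hY)).1
  obtain ⟨T, hW⟩ := X.st (c := c) (l := l^3) (by linarith only [hσ, hσ1, b5, hl, hl3]) (hc0 _ (ge_trans hl3 h4)) (by rw [elog]; linarith only [hσ, hσ1, h3]) (by rw [elog]; linarith only [hσ, hσ1, h3, hp]) (by rw [← pow_mul]; exact hY)
  rw [elog] at hW
  set t := Real.log l with ht
  have hΔ : σ*(1-1/Real.log (l^3)) - σ*(1-1/t) = 2*σ/3/t := by rw [elog]; field_simp; ring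
  have i1 : 1/t ≤ 1 := by rw [div_le_one (by linarith only [hσ, hσ1, hlog1])]; exact hlog1
  have i0 : 0 < 1/t := by positivity
  have hΔ1 : 2*σ/3/t ≤ 1 := by rw [div_le_one (by linarith only [hσ, hσ1, hlog1])]; linarith only [hσ, hσ1, hlog1]
  have l8 : Real.log 8 ≤ 3 := by
    rw [show (8:ℝ) = 2^3 by norm_num, Real.log_pow]; push_cast; linarith only [hσ, hσ1, Real.log_two_lt_d9]
  have c1 : 8*(1+Real.log (8*(l^3)^2)) ≤ 2*σ/3/t*l := by
    rw [Real.log_mul (by norm_num) (by positivity), ← pow_mul, Real.log_pow, div_mul_eq_mul_div, le_div_iff₀ (by linarith only [hσ, hσ1, hlog1])]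
    push_cast; rw [← ht]
    refine le_trans ?_ h1
    have := mul_le_mul_of_nonneg_right l8 (show 0 ≤ t by linarith only [hσ, hσ1, hlog1])
    nlinarith only [this, hlog1]
  have c2 : 16*l^2 ≤ 2*σ/3/t*l^3 := by
    rw [div_mul_eq_mul_div, le_div_iff₀ (by linarith only [hσ, hσ1, hlog1])]
    have : 16*t ≤ 2*σ/3*l := by
      refine le_trans ?_ h1
      nlinarith only [hlog1]
    calc 16*l^2*t = l^2*(16*t) := by ring
      _ ≤ l^2*(2*σ/3*l) := by gcongr
      _ = _ := by ring
  have h := X.step T' T (α' := σ*(1-1/t)) (α := σ*(1-1/Real.log (l^3))) (mul_nonneg hσ.le (by linarith only [i1])) ((mul_le_of_le_one_right hσ.le (by linarith only [i0])).trans (by linarith only [hσ, hσ1])) (by rw [hΔ]; exact hΔ1) (by rw [hΔ]; exact c1) (by rw [hΔ]; exact c2)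
  rw [hΔ] at h
  rw [Il, Il, Iu, Iu]
  refine h.trans ?_
  rw [add_assoc]
  refine add_le_add le_rfl ?_
  have hTh : 0 ≤ Th k L Y := by rw [Th]; positivity
  have hK : Real.exp (2*pf q) ≤ l := by
    rw [← Real.le_log_iff_exp_le hl0, ← ht]; have := mul_le_mul_of_nonneg_right hc1 (show 0 ≤ t by linarith only [hσ, hσ1, hlog1]); linarith only [hp, this]
  have hE := X.th hK
  have cl : ∀ x : ℝ, 1 ≤ x → (⌈x⌉₊:ℝ) ≤ 2*x := fun x hx => by linarith [Nat.ceil_lt_add_one (show 0 ≤ x by linarith only [hσ, hσ1, hx])]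
  have e3 : 192*Real.exp 6*(⌈l⌉₊*l^2)*(⌈l^3⌉₊*(l^3)^2)^2*Real.exp (-(2*σ/3/t*l^3/4))*(L^2*k/Y^2) ≤ Th k L Y/t := by
    have : Real.exp (-(2*σ/3/t*l^3/4)) ≤ Real.exp (-(σ/6*l)) := by
      rw [Real.exp_le_exp, neg_le_neg_iff, show 2*σ/3/t*l^3/4 = σ/6*(l^3/t) by ring]
      gcongr
      rw [le_div_iff₀ (by linarith only [hσ, hσ1, hlog1])]
      have := mul_le_mul_of_nonneg_left hlogl hl0.le
      have : l^2 ≤ l^3 := pow_le_pow_right₀ (by linarith only [hσ, hσ1, b5, hl]) (by norm_num)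
      linarith [sq l]
    calc _ ≤ 192*Real.exp 6*((2*l)*l^2)*((2*l^3)*(l^3)^2)^2*Real.exp (-(σ/6*l))*(l*Th k L Y) := by
            gcongr
            · exact cl _ (by linarith only [hσ, hσ1, b5, hl])
            · exact cl _ (by linarith only [hσ, hσ1, b5, hl, hl3])
      _ = (1536*Real.exp 6*l^23*Real.exp (-(σ/6*l)))*(Th k L Y/l) := by field_simp; ring
      _ ≤ 1*(Th k L Y/t) := by gcongr
      _ = _ := one_mul _
  have e2 : 1/sW q (l^3) ((l^3)^2)+1/⌈l^3⌉₊+Real.exp (-l^3) ≤ (2/c+2)*(1/t) := by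
    have j1 : 1/sW q (l^3) ((l^3)^2) ≤ 2/c*(1/t) := by
      rw [div_mul_div_comm, mul_one, div_le_div_iff₀ (by linarith only [hσ, hσ1, h3, hW]) (by positivity)]; linarith only [hσ, hσ1, h3, hW]
    have j2 : 1/(⌈l^3⌉₊:ℝ) ≤ 1/t := one_div_le_one_div_of_le (by linarith only [hσ, hσ1, hlog1]) (by linarith only [hl3, hlogl, Nat.le_ceil (l^3)])
    have j3 : Real.exp (-l^3) ≤ 1/t := by
      rw [Real.exp_neg, ← one_div]; refine one_div_le_one_div_of_le (by linarith only [hσ, hσ1, hlog1]) (by linarith only [hσ, hσ1, hl3, hlogl, Real.add_one_le_exp (l^3)])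
    linarith only [j1, j2, j3]
  calc _ ≤ 10560*Th k L Y*((2/c+2)*(1/t)) + Th k L Y/t := add_le_add (mul_le_mul_of_nonneg_left e2 (by positivity)) e3
    _ = _ := by ring
end MR

namespace MR
open MeasureTheory

set_option maxHeartbeats 1000000 in
lemma fin_par {c δ : ℝ} (hc : 0 < c) (hc1 : c ≤ 1/24) (hδ : 0 < δ) : ∃ (a0 : ℝ) (H : ℕ) (y0 : ℝ), 0 < a0 ∧ 1 ≤ H ∧ ∀ y ≥ y0,
    ∀ {Ω : Type} [MeasurableSpace Ω] {ν : Measure Ω} {ψ : ℕ → Ω → ℂ} {k q : ℕ} {κ : ℝ} {g : ℕ → ℂ} {η Y L : ℝ}, Cq ν ψ k κ g η Y L q → y = Real.log Y → (q:ℝ) ≤ Real.exp (a0*y) →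
      Stg k g Y (sP q (a0*y) (c/16*y)) H (a0*y) (c/16*y) (sW q (a0*y) (c/16*y)) ∧
      10560*(1/sW q (a0*y) (c/16*y)+1/H+Real.exp (-(a0*y))) ≤ δ ∧ ν.real (UU ψ H (sP q (a0*y) (c/16*y)) (c/16)) ≤ κ^2*Y^(c/2) := by
  obtain ⟨P0, c0, hP0, hc0, hps⟩ := ps_lower
  obtain ⟨D, hD⟩ : ∃ D : ℝ, D = 31680/δ + 2 := ⟨_, rfl⟩
  have hD0 : 0 < 31680/δ := by positivity
  obtain ⟨j, hj⟩ := exists_nat_ge (D/c0)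
  rw [div_le_iff₀' hc0] at hj
  obtain ⟨H, hH⟩ := exists_nat_ge D
  obtain ⟨a0, ha0⟩ : ∃ a0 : ℝ, a0 = c/16/2^j := ⟨_, rfl⟩
  have ha : 0 < a0 := by rw [ha0]; positivity
  have ha1 : a0 ≤ c/16 := by rw [ha0]; exact div_le_self (by positivity) (one_le_pow₀ (by norm_num))
  obtain ⟨l0, hl0⟩ := exists_nat_ge (4/a0+1)
  have hH1 : 1 ≤ H := by
    have : (1:ℝ) ≤ H := by linarith
    exact_mod_cast this
  obtain ⟨C, hC⟩ : ∃ C : ℝ, C = 6*H*(Real.exp (c/8+2+2*l0)*Real.exp 6*(2*l0).factorial) := ⟨_, rfl⟩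
  have t1 : ∀ᶠ y : ℝ in atTop, D + Real.log P0 ≤ a0*y := (tendsto_id.const_mul_atTop ha).eventually_ge_atTop _
  obtain ⟨y0, hy0⟩ := eventually_atTop.1 (((ev_exp 1 C (show 0 < c/8 by positivity)).and (ev_exp 0 H (show (0:ℝ) < 1/2 by norm_num))).and (t1.and (eventually_ge_atTop 1)))
  refine ⟨a0, H, y0, ha, hH1, fun y hy => ?_⟩
  obtain ⟨⟨h1, h2⟩, h3, h4⟩ := hy0 y hy
  intro Ω _ ν ψ k q κ g η Y L X hyY hq
  have hY0 : 0 < Y := by linarith only [hc1, ha, ha1, X, X.hY]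
  have eY : Real.exp y = Y := by rw [hyY, Real.exp_log hY0]
  have lP : 0 ≤ Real.log P0 := Real.log_nonneg (by linarith only [hc1, hP0, ha, ha1])
  have hP : P0 ≤ Real.exp (a0*y) := by rw [← Real.log_le_iff_le_exp (by linarith)]; linarith only [hc1, hD, hD0, ha, ha1, h3]
  have hW : D ≤ sW q (a0*y) (c/16*y) := by
    rw [sW_eq X.hq hq]
    refine hj.trans ((hps _ hP j).trans_eq ?_)
    rw [← Real.exp_nat_mul, ha0]; congr 2; push_cast; field_simp
  have hk : (k:ℝ) ≤ q := by exact_mod_cast Nat.le_of_dvd X.hq X.hk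
  have hcy : 0 ≤ c*y := by positivity
  have hcy' : c*y ≤ 1/24*y := by gcongr
  have hay : a0*y ≤ c/16*y := by gcongr
  have T : Stg k g Y (sP q (a0*y) (c/16*y)) H (a0*y) (c/16*y) (sW q (a0*y) (c/16*y)) := by
    refine stg_mk X.hk X.hgq hH1 (by linarith only [hD, hD0, h3, lP]) (by linarith only [hc1, hD, hD0, ha, ha1, hW]) ?_
    rw [pow_zero, mul_one] at h2
    calc (k:ℝ)^2*Real.exp (2*(c/16*y))*H ≤ Real.exp (a0*y)^2*Real.exp (2*(c/16*y))*H := by gcongr; linarith only [hq, hk]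
      _ = Real.exp (2*(a0*y)+2*(c/16*y)+1/2*y)*(H*Real.exp (-(1/2*y))) := by
          rw [Real.exp_add, Real.exp_add, ← Real.exp_nat_mul, Real.exp_neg]; field_simp; norm_num; ring
      _ ≤ Real.exp y*1 := by gcongr; linarith only [hc1, hD, hD0, ha, ha1, h3, lP, hcy', hay]
      _ = Y := by rw [eY, mul_one]
  refine ⟨T, ?_, ?_⟩
  · have j1 : 1/sW q (a0*y) (c/16*y) ≤ 1/(31680/δ) := one_div_le_one_div_of_le hD0 (by linarith only [hc1, hD, ha, ha1, hW])
    have j2 : 1/(H:ℝ) ≤ 1/(31680/δ) := one_div_le_one_div_of_le hD0 (by linarith only [hc1, hD, hH, ha, ha1])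
    have j3 : Real.exp (-(a0*y)) ≤ 1/(31680/δ) := by
      rw [Real.exp_neg, ← one_div]; exact one_div_le_one_div_of_le hD0 (by linarith only [hc1, hD, ha, ha1, h3, lP, Real.add_one_le_exp (a0*y)])
    have : 10560*(3*(1/(31680/δ))) = δ := by field_simp; norm_num
    linarith only [j1, j2, j3]
  · have hm := X.mass T (α := c/16) (by positivity) (l0 := l0) (by
      refine le_trans ?_ hl0
      rw [← hyY, add_le_add_iff_right, div_le_div_iff₀ (by positivity) ha]
      nlinarith only [hc1, hD, hD0, ha, ha1, h3, lP])
    refine hm.trans ?_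
    have hk1 : (1:ℝ) ≤ k := by exact_mod_cast X.k1
    have hc2 : c*(c*y) ≤ 1*(c*y) := by gcongr; linarith only [hc1, ha, ha1]
    have hkk : L^2*k/Y^2 ≤ κ^2 := by
      rw [X.hκ, div_pow, mul_pow]; gcongr; nlinarith only [hk1]
    rw [← hyY, Real.rpow_def_of_pos hY0, ← hyY]
    calc _ ≤ 2*H*y*(Real.exp (c/8*(y+1+c/16*y))*(3*Real.exp (1+c/16*y+l0)^2*Real.exp 6*(2*l0).factorial*κ^2)) := by
          gcongr
          · linarith only [hc1, hD, hD0, ha, ha1, h3, lP, hcy', hay]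
          · linarith only []
      _ = (C*y^1*Real.exp (-(c/8*y)))*κ^2*Real.exp (c/8*y+c/8*(y+c/16*y)+2*(c/16*y)) := by
          rw [hC, ← Real.exp_nat_mul, Real.exp_neg]
          have e1 : Real.exp (c/8*(y+1+c/16*y)) = Real.exp (c/8)*Real.exp (c/8*(y+c/16*y)) := by rw [← Real.exp_add]; ring_nf
          have e2 : Real.exp ((2:ℕ)*(1+c/16*y+l0)) = Real.exp (2+2*l0)*Real.exp (2*(c/16*y)) := by rw [← Real.exp_add]; push_cast; ring_nf
          have e3 : Real.exp (c/8+2+2*l0) = Real.exp (c/8)*Real.exp (2+2*l0) := by rw [← Real.exp_add]; ring_nf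
          rw [e1, e2, e3, Real.exp_add (_+_), Real.exp_add (c/8*y)]
          field_simp; ring
      _ ≤ 1*κ^2*Real.exp (y*(c/2)) := by gcongr; linarith only [hc1, hD, hD0, ha, ha1, h3, lP, hay, hc2]
      _ = _ := by ring

set_option maxHeartbeats 1000000 in
lemma fin_stage {c c1 Λ0 δ : ℝ} (hc : 0 < c) (hc' : c ≤ 1/24) (hδ : 0 < δ) (hc1 : c1 ≤ 1) (hc0 : ∀ l ≥ Λ0, c1*Real.log l ≤ ps (Real.exp l) (Real.exp (l^2))) (hΛ2 : 2 ≤ c1*Real.log Λ0) (h01 : 0 < c1) (h0 : 3 ≤ Λ0) :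
    ∃ a0 > 0, ∃ Λ ≥ Λ0, ∀ l ≥ Λ, ∀ {Ω : Type} [MeasurableSpace Ω] {ν : Measure Ω} {ψ : ℕ → Ω → ℂ} {k q : ℕ} {κ : ℝ} {g : ℕ → ℂ} {η Y L : ℝ}, Cq ν ψ k κ g η Y L q →
      pf q ≤ c1/2*Real.log l → l^3 ≤ Real.log Y → Real.log Y ≤ l^10 → (q:ℝ) ≤ Real.exp (a0*Real.log Y) →
      (∀ A, MeasurableSet A → ν.real A ≤ κ^2*Y^(c/2) → ∫ ω in A, ‖RR g ψ η Y 1 ω‖^2 ∂ν ≤ δ*Th k L Y) →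
      Il ν ψ g η Y q (c/32) l ≤ 3*δ*Th k L Y := by
  obtain ⟨a0, H, y0, ha0, hH, hy0⟩ := fin_par hc hc' hδ
  obtain ⟨σ, hσ⟩ : ∃ σ, σ = c/32 := ⟨_, rfl⟩
  have hσ0 : 0 < σ := by rw [hσ]; positivity
  have t1 : ∀ᶠ l : ℝ in atTop, 16 ≤ σ*a0*l := (tendsto_id.const_mul_atTop (by positivity)).eventually_ge_atTop _
  obtain ⟨Λ, hΛ⟩ := eventually_atTop.1 (((ev_log 80 hσ0).and (ev_exp 24 (384*Real.exp 6*H^2/δ) (show 0 < σ*a0/4 by positivity))).and (t1.and ((eventually_ge_atTop y0).and (eventually_ge_atTop Λ0))))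
  refine ⟨a0, ha0, Λ, (hΛ Λ le_rfl).2.2.2, fun l hl => ?_⟩
  obtain ⟨⟨h1, h2⟩, h3, h4, h5⟩ := hΛ l hl
  intro Ω _ ν ψ k q κ g η Y L X hp hYl hYu hq hA
  have hl0 : 0 < l := by linarith
  have hl3 : l ≤ l^3 := le_self_pow₀ (by linarith) (by norm_num)
  have hlog1 : 1 ≤ Real.log l := by rw [Real.le_log_iff_exp_le hl0]; linarith only [h0, h5, Real.exp_one_lt_d9]
  obtain ⟨T, hE, hm⟩ := hy0 (Real.log Y) (ge_trans (hl3.trans hYl) h4) X rfl hq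
  have T' := (X.st (by linarith) (hc0 l h5) (hΛ2.trans (by have := Real.log_le_log (by linarith only [h0]) h5; gcongr)) hp (by rw [show l^6 = (l^3)^2 by ring]; gcongr)).1
  set y := Real.log Y with hy
  set t := Real.log l with ht
  have hy0' : 0 < y := by linarith only [h0, h5, hl3, hYl]
  have i1 : 1/t ≤ 1 := by rw [div_le_one (by linarith)]; exact hlog1
  have i0 : 0 < 1/t := by positivity
  have hσi : σ*(1/t) ≤ σ := mul_le_of_le_one_right hσ0.le i1
  have hσi0 : 0 < σ*(1/t) := by positivity
  have hΔ : σ ≤ c/16 - σ*(1-1/t) := by linarith only [hσ, hσi0]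
  have h6 : a0*l^3 ≤ a0*y := by gcongr
  have c1 : 8*(1+Real.log (8*(c/16*y))) ≤ (c/16 - σ*(1-1/t))*l := by
    refine le_trans ?_ (mul_le_mul_of_nonneg_right hΔ hl0.le)
    refine le_trans ?_ h1
    have : Real.log (8*(c/16*y)) ≤ 10*t := by
      rw [show 10*t = Real.log (l^10) by rw [Real.log_pow, ht]; norm_num]
      refine Real.log_le_log (by positivity) (le_trans ?_ hYu)
      rw [← mul_assoc]; exact mul_le_of_le_one_left hy0'.le (by linarith only [hc'])
    nlinarith only [this, hlog1]
  have c2 : 16*l^2 ≤ (c/16 - σ*(1-1/t))*(a0*y) := by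
    refine le_trans ?_ (mul_le_mul_of_nonneg_right hΔ (by positivity))
    calc 16*l^2 ≤ σ*a0*l*l^2 := by gcongr
      _ = σ*(a0*l^3) := by ring
      _ ≤ _ := by gcongr
  have h := X.step T' T (α' := σ*(1-1/t)) (α := c/16) (mul_nonneg hσ0.le (by linarith only [i1])) (by linarith only [hc', hσ, hσ0, hσi0]) (by linarith only [hc', hσi]) c1 c2
  rw [Il, Iu, ← hσ]
  refine h.trans ?_
  have hTh : 0 ≤ Th k L Y := by rw [Th]; positivity
  have hK : Real.exp (2*pf q) ≤ l := by
    rw [← Real.le_log_iff_exp_le hl0, ← ht]; have := mul_le_mul_of_nonneg_right hc1 (show 0 ≤ t by linarith only [hlog1]); linarith only [hp, this]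
  have hE' := X.th hK
  have cl : (⌈l⌉₊:ℝ) ≤ 2*l := by linarith only [h0, h5, hl0, Nat.ceil_lt_add_one hl0.le]
  have e3 : 192*Real.exp 6*(⌈l⌉₊*l^2)*(H*(c/16*y))^2*Real.exp (-((c/16 - σ*(1-1/t))*(a0*y)/4))*(L^2*k/Y^2) ≤ δ*Th k L Y := by
    have : Real.exp (-((c/16 - σ*(1-1/t))*(a0*y)/4)) ≤ Real.exp (-(σ*a0/4*l)) := by
      rw [Real.exp_le_exp, neg_le_neg_iff, show σ*a0/4*l = σ*(a0*l)/4 by ring]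
      have := mul_le_mul hΔ (mul_le_mul_of_nonneg_left (hl3.trans hYl) ha0.le) (by positivity) (by linarith only [hσ, hσ0, hσi0])
      linarith only [this]
    have hcy : c/16*y ≤ l^10 := (mul_le_of_le_one_left hy0'.le (by linarith only [hc'])).trans hYu
    calc _ ≤ 192*Real.exp 6*((2*l)*l^2)*(H*l^10)^2*Real.exp (-(σ*a0/4*l))*(l*Th k L Y) := by gcongr
      _ = (384*Real.exp 6*H^2/δ*l^24*Real.exp (-(σ*a0/4*l)))*(δ*Th k L Y) := by field_simp; ring
      _ ≤ 1*(δ*Th k L Y) := by gcongr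
      _ = _ := one_mul _
  have e2 := mul_le_mul_of_nonneg_left hE hTh
  have e1 := hA _ X.mUU hm
  rw [Th] at *
  linarith only [e3, e2, e1]
end MR

namespace MR
open MeasureTheory

lemma chain {c δ : ℝ} (hc : 0 < c) (hc' : c ≤ 1/24) (hδ : 0 < δ) : ∃ c1 Λ C a0 : ℝ, 0 < c1 ∧ c1 ≤ 1 ∧ 3 ≤ Λ ∧ 0 < a0 ∧ 2 ≤ c1*Real.log Λ ∧ (∀ l ≥ Λ, c1*Real.log l ≤ ps (Real.exp l) (Real.exp (l^2))) ∧
    ∀ n : ℕ, ∀ l ≥ Λ, ∀ {Ω : Type} [MeasurableSpace Ω] {ν : Measure Ω} {ψ : ℕ → Ω → ℂ} {k q : ℕ} {κ : ℝ} {g : ℕ → ℂ} {η Y L : ℝ}, Cq ν ψ k κ g η Y L q →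
      pf q ≤ c1/2*Real.log l → l^3 ≤ Real.log Y → Real.log Y ≤ l^(10*3^n) → (q:ℝ) ≤ Real.exp (a0*Real.log Y) →
      (∀ A, MeasurableSet A → ν.real A ≤ κ^2*Y^(c/2) → ∫ ω in A, ‖RR g ψ η Y 1 ω‖^2 ∂ν ≤ δ*Th k L Y) →
      Il ν ψ g η Y q (c/32) l ≤ (3/2*C/Real.log l + 3*δ)*Th k L Y := by
  obtain ⟨c1, Λ0, h1, h2, h3⟩ := ps_log
  have h3' : ∀ l ≥ Λ0, min c1 1*Real.log l ≤ ps (Real.exp l) (Real.exp (l^2)) := fun l hl =>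
    (mul_le_mul_of_nonneg_right (min_le_left _ _) (Real.log_nonneg (h2.trans hl))).trans (h3 l hl)
  have h01 : 0 < min c1 1 := by positivity
  obtain ⟨Λ1, h4, h5, h6, h7⟩ := tower h01 (min_le_right _ _) h3' (show 0 < c/32 by positivity) (by linarith)
  have hb : Λ1 ≤ max Λ1 3 := le_max_left _ _
  have e1 := Real.exp_pos 1
  obtain ⟨a0, h8, Λ2, h9, h10⟩ := fin_stage hc hc' hδ (min_le_right c1 1) (fun l hl => h3' l (h4.trans (hb.trans hl))) (h6.trans (mul_le_mul_of_nonneg_left (Real.log_le_log (by linarith) hb) h01.le)) h01 (le_max_right Λ1 3)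
  refine ⟨min c1 1, Λ2, 10560*(2/min c1 1+2)+1, a0, h01, min_le_right _ _, (le_max_right Λ1 3).trans h9, h8, h6.trans (mul_le_mul_of_nonneg_left (Real.log_le_log (by linarith) (hb.trans h9)) h01.le), fun l hl => h3' l (h4.trans (hb.trans (ge_trans hl h9))), fun n => ?_⟩
  induction n with
  | zero =>
    intro l hl Ω _ ν ψ k q κ g η Y L X hp hY1 hY2 hq hA
    refine (h10 l hl X hp hY1 (by simpa using hY2) hq hA).trans ?_
    have hTh : 0 ≤ Th k L Y := by rw [Th]; positivity
    gcongr
    have : 0 < Real.log l := Real.log_pos (by linarith [(le_max_right Λ1 3).trans h9])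
    exact le_add_of_nonneg_left (by positivity)
  | succ n ih =>
    intro l hl Ω _ ν ψ k q κ g η Y L X hp hY1 hY2 hq hA
    have hTh : 0 ≤ Th k L Y := by rw [Th]; positivity
    have hl3 : 3 ≤ l := (le_max_right Λ1 3).trans (h9.trans hl)
    have hll : 0 < Real.log l := Real.log_pos (by linarith)
    by_cases hc : Real.log Y ≤ l^10
    · refine (h10 l hl X hp hY1 hc hq hA).trans ?_
      gcongr
      exact le_add_of_nonneg_left (by positivity)
    · push Not at hc
      have hl3' : l ≤ l^3 := le_self_pow₀ (by linarith) (by norm_num)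
      have e := ih (l^3) (hl.le.trans hl3') X (hp.trans (by gcongr)) (by rw [← pow_mul]; exact (pow_le_pow_right₀ (by linarith) (by norm_num)).trans hc.le)
        (hY2.trans_eq (by rw [← pow_mul]; ring_nf)) hq hA
      have e' := h7 l (ge_trans hl (hb.trans h9)) X hp (by
        calc l^18 ≤ (l^10)^2 := by rw [← pow_mul]; exact pow_le_pow_right₀ (by linarith) (by norm_num)
          _ ≤ _ := by gcongr)
      rw [Real.log_pow] at e
      refine (e'.trans (add_le_add e le_rfl)).trans_eq ?_
      push_cast; field_simp; ring

lemma three {δ W H a : ℝ} (hδ : 0 < δ) (h1 : 31680/δ ≤ W) (h2 : 31680/δ ≤ H) (h3 : 31680/δ ≤ a) : 10560*(1/W+1/H+Real.exp (-a)) ≤ δ := by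
  have hD0 : 0 < 31680/δ := by positivity
  have j1 := one_div_le_one_div_of_le hD0 h1
  have j2 := one_div_le_one_div_of_le hD0 h2
  have j3 : Real.exp (-a) ≤ 1/(31680/δ) := by
    rw [Real.exp_neg, ← one_div]; exact one_div_le_one_div_of_le hD0 (by linarith [Real.add_one_le_exp a])
  have : 10560*(3*(1/(31680/δ))) = δ := by field_simp; norm_num
  linarith

lemma ps_lb : ∃ c > 0, ∃ ℓ0 : ℝ, ∀ ℓ ≥ ℓ0, c*Real.log ℓ ≤ ps 1 (Real.exp ℓ) := by
  obtain ⟨c, Λ, h1, h2, h3⟩ := ps_log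
  refine ⟨c/2, by positivity, Λ^2, fun ℓ hℓ => ?_⟩
  have h0 : 0 ≤ ℓ := (sq_nonneg _).trans hℓ
  have h := h3 (√ℓ) (Real.le_sqrt_of_sq_le hℓ)
  rw [Real.sq_sqrt h0, Real.log_sqrt h0] at h
  have h4 : √ℓ ≤ ℓ := by
    have : 1 ≤ ℓ := le_trans (by nlinarith) hℓ
    rw [Real.sqrt_le_left h0]; nlinarith
  have := ps_add (Real.one_le_exp (Real.sqrt_nonneg ℓ)) (Real.exp_le_exp.2 h4)
  have := ps_nonneg 1 (Real.exp √ℓ)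
  linarith

set_option maxHeartbeats 2000000 in
lemma propE {c ε δ : ℝ} (hc : 0 < c) (hc' : c ≤ 1/24) (hε : 0 < ε) (hδ : 0 < δ) (hδ1 : δ ≤ 1) : ∃ a0 > 0, ∃ L0 : ℝ, ∀ L ≥ L0, ∃ y1 : ℝ,
    ∀ {Ω : Type} [MeasurableSpace Ω] {ν : Measure Ω} {ψ : ℕ → Ω → ℂ} {k q : ℕ} {κ : ℝ} {g : ℕ → ℂ} {η Y : ℝ}, Cq ν ψ k κ g η Y L q → pf q ≤ (1-ε)*ps 1 L →
      y1 ≤ Real.log Y → (q:ℝ) ≤ Real.exp (a0*Real.log Y) →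
      (∀ A, MeasurableSet A → ν.real A ≤ κ^2*Y^(c/2) → ∫ ω in A, ‖RR g ψ η Y 1 ω‖^2 ∂ν ≤ δ*Th k L Y) →
      ∫ ω, ‖RR g ψ η Y 1 ω‖^2 ∂ν ≤ 8*δ*Th k L Y := by
  obtain ⟨c1, Λ, C, a0, h1, h1', h2, h3, h4, h4', h5⟩ := chain hc hc' hδ
  obtain ⟨c2, hc2, ℓ0, h6⟩ := ps_lb
  obtain ⟨σ, hσ⟩ : ∃ σ, σ = c/32 := ⟨_, rfl⟩
  have hσ0 : 0 < σ := by rw [hσ]; positivity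
  have hσ1 : σ ≤ 1 := by linarith
  obtain ⟨D, hD⟩ : ∃ D, D = 34/c1 := ⟨_, rfl⟩
  have hD34 : 34 ≤ D := by rw [hD, le_div_iff₀ h1]; linarith
  obtain ⟨A, hA⟩ : ∃ A, A = 32*(4+2*D)/σ := ⟨_, rfl⟩
  have hAσ : σ/4*A = 8*(4+2*D) := by rw [hA]; field_simp; norm_num
  have hA1 : 1 ≤ A := by rw [hA, le_div_iff₀ hσ0]; linarith
  have lA := Real.log_nonneg hA1
  have hD0 : 0 < 31680/δ := by positivity
  have hu : ∀ᶠ u : ℝ in atTop, (17*(1+Real.log A)*(1+Real.log u)^2 ≤ ε*c2/2*u ∧ 31680/δ+ε*c2 ≤ ε*c2/2*u) ∧ (320/δ*u^2*Real.exp (-(1*u)) ≤ 1 ∧ 64/σ ≤ u) ∧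
      (A*u^1*Real.exp (-(1*(u-1))) ≤ 1 ∧ 31680/δ ≤ u) ∧ (Λ ≤ u ∧ 3/2*C/δ ≤ u) ∧ ∀ l ≥ u, 1536*Real.exp 6/δ*l^9*Real.exp (-(σ/16*l)) ≤ 1 := by
    have k1 : ∀ᶠ u : ℝ in atTop, 31680/δ+ε*c2 ≤ ε*c2/2*u := (tendsto_id.const_mul_atTop (by positivity)).eventually_ge_atTop _
    have k2 := ev_exp 1 (A*Real.exp 1) one_pos
    refine ((ev_log _ (by positivity)).and k1).and (((ev_exp 2 _ one_pos).and (eventually_ge_atTop _)).and (((?_ : ∀ᶠ u : ℝ in atTop, _).and (eventually_ge_atTop _)).and (((eventually_ge_atTop _).and (eventually_ge_atTop _)).and (eventually_forall_ge_atTop.2 (ev_exp 9 _ (by positivity))))))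
    filter_upwards [k2] with u h
    rw [mul_sub, neg_sub, mul_one, sub_eq_add_neg, Real.exp_add]
    linarith
  have hL : ∀ᶠ L : ℝ in atTop, ℓ0 ≤ Real.log L ∧ 3 ≤ L ∧ 1 ≤ Real.log L ∧ (fun u : ℝ => _) (1+Real.log (Real.log L)) :=
    (Real.tendsto_log_atTop.eventually_ge_atTop _).and ((eventually_ge_atTop _).and ((Real.tendsto_log_atTop.eventually_ge_atTop _).and ((tendsto_atTop_add_const_left _ 1 (Real.tendsto_log_atTop.comp Real.tendsto_log_atTop)).eventually hu)))
  obtain ⟨L0, hL0⟩ := eventually_atTop.1 hL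
  refine ⟨a0, h3, L0, fun L hL => ?_⟩
  obtain ⟨b1, b2, b3, ⟨⟨d1, d2⟩, ⟨d3, d4⟩, ⟨d5, d6⟩, ⟨d7, d8⟩, d9⟩⟩ := hL0 L hL
  have hL0' : 0 < L := by linarith
  set ℓ := Real.log L with hℓ
  have eL : Real.exp ℓ = L := Real.exp_log hL0'
  set u := 1+Real.log ℓ with hu'
  have eℓ : Real.exp (u-1) = ℓ := by rw [hu', add_sub_cancel_left, Real.exp_log (by linarith)]
  have hu0 : 3 ≤ u := h2.trans d7
  have uℓ : u ≤ ℓ := by linarith [Real.add_one_le_exp (u-1)]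
  obtain ⟨l, hl⟩ : ∃ l, l = Real.exp (D*u) := ⟨_, rfl⟩
  have ll : Real.log l = D*u := by rw [hl, Real.log_exp]
  have hDu : 34*u ≤ D*u := by gcongr
  have ul : u ≤ l := by rw [hl]; linarith [Real.add_one_le_exp (D*u)]
  have hl1 : 1 < l := by linarith
  refine ⟨max (ℓ^2) (l^3), ?_⟩
  intro Ω _ ν ψ k q κ g η Y X hp hy hq hAA
  have hy1 := (le_max_left _ _).trans hy
  have hy2 := (le_max_right _ _).trans hy
  have hps := ps_S b2
  rw [← hℓ, ← hu'] at hps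
  have hpp := ps_nonneg 1 L
  have hp17 : pf q ≤ 17*u := by nlinarith only [hp, hps, hpp, hε]
  have hpl : pf q ≤ c1/2*Real.log l := by
    rw [ll, hD]; refine hp17.trans_eq ?_; field_simp; norm_num
  have hTh : 0 ≤ Th k L Y := by rw [Th]; positivity
  obtain ⟨n, hn⟩ := (tendsto_pow_atTop_atTop_of_one_lt hl1).eventually_ge_atTop (Real.log Y) |>.exists
  have hchain := h5 n l (d7.trans ul) X hpl hy2 (hn.trans (pow_le_pow_right₀ hl1.le (by linarith only [(Nat.lt_pow_self (show 1 < 3 by norm_num) : n < 3^n)]))) hq hAA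
  rw [← hσ] at hchain
  -- stage 1
  have hAu : A*u ≤ ℓ := by
    rw [one_mul, Real.exp_neg, eℓ, pow_one, ← div_eq_mul_inv, div_le_one (by linarith only [hc', h2, hσ, hσ0, d7, uℓ])] at d5; exact d5
  have hA3 : 1*u ≤ A*u := by gcongr
  have hW : 31680/δ ≤ sW q (A*u) ℓ := by
    have i1 := sW_ge X.hq (A*u) ℓ
    have i2 := ps_add (Real.one_le_exp (show 0 ≤ A*u by linarith only [hc', h2, hσ, hσ0, d7, hA3])) (Real.exp_le_exp.2 hAu)
    have i3 := ps_S (y := Real.exp (A*u)) (by linarith only [hc', h2, hσ, hσ0, d7, hA3, Real.add_one_le_exp (A*u)])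
    rw [Real.log_exp, Real.log_mul (by linarith only [hc', hσ, hσ0, hA1]) (by linarith only [hc', h2, hσ, hσ0, d7])] at i3
    have i4 := h6 ℓ b1
    rw [eL] at i1 i2 i4
    have i5 : 0 ≤ Real.log u := Real.log_nonneg (by linarith only [hc', h2, hσ, hσ0, d7])
    have i6 : 1+(Real.log A+Real.log u) ≤ (1+Real.log A)*(1+Real.log u)^2 := by
      have := mul_nonneg lA i5
      have := mul_nonneg (show 0 ≤ 1+Real.log A by linarith only [hc', hσ, hσ0, lA]) (sq_nonneg (Real.log u))
      nlinarith only [this, lA, i5, mul_nonneg lA i5]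
    have i7 : ε*(c2*(u-1)) ≤ ε*ps 1 L := by gcongr; rw [hu']; linarith only [i4]
    linarith only [d1, d2, hp, i1, i2, i3, i6, i7]
  have T1 : Stg k g Y (sP q (A*u) ℓ) ⌈u⌉₊ (A*u) ℓ (sW q (A*u) ℓ) := by
    refine stg_mk X.hk X.hgq (Nat.one_le_ceil_iff.2 (by linarith only [hc', h2, hσ, hσ0, d7])) (by linarith only [hc', h2, hσ, hσ0, d7, hA3]) (by have : 1 ≤ 31680/δ := (by rw [le_div_iff₀ hδ]; linarith only [hc', hδ1, hσ, hσ0]); linarith only [hW, this]) (le_trans ?_ (X.hYk ℓ b3 ?_))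
    · gcongr; linarith [Nat.ceil_lt_add_one (show 0 ≤ u by linarith only [hc', h2, hσ, hσ0, d7])]
    · calc ℓ^3 ≤ (ℓ^2)^2 := by rw [← pow_mul]; exact pow_le_pow_right₀ b3 (by norm_num)
        _ ≤ _ := by gcongr
  have cu : (⌈u⌉₊:ℝ) ≤ 2*u := by linarith [Nat.ceil_lt_add_one (show 0 ≤ u by linarith only [hc', h2, hσ, hσ0, d7])]
  have f1 := X.first T1 (α := σ/4) (by positivity) eL.le (by
    refine le_trans ?_ (X.hYk ℓ b3 ?_)
    · rw [eL, mul_comm 2 ℓ, Real.exp_mul, eL]; norm_num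
      have : 3*L*(2*3) ≤ L*L*(2*ℓ) := by gcongr; linarith only [h2, d7, uℓ]
      have := mul_le_mul_of_nonneg_left (show 4*L ≤ L^2*(2*ℓ) by linarith only [hc', hσ, hσ0, b2, this, sq L]) (sq_nonneg (k:ℝ))
      linarith only [this]
    · calc ℓ^3 ≤ (ℓ^2)^2 := by rw [← pow_mul]; exact pow_le_pow_right₀ b3 (by norm_num)
        _ ≤ _ := by gcongr)
  have f2 := three hδ hW (d6.trans (Nat.le_ceil u)) (d6.trans (show u ≤ A*u by linarith only [hA3]))
  have f3 : 80*(⌈u⌉₊*ℓ)^2*Real.exp (-(σ/4*(A*u))) ≤ δ := by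
    have : Real.exp (-(σ/4*(A*u))) ≤ Real.exp (-(3*u)) := by
      rw [← mul_assoc, hAσ]; gcongr; linarith only [hc', hσ, hσ0, hD34]
    calc _ ≤ 80*(2*u*Real.exp u)^2*Real.exp (-(3*u)) := by
          gcongr
          · rw [← eℓ]; gcongr; linarith only [hc', hσ, hσ0]
      _ = δ*(320/δ*u^2*Real.exp (-(1*u))) := by
          rw [mul_pow, ← Real.exp_nat_mul, show -(1*u) = (2:ℕ)*u+ -(3*u) by push_cast; ring, Real.exp_add]; field_simp; norm_num
      _ ≤ δ*1 := by gcongr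
      _ = δ := mul_one _
  -- step
  have h4l : 2 ≤ c1*Real.log l := h4.trans (by gcongr; exact d7.trans ul)
  obtain ⟨T2, hW2⟩ := X.st (by linarith only [hc', h2, hσ, hσ0, d7, ul]) (h4' l (d7.trans ul)) h4l hpl (by rw [show l^6 = (l^3)^2 by ring]; gcongr)
  have hi : 1/Real.log l ≤ 1/4 := one_div_le_one_div_of_le (by norm_num) (by rw [ll]; linarith only [hc', h2, hσ, hσ0, d7, hDu])
  have hi0 : 0 < 1/Real.log l := by rw [ll]; positivity
  have hiσ : σ*(1/Real.log l) ≤ σ*(1/4) := by gcongr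
  have hiσ0 : 0 < σ*(1/Real.log l) := by positivity
  have hΔ : σ/4 ≤ σ*(1-1/Real.log l) - σ/4 := by linarith only [hiσ, hiσ0]
  have l8 : Real.log 8 ≤ 3 := by
    rw [show (8:ℝ) = 2^3 by norm_num, Real.log_pow]; push_cast; linarith only [hc', hσ, hiσ, hiσ0, Real.log_two_lt_d9]
  have g1 := X.step T1 T2 (α' := σ/4) (α := σ*(1-1/Real.log l)) (by positivity) (by linarith only [hc', hσ, hiσ, hiσ0]) (by linarith only [hc', hσ, hiσ, hiσ0])
    (by
      refine le_trans ?_ (mul_le_mul_of_nonneg_right hΔ (by linarith only [hc', h2, hσ, d7, hA3, hiσ, hiσ0]))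
      rw [← mul_assoc, hAσ, Real.log_mul (by norm_num) (by positivity), Real.log_pow, ll]; push_cast
      linarith only [hc', h2, hσ, d7, hiσ, hiσ0, l8])
    (by
      refine le_trans ?_ (mul_le_mul_of_nonneg_right hΔ (by linarith only [hc', h2, hσ, d7, ul, hiσ, hiσ0]))
      rw [div_le_iff₀ hσ0] at d4
      have : u*ℓ ≤ l := by
        calc u*ℓ ≤ Real.exp u*Real.exp u := by
              gcongr
              · linarith only [hc', hσ, hiσ, hiσ0, Real.add_one_le_exp u]
              · rw [← eℓ]; gcongr; linarith only [hc', hσ, hiσ, hiσ0]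
          _ = Real.exp (2*u) := by rw [← Real.exp_add]; ring_nf
          _ ≤ l := by rw [hl]; gcongr; linarith only [hc', hσ, hD34, hiσ, hiσ0]
      have := mul_le_mul_of_nonneg_left this hσ0.le
      have := mul_le_mul_of_nonneg_right d4 (show 0 ≤ ℓ by linarith only [hc', h2, hσ, d7, uℓ, hiσ, hiσ0])
      linarith)
  have g2 := three hδ (show 31680/δ ≤ sW q l (l^2) by
    refine le_trans ?_ hW2
    rw [ll, hD, show c1/2*(34/c1*u) = 17*u by field_simp; norm_num]; linarith only [hc', h2, hσ, d6, d7, hiσ, hiσ0]) ((d6.trans ul).trans (Nat.le_ceil l)) (d6.trans ul)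
  have hK : Real.exp (2*pf q) ≤ l := by
    rw [← Real.le_log_iff_exp_le (by linarith only [hc', h2, hσ, d7, ul, hiσ, hiσ0]), ll]; linarith only [hDu, hp17]
  have hE := X.th hK
  have ℓl : ℓ ≤ l := by rw [← eℓ, hl]; gcongr; linarith only [hc', h2, hσ, d7, hDu, hiσ, hiσ0]
  have g3 : 192*Real.exp 6*(⌈u⌉₊*ℓ)*(⌈l⌉₊*l^2)^2*Real.exp (-((σ*(1-1/Real.log l) - σ/4)*l/4))*(L^2*k/Y^2) ≤ δ*Th k L Y := by
    have : Real.exp (-((σ*(1-1/Real.log l) - σ/4)*l/4)) ≤ Real.exp (-(σ/16*l)) := by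
      rw [Real.exp_le_exp, neg_le_neg_iff]
      have := mul_le_mul_of_nonneg_right hΔ (show 0 ≤ l by linarith only [hc', h2, hσ, d7, ul, hiσ, hiσ0])
      linarith only [this]
    calc _ ≤ 192*Real.exp 6*((2*l)*l)*((2*l)*l^2)^2*Real.exp (-(σ/16*l))*(l*Th k L Y) := by
          gcongr
          · linarith only [ul, cu]
          · linarith [Nat.ceil_lt_add_one (show 0 ≤ l by linarith only [hc', h2, hσ, d7, ul, hiσ, hiσ0])]
      _ = (1536*Real.exp 6/δ*l^9*Real.exp (-(σ/16*l)))*(δ*Th k L Y) := by field_simp; ring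
      _ ≤ 1*(δ*Th k L Y) := by gcongr; exact d9 l ul
      _ = _ := one_mul _
  have hC : 3/2*C/Real.log l ≤ δ := by
    rw [div_le_iff₀ hδ] at d8
    rw [ll, div_le_iff₀ (by linarith only [hc', h2, hσ, d7, hDu, hiσ, hiσ0])]
    have := mul_le_mul_of_nonneg_right hDu hδ.le
    have := mul_pos (show 0 < u by linarith only [hc', h2, hσ, d7, hiσ, hiσ0]) hδ
    linarith
  have q1 := mul_le_mul_of_nonneg_right f2 hTh
  have q2 := mul_le_mul_of_nonneg_right f3 hTh
  have q3 := mul_le_mul_of_nonneg_right g2 hTh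
  have q4 := mul_le_mul_of_nonneg_right hC hTh
  rw [Il, Iu] at hchain
  rw [Th] at *
  linarith only [hchain, f1, g1, g3, q1, q2, q3, q4]
end MR

namespace MR
open MeasureTheory FourierTransform

lemma fe_even (y : ℝ) : fe (-y) = fe y := by simp [fe]

lemma fe_ft (u : ℝ) : ∫ t, (fe t:ℂ) * ee (u*t) = 2*Real.pi*((max 0 (1-|u|):ℝ):ℂ) := by
  set f : ℝ → ℂ := fun v => ((max 0 (1-|v|):ℝ):ℂ) with hf
  have fc : Continuous f := by fun_prop
  have hs : HasCompactSupport f := by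
    refine HasCompactSupport.intro (K := Set.Icc (-1) 1) isCompact_Icc fun x hx => ?_
    have : ¬ |x| ≤ 1 := fun h => hx (abs_le.1 h)
    rw [hf]; simp only; rw [max_eq_left (by linarith)]; simp
  have fi : Integrable f := fc.integrable_of_hasCompactSupport hs
  have h1 : ∀ w ≠ 0, 𝓕 f w = (fe (2*Real.pi*w):ℂ) := fun w hw => by
    have hy : -(2*Real.pi*w) ≠ 0 := neg_ne_zero.2 (mul_ne_zero (by positivity) hw)
    have h := tri_ft 1 (-(2*Real.pi*w)) hy zero_le_one
    rw [← fe_even, Real.fourier_eq', fe]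
    rw [one_mul] at h
    rw [← h, intervalIntegral.integral_of_le (by norm_num), ← integral_Icc_eq_integral_Ioc, ← setIntegral_eq_integral_of_forall_compl_eq_zero (s := Set.Icc (-1) 1)]
    · refine setIntegral_congr_fun measurableSet_Icc fun x hx => ?_
      have : |x| ≤ 1 := abs_le.2 hx
      simp only [hf, max_eq_right (show 0 ≤ 1-|x| by linarith), smul_eq_mul, ee]
      rw [mul_comm]; congr 3; simp [inner]; ring
    · intro x hx
      have : ¬ |x| ≤ 1 := fun h => hx (abs_le.1 h)
      simp only [hf]; rw [max_eq_left (by linarith)]; simp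
  have hae : 𝓕 f =ᵐ[volume] fun w => (fe (2*Real.pi*w):ℂ) := by
    filter_upwards [compl_mem_ae_iff.2 (measure_singleton (0:ℝ))] with w hw using h1 w hw
  have gi : Integrable fun w : ℝ => (fe (2*Real.pi*w):ℂ) := (fe_int.comp_mul_left' (by positivity)).ofReal
  have h2 := fi.fourierInv_fourier_eq (gi.congr hae.symm) (fc.continuousAt (x := u))
  rw [Real.fourierInv_eq'] at h2
  have h3 : ∫ v : ℝ, Complex.exp (↑(2*Real.pi*inner ℝ v u)*Complex.I) • 𝓕 f v = ∫ v : ℝ, (fun t : ℝ => (fe t:ℂ)*ee (u*t)) (2*Real.pi*v) := by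
    refine integral_congr_ae ?_
    filter_upwards [hae] with v hv
    rw [hv, smul_eq_mul, mul_comm, ee]; congr 3; simp [inner]; ring
  rw [h3, Measure.integral_comp_mul_left (fun t : ℝ => (fe t:ℂ)*ee (u*t)), abs_of_pos (by positivity)] at h2
  rw [← show f u = ((max 0 (1-|u|):ℝ):ℂ) from rfl, ← h2, Complex.real_smul]
  push_cast; field_simp

noncomputable def wm (κ : ℝ) : Measure ℝ := volume.withDensity fun t => ENNReal.ofReal (fe (κ*t)/(2*Real.pi))

lemma wd_nn (κ t : ℝ) : 0 ≤ fe (κ*t)/(2*Real.pi) := div_nonneg (fe_nn _) (by positivity)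
lemma wd_meas (κ : ℝ) : Measurable fun t => fe (κ*t)/(2*Real.pi) := (fe_meas.comp (measurable_const_mul κ)).div_const _
lemma wd_int {κ : ℝ} (hκ : 0 < κ) : Integrable fun t => fe (κ*t)/(2*Real.pi) := (fe_int.comp_mul_left' hκ.ne').div_const _

lemma wm_le (κ : ℝ) : wm κ ≤ volume := by
  refine (withDensity_mono (ae_of_all _ fun t => ?_)).trans_eq withDensity_one
  simp only [Pi.one_apply, ENNReal.ofReal_le_one]
  rw [div_le_one (by positivity)]; linarith [fe_le_one (κ*t), Real.pi_gt_three]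
lemma wm_fin {κ : ℝ} (hκ : 0 < κ) : IsFiniteMeasure (wm κ) := isFiniteMeasure_withDensity_ofReal (wd_int hκ).2

lemma wm_int {E : Type*} [NormedAddCommGroup E] [NormedSpace ℝ E] (κ : ℝ) (f : ℝ → E) : ∫ t, f t ∂wm κ = ∫ t, (fe (κ*t)/(2*Real.pi)) • f t := by
  rw [wm, integral_withDensity_eq_integral_toReal_smul (wd_meas κ).ennreal_ofReal (ae_of_all _ fun _ => ENNReal.ofReal_lt_top)]
  refine integral_congr_ae (ae_of_all _ fun t => ?_)
  simp only [ENNReal.toReal_ofReal (wd_nn κ t)]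

lemma wm_ft {κ : ℝ} (hκ : 0 < κ) (u : ℝ) : (κ:ℂ)^2*∫ t, ee (u*t) ∂wm κ = ((max 0 (κ-|u|):ℝ):ℂ) := by
  have h := fe_ft (u/κ)
  have h1 : ∫ t, ee (u*t) ∂wm κ = (2*Real.pi:ℂ)⁻¹*∫ t, (fun s : ℝ => (fe s:ℂ)*ee (u/κ*s)) (κ*t) := by
    rw [wm_int, ← integral_const_mul]
    refine integral_congr_ae (ae_of_all _ fun t => ?_)
    simp only [Complex.real_smul]
    rw [show u/κ*(κ*t) = u*t by field_simp]; push_cast; ring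
  have h2 : max 0 (κ-|u|) = κ*max 0 (1-|u/κ|) := by
    rw [mul_max_of_nonneg _ _ hκ.le, mul_zero, mul_sub, abs_div, abs_of_pos hκ]; field_simp
  have hπ : (Real.pi:ℂ) ≠ 0 := by exact_mod_cast Real.pi_ne_zero
  have hκ' : (κ:ℂ) ≠ 0 := by exact_mod_cast hκ.ne'
  rw [h1, Measure.integral_comp_mul_left (fun s : ℝ => (fe s:ℂ)*ee (u/κ*s)), h, abs_of_pos (by positivity), h2, Complex.real_smul]
  push_cast; field_simp

lemma wm_tail {κ T : ℝ} (hκ : 0 < κ) (hT : 0 < T) : (wm κ).real {t | T < |t|} ≤ 4/(κ^2*T) := by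
  haveI := wm_fin hκ
  have hm : MeasurableSet {t : ℝ | T < |t|} := measurableSet_lt measurable_const measurable_norm
  rw [← integral_indicator_one hm, wm_int]
  have hi : Integrable fun t : ℝ => 4/(Real.pi*κ^2*T^2)*(1+(T⁻¹*t)^2)⁻¹ := (integrable_inv_one_add_sq.comp_mul_left' (by positivity)).const_mul _
  refine (integral_mono_of_nonneg (ae_of_all _ fun t => smul_nonneg (wd_nn κ t) (Set.indicator_nonneg (fun _ _ => zero_le_one) _)) hi (ae_of_all _ fun t => ?_)).trans_eq ?_
  · by_cases ht : T < |t|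
    · simp only [Set.indicator_of_mem (show t ∈ {t : ℝ | T < |t|} from ht), Pi.one_apply, smul_eq_mul, mul_one]
      have h1 := fe_cl (κ*t)
      have h2 : T^2 < t^2 := by rw [← sq_abs t]; gcongr
      have : 4/(Real.pi*κ^2*T^2)*(1+(T⁻¹*t)^2)⁻¹ = 4/(Real.pi*κ^2*(T^2+t^2)) := by field_simp
      rw [this, div_le_div_iff₀ (by positivity) (by positivity)]
      have h3 := mul_le_mul_of_nonneg_left (show T^2+t^2 ≤ 2*t^2 by linarith) (fe_nn (κ*t))
      have h4 := mul_le_mul_of_nonneg_left h3 (show 0 ≤ Real.pi*κ^2 by positivity)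
      have h5 := mul_le_mul_of_nonneg_left h1 (show 0 ≤ 2*Real.pi by positivity)
      linarith
    · simp only [Set.indicator_of_notMem (show t ∉ {t : ℝ | T < |t|} from ht), smul_zero]; positivity
  · rw [integral_const_mul, Measure.integral_comp_mul_left (fun s => (1+s^2)⁻¹), integral_univ_inv_one_add_sq, inv_inv, abs_of_pos hT, smul_eq_mul]
    field_simp
end MR

namespace MR
open MeasureTheory

instance mDC {k : ℕ} : MeasurableSpace (DirichletCharacter ℂ k) := ⊤
instance mDC1 {k : ℕ} : DiscreteMeasurableSpace (DirichletCharacter ℂ k) := ⟨fun _ => trivial⟩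

noncomputable def ph (k n : ℕ) (ω : DirichletCharacter ℂ k × ℝ) : ℂ := if n = 0 then 0 else ω.1 n * ee (-ω.2*Real.log n)
noncomputable def nu (k : ℕ) [NeZero k] (κ : ℝ) : Measure (DirichletCharacter ℂ k × ℝ) := ENNReal.ofReal (κ^2/k.totient) • ∑ χ : DirichletCharacter ℂ k, (wm κ).map (Prod.mk χ)

variable {k : ℕ} [NeZero k] {κ : ℝ}

lemma nu_fin (hκ : 0 < κ) : IsFiniteMeasure (nu k κ) := by
  haveI := wm_fin hκ
  refine ⟨?_⟩
  rw [nu, Measure.smul_apply, Measure.finsetSum_apply, smul_eq_mul]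
  exact ENNReal.mul_lt_top ENNReal.ofReal_lt_top (ENNReal.sum_lt_top.2 fun χ _ => measure_lt_top _ _)

lemma nu_int (hκ : 0 < κ) {E : Type*} [NormedAddCommGroup E] [NormedSpace ℝ E] {f : DirichletCharacter ℂ k × ℝ → E} (hf : StronglyMeasurable f) (C : ℝ) (hC : ∀ ω, ‖f ω‖ ≤ C) :
    ∫ ω, f ω ∂nu k κ = (κ^2/k.totient) • ∑ χ : DirichletCharacter ℂ k, ∫ t, f (χ, t) ∂wm κ := by
  haveI := wm_fin hκ
  rw [nu, integral_smul_measure, integral_finsetSum_measure fun χ _ => bdd_int C hf.aestronglyMeasurable hC, ENNReal.toReal_ofReal (by positivity)]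
  congr 1
  refine Finset.sum_congr rfl fun χ _ => ?_
  rw [integral_map measurable_prodMk_left.aemeasurable hf.aestronglyMeasurable]

lemma ph_meas (n : ℕ) : Measurable (ph k n) := by
  refine measurable_from_prod_countable_right fun χ => ?_
  simp only [ph]
  split_ifs
  · exact measurable_const
  · exact ((continuous_ee.comp (by fun_prop : Continuous fun t : ℝ => -t*Real.log n)).measurable).const_mul _

lemma ph_bd (n : ℕ) (ω : DirichletCharacter ℂ k × ℝ) : ‖ph k n ω‖ ≤ 1 := by
  rw [ph]; split_ifs
  · simp
  · rw [norm_mul, norm_ee, mul_one]; exact DirichletCharacter.norm_le_one _ _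

lemma char_orth (m n : ℕ) : ∑ χ : DirichletCharacter ℂ k, χ m*(starRingEnd ℂ) (χ n) = if m.Coprime k ∧ n.Coprime k ∧ m ≡ n [MOD k] then (k.totient:ℂ) else 0 := by
  by_cases hn : n.Coprime k
  · have hu : IsUnit (n : ZMod k) := (ZMod.isUnit_iff_coprime n k).2 hn
    have h := DirichletCharacter.sum_char_inv_mul_char_eq ℂ hu (m : ZMod k)
    have h1 : ∀ χ : DirichletCharacter ℂ k, χ m*(starRingEnd ℂ) (χ n) = χ (n:ZMod k)⁻¹*χ m := fun χ => by
      rw [mul_comm]; congr 1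
      have := MulChar.star_apply' χ (n : ZMod k)
      rw [show (starRingEnd ℂ) (χ n) = star (χ n) from rfl, this, MulChar.inv_apply_eq_inv']
      exact inv_eq_of_mul_eq_one_right (by rw [← map_mul, ZMod.mul_inv_of_unit _ hu, map_one])
    rw [Finset.sum_congr rfl fun χ _ => h1 χ, h]
    refine if_congr ?_ rfl rfl
    rw [eq_comm, ZMod.natCast_eq_natCast_iff]
    refine ⟨fun h => ⟨?_, hn, h⟩, fun h => h.2.2⟩
    rw [Nat.Coprime, h.gcd_eq]; exact hn
  · rw [if_neg fun h => hn h.2.1]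
    refine Finset.sum_eq_zero fun χ _ => ?_
    rw [χ.map_nonunit (fun h => hn ((ZMod.isUnit_iff_coprime n k).1 h))]; simp

lemma sy_mk (hκ : 0 < κ) : Sy (nu k κ) (ph k) k κ where
  k1 := Nat.pos_of_ne_zero (NeZero.ne k)
  κ0 := hκ
  fin := nu_fin hκ
  meas := ph_meas
  mul m n ω := by
    by_cases hm : m = 0
    · simp [ph, hm]
    by_cases hn : n = 0
    · simp [ph, hn]
    rw [ph, ph, ph, if_neg hm, if_neg hn, if_neg (mul_ne_zero hm hn)]
    push_cast
    rw [Real.log_mul (by exact_mod_cast hm) (by exact_mod_cast hn), mul_add, ee_add, map_mul]; ring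
  bd := ph_bd
  cor m n hm hn := by
    have hφ : (k.totient:ℂ) ≠ 0 := by
      have := Nat.totient_pos.2 (Nat.pos_of_ne_zero (NeZero.ne k))
      exact_mod_cast this.ne'
    rw [nu_int hκ (f := fun ω => ph k m ω*(starRingEnd ℂ) (ph k n ω)) (((ph_meas m).mul (Complex.continuous_conj.measurable.comp (ph_meas n))).stronglyMeasurable) 1 fun ω => by
      rw [norm_mul, RCLike.norm_conj]; exact mul_le_one₀ (ph_bd _ _) (norm_nonneg _) (ph_bd _ _)]
    have h1 : ∀ χ : DirichletCharacter ℂ k, ∫ t, ph k m (χ, t)*(starRingEnd ℂ) (ph k n (χ, t)) ∂wm κ = χ m*(starRingEnd ℂ) (χ n)*∫ t, ee ((Real.log n-Real.log m)*t) ∂wm κ := fun χ => by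
      rw [← integral_const_mul]
      refine integral_congr_ae (ae_of_all _ fun t => ?_)
      simp only [ph, if_neg (show m ≠ 0 by omega), if_neg (show n ≠ 0 by omega), map_mul, ee_conj]
      rw [show (Real.log n-Real.log m)*t = -t*Real.log m+ -(-t*Real.log n) by ring, ee_add]; ring
    rw [Finset.sum_congr rfl fun χ _ => h1 χ, ← Finset.sum_mul, char_orth, Complex.real_smul, kk]
    have h2 := wm_ft hκ (Real.log n-Real.log m)
    rw [abs_sub_comm] at h2
    split_ifs
    · rw [← h2]; push_cast; field_simp
    · simp

lemma RR_FF (g : ℕ → ℂ) {η Y : ℝ} (χ : DirichletCharacter ℂ k) (t : ℝ) : RR g (ph k) η Y 1 (χ, t) = FF (fun n => g n*χ n) η Y t := by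
  rw [RR, FF, JI, div_one, div_one]
  refine Finset.sum_congr rfl fun n hn => ?_
  have : n ≠ 0 := by have := (Finset.mem_Ioc.1 hn).1; omega
  simp only [ph, if_neg this]; ring
end MR

namespace MR
open MeasureTheory

noncomputable def gm (d n : ℕ) : ℂ := (ArithmeticFunction.moebius (d*n) : ℂ)

lemma gm_bd (d n : ℕ) : ‖gm d n‖ ≤ 1 := by
  rw [gm, Complex.norm_intCast]; exact_mod_cast ArithmeticFunction.abs_moebius_le_one

lemma gm_cop {d n : ℕ} (h : d.Coprime n) : gm d n = ArithmeticFunction.moebius d * ArithmeticFunction.moebius n := by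
  rw [gm, ArithmeticFunction.isMultiplicative_moebius.map_mul_of_coprime h]; push_cast; rfl

lemma gm_ncop {d n : ℕ} (h : ¬ d.Coprime n) : gm d n = 0 := by
  rw [gm, ArithmeticFunction.moebius_eq_zero_of_not_squarefree, Int.cast_zero]
  exact fun hs => h (Nat.coprime_of_squarefree_mul hs)

lemma gm_rel {d p : ℕ} (hp : p.Prime) (hd : ¬ p ∣ d) (m : ℕ) : gm d (p*m) = if p ∣ m then 0 else -gm d m := by
  rw [gm, show d*(p*m) = p*(d*m) by ring]
  split_ifs with h
  · rw [ArithmeticFunction.moebius_eq_zero_of_not_squarefree, Int.cast_zero]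
    intro hs
    exact (Nat.Prime.coprime_iff_not_dvd hp).1 (Nat.coprime_of_squarefree_mul hs) (h.mul_left d)
  · rw [ArithmeticFunction.isMultiplicative_moebius.map_mul_of_coprime ((Nat.Prime.coprime_iff_not_dvd hp).2 fun h' => (hp.dvd_mul.1 h').elim hd h), ArithmeticFunction.moebius_apply_prime hp, gm]
    push_cast; ring

variable {k : ℕ} [NeZero k]

lemma gm_tend {d : ℕ} (hd : 1 ≤ d) (χ : DirichletCharacter ℂ k) {η : ℝ} (hη : 0 ≤ η) (t : ℝ) : Tendsto (fun Y => FF (fun n => gm d n*χ n) η Y t) atTop (𝓝 0) := by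
  haveI : NeZero (d*k) := ⟨mul_ne_zero (by omega) (NeZero.ne k)⟩
  set ψ := DirichletCharacter.changeLevel (dvd_mul_left k d) χ with hψ
  have h := FF_tend (h := fun n => ψ n * (ArithmeticFunction.moebius n : ℂ)) (by simp) (mu_char ψ) hη t
  have h2 := h.const_mul (ArithmeticFunction.moebius d : ℂ)
  rw [mul_zero] at h2
  refine h2.congr fun Y => ?_
  rw [FF, FF, Finset.mul_sum]
  refine Finset.sum_congr rfl fun n _ => ?_
  suffices gm d n*χ n = ArithmeticFunction.moebius d*(ψ n * (ArithmeticFunction.moebius n : ℂ)) by rw [this]; ring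
  by_cases hn : n.Coprime (d*k)
  · have := DirichletCharacter.changeLevel_eq_cast_of_dvd' χ (dvd_mul_left k d) (a := n) (Nat.isCoprime_iff_coprime.2 hn)
    push_cast at this
    rw [hψ, this, gm_cop (Nat.Coprime.coprime_mul_right_right hn).symm]; ring
  · rw [ψ.map_nonunit fun h => hn ((ZMod.isUnit_iff_coprime n _).1 h)]
    by_cases h1 : d.Coprime n
    · rw [χ.map_nonunit fun h => hn (Nat.Coprime.mul_right h1.symm ((ZMod.isUnit_iff_coprime n _).1 h))]; simp
    · rw [gm_ncop h1]; simp

lemma finA : ∃ c : ℝ, 0 < c ∧ c ≤ 1/24 ∧ ∀ {η : ℝ}, 0 < η → η ≤ 1/2 → ∀ {d k : ℕ} [NeZero k], 1 ≤ d → ∀ {L δ : ℝ}, 1 ≤ L → 0 < δ → ∃ Y1 : ℝ, ∀ Y ≥ Y1,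
    ∀ A, MeasurableSet A → (nu k (L*k/Y)).real A ≤ (L*k/Y)^2*Y^(c/2) → ∫ ω in A, ‖RR (gm d) (ph k) η Y 1 ω‖^2 ∂nu k (L*k/Y) ≤ δ*Th k L Y := by
  obtain ⟨c, hc, hc', H⟩ := final
  refine ⟨c, hc, hc'.le, fun {η} hη hη1 {d k} _ hd {L δ} hL hδ => ?_⟩
  have hk : 1 ≤ k := Nat.pos_of_ne_zero (NeZero.ne k)
  have hkR : (1:ℝ) ≤ k := by exact_mod_cast hk
  have hφ : 1 ≤ k.totient := Nat.totient_pos.2 hk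
  have hφR : (1:ℝ) ≤ k.totient := by exact_mod_cast hφ
  have h1 : ∀ χ : DirichletCharacter ℂ k, ∃ Y0 : ℝ, ∀ Y, Y0 ≤ Y → ∀ (μ : Measure ℝ) [IsFiniteMeasure μ], μ ≤ volume → μ.real Set.univ ≤ Y^c →
    (∀ᵐ t ∂μ, |t| ≤ Y^3) → ∫ t, ‖FF (fun n => gm d n*χ n) η Y t‖^2 ∂μ ≤ δ/(2*k^2) := fun χ => by
    refine H η hη hη1 _ (fun n => χ n) k.totient (max d k) hφ (fun n => ?_) (fun p hp hpq => ?_) (gm_tend hd χ hη.le) _ (by positivity)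
    · rw [norm_mul]; exact mul_le_one₀ (gm_bd _ _) (norm_nonneg _) (DirichletCharacter.norm_le_one _ _)
    · have hpd : ¬ p ∣ d := fun h => absurd (Nat.le_of_dvd hd h) (by have := le_max_left d k; omega)
      have hpk : ¬ p ∣ k := fun h => absurd (Nat.le_of_dvd hk h) (by have := le_max_right d k; omega)
      have hu : IsUnit (p : ZMod k) := (ZMod.isUnit_iff_coprime p k).2 ((Nat.Prime.coprime_iff_not_dvd hp).2 hpk)
      obtain ⟨u, hu⟩ := hu
      refine ⟨?_, ?_, fun m => ?_⟩
      · rw [← hu]; exact DirichletCharacter.unit_norm_eq_one χ u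
      · rw [← hu, ← map_pow, ← Units.val_pow_eq_pow_val, ZMod.pow_totient]; simp
      · rw [gm_rel hp hpd]; push_cast; rw [map_mul]; split_ifs <;> ring
  choose Y0 hY0 using h1
  have hev : ∀ᶠ Y : ℝ in atTop, ∀ χ : DirichletCharacter ℂ k, Y0 χ ≤ Y := eventually_all.2 fun χ => eventually_ge_atTop _
  have hev2 : ∀ᶠ Y : ℝ in atTop, (k.totient:ℝ) ≤ Y^(c/2) := (tendsto_rpow_atTop (by linarith)).eventually_ge_atTop _
  obtain ⟨Y1, hY1⟩ := eventually_atTop.1 (hev.and hev2)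
  refine ⟨max (max Y1 1) (72*k^2/δ), fun Y hY A hA hνA => ?_⟩
  obtain ⟨hYa, hYb⟩ := hY1 Y (le_trans (le_trans (le_max_left _ _) (le_max_left _ _)) hY)
  have hY1' : 1 ≤ Y := le_trans (le_trans (le_max_right _ _) (le_max_left _ _)) hY
  have hYδ : 72*k^2/δ ≤ Y := le_trans (le_max_right _ _) hY
  set κ := L*k/Y with hκ
  have hκ0 : 0 < κ := by positivity
  haveI := wm_fin hκ0
  haveI := nu_fin (k := k) hκ0
  have S := sy_mk (k := k) hκ0
  have hFb : ∀ (χ : DirichletCharacter ℂ k) t, ‖FF (fun n => gm d n*χ n) η Y t‖ ≤ 3 := fun χ t =>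
    FF_bd (fun n => by rw [norm_mul]; exact mul_le_one₀ (gm_bd _ _) (norm_nonneg _) (DirichletCharacter.norm_le_one _ _)) hη.le hη1 hY1' t
  have hF2 : ∀ (χ : DirichletCharacter ℂ k) t, ‖FF (fun n => gm d n*χ n) η Y t‖^2 ≤ 9 := fun χ t => by
    nlinarith [hFb χ t, norm_nonneg (FF (fun n => gm d n*χ n) η Y t)]
  have hAx : ∀ χ : DirichletCharacter ℂ k, MeasurableSet (Prod.mk χ ⁻¹' A) := fun χ => measurable_prodMk_left hA
  -- mass of sections
  have hmass : ∀ χ : DirichletCharacter ℂ k, (wm κ).real (Prod.mk χ ⁻¹' A) ≤ Y^c := fun χ => by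
    have e1 := nu_int (k := k) hκ0 (f := A.indicator (1 : DirichletCharacter ℂ k × ℝ → ℝ)) (stronglyMeasurable_one.indicator hA) 1 fun ω => by
      by_cases h : ω ∈ A <;> simp [h]
    rw [integral_indicator_one hA] at e1
    have e2 : ∀ χ : DirichletCharacter ℂ k, ∫ t, A.indicator (1 : DirichletCharacter ℂ k × ℝ → ℝ) (χ, t) ∂wm κ = (wm κ).real (Prod.mk χ ⁻¹' A) := fun χ => by
      rw [← integral_indicator_one (hAx χ)]; rfl
    rw [Finset.sum_congr rfl fun χ _ => e2 χ, smul_eq_mul] at e1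
    have e3 : (wm κ).real (Prod.mk χ ⁻¹' A) ≤ ∑ χ : DirichletCharacter ℂ k, (wm κ).real (Prod.mk χ ⁻¹' A) :=
      Finset.single_le_sum (f := fun χ : DirichletCharacter ℂ k => (wm κ).real (Prod.mk χ ⁻¹' A)) (fun _ _ => measureReal_nonneg) (Finset.mem_univ χ)
    rw [e1, div_mul_eq_mul_div, mul_div_assoc] at hνA
    have e4 := le_of_mul_le_mul_left hνA (by positivity)
    rw [div_le_iff₀ (by positivity)] at e4
    have e5 : Y^c = Y^(c/2)*Y^(c/2) := by rw [← Real.rpow_add (by linarith)]; congr 1; ring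
    rw [e5]
    exact e3.trans (e4.trans (mul_le_mul_of_nonneg_left hYb (by positivity)))
  have hχ : ∀ χ : DirichletCharacter ℂ k, ∫ t in Prod.mk χ ⁻¹' A, ‖FF (fun n => gm d n*χ n) η Y t‖^2 ∂wm κ ≤ δ/k^2 := fun χ => by
    set B : Set ℝ := {t | Y^3 < |t|} with hB
    have hBm : MeasurableSet B := measurableSet_lt measurable_const measurable_norm
    have hi : ∀ s, Integrable (fun t => ‖FF (fun n => gm d n*χ n) η Y t‖^2) ((wm κ).restrict s) := fun s =>
      bdd_int 9 ((FF_cont _ η Y).norm.pow 2).aestronglyMeasurable fun t => by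
        rw [Real.norm_of_nonneg (by positivity)]; exact hF2 χ t
    rw [← integral_add_compl hBm (hi _), Measure.restrict_restrict hBm, Measure.restrict_restrict hBm.compl]
    have b1 : ∫ t in B ∩ Prod.mk χ ⁻¹' A, ‖FF (fun n => gm d n*χ n) η Y t‖^2 ∂wm κ ≤ 9*(4/(κ^2*Y^3)) := by
      calc _ ≤ ∫ t in B ∩ Prod.mk χ ⁻¹' A, (9:ℝ) ∂wm κ := integral_mono (hi _) (integrable_const _) (hF2 χ)
        _ = 9*(wm κ).real (B ∩ Prod.mk χ ⁻¹' A) := by rw [setIntegral_const, smul_eq_mul, mul_comm]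
        _ ≤ 9*(wm κ).real B := by exact mul_le_mul_of_nonneg_left (measureReal_mono Set.inter_subset_left (measure_ne_top _ _)) (by norm_num)
        _ ≤ _ := by gcongr; exact wm_tail hκ0 (by positivity)
    have b2 : ∫ t in Bᶜ ∩ Prod.mk χ ⁻¹' A, ‖FF (fun n => gm d n*χ n) η Y t‖^2 ∂wm κ ≤ δ/(2*k^2) := by
      refine hY0 χ Y (hYa χ) _ (Measure.restrict_le_self.trans (wm_le κ)) ?_ ?_
      · rw [measureReal_restrict_apply_univ]; exact (measureReal_mono Set.inter_subset_right).trans (hmass χ)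
      · filter_upwards [ae_restrict_mem (hBm.compl.inter (hAx χ))] with t ht
        exact not_lt.1 ht.1
    have b3 : 9*(4/(κ^2*Y^3)) ≤ δ/(2*k^2) := by
      have : κ^2*Y^3 = (L*k)^2*Y := by rw [hκ]; field_simp
      rw [this]
      have h2 : (1:ℝ) ≤ (L*k)^2 := one_le_pow₀ (by nlinarith)
      rw [div_le_iff₀ hδ] at hYδ
      rw [← mul_div_assoc, div_le_div_iff₀ (by positivity) (by positivity)]
      nlinarith [mul_le_mul_of_nonneg_right h2 (show 0 ≤ Y*δ by positivity)]
    have : δ/(k:ℝ)^2 = δ/(2*k^2)+δ/(2*k^2) := by field_simp; ring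
    linarith
  rw [← integral_indicator hA, nu_int hκ0 (C := (∑ m ∈ JI η Y 1, ‖gm d m/m‖)^2) (((S.mRR 1).norm.pow_const 2).indicator hA).stronglyMeasurable fun ω => by
    rw [Set.indicator]; split_ifs
    · rw [norm_pow, norm_norm]; exact pow_le_pow_left₀ (norm_nonneg _) (S.bRR 1 ω) 2
    · rw [norm_zero]; positivity]
  have e : ∀ χ : DirichletCharacter ℂ k, ∫ t, A.indicator (fun ω => ‖RR (gm d) (ph k) η Y 1 ω‖^2) (χ, t) ∂wm κ ≤ δ/k^2 := fun χ => by
    refine le_of_eq_of_le ?_ (hχ χ)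
    rw [← integral_indicator (hAx χ)]
    refine integral_congr_ae (ae_of_all _ fun t => ?_)
    simp only [Set.indicator, RR_FF]; rfl
  have e2 := Finset.sum_le_card_nsmul Finset.univ _ _ fun χ _ => e χ
  rw [Finset.card_univ, ← Nat.card_eq_fintype_card, DirichletCharacter.card_eq_totient_of_hasEnoughRootsOfUnity ℂ k, nsmul_eq_mul] at e2
  rw [smul_eq_mul]
  refine (mul_le_mul_of_nonneg_left e2 (by positivity)).trans ?_
  have : κ^2/k.totient*(k.totient*(δ/(k:ℝ)^2)) = δ*(L^2/Y^2) := by rw [hκ]; field_simp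
  rw [this, Th, mul_div_assoc]
  exact mul_le_mul_of_nonneg_left (le_mul_of_one_le_left (by positivity) hφR) hδ.le
end MR

namespace MR
open MeasureTheory

noncomputable def gr (d n : ℕ) : ℝ := (ArithmeticFunction.moebius (d*n) : ℝ)

lemma propS {ε ε3 : ℝ} (hε : 0 < ε) (h3 : 0 < ε3) : ∃ L0 : ℝ, ∀ L ≥ L0, ∀ {η : ℝ}, 0 < η → η ≤ 1/2 → ∀ {d k : ℕ}, 1 ≤ d → 1 ≤ k → pf (d*k) ≤ (1-ε)*ps 1 L → ∃ Y0 : ℝ, ∀ Y ≥ Y0,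
    ∑ m ∈ JI η Y 1, ∑ n ∈ JI η Y 1, gr d m/m*(gr d n/n)*kk k (L*k/Y) m n ≤ ε3*Th k L Y := by
  obtain ⟨c, hc, hc', H⟩ := finA
  set δ := min 1 (ε3/8) with hδ
  have hδ0 : 0 < δ := by positivity
  have hδ2 : 8*δ ≤ ε3 := by have := min_le_right 1 (ε3/8); linarith
  obtain ⟨a0, ha0, L0, H2⟩ := propE hc hc' hε hδ0 (min_le_left _ _)
  refine ⟨max L0 1, fun L hL {η} hη hη1 {d k} hd hk hp => ?_⟩
  have hL1 : 1 ≤ L := (le_max_right _ _).trans hL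
  obtain ⟨y1, H3⟩ := H2 L ((le_max_left _ _).trans hL)
  haveI : NeZero k := ⟨by omega⟩
  obtain ⟨Y1, H4⟩ := H hη hη1 (k := k) hd hL1 hδ0
  have hkR : (1:ℝ) ≤ k := by exact_mod_cast hk
  have hqR : (1:ℝ) ≤ (d*k:ℕ) := by exact_mod_cast Nat.mul_pos hd hk
  have hev : ∀ᶠ Y : ℝ in atTop, max (max y1 512) (max (4*Real.log k) (Real.log (d*k:ℕ)/a0)) ≤ Real.log Y := Real.tendsto_log_atTop.eventually_ge_atTop _
  obtain ⟨Y0, hY0⟩ := eventually_atTop.1 ((hev.and (eventually_ge_atTop 1)).and (eventually_ge_atTop Y1))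
  refine ⟨Y0, fun Y hY => ?_⟩
  obtain ⟨⟨hl, hY1⟩, hY2⟩ := hY0 Y hY
  simp only [max_le_iff] at hl
  obtain ⟨⟨l1, l2⟩, l3, l4⟩ := hl
  have hκ0 : 0 < L*k/Y := by positivity
  have S := sy_mk (k := k) hκ0
  have hYe : Real.exp (Real.log Y) = Y := Real.exp_log (by linarith)
  have X : Cq (nu k (L*k/Y)) (ph k) k (L*k/Y) (gm d) η Y L (d*k) :=
    { S with
      hg := gm_bd d
      hη := hη
      hη1 := hη1
      hY := hY1
      hL := hL1
      hκ := rfl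
      hq := Nat.mul_pos hd hk
      hk := dvd_mul_left _ _
      hgq := fun p hp hpq m => gm_rel hp (fun h => hpq (h.mul_right _)) m
      hYk := fun x hx hx3 => by
        set y := Real.log Y with hy
        have hxy : x ≤ y/8 := by
          by_contra! h
          have : (y/8)^3 < x^3 := pow_lt_pow_left₀ h (by linarith) (by norm_num)
          nlinarith only [this, hx3, l2, mul_le_mul_of_nonneg_right l2 (sq_nonneg y)]
        have h1 : (k:ℝ) ≤ Real.exp (y/4) := by
          rw [← Real.exp_log (show (0:ℝ) < k by linarith)]; exact Real.exp_le_exp.2 (by linarith)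
        have h2 : 2*x ≤ Real.exp (2*x) := by linarith [Real.add_one_le_exp (2*x)]
        calc _ ≤ Real.exp (y/4)^2*Real.exp (2*x)*Real.exp (2*x) := by gcongr
          _ = Real.exp (y/2+4*x) := by rw [← Real.exp_nat_mul, ← Real.exp_add, ← Real.exp_add]; congr 1; push_cast; ring
          _ ≤ Real.exp y := Real.exp_le_exp.2 (by linarith)
          _ = Y := hYe }
  have h5 := H3 X hp l1 (by
    rw [← Real.exp_log (show (0:ℝ) < (d*k:ℕ) by linarith)]
    rw [div_le_iff₀ ha0] at l4
    exact Real.exp_le_exp.2 (by linarith)) (H4 Y hY2)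
  have hTh : 0 ≤ Th k L Y := by rw [Th]; positivity
  refine le_trans (le_of_eq ?_) (h5.trans (mul_le_mul_of_nonneg_right hδ2 hTh))
  have h6 := S.quad (JI η Y 1) (fun n hn => by have := (Finset.mem_Ioc.1 hn).1; omega) (fun n => gm d n/n)
  rw [← Complex.ofReal_inj]
  refine Eq.trans ?_ h6.symm
  push_cast
  refine Finset.sum_congr rfl fun m _ => Finset.sum_congr rfl fun n _ => ?_
  simp [gr, gm]
end MR

namespace MR
open MeasureTheory

noncomputable def cn (n : ℕ) : ℝ := (ArithmeticFunction.moebius n : ℝ)/n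
noncomputable def mk0 (κ : ℝ) (m n : ℕ) : ℝ := max 0 (κ-|Real.log m-Real.log n|)

lemma JI_dvd {d : ℕ} (hd : 1 ≤ d) {η X : ℝ} (hX : 0 < X) (F : ℕ → ℝ) : ∑ n ∈ JI η X 1, (if d ∣ n then F n else 0) = ∑ m ∈ JI η (X/d) 1, F (d*m) := by
  have hd0 : (0:ℝ) < d := by exact_mod_cast hd
  rw [← Finset.sum_filter]
  symm
  refine Finset.sum_nbij (fun m => d*m) (fun m hm => ?_) (fun m _ n _ h => Nat.eq_of_mul_eq_mul_left hd h) (fun n hn => ?_) (fun _ _ => rfl)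
  · rw [mem_JI (by positivity) one_pos, one_mul, div_lt_iff₀ hd0, div_mul_eq_mul_div, le_div_iff₀ hd0] at hm
    rw [Finset.mem_filter, mem_JI hX one_pos]; push_cast
    exact ⟨⟨by linarith, by linarith⟩, dvd_mul_right _ _⟩
  · obtain ⟨h, m, rfl⟩ := Finset.mem_filter.1 hn
    rw [mem_JI hX one_pos] at h; push_cast at h
    refine ⟨m, ?_, rfl⟩
    rw [Finset.mem_coe, mem_JI (by positivity) one_pos, one_mul, div_lt_iff₀ hd0, div_mul_eq_mul_div, le_div_iff₀ hd0]
    exact ⟨by linarith, by linarith⟩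

lemma kk_mk {d k : ℕ} (hd : 1 ≤ d) {m n : ℕ} (hm : 1 ≤ m) (hn : 1 ≤ n) (κ : ℝ) :
    kk k κ m n = if (d*m).gcd (d*k) = d ∧ d*m % (d*k) = d*n % (d*k) then mk0 κ (d*m) (d*n) else 0 := by
  have hd0 : (d:ℝ) ≠ 0 := by positivity
  have : mk0 κ (d*m) (d*n) = max 0 (κ-|Real.log m-Real.log n|) := by
    rw [mk0]; push_cast
    rw [Real.log_mul hd0 (by positivity), Real.log_mul hd0 (by positivity), add_sub_add_left_eq_sub]
  rw [kk, this, Nat.gcd_mul_left, Nat.mul_mod_mul_left, Nat.mul_mod_mul_left]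
  refine if_congr ⟨fun h => ⟨by rw [h.1, mul_one], by rw [h.2.2]⟩, fun h => ?_⟩ rfl rfl
  have h2 : m ≡ n [MOD k] := Nat.eq_of_mul_eq_mul_left hd h.2
  have h1 : m.Coprime k := Nat.eq_of_mul_eq_mul_left hd (by rw [h.1, mul_one])
  exact ⟨h1, by rw [Nat.Coprime, ← h2.gcd_eq]; exact h1, h2⟩

lemma SSq {ε ε3 : ℝ} (hε : 0 < ε) (h3 : 0 < ε3) : ∃ L0 : ℝ, ∀ L ≥ L0, ∀ {η : ℝ}, 0 < η → η ≤ 1/2 → ∀ {q : ℕ}, 1 ≤ q → pf q ≤ (1-ε)*ps 1 L → ∀ᶠ X : ℝ in atTop,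
    ∑ m ∈ JI η X 1, ∑ n ∈ JI η X 1, (if m % q = n % q then cn m*cn n*mk0 (L*q/X) m n else 0) ≤ ε3*q*L^2/X^2 := by
  obtain ⟨L0, H⟩ := propS hε h3
  refine ⟨L0, fun L hL {η} hη hη1 {q} hq hp => ?_⟩
  have h1 : ∀ d ∈ q.divisors, ∀ᶠ X : ℝ in atTop, ∑ m ∈ JI η X 1, ∑ n ∈ JI η X 1, (if m.gcd q = d ∧ m % q = n % q then cn m*cn n*mk0 (L*q/X) m n else 0) ≤ ε3*(q/d).totient*L^2/X^2 := by
    intro d hdq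
    obtain ⟨k, rfl⟩ := Nat.dvd_of_mem_divisors hdq
    have hd : 1 ≤ d := Nat.pos_of_mul_pos_right hq
    have hk : 1 ≤ k := Nat.pos_of_mul_pos_left hq
    have hd0 : (0:ℝ) < d := by exact_mod_cast hd
    obtain ⟨Y0, h⟩ := H L hL hη hη1 hd hk hp
    filter_upwards [eventually_ge_atTop (d*Y0), eventually_ge_atTop 1] with X hX hX1
    have hX0 : 0 < X := by linarith
    have h2 := h (X/d) (by rw [ge_iff_le, le_div_iff₀ hd0]; linarith)
    have e1 : L*k/(X/d) = L*(d*k:ℕ)/X := by push_cast; field_simp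
    rw [e1] at h2
    set κ := L*(d*k:ℕ)/X with hκ
    have e2 : ∑ m ∈ JI η X 1, ∑ n ∈ JI η X 1, (if m.gcd (d*k) = d ∧ m % (d*k) = n % (d*k) then cn m*cn n*mk0 κ m n else 0)
      = ∑ m ∈ JI η X 1, (if d ∣ m then ∑ n ∈ JI η X 1, if d ∣ n then (if m.gcd (d*k) = d ∧ m % (d*k) = n % (d*k) then cn m*cn n*mk0 κ m n else 0) else 0 else 0) := by
      refine Finset.sum_congr rfl fun m _ => ?_
      split_ifs with hm
      · refine Finset.sum_congr rfl fun n _ => ?_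
        by_cases hn : d ∣ n
        · rw [if_pos hn]
        · rw [if_neg hn, if_neg]
          rintro ⟨ha, hb⟩
          exact hn ((Nat.ModEq.dvd_iff (show m ≡ n [MOD d*k] from hb) (dvd_mul_right d k)).1 hm)
      · refine Finset.sum_eq_zero fun n _ => if_neg ?_
        rintro ⟨ha, hb⟩
        exact hm (ha ▸ Nat.gcd_dvd_left _ _)
    rw [e2, JI_dvd hd hX0 fun m => ∑ n ∈ JI η X 1, if d ∣ n then (if m.gcd (d*k) = d ∧ m % (d*k) = n % (d*k) then cn m*cn n*mk0 κ m n else 0) else 0]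
    have e3 : ∑ m ∈ JI η (X/d) 1, ∑ n ∈ JI η (X/d) 1, gr d m/m*(gr d n/n)*kk k κ m n = (d:ℝ)^2*∑ m ∈ JI η (X/d) 1, ∑ n ∈ JI η X 1, (if d ∣ n then (if (d*m).gcd (d*k) = d ∧ (d*m) % (d*k) = n % (d*k) then cn (d*m)*cn n*mk0 κ (d*m) n else 0) else 0) := by
      rw [Finset.mul_sum]
      refine Finset.sum_congr rfl fun m hm => ?_
      rw [JI_dvd hd hX0 fun n => if (d*m).gcd (d*k) = d ∧ (d*m) % (d*k) = n % (d*k) then cn (d*m)*cn n*mk0 κ (d*m) n else 0, Finset.mul_sum]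
      refine Finset.sum_congr rfl fun n hn => ?_
      have hm1 : 1 ≤ m := by have := (Finset.mem_Ioc.1 hm).1; omega
      have hn1 : 1 ≤ n := by have := (Finset.mem_Ioc.1 hn).1; omega
      have : (0:ℝ) < m := by exact_mod_cast hm1
      have : (0:ℝ) < n := by exact_mod_cast hn1
      rw [kk_mk hd hm1 hn1]
      split_ifs
      · rw [cn, cn, gr, gr]; push_cast; field_simp
      · simp
    rw [e3, Th] at h2
    rw [Nat.mul_div_cancel_left _ hd]
    refine le_of_mul_le_mul_left (h2.trans (le_of_eq ?_)) (show (0:ℝ) < (d:ℝ)^2 by positivity)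
    field_simp
  have h2 := (Filter.eventually_all_finset q.divisors).2 h1
  filter_upwards [h2] with X hX
  have e : ∑ m ∈ JI η X 1, ∑ n ∈ JI η X 1, (if m % q = n % q then cn m*cn n*mk0 (L*q/X) m n else 0) = ∑ d ∈ q.divisors, ∑ m ∈ JI η X 1, ∑ n ∈ JI η X 1, (if m.gcd q = d ∧ m % q = n % q then cn m*cn n*mk0 (L*q/X) m n else 0) := by
    symm
    rw [Finset.sum_comm]
    refine Finset.sum_congr rfl fun m _ => ?_
    rw [Finset.sum_comm]
    refine Finset.sum_congr rfl fun n _ => ?_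
    rw [Finset.sum_eq_single (m.gcd q) (fun b _ hb => if_neg fun h => hb h.1.symm) fun h => absurd (Nat.mem_divisors.2 ⟨Nat.gcd_dvd_right _ _, by omega⟩) h]
    simp
  rw [e]
  refine (Finset.sum_le_sum hX).trans (le_of_eq ?_)
  rw [← Finset.sum_div, ← Finset.sum_mul, ← Finset.mul_sum, ← Nat.cast_sum, Nat.sum_div_divisors q Nat.totient, Nat.sum_totient]
end MR

namespace MR
open MeasureTheory

noncomputable def wn (κ : ℝ) (n : ℕ) : ℝ → ℝ := (Set.Ico (Real.log n-κ) (Real.log n)).indicator 1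
noncomputable def bw (J : Finset ℕ) (κ : ℝ) (q a : ℕ) (u : ℝ) : ℝ := ∑ n ∈ J with n % q = a, cn n*wn κ n u

lemma wn_mul (κ : ℝ) (m n : ℕ) : Integrable (fun u => wn κ m u*wn κ n u) ∧ ∫ u, wn κ m u*wn κ n u = mk0 κ m n := by
  have h : (fun u => wn κ m u*wn κ n u) = (Set.Ico (max (Real.log m-κ) (Real.log n-κ)) (min (Real.log m) (Real.log n))).indicator 1 := by
    rw [← Set.Ico_inter_Ico, Set.inter_indicator_one]; rfl
  rw [h]
  refine ⟨(integrable_indicator_iff measurableSet_Ico).2 (integrableOn_const (by simp)), ?_⟩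
  rw [integral_indicator_one measurableSet_Ico, Real.volume_real_Ico, mk0, max_comm]
  congr 1
  rcases le_total (Real.log m) (Real.log n) with h | h
  · rw [min_eq_left h, max_eq_right (by linarith), abs_of_nonpos (by linarith)]; ring
  · rw [min_eq_right h, max_eq_left (by linarith), abs_of_nonneg (by linarith)]; ring

lemma bw_sq (J : Finset ℕ) (κ : ℝ) (q a : ℕ) (u : ℝ) : bw J κ q a u^2 = ∑ m ∈ J, ∑ n ∈ J, (if m % q = a ∧ n % q = a then cn m*cn n else 0)*(wn κ m u*wn κ n u) := by
  rw [bw, sq, Finset.sum_filter, Finset.sum_mul_sum]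
  refine Finset.sum_congr rfl fun m _ => Finset.sum_congr rfl fun n _ => ?_
  by_cases h1 : m % q = a <;> by_cases h2 : n % q = a <;> simp [h1, h2]
  ring

lemma bw_i (J : Finset ℕ) (κ : ℝ) (q a : ℕ) : Integrable (fun u => bw J κ q a u^2) := by
  simp only [bw_sq]
  exact integrable_finsetSum _ fun m _ => integrable_finsetSum _ fun n _ => (wn_mul κ m n).1.const_mul _

lemma bw_tot (J : Finset ℕ) (κ : ℝ) {q : ℕ} (hq : 1 ≤ q) : ∑ a ∈ Finset.range q, ∫ u, bw J κ q a u^2 = ∑ m ∈ J, ∑ n ∈ J, (if m % q = n % q then cn m*cn n*mk0 κ m n else 0) := by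
  have h : ∀ a, ∫ u, bw J κ q a u^2 = ∑ m ∈ J, ∑ n ∈ J, (if m % q = a ∧ n % q = a then cn m*cn n else 0)*mk0 κ m n := fun a => by
    simp only [bw_sq]
    rw [integral_finsetSum _ fun m _ => integrable_finsetSum _ fun n _ => (wn_mul κ m n).1.const_mul _]
    refine Finset.sum_congr rfl fun m _ => ?_
    rw [integral_finsetSum _ fun n _ => (wn_mul κ m n).1.const_mul _]
    refine Finset.sum_congr rfl fun n _ => ?_
    rw [integral_const_mul, (wn_mul κ m n).2]
  rw [Finset.sum_congr rfl fun a _ => h a, Finset.sum_comm]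
  refine Finset.sum_congr rfl fun m _ => ?_
  rw [Finset.sum_comm]
  refine Finset.sum_congr rfl fun n _ => ?_
  rw [Finset.sum_eq_single (m % q) (fun b _ hb => by rw [if_neg fun h => hb h.1.symm, zero_mul]) fun h => absurd (Finset.mem_range.2 (Nat.mod_lt m hq)) h]
  by_cases h1 : m % q = n % q
  · rw [if_pos ⟨rfl, h1.symm⟩, if_pos h1]
  · rw [if_neg fun h => h1 h.2.symm, if_neg h1, zero_mul]

lemma ctq {q : ℕ} (hq : 1 ≤ q) (a x y : ℕ) (h : x ≤ y) : (((Finset.Ioc x y).filter fun n => n % q = a).card : ℝ) ≤ ((y:ℝ)-x)/q+1 := by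
  have hq0 : (0:ℝ) < q := by exact_mod_cast hq
  by_cases ha : a < q
  · have := Nat.Ioc_filter_modEq_card x y hq a
    have e : (Finset.Ioc x y).filter (fun n => n % q = a) = (Finset.Ioc x y).filter (fun n => n ≡ a [MOD q]) :=
      Finset.filter_congr fun n _ => by rw [Nat.ModEq, Nat.mod_eq_of_lt ha]
    rw [e]
    have h1 := Int.floor_le (((y:ℚ)-a)/q)
    have h2 := Int.lt_floor_add_one (((x:ℚ)-a)/q)
    have h3 : (((Finset.Ioc x y).filter fun n => n ≡ a [MOD q]).card : ℚ) ≤ ((y:ℚ)-x)/q+1 := by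
      rw [← Int.cast_natCast, this]
      push_cast
      have hxy : (x:ℚ) ≤ y := by exact_mod_cast h
      have e2 : ((y:ℚ)-x)/q = (y-a)/q-(x-a)/q := by ring
      refine max_le (by linarith) ?_
      have : (0:ℚ) ≤ ((y:ℚ)-x)/q := div_nonneg (sub_nonneg.2 hxy) (by positivity)
      linarith
    have h4 : (((((Finset.Ioc x y).filter fun n => n ≡ a [MOD q]).card : ℚ)):ℝ) ≤ ((((y:ℚ)-x)/q+1:ℚ):ℝ) := by exact_mod_cast h3
    push_cast at h4; exact h4
  · rw [Finset.filter_false_of_mem fun n _ (h : n % q = a) => ha (h ▸ Nat.mod_lt n hq)]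
    have : (x:ℝ) ≤ y := by exact_mod_cast h
    simp; have := div_nonneg (sub_nonneg.2 this) hq0.le; linarith

noncomputable def Sx (H q a x : ℕ) : ℝ := ∑ m ∈ (Finset.Icc x (x+H)).filter (fun m => m % q = a), ((ArithmeticFunction.moebius m : ℤ) : ℝ)

lemma mub (n : ℕ) : |((ArithmeticFunction.moebius n : ℤ) : ℝ)| ≤ 1 := by exact_mod_cast ArithmeticFunction.abs_moebius_le_one

lemma pw {η X u : ℝ} {L q a x : ℕ} (hη : 0 < η) (hη1 : η ≤ 1/2) (hq : 1 ≤ q) (hX : 0 < X) (hκ : (L*q:ℕ)/X ≤ η) (hx : X < x) (hx2 : ((x:ℝ)+1)*Real.exp ((L*q:ℕ)/X) ≤ X*Real.exp η)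
    (hu : Real.log x ≤ u) (hu2 : u < Real.log (x+1)) : |Sx (L*q) q a x| ≤ X*|bw (JI η X 1) ((L*q:ℕ)/X) q a u| + (5*η*L+4) := by
  set H := L*q with hH
  set κ : ℝ := (H:ℕ)/X with hκd
  have hκ0 : 0 ≤ κ := by positivity
  have hx0 : (0:ℝ) < x := hX.trans hx
  set v := Real.exp u with hv
  have hv1 : (x:ℝ) ≤ v := (Real.log_le_iff_le_exp hx0).1 hu
  have hv2 : v < x+1 := (Real.lt_log_iff_exp_lt (by linarith)).1 hu2
  set B := ⌊v*Real.exp κ⌋₊ with hB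
  have hvB : 0 ≤ v*Real.exp κ := by positivity
  have hHX : (H:ℝ) = κ*X := by rw [hκd]; field_simp
  have hxB : x+H ≤ B := Nat.le_floor (by
    push_cast
    have := mul_le_mul hv1 (Real.add_one_le_exp κ) (by positivity) (Real.exp_pos u).le
    linarith [mul_le_mul_of_nonneg_left hx.le hκ0])
  have hbb : bw (JI η X 1) κ q a u = ∑ n ∈ Finset.Ioc x B with n % q = a, cn n := by
    rw [bw, Finset.sum_filter, Finset.sum_filter]
    have hsub : Finset.Ioc x B ⊆ JI η X 1 := fun n hn => by
      rw [Finset.mem_Ioc, hB, Nat.le_floor_iff hvB] at hn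
      rw [mem_JI hX one_pos, one_mul]
      have : (x:ℝ) < n := by exact_mod_cast hn.1
      exact ⟨by linarith, by linarith [mul_le_mul_of_nonneg_right hv2.le (Real.exp_pos κ).le]⟩
    rw [← Finset.sum_subset hsub fun n hn hn2 => ?_]
    · refine Finset.sum_congr rfl fun n hn => ?_
      rw [Finset.mem_Ioc, hB, Nat.le_floor_iff hvB] at hn
      have hn0 : (x:ℝ)+1 ≤ n := by exact_mod_cast hn.1
      rw [wn, Set.indicator_of_mem, Pi.one_apply, mul_one]
      constructor
      · rw [sub_le_iff_le_add, Real.log_le_iff_le_exp (by linarith), Real.exp_add]; exact hn.2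
      · rw [Real.lt_log_iff_exp_lt (by linarith)]; linarith
    · rw [wn, Set.indicator_of_notMem, mul_zero, ite_self]
      rintro ⟨ha, hb⟩
      rw [mem_JI hX one_pos, one_mul] at hn
      have hn0 : (0:ℝ) < n := by linarith
      rw [Real.lt_log_iff_exp_lt hn0] at hb
      rw [sub_le_iff_le_add, Real.log_le_iff_le_exp hn0, Real.exp_add] at ha
      refine hn2 (Finset.mem_Ioc.2 ⟨?_, Nat.le_floor ha⟩)
      exact_mod_cast hv1.trans_lt hb
  have hS : Sx H q a x = (if x % q = a then ((ArithmeticFunction.moebius x : ℤ) : ℝ) else 0) + ∑ n ∈ Finset.Ioc x (x+H) with n % q = a, ((ArithmeticFunction.moebius n : ℤ) : ℝ) := by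
    rw [Sx, Finset.sum_filter, Finset.sum_filter, ← Finset.add_sum_Ioc_eq_sum_Icc (by omega)]
  have hsp : ∑ n ∈ Finset.Ioc x B with n % q = a, cn n = ∑ n ∈ Finset.Ioc x (x+H) with n % q = a, cn n + ∑ n ∈ Finset.Ioc (x+H) B with n % q = a, cn n := by
    simp only [Finset.sum_filter]
    rw [Finset.sum_Ioc_consecutive _ (by omega) hxB]
  have hn0 : ∀ n ∈ Finset.Ioc x B, X < n ∧ (n:ℝ) ≤ X*Real.exp η := fun n hn => by
    rw [Finset.mem_Ioc, hB, Nat.le_floor_iff hvB] at hn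
    have : (x:ℝ) < n := by exact_mod_cast hn.1
    exact ⟨by linarith, by linarith [mul_le_mul_of_nonneg_right hv2.le (Real.exp_pos κ).le]⟩
  have hE : Real.exp η ≤ 1+2*η := by
    have := Real.exp_bound_div_one_sub_of_interval hη.le (by linarith)
    refine this.trans ?_
    rw [div_le_iff₀ (by linarith)]; nlinarith only [hη, hη1]
  have hE2 : Real.exp κ ≤ 1+κ+κ^2 := by
    have := Real.abs_exp_sub_one_sub_id_le (x := κ) (by rw [abs_of_nonneg hκ0]; linarith)
    linarith [(abs_le.1 this).2]
  have hA : |∑ n ∈ Finset.Ioc x (x+H) with n % q = a, (((ArithmeticFunction.moebius n : ℤ) : ℝ)-X*cn n)| ≤ (L+1)*η := by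
    refine (Finset.abs_sum_le_sum_abs _ _).trans ((Finset.sum_le_card_nsmul _ _ η fun n hn => ?_).trans ?_)
    · obtain ⟨h1, h2⟩ := hn0 n (Finset.Ioc_subset_Ioc_right hxB (Finset.mem_filter.1 hn).1)
      have hn1 : (0:ℝ) < n := hX.trans h1
      have e : ((ArithmeticFunction.moebius n : ℤ) : ℝ)-X*cn n = ((ArithmeticFunction.moebius n : ℤ) : ℝ)*(1-X/n) := by rw [cn]; field_simp
      have h3 : X/n ≤ 1 := (div_le_one hn1).2 h1.le
      have h4 : 1-η ≤ X/n := by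
        rw [le_div_iff₀ hn1]
        have : 1-η ≤ Real.exp (-η) := by linarith only [Real.add_one_le_exp (-η)]
        calc (1-η)*n ≤ Real.exp (-η)*(X*Real.exp η) := mul_le_mul this h2 hn1.le (Real.exp_pos _).le
          _ = X := by rw [Real.exp_neg]; field_simp
      rw [e, abs_mul, abs_of_nonneg (by linarith only [h3] : 0 ≤ 1-X/n)]
      exact (mul_le_of_le_one_left (by linarith) (mub n)).trans (by linarith)
    · rw [nsmul_eq_mul]
      refine mul_le_mul_of_nonneg_right ((ctq hq a x (x+H) (by omega)).trans ?_) hη.le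
      rw [hH]; push_cast; field_simp; linarith
  have hBx : (B:ℝ)-(x+H:ℕ) ≤ 1+4*η*H := by
    have h1 : (B:ℝ) ≤ (x+1)*Real.exp κ := (Nat.floor_le hvB).trans (by gcongr)
    have h2 : ((x:ℝ)+1)*κ ≤ (1+2*η)*H := by
      have : (x:ℝ)+1 ≤ X*Real.exp η := le_trans (le_mul_of_one_le_right (by positivity) (Real.one_le_exp hκ0)) hx2
      rw [hHX]
      linarith [mul_le_mul_of_nonneg_right (this.trans (mul_le_mul_of_nonneg_left hE hX.le)) hκ0]
    have h3 : ((x:ℝ)+1)*κ^2 ≤ (1+2*η)*H*η := by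
      rw [sq, ← mul_assoc]; exact mul_le_mul h2 hκ hκ0 (by positivity)
    have h4 := mul_le_mul_of_nonneg_left hE2 (show 0 ≤ (x:ℝ)+1 by positivity)
    push_cast
    nlinarith only [h1, h2, h3, h4, mul_le_mul_of_nonneg_left hη1 (show 0 ≤ (H:ℝ)*η by positivity)]
  have hC : |∑ n ∈ Finset.Ioc (x+H) B with n % q = a, X*cn n| ≤ 4*η*L+2 := by
    refine (Finset.abs_sum_le_sum_abs _ _).trans ((Finset.sum_le_card_nsmul _ _ 1 fun n hn => ?_).trans ?_)
    · obtain ⟨h1, h2⟩ := hn0 n (Finset.Ioc_subset_Ioc_left (by omega) (Finset.mem_filter.1 hn).1)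
      have hn1 : (0:ℝ) < n := hX.trans h1
      rw [cn, mul_div_left_comm, abs_mul, abs_of_pos (by positivity : 0 < X/n)]
      exact mul_le_one₀ (mub n) (by positivity) ((div_le_one hn1).2 h1.le)
    · rw [nsmul_eq_mul, mul_one]
      refine (ctq hq a _ _ hxB).trans ?_
      have hq1 : (1:ℝ) ≤ q := by exact_mod_cast hq
      have : ((B:ℝ)-(x+H:ℕ))/q ≤ 4*η*L+1 := by
        rw [div_le_iff₀ (by linarith only [hη, hη1, hq1])]
        have : (H:ℝ) = L*q := by rw [hH]; push_cast; rfl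
        rw [this] at hBx; linarith only [hBx, hq1]
      linarith only [this]
  have hfin : Sx H q a x = X*bw (JI η X 1) κ q a u + ((if x % q = a then ((ArithmeticFunction.moebius x : ℤ) : ℝ) else 0) + ∑ n ∈ Finset.Ioc x (x+H) with n % q = a, (((ArithmeticFunction.moebius n : ℤ) : ℝ)-X*cn n) - ∑ n ∈ Finset.Ioc (x+H) B with n % q = a, X*cn n) := by
    rw [hS, hbb, hsp, Finset.sum_sub_distrib, mul_add, ← Finset.mul_sum, ← Finset.mul_sum]; ring
  have h0 : |(if x % q = a then ((ArithmeticFunction.moebius x : ℤ) : ℝ) else 0)| ≤ 1 := by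
    split_ifs
    · exact mub x
    · simp
  rw [hfin]
  refine (abs_add_le _ _).trans ?_
  rw [abs_mul, abs_of_pos hX]
  have := (abs_sub _ _).trans (add_le_add ((abs_add_le _ _).trans (add_le_add h0 hA)) hC)
  have hL0 : (0:ℝ) ≤ L*η := by positivity
  linarith only [hη, hη1, this]
end MR

namespace MR
open MeasureTheory

lemma pw2 {η θ X : ℝ} {L q a x : ℕ} (hη : 0 < η) (hη1 : η ≤ 1/2) (hθ : 0 < θ) (hL : 1 ≤ L) (hq : 1 ≤ q) (hX : 0 < X) (hκ : (L*q:ℕ)/X ≤ η) (hx : X < x) (hx2 : ((x:ℝ)+1)*Real.exp ((L*q:ℕ)/X) ≤ X*Real.exp η) :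
    |Sx (L*q) q a x| ≤ (5*η*L+4+θ*L) + X^3/(2*θ*L)*∫ u in Set.Ico (Real.log x) (Real.log (x+1)), bw (JI η X 1) ((L*q:ℕ)/X) q a u^2 := by
  set D := |Sx (L*q) q a x| - (5*η*L+4+θ*L) with hD
  set b := bw (JI η X 1) ((L*q:ℕ)/X) q a with hb
  have hL0 : (0:ℝ) < L := by exact_mod_cast hL
  have hx0 : (0:ℝ) < x := hX.trans hx
  have h1 : ∀ u ∈ Set.Ico (Real.log x) (Real.log (x+1)), D ≤ X^2/(4*θ*L)*b u^2 := fun u hu => by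
    have h := pw (a := a) hη hη1 hq hX hκ hx hx2 hu.1 hu.2
    have h2 : X*|b u| ≤ θ*L + (X*|b u|)^2/(4*θ*L) := by
      rw [← sub_le_iff_le_add', le_div_iff₀ (by positivity)]
      nlinarith only [sq_nonneg (X*|b u|-2*(θ*L))]
    rw [mul_pow, sq_abs, mul_div_right_comm] at h2
    linarith only [h, h2]
  have hi : ∀ s, IntegrableOn (fun u => b u^2) s := fun s => (bw_i _ _ q a).integrableOn
  have h2 : ∫ u in Set.Ico (Real.log x) (Real.log (x+1)), D ≤ ∫ u in Set.Ico (Real.log x) (Real.log (x+1)), X^2/(4*θ*L)*b u^2 :=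
    setIntegral_mono_on (integrableOn_const (by simp)) ((hi _).const_mul _) measurableSet_Ico h1
  have hl : 1/(2*X) ≤ Real.log (x+1)-Real.log x := by
    rw [← Real.log_div (by positivity) (by positivity)]
    have h3 := Real.one_sub_inv_le_log_of_pos (show 0 < ((x:ℝ)+1)/x by positivity)
    refine le_trans ?_ h3
    have : 1-(((x:ℝ)+1)/x)⁻¹ = 1/(x+1) := by field_simp; ring
    rw [this]
    apply one_div_le_one_div_of_le (by positivity)
    have h4 : (x:ℝ)+1 ≤ X*Real.exp η := le_trans (le_mul_of_one_le_right (by positivity) (Real.one_le_exp (by positivity))) hx2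
    have h5 : Real.exp η ≤ 2 := by
      have := Real.exp_bound_div_one_sub_of_interval hη.le (by linarith)
      refine this.trans ?_
      rw [div_le_iff₀ (by linarith)]; linarith
    nlinarith only [h4, h5, hX]
  have hl0 : 0 < 1/(2*X) := by positivity
  rw [setIntegral_const, smul_eq_mul, integral_const_mul, Real.volume_real_Ico_of_le (by linarith)] at h2
  set R := ∫ u in Set.Ico (Real.log x) (Real.log (x+1)), b u^2 with hR
  have hR0 : 0 ≤ R := setIntegral_nonneg measurableSet_Ico fun u _ => sq_nonneg _
  suffices D ≤ X^3/(2*θ*L)*R by linarith only [this]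
  rcases le_total D 0 with h | h
  · exact h.trans (by positivity)
  · have h6 := (mul_le_mul_of_nonneg_right hl h).trans h2
    rw [one_div_mul_eq_div, div_le_iff₀ (by positivity)] at h6
    refine h6.trans (le_of_eq ?_)
    field_simp; ring

lemma dsum {f : ℝ → ℝ} (hf : Integrable f) (h0 : ∀ u, 0 ≤ f u) (s : Finset ℕ) : ∑ x ∈ s, ∫ u in Set.Ico (Real.log x) (Real.log (x+1)), f u ≤ ∫ u, f u := by
  have hmono : Monotone fun n : ℕ => Real.log n := fun m n h => by
    rcases Nat.eq_zero_or_pos m with rfl | hm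
    · simp only [Nat.cast_zero, Real.log_zero]; exact Real.log_natCast_nonneg n
    · exact Real.log_le_log (by exact_mod_cast hm) (by exact_mod_cast h)
  have hd := hmono.pairwise_disjoint_on_Ico_succ
  simp only [Nat.succ_eq_succ, Nat.succ_eq_add_one, Nat.cast_add, Nat.cast_one] at hd
  rw [← integral_biUnion_finset s (fun _ _ => measurableSet_Ico) (hd.set_pairwise _) fun _ _ => hf.integrableOn]
  exact setIntegral_le_integral hf (ae_of_all _ h0)

lemma pieceX {ε η : ℝ} (hε : 0 < ε) (hη : 0 < η) (hη1 : η ≤ 1/2) : ∃ L0 : ℕ, ∀ L ≥ L0, ∀ q, 1 ≤ q → pf q ≤ (1-ε)*ps 1 L → ∀ᶠ X : ℝ in atTop,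
    ∑ x ∈ Finset.Ioc ⌊X⌋₊ ⌊X*Real.exp (η/2)⌋₊, ∑ a ∈ Finset.range q, |Sx (L*q) q a x| ≤ 15*η*(L*q)*(X*Real.exp (η/2)-X) := by
  obtain ⟨L0, H⟩ := SSq hε (show 0 < η^2*η by positivity)
  refine ⟨max ⌈L0⌉₊ ⌈4/η⌉₊, fun L hL q hq hp => ?_⟩
  have hL1 : L0 ≤ L := (Nat.le_ceil _).trans (by exact_mod_cast (le_max_left _ _).trans hL)
  have hL2 : 4/η ≤ L := (Nat.le_ceil _).trans (by exact_mod_cast (le_max_right _ _).trans hL)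
  have hL0 : (0:ℝ) < L := lt_of_lt_of_le (by positivity) hL2
  have hLn : 1 ≤ L := by exact_mod_cast hL0
  rw [div_le_iff₀ hη] at hL2
  have h1 := H L hL1 hη hη1 hq hp
  have hee : 0 < Real.exp (3*η/4)-Real.exp (η/2) := sub_pos.2 (Real.exp_lt_exp.2 (by linarith))
  have he1 : η/2 ≤ Real.exp (η/2)-1 := by linarith [Real.add_one_le_exp (η/2)]
  filter_upwards [h1, eventually_ge_atTop (max (max 1 ((L*q:ℕ)/(η/4))) (max (1/(Real.exp (3*η/4)-Real.exp (η/2))) (1/(η/2))))] with X h1 hX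
  simp only [max_le_iff] at hX
  obtain ⟨⟨hX1, hX2⟩, hX3, hX4⟩ := hX
  have hX0 : 0 < X := by linarith
  rw [div_le_iff₀ (by positivity)] at hX2 hX4
  rw [div_le_iff₀ hee] at hX3
  have hκ : (L*q:ℕ)/X ≤ η/4 := by rw [div_le_iff₀ hX0]; linarith only [hX2]
  have hq0 : (0:ℝ) < q := by exact_mod_cast hq
  set s := Finset.Ioc ⌊X⌋₊ ⌊X*Real.exp (η/2)⌋₊ with hs
  set b := bw (JI η X 1) ((L*q:ℕ)/X) q with hb
  have hpt : ∀ x ∈ s, ∀ a ∈ Finset.range q, |Sx (L*q) q a x| ≤ 7*η*L + X^3/(2*η*L)*∫ u in Set.Ico (Real.log x) (Real.log (x+1)), b a u^2 := fun x hx a _ => by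
    rw [hs, Finset.mem_Ioc, Nat.floor_lt hX0.le, Nat.le_floor_iff (by positivity)] at hx
    have h := pw2 (a := a) hη hη1 hη hLn hq hX0 (by linarith only [hη, hκ]) hx.1 ?_
    · linarith only [hL2, h]
    · calc ((x:ℝ)+1)*Real.exp ((L*q:ℕ)/X) ≤ (X*Real.exp (3*η/4))*Real.exp (η/4) := by
            refine mul_le_mul (by linarith) (Real.exp_le_exp.2 hκ) (Real.exp_pos _).le (by positivity)
        _ = X*Real.exp η := by rw [mul_assoc, ← Real.exp_add]; congr 2; ring
  have hcard : (s.card:ℝ) ≤ 2*(X*Real.exp (η/2)-X) := by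
    rw [hs, Nat.card_Ioc, Nat.cast_sub (Nat.floor_le_floor (le_mul_of_one_le_right hX0.le (Real.one_le_exp (by positivity))))]
    have := Nat.floor_le (show 0 ≤ X*Real.exp (η/2) by positivity)
    have := Nat.lt_floor_add_one X
    nlinarith only [mul_le_mul_of_nonneg_left he1 hX0.le, hX4, this, Nat.floor_le (show 0 ≤ X*Real.exp (η/2) by positivity)]
  have hQ : ∑ a ∈ Finset.range q, ∫ u, b a u^2 ≤ η^2*η*q*L^2/X^2 := by
    rw [hb, bw_tot _ _ hq]; push_cast; exact h1
  calc _ ≤ ∑ x ∈ s, ∑ a ∈ Finset.range q, (7*η*L + X^3/(2*η*L)*∫ u in Set.Ico (Real.log x) (Real.log (x+1)), b a u^2) :=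
        Finset.sum_le_sum fun x hx => Finset.sum_le_sum fun a ha => hpt x hx a ha
    _ = s.card*(q*(7*η*L)) + X^3/(2*η*L)*∑ a ∈ Finset.range q, ∑ x ∈ s, ∫ u in Set.Ico (Real.log x) (Real.log (x+1)), b a u^2 := by
        simp only [Finset.sum_add_distrib, Finset.sum_const, nsmul_eq_mul, Finset.card_range, Finset.mul_sum]
        rw [Finset.sum_comm]
    _ ≤ (2*(X*Real.exp (η/2)-X))*(q*(7*η*L)) + X^3/(2*η*L)*(η^2*η*q*L^2/X^2) := by
        gcongr
        exact (Finset.sum_le_sum fun a _ => dsum (bw_i _ _ q a) (fun u => sq_nonneg _) s).trans hQ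
    _ = 14*η*(L*q)*(X*Real.exp (η/2)-X) + η*(L*q)*(X*(η/2)) := by field_simp; ring
    _ ≤ _ := by
        have := mul_le_mul_of_nonneg_left (mul_le_mul_of_nonneg_left he1 hX0.le) (show 0 ≤ η*(L*q) by positivity)
        linarith only [this]
end MR

namespace MR

lemma tele {w : ℕ → ℝ} (hw : ∀ x, 0 ≤ w x) {r B : ℝ} (hr : 1 < r) (hB : 0 ≤ B) (h : ∀ᶠ X : ℝ in atTop, ∑ x ∈ Finset.Ioc ⌊X⌋₊ ⌊X*r⌋₊, w x ≤ B*(X*r-X)) :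
    ∃ C : ℝ, ∀ n : ℕ, ∑ x ∈ Finset.range (n+1), w x ≤ C+B*n := by
  obtain ⟨X0, h⟩ := eventually_atTop.1 (h.and (eventually_ge_atTop 1))
  have hX0 : 1 ≤ X0 := (h X0 le_rfl).2
  set G : ℕ → ℝ := fun n => ∑ x ∈ Finset.range (n+1), w x with hG
  have hGm : Monotone G := fun m n hmn => Finset.sum_le_sum_of_subset_of_nonneg (Finset.range_subset_range.2 (by omega)) fun _ _ _ => hw _
  set C := G ⌊X0*r⌋₊ with hC
  have hC0 : 0 ≤ C := Finset.sum_nonneg fun _ _ => hw _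
  have key : ∀ n : ℕ, ∀ X : ℝ, 0 ≤ X → X ≤ X0*r^(n+1) → G ⌊X⌋₊ ≤ C+B*X := by
    intro n
    induction n with
    | zero => intro X h0 hX; rw [zero_add, pow_one] at hX; linarith [hGm (Nat.floor_le_floor hX), mul_nonneg hB h0]
    | succ n ih =>
      intro X h0 hX
      rcases le_total X (X0*r) with h1 | h1
      · linarith [hGm (Nat.floor_le_floor h1), mul_nonneg hB h0]
      · have hr0 : 0 < r := by linarith
        have h2 := ih (X/r) (by positivity) (by rw [div_le_iff₀ hr0, mul_assoc, ← pow_succ]; exact hX)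
        have h3 := (h (X/r) ((le_div_iff₀ hr0).2 h1)).1
        rw [div_mul_cancel₀ X hr0.ne'] at h3
        have h4 : G ⌊X⌋₊ = G ⌊X/r⌋₊ + ∑ x ∈ Finset.Ioc ⌊X/r⌋₊ ⌊X⌋₊, w x := by
          simp only [hG, Finset.range_eq_Ico]
          rw [← Finset.Ico_add_one_add_one_eq_Ioc]
          exact (Finset.sum_Ico_consecutive _ (by omega) (Nat.add_le_add_right (Nat.floor_le_floor (div_le_self h0 hr.le)) 1)).symm
        linarith
  refine ⟨C, fun n => ?_⟩
  obtain ⟨N, hN⟩ := pow_unbounded_of_one_lt (n:ℝ) hr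
  have h5 := key N n (by positivity) (by
    rw [pow_succ]
    nlinarith only [hN, hX0, hr, mul_le_mul hX0 (mul_le_mul_of_nonneg_left hr.le (show 0 ≤ r^N by positivity)) (by positivity) (by linarith)])
  rwa [Nat.floor_natCast] at h5

lemma sum_blk (w : ℕ → ℝ) (H K : ℕ) : ∑ z ∈ Finset.range H, ∑ j ∈ Finset.range K, w (z+j*H) = ∑ x ∈ Finset.range (K*H), w x := by
  induction K with
  | zero => simp
  | succ K ih =>
    simp only [Finset.sum_range_succ, Finset.sum_add_distrib]
    rw [ih, add_mul, one_mul, Finset.sum_range_add]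
    simp only [add_comm]
end MR

theorem moebius_short_intervals_arith_progressions (ε : ℝ) (hε : 0 < ε) :
    ∃ L0 : ℕ, ∀ L : ℕ, L0 ≤ L → ∀ q : ℕ, 1 ≤ q →
      (∑ p ∈ q.primeFactors, (1 / p : ℝ)) ≤
        (1 - ε) * ∑ p ∈ (Finset.range (L + 1)).filter Nat.Prime, (1 / p : ℝ) →
      ∃ M0 : ℕ, ∀ M : ℕ, M0 ≤ M → ∃ z : ℕ, z < L * q ∧
        ∑ j ∈ Finset.range (M / (L * q) + 1), ∑ a ∈ Finset.range q,
          |∑ m ∈ (Finset.Icc (z + j * (L * q)) (z + (j + 1) * (L * q))).filter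
              (fun m => m % q = a),
            ((ArithmeticFunction.moebius m : ℤ) : ℝ)| < ε * M := by
  set η := (min ε 1)/60 with hη
  have hm : 0 < min ε 1 := by positivity
  have hm1 := min_le_right ε 1
  have hm2 := min_le_left ε 1
  obtain ⟨L0, h⟩ := MR.pieceX hε (show 0 < η by positivity) (by linarith)
  refine ⟨max L0 1, fun L hL q hq hp => ?_⟩
  have hL1 : 1 ≤ L := (le_max_right _ _).trans hL
  have hps : MR.ps 1 L = ∑ p ∈ (Finset.range (L + 1)).filter Nat.Prime, (1 / p : ℝ) := by
    rw [MR.ps, Nat.floor_one, Nat.floor_natCast]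
    refine Finset.sum_congr (Finset.ext fun p => ?_) fun _ _ => rfl
    simp only [Finset.mem_filter, Finset.mem_Ioc, Finset.mem_range]
    exact ⟨fun h => ⟨by omega, h.2⟩, fun h => ⟨⟨h.2.one_lt, by omega⟩, h.2⟩⟩
  have h1 := h L ((le_max_left _ _).trans hL) q hq (by rw [hps]; exact hp)
  set H := L*q with hH
  have hH1 : 1 ≤ H := Nat.mul_pos hL1 hq
  have hH0 : (0:ℝ) < H := by exact_mod_cast hH1
  set w : ℕ → ℝ := fun x => ∑ a ∈ Finset.range q, |MR.Sx H q a x| with hw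
  obtain ⟨C, hC⟩ := MR.tele (w := w) (fun x => Finset.sum_nonneg fun _ _ => abs_nonneg _) (Real.one_lt_exp_iff.2 (show 0 < η/2 by positivity)) (show 0 ≤ 15*η*(L*q) by positivity) h1
  refine ⟨max H (⌈2*C/(ε*H)⌉₊+1), fun M hM => ?_⟩
  have hMH : H ≤ M := (le_max_left _ _).trans hM
  have hMC : 2*C/(ε*H) < M := (Nat.le_ceil _).trans_lt (by exact_mod_cast (le_max_right _ _).trans hM)
  rw [div_lt_iff₀ (by positivity)] at hMC
  by_contra! hcon
  have e : ∀ z ∈ Finset.range H, ε*M ≤ ∑ j ∈ Finset.range (M/H+1), w (z+j*H) := fun z hz => by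
    refine (hcon z (Finset.mem_range.1 hz)).trans (le_of_eq ?_)
    refine Finset.sum_congr rfl fun j _ => Finset.sum_congr rfl fun a _ => ?_
    rw [MR.Sx, show z+(j+1)*H = z+j*H+H by ring]
  have e2 := Finset.card_nsmul_le_sum _ _ _ e
  rw [MR.sum_blk, Finset.card_range, nsmul_eq_mul] at e2
  have hK : (M/H+1)*H ≤ 2*M+1 := by
    have := Nat.div_mul_le_self M H
    rw [add_mul, one_mul]; omega
  have e3 : ∑ x ∈ Finset.range ((M/H+1)*H), w x ≤ ∑ x ∈ Finset.range (2*M+1), w x :=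
    Finset.sum_le_sum_of_subset_of_nonneg (Finset.range_subset_range.2 hK) fun _ _ _ => Finset.sum_nonneg fun _ _ => abs_nonneg _
  have e4 := hC (2*M)
  have hHc : (L:ℝ)*q = H := by rw [hH]; push_cast; rfl
  have e5 : 15*η*(L*q)*((2*M:ℕ):ℝ) ≤ ε/2*(M*H) := by
    rw [hHc]; push_cast
    rw [show 15*η*H*(2*M) = (30*η)*(M*H:ℝ) by ring]
    exact mul_le_mul_of_nonneg_right (by linarith) (by positivity)
  linarith
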